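/- Let N ≥ 2, β > 0, and 0 < c₁⁰ < c₂⁰ < … < c_N⁰ < 2/(9β) be such that the Weinstein criterion holds: for each j = 1, …, N, the map c ↦ ∫_ℝ Q_{c,β}(x)² dx is differentiable at c = c_j⁰ with strictly positive derivative. Then there exist constants α̃₀, Ã₀, L̃₀, γ̃ > 0 such that the following holds. Let L̃ > L̃₀, α̃ ∈ (0, α̃₀), and x̃₁⁰ < … < x̃_N⁰ with x̃_j⁰ > x̃_{j-1}⁰ + L̃ for j = 2, …, N. Let v be a classical solution of the Gardner equation such that ‖v(0,·) − Σ_{j=1}^N Q_{c_j⁰,β}(· − x̃_j⁰)‖_{H¹(ℝ)} ≤ α̃. Then there exist C¹ functions x̃₁, …, x̃_N : [0,∞) → ℝ such that sup_{t ≥ 0} ( ‖v(t,·) − Σ_{j=1}^N Q_{c_j⁰,β}(· − x̃_j(t))‖_{H¹(ℝ)} + Σ_{j=1}^N |x̃_j′(t) − c_j⁰| ) ≤ Ã₀ (α̃ + e^{−γ̃ L̃}). -/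

import Mathlib

open MeasureTheory Filter Real

/-- The Gardner soliton profile `Q_{c,β}(s) = 3c / (1 + ρ cosh(√c s))`,
with `ρ = (1 - (9/2) β c)^{1/2}`. -/
noncomputable def QG (c β s : ℝ) : ℝ :=
  3 * c / (1 + Real.sqrt (1 - 9 / 2 * β * c) * Real.cosh (Real.sqrt c * s))

/-- `f` satisfies the Schwartz class decay estimates. -/
def IsSchwartzFn (f : ℝ → ℝ) : Prop :=
  ∀ k n : ℕ, ∃ C : ℝ, ∀ x : ℝ, |x| ^ k * |iteratedDeriv n f x| ≤ C

/-- `v` is a classical solution of the Gardner equation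
`v_t + (v_xx + v² - β v³)_x = 0`, smooth and Schwartz in space for each time. -/
def IsGardnerSolution (β : ℝ) (v : ℝ → ℝ → ℝ) : Prop :=
  ContDiff ℝ (⊤ : ℕ∞) (Function.uncurry v) ∧ (∀ t : ℝ, IsSchwartzFn (v t)) ∧
  ∀ t x : ℝ,
    deriv (fun τ => v τ x) t +
      deriv (fun y => deriv (deriv (v t)) y + (v t y) ^ 2 - β * (v t y) ^ 3) x = 0

/-- Continuous functions with quadratic decay at infinity. -/
def Dec (g : ℝ → ℝ) : Prop :=
  Continuous g ∧ ∃ C : ℝ, ∀ x : ℝ, |g x| ≤ C * (1 + x ^ 2)⁻¹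

namespace Dec

variable {f g : ℝ → ℝ}

lemma exists_nonneg (hf : Dec f) : ∃ C : ℝ, 0 ≤ C ∧ ∀ x, |f x| ≤ C * (1 + x ^ 2)⁻¹ := by
  obtain ⟨_, C, hC⟩ := hf
  refine ⟨C, ?_, hC⟩
  have := hC 0
  simp at this
  exact (abs_nonneg _).trans this

lemma bounded (hf : Dec f) : ∃ C : ℝ, 0 ≤ C ∧ ∀ x, |f x| ≤ C := by
  obtain ⟨C, h0, hC⟩ := hf.exists_nonneg
  refine ⟨C, h0, fun x => (hC x).trans ?_⟩
  have : (1 + x ^ 2)⁻¹ ≤ 1 := inv_le_one_of_one_le₀ (by nlinarith [sq_nonneg x])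
  nlinarith

lemma of_abs_le (hg : Dec g) (hf : Continuous f) {B : ℝ} (h : ∀ x, |f x| ≤ B * |g x|) :
    Dec f := by
  obtain ⟨C, h0, hC⟩ := hg.exists_nonneg
  refine ⟨hf, |B| * C, fun x => (h x).trans ?_⟩
  calc B * |g x| ≤ |B| * |g x| := by gcongr; exact le_abs_self B
    _ ≤ |B| * (C * (1 + x ^ 2)⁻¹) := by gcongr; exact hC x
    _ = _ := by ring

lemma mul_bounded (hf : Dec f) (hg : Continuous g) {B : ℝ} (h : ∀ x, |g x| ≤ B) :
    Dec (fun x => f x * g x) := by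
  refine hf.of_abs_le (hf.1.mul hg) (B := B) fun x => ?_
  rw [abs_mul, mul_comm]
  gcongr
  exact h x

lemma bounded_mul (hf : Dec f) (hg : Continuous g) {B : ℝ} (h : ∀ x, |g x| ≤ B) :
    Dec (fun x => g x * f x) := by
  simpa only [mul_comm] using hf.mul_bounded hg h

lemma add (hf : Dec f) (hg : Dec g) : Dec (fun x => f x + g x) := by
  obtain ⟨hf0, C, hC⟩ := hf
  obtain ⟨hg0, D, hD⟩ := hg
  refine ⟨hf0.add hg0, C + D, fun x => (abs_add_le _ _).trans ?_⟩
  have := hC x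
  have := hD x
  linarith [add_mul C D (1 + x ^ 2)⁻¹]

lemma neg (hf : Dec f) : Dec (fun x => - f x) := by
  obtain ⟨hf0, C, hC⟩ := hf
  exact ⟨hf0.neg, C, fun x => by simpa using hC x⟩

lemma sub (hf : Dec f) (hg : Dec g) : Dec (fun x => f x - g x) := by
  simpa only [sub_eq_add_neg] using hf.add hg.neg

lemma mul (hf : Dec f) (hg : Dec g) : Dec (fun x => f x * g x) := by
  obtain ⟨B, _, hB⟩ := hg.bounded
  exact hf.mul_bounded hg.1 hB

lemma const_mul (hf : Dec f) (a : ℝ) : Dec (fun x => a * f x) :=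
  hf.bounded_mul continuous_const (B := |a|) fun _ => le_rfl

lemma mul_const (hf : Dec f) (a : ℝ) : Dec (fun x => f x * a) :=
  hf.mul_bounded continuous_const (B := |a|) fun _ => le_rfl

lemma div_const (hf : Dec f) (a : ℝ) : Dec (fun x => f x / a) := by
  simpa only [div_eq_mul_inv] using hf.mul_const a⁻¹

lemma zero : Dec (fun _ => 0) := ⟨continuous_const, 0, fun x => by simp⟩

lemma pow (hf : Dec f) (n : ℕ) : Dec (fun x => f x ^ (n + 1)) := by
  induction n with
  | zero => simpa using hf
  | succ n ih => simpa only [pow_succ (f _) (n + 1)] using ih.mul hf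

lemma sq (hf : Dec f) : Dec (fun x => f x ^ 2) := hf.pow 1
lemma cube (hf : Dec f) : Dec (fun x => f x ^ 3) := hf.pow 2
lemma pow_four (hf : Dec f) : Dec (fun x => f x ^ 4) := hf.pow 3

lemma sum {ι : Type*} (s : Finset ι) {F : ι → ℝ → ℝ} (h : ∀ i ∈ s, Dec (F i)) :
    Dec (fun x => ∑ i ∈ s, F i x) := by
  classical
  induction s using Finset.induction_on with
  | empty => simpa using Dec.zero
  | insert i s hi ih =>
    simp only [Finset.sum_insert hi]
    exact (h i (by simp)).add (ih fun j hj => h j (by simp [hj]))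

lemma abs (hf : Dec f) : Dec (fun x => |f x|) :=
  hf.of_abs_le hf.1.abs (B := 1) fun x => by simp

lemma comp_neg (hf : Dec f) : Dec (fun x => f (-x)) := by
  obtain ⟨hf0, C, hC⟩ := hf
  exact ⟨hf0.comp continuous_neg, C, fun x => by simpa using hC (-x)⟩

lemma comp_add (hf : Dec f) (a : ℝ) : Dec (fun x => f (x + a)) := by
  obtain ⟨C, h0, hC⟩ := hf.exists_nonneg
  refine ⟨hf.1.comp (by fun_prop), C * (2 * (1 + a ^ 2)), fun x => (hC _).trans ?_⟩
  rw [mul_assoc]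
  gcongr
  have h1 : 0 < 1 + (x + a) ^ 2 := by positivity
  have h2 : 0 < 1 + x ^ 2 := by positivity
  rw [← div_eq_mul_inv, inv_eq_one_div, div_le_div_iff₀ h1 h2]
  nlinarith [sq_nonneg (x + 2 * a), sq_nonneg (a * (x + a)), sq_nonneg a, sq_nonneg (x + a)]

lemma comp_sub (hf : Dec f) (a : ℝ) : Dec (fun x => f (x - a)) := by
  simpa only [sub_eq_add_neg] using hf.comp_add (-a)

lemma integrable (hf : Dec f) : Integrable f := by
  obtain ⟨hf0, C, hC⟩ := hf
  exact (integrable_inv_one_add_sq.const_mul C).mono' hf0.aestronglyMeasurable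
    (Eventually.of_forall hC)

lemma tendsto_cocompact (hf : Dec f) : Tendsto f (cocompact ℝ) (nhds 0) := by
  obtain ⟨C, h0, hC⟩ := hf.exists_nonneg
  have h1 : Tendsto (fun x : ℝ => C * (1 + x ^ 2)⁻¹) (cocompact ℝ) (nhds 0) := by
    have : Tendsto (fun x : ℝ => 1 + x ^ 2) (cocompact ℝ) atTop := by
      have h2 := (tendsto_pow_atTop (α := ℝ) two_ne_zero).comp (tendsto_norm_cocompact_atTop (E := ℝ))
      refine tendsto_atTop_add_const_left _ _ (h2.congr fun x => ?_)
      simp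
    simpa using (tendsto_inv_atTop_zero.comp this).const_mul C
  exact squeeze_zero_norm hC h1

lemma tendsto_atTop (hf : Dec f) : Tendsto f atTop (nhds 0) :=
  hf.tendsto_cocompact.mono_left atTop_le_cocompact

lemma tendsto_atBot (hf : Dec f) : Tendsto f atBot (nhds 0) :=
  hf.tendsto_cocompact.mono_left atBot_le_cocompact

lemma of_hasCompactSupport (hf : Continuous f) (h : HasCompactSupport f) : Dec f := by
  have hc : Continuous fun x : ℝ => f x * (1 + x ^ 2) := by fun_prop
  obtain ⟨C, hC⟩ := hc.bounded_above_of_compact_support (h.mul_right)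
  refine ⟨hf, C, fun x => ?_⟩
  have h1 : 0 < 1 + x ^ 2 := by positivity
  rw [← div_eq_mul_inv, le_div_iff₀ h1]
  have := hC x
  rwa [Real.norm_eq_abs, abs_mul, abs_of_pos h1] at this

end Dec

lemma integral_deriv_eq_zero {f f' : ℝ → ℝ} (hd : ∀ x, HasDerivAt f (f' x) x) (hf : Dec f)
    (hf' : Dec f') : ∫ x, f' x = 0 := by
  have := integral_of_hasDerivAt_of_tendsto hd hf'.integrable hf.tendsto_atBot hf.tendsto_atTop
  simpa using this

lemma integral_Ioi_deriv {f f' : ℝ → ℝ} (a : ℝ) (hd : ∀ x, HasDerivAt f (f' x) x) (hf : Dec f)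
    (hf' : Dec f') : ∫ x in Set.Ioi a, f' x = - f a := by
  have := integral_Ioi_of_hasDerivAt_of_tendsto' (a := a) (fun x _ => hd x)
    hf'.integrable.integrableOn hf.tendsto_atTop
  simpa using this

lemma integral_by_parts {f f' g g' : ℝ → ℝ} (hd : ∀ x, HasDerivAt f (f' x) x)
    (hg : ∀ x, HasDerivAt g (g' x) x) (h1 : Dec (fun x => f x * g x))
    (h2 : Dec (fun x => f' x * g x)) (h3 : Dec (fun x => f x * g' x)) :
    ∫ x, f' x * g x = - ∫ x, f x * g' x := by
  have := integral_deriv_eq_zero (fun x => (hd x).mul (hg x)) h1 (h2.add h3)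
  rw [integral_add h2.integrable h3.integrable] at this
  linarith

/-- One-dimensional Sobolev inequality. -/
lemma sq_le_integral {f f' : ℝ → ℝ} (hd : ∀ x, HasDerivAt f (f' x) x) (hf : Dec f)
    (hf' : Dec f') (x : ℝ) : f x ^ 2 ≤ ∫ y, (f y ^ 2 + f' y ^ 2) := by
  have h1 := integral_Ioi_deriv x (f := fun y => f y ^ 2) (f' := fun y => 2 * f y * f' y)
    (fun y => by simpa using (hd y).fun_pow 2) hf.sq ((hf.const_mul 2).mul hf')
  have hint : Integrable (fun y => f y ^ 2 + f' y ^ 2) := (hf.sq.add hf'.sq).integrable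
  have h2 : -∫ y in Set.Ioi x, 2 * f y * f' y ≤ ∫ y in Set.Ioi x, (f y ^ 2 + f' y ^ 2) := by
    rw [← integral_neg]
    refine integral_mono ((hf.const_mul 2).mul hf').neg.integrable.integrableOn
      hint.integrableOn fun y => ?_
    simp only
    nlinarith [sq_nonneg (f y + f' y)]
  have h3 : ∫ y in Set.Ioi x, (f y ^ 2 + f' y ^ 2) ≤ ∫ y, (f y ^ 2 + f' y ^ 2) :=
    setIntegral_le_integral hint (Eventually.of_forall fun y => by positivity)
  linarith

/-- Differentiation under the integral sign for integrands supported in a fixed compact set. -/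
lemma hasDerivAt_integral_of_compact {e e' : ℝ → ℝ → ℝ} (R : ℝ)
    (he : Continuous (Function.uncurry e)) (he' : Continuous (Function.uncurry e'))
    (hd : ∀ t x, HasDerivAt (fun τ => e τ x) (e' t x) t)
    (hs : ∀ t x, R < |x| → e t x = 0) (t : ℝ) :
    HasDerivAt (fun τ => ∫ x, e τ x) (∫ x, e' t x) t := by
  have hs' : ∀ t x, R < |x| → e' t x = 0 := fun t x hx => by
    have h1 : (fun τ => e τ x) = fun _ => 0 := funext fun τ => hs τ x hx
    have h2 := hd t x
    rw [h1] at h2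
    exact h2.unique (hasDerivAt_const t 0)
  have hcont : ∀ τ, Continuous (e τ) := fun τ => he.comp (by fun_prop : Continuous fun x => (τ, x))
  have hcont' : ∀ τ, Continuous (e' τ) :=
    fun τ => he'.comp (by fun_prop : Continuous fun x => (τ, x))
  have hcomp : HasCompactSupport (e t) :=
    HasCompactSupport.of_support_subset_isCompact (isCompact_Icc (a := -R) (b := R)) fun x hx => by
      by_contra h
      refine hx (hs t x ?_)
      by_contra h'
      exact h (abs_le.1 (not_lt.1 h'))
  have hK : IsCompact (Metric.closedBall t 1 ×ˢ Set.Icc (-R) R) :=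
    (isCompact_closedBall t 1).prod isCompact_Icc
  obtain ⟨C, hC⟩ := hK.exists_bound_of_continuousOn he'.continuousOn
  refine (hasDerivAt_integral_of_dominated_loc_of_deriv_le (F' := e')
    (bound := Set.indicator (Set.Icc (-R) R) fun _ => C) (Metric.ball_mem_nhds t one_pos)
    (Eventually.of_forall fun τ => (hcont τ).aestronglyMeasurable)
    ((hcont t).integrable_of_hasCompactSupport hcomp) (hcont' t).aestronglyMeasurable
    (Eventually.of_forall fun x τ hτ => ?_) ?_ (Eventually.of_forall fun x τ _ => hd τ x)).2
  · by_cases hx : x ∈ Set.Icc (-R) R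
    · rw [Set.indicator_of_mem hx]
      exact hC (τ, x) ⟨Metric.ball_subset_closedBall hτ, hx⟩
    · rw [Set.indicator_of_notMem hx, hs' τ x, norm_zero]
      by_contra h
      exact hx (abs_le.1 (not_lt.1 h))
  · rw [integrable_indicator_iff measurableSet_Icc]
    exact integrableOn_const (by simp)

lemma exists_cutoff : ∃ χ χ₁ χ₂ χ₃ : ℝ → ℝ, ∃ C : ℝ, 0 ≤ C ∧ Continuous χ ∧ Continuous χ₁ ∧
    Continuous χ₂ ∧ Continuous χ₃ ∧ (∀ x, HasDerivAt χ (χ₁ x) x) ∧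
    (∀ x, HasDerivAt χ₁ (χ₂ x) x) ∧ (∀ x, HasDerivAt χ₂ (χ₃ x) x) ∧
    (∀ x, 0 ≤ χ x) ∧ (∀ x, χ x ≤ 1) ∧ (∀ x, |x| ≤ 1 → χ x = 1) ∧ (∀ x, 2 < |x| → χ x = 0) ∧
    HasCompactSupport χ ∧ HasCompactSupport χ₁ ∧ HasCompactSupport χ₂ ∧ HasCompactSupport χ₃ ∧
    (∀ x, |χ₁ x| ≤ C) ∧ (∀ x, |χ₃ x| ≤ C) := by
  let b : ContDiffBump (0 : ℝ) := ⟨1, 2, one_pos, one_lt_two⟩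
  have h0 : ContDiff ℝ (⊤ : ℕ∞) b := b.contDiff
  have h1 : ContDiff ℝ (⊤ : ℕ∞) (deriv b) := (contDiff_infty_iff_deriv.1 h0).2
  have h2 : ContDiff ℝ (⊤ : ℕ∞) (deriv (deriv b)) := (contDiff_infty_iff_deriv.1 h1).2
  have h3 : ContDiff ℝ (⊤ : ℕ∞) (deriv (deriv (deriv b))) := (contDiff_infty_iff_deriv.1 h2).2
  have s0 : HasCompactSupport b := b.hasCompactSupport
  have s1 := s0.deriv
  have s2 := s1.deriv
  have s3 := s2.deriv
  obtain ⟨C1, hC1⟩ := h1.continuous.bounded_above_of_compact_support s1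
  obtain ⟨C3, hC3⟩ := h3.continuous.bounded_above_of_compact_support s3
  have hn : (⊤ : ℕ∞) ≠ 0 := by simp
  refine ⟨b, deriv b, deriv (deriv b), deriv (deriv (deriv b)), max C1 C3,
    ((norm_nonneg _).trans (hC1 0)).trans (le_max_left _ _), h0.continuous, h1.continuous,
    h2.continuous, h3.continuous, fun x => (h0.differentiable (by simp) x).hasDerivAt,
    fun x => (h1.differentiable (by simp) x).hasDerivAt,
    fun x => (h2.differentiable (by simp) x).hasDerivAt, fun x => b.nonneg, fun x => b.le_one,
    fun x hx => b.one_of_mem_closedBall (by simpa [b] using hx), fun x hx => ?_, s0, s1, s2, s3,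
    fun x => (hC1 x).trans (le_max_left _ _), fun x => (hC3 x).trans (le_max_right _ _)⟩
  apply b.zero_of_le_dist
  simpa [b] using hx.le

/-- Integrated form of a differential (in)equality `∂ₜ e = ∂ₓ (j + ∂ₓ² k) + r`
under mere integrability of the fluxes. -/
lemma integral_le_of_flux {e e' j k k₁ k₂ r ρ : ℝ → ℝ → ℝ} {B B' : ℝ → ℝ} {a b K : ℝ}
    (hab : a ≤ b)
    (he : Continuous (Function.uncurry e)) (he' : Continuous (Function.uncurry e'))
    (hd : ∀ t x, HasDerivAt (fun τ => e τ x) (e' t x) t)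
    (hr : ∀ t, Continuous (r t)) (hj : ∀ t, Continuous (j t))
    (hk : ∀ t x, HasDerivAt (k t) (k₁ t x) x) (hk₁ : ∀ t x, HasDerivAt (k₁ t) (k₂ t x) x)
    (hJ : ∀ t x, HasDerivAt (fun y => j t y + k₂ t y) (e' t x - r t x) x)
    (hjK : ∀ t ∈ Set.Icc a b, Integrable (j t) ∧ ∫ x, |j t x| ≤ K)
    (hkK : ∀ t ∈ Set.Icc a b, Integrable (k t) ∧ ∫ x, |k t x| ≤ K)
    (hrρ : ∀ t ∈ Set.Icc a b, ∀ x, r t x ≤ ρ t x) (hρ0 : ∀ t ∈ Set.Icc a b, ∀ x, 0 ≤ ρ t x)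
    (hρ : ∀ t ∈ Set.Icc a b, Integrable (ρ t))
    (hρB : ∀ t ∈ Set.Icc a b, ∫ x, ρ t x ≤ B' t)
    (hB : ∀ t ∈ Set.Icc a b, HasDerivAt B (B' t) t)
    (hea : Integrable (e a)) (heb : Integrable (e b)) :
    (∫ x, e b x) - (∫ x, e a x) ≤ B b - B a := by
  obtain ⟨χ, χ₁, χ₂, χ₃, C, hC0, c0, c1, c2, c3, d0, d1, d2, nn, le1, one, zero, s0, s1, s2, s3,
    hC1, hC3⟩ := exists_cutoff
  have hK0 : 0 ≤ K := (integral_nonneg fun x => abs_nonneg _).trans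
    (hjK a (Set.left_mem_Icc.2 hab)).2
  have ce' : ∀ t, Continuous (e' t) := fun t => he'.comp (by fun_prop : Continuous fun x => (t, x))
  have cJ : ∀ t, Continuous (fun y => j t y + k₂ t y) :=
    fun t => continuous_iff_continuousAt.2 fun x => (hJ t x).continuousAt
  have ck : ∀ t, Continuous (k t) :=
    fun t => continuous_iff_continuousAt.2 fun x => (hk t x).continuousAt
  have ck1 : ∀ t, Continuous (k₁ t) :=
    fun t => continuous_iff_continuousAt.2 fun x => (hk₁ t x).continuousAt
  have ck2 : ∀ t, Continuous (k₂ t) := fun t => by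
    have h1 := Continuous.fun_sub (cJ t) (hj t)
    simpa using h1
  have key : ∀ n : ℕ, (∫ x, e b x * χ (x * ((n : ℝ) + 1)⁻¹)) -
      ∫ x, e a x * χ (x * ((n : ℝ) + 1)⁻¹) ≤
      2 * K * C * (b - a) * ((n : ℝ) + 1)⁻¹ + (B b - B a) := by
    intro n
    set q : ℝ := ((n : ℝ) + 1)⁻¹ with hq
    have hq0 : 0 < q := by positivity
    have hq1 : q ≤ 1 := inv_le_one_of_one_le₀ (by simp)
    have cs : ∀ {g : ℝ → ℝ}, HasCompactSupport g → HasCompactSupport fun x => g (x * q) := by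
      intro g hg
      exact hg.comp_homeomorph (Homeomorph.mulRight₀ q hq0.ne')
    have dq : ∀ {g g' : ℝ → ℝ}, (∀ x, HasDerivAt g (g' x) x) → ∀ x,
        HasDerivAt (fun x => g (x * q)) (g' (x * q) * q) x := by
      intro g g' hg x
      have h1 := (hg (x * q)).comp x ((hasDerivAt_id' x).mul_const q)
      rw [one_mul] at h1
      exact h1
    have hder : ∀ t, HasDerivAt (fun τ => ∫ x, e τ x * χ (x * q)) (∫ x, e' t x * χ (x * q)) t := by
      refine hasDerivAt_integral_of_compact (e := fun t x => e t x * χ (x * q))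
        (e' := fun t x => e' t x * χ (x * q)) (2 * ((n : ℝ) + 1)) ?_ ?_ ?_ ?_
      · exact he.mul (by fun_prop : Continuous fun p : ℝ × ℝ => χ (p.2 * q))
      · exact he'.mul (by fun_prop : Continuous fun p : ℝ × ℝ => χ (p.2 * q))
      · exact fun t x => (hd t x).mul_const _
      · intro t x hx
        rw [zero, mul_zero]
        rw [abs_mul, abs_of_pos hq0, hq, ← div_eq_mul_inv, lt_div_iff₀ (by positivity)]
        exact hx
    have hbd : ∀ t ∈ Set.Icc a b, ∫ x, e' t x * χ (x * q) ≤ 2 * K * C * q + B' t := by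
      intro t ht
      have D : ∀ {f g : ℝ → ℝ}, Continuous f → Continuous g → HasCompactSupport g →
          Dec fun x => f x * g (x * q) := fun hf hg h =>
        Dec.of_hasCompactSupport (by fun_prop) (cs h).mul_left
      have D' : ∀ {f g : ℝ → ℝ} (z : ℝ), Continuous f → Continuous g → HasCompactSupport g →
          Dec fun x => f x * (g (x * q) * z) := fun z hf hg h => by
        simpa only [mul_assoc] using (D hf hg h).mul_const z
      have e1 := integral_by_parts (hJ t) (dq d0) (D (cJ t) c0 s0)
        (D ((ce' t).sub (hr t)) c0 s0) (D' q (cJ t) c1 s1)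
      have e2 := integral_by_parts (hk₁ t) (dq d1) (D (ck1 t) c1 s1)
        (D (ck2 t) c1 s1) (D' q (ck1 t) c2 s2)
      have e3 := integral_by_parts (hk t) (dq d2) (D (ck t) c2 s2)
        (D (ck1 t) c2 s2) (D' q (ck t) c3 s3)
      have e4 : ∫ x, (e' t x - r t x) * χ (x * q) =
          (∫ x, e' t x * χ (x * q)) - ∫ x, r t x * χ (x * q) := by
        rw [← integral_sub (D (ce' t) c0 s0).integrable (D (hr t) c0 s0).integrable]
        simp only [sub_mul]
      have e5 : ∫ x, (j t x + k₂ t x) * (χ₁ (x * q) * q) =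
          q * (∫ x, j t x * χ₁ (x * q)) + q * ∫ x, k₂ t x * χ₁ (x * q) := by
        rw [← integral_const_mul, ← integral_const_mul, ← integral_add
          ((D (hj t) c1 s1).const_mul q).integrable ((D (ck2 t) c1 s1).const_mul q).integrable]
        congr 1; ext x; ring
      have e6 : ∫ x, k₁ t x * (χ₂ (x * q) * q) = q * ∫ x, k₁ t x * χ₂ (x * q) := by
        rw [← integral_const_mul]; congr 1; ext x; ring
      have e7 : ∫ x, k t x * (χ₃ (x * q) * q) = q * ∫ x, k t x * χ₃ (x * q) := by
        rw [← integral_const_mul]; congr 1; ext x; ring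
      have b1 : ∀ {f g : ℝ → ℝ}, Integrable f → ∫ x, |f x| ≤ K → (∀ x, |g x| ≤ C) →
          -(∫ x, f x * g (x * q)) ≤ K * C := by
        intro f g hf hfK hg
        have h1 : |∫ x, f x * g (x * q)| ≤ ∫ x, |f x| * C := by
          rw [← Real.norm_eq_abs]
          refine norm_integral_le_of_norm_le (hf.abs.mul_const C) (Eventually.of_forall fun x => ?_)
          rw [Real.norm_eq_abs, abs_mul]
          gcongr
          exact hg _
        rw [integral_mul_const] at h1
        have := neg_le_abs (∫ x, f x * g (x * q))
        nlinarith
      have b2 := b1 (hjK t ht).1 (hjK t ht).2 hC1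
      have b3 := b1 (hkK t ht).1 (hkK t ht).2 hC3
      have b4 : ∫ x, r t x * χ (x * q) ≤ ∫ x, ρ t x := by
        refine integral_mono (D (hr t) c0 s0).integrable (hρ t ht) fun x => ?_
        have h1 := hrρ t ht x
        have h2 := hρ0 t ht x
        have h3 := nn (x * q)
        have h4 := le1 (x * q)
        simp only
        nlinarith
      have b5 := hρB t ht
      rw [e4, e5, e2, e6, e3, e7] at e1
      have b6 : q * -(∫ x, j t x * χ₁ (x * q)) ≤ q * (K * C) := by gcongr
      have b7 : q * (q * (q * -(∫ x, k t x * χ₃ (x * q)))) ≤ q * (1 * (1 * (K * C))) := by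
        have hKC : 0 ≤ K * C := by positivity
        have h1 : q * (q * -(∫ x, k t x * χ₃ (x * q))) ≤ 1 * (1 * (K * C)) :=
          calc q * (q * -(∫ x, k t x * χ₃ (x * q))) ≤ q * (q * (K * C)) := by gcongr
            _ ≤ _ := by gcongr
        exact mul_le_mul_of_nonneg_left h1 hq0.le
      linarith
    have hmono : AntitoneOn (fun t => (∫ x, e t x * χ (x * q)) - (2 * K * C * q * t + B t))
        (Set.Icc a b) := by
      have hD : ∀ t ∈ Set.Icc a b, HasDerivAt
          (fun t => (∫ x, e t x * χ (x * q)) - (2 * K * C * q * t + B t))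
          ((∫ x, e' t x * χ (x * q)) - (2 * K * C * q * 1 + B' t)) t := fun t ht =>
        (hder t).sub (((hasDerivAt_id t).const_mul _).add (hB t ht))
      refine antitoneOn_of_deriv_nonpos (convex_Icc a b)
        (fun t ht => (hD t ht).continuousAt.continuousWithinAt) ?_ ?_
      · intro t ht
        rw [interior_Icc] at ht
        exact (hD t ⟨ht.1.le, ht.2.le⟩).differentiableAt.differentiableWithinAt
      · intro t ht
        rw [interior_Icc] at ht
        have ht' : t ∈ Set.Icc a b := ⟨ht.1.le, ht.2.le⟩
        rw [(hD t ht').deriv]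
        have := hbd t ht'
        linarith
    have := hmono (Set.left_mem_Icc.2 hab) (Set.right_mem_Icc.2 hab) hab
    simp only at this
    linarith
  have hq0 : Tendsto (fun n : ℕ => ((n : ℝ) + 1)⁻¹) atTop (nhds 0) := by
    simpa [one_div] using tendsto_one_div_add_atTop_nhds_zero_nat (𝕜 := ℝ)
  have hlim : ∀ {f : ℝ → ℝ}, Integrable f → Tendsto (fun n : ℕ => ∫ x, f x * χ (x * ((n : ℝ) + 1)⁻¹))
      atTop (nhds (∫ x, f x)) := by
    intro f hf
    refine tendsto_integral_of_dominated_convergence (fun x => ‖f x‖) (fun n => ?_) hf.norm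
      (fun n => Eventually.of_forall fun x => ?_) (Eventually.of_forall fun x => ?_)
    · exact hf.aestronglyMeasurable.mul (by fun_prop : Continuous fun x : ℝ =>
        χ (x * ((n : ℝ) + 1)⁻¹)).aestronglyMeasurable
    · rw [norm_mul]
      refine mul_le_of_le_one_right (norm_nonneg _) ?_
      rw [Real.norm_eq_abs, abs_of_nonneg (nn _)]
      exact le1 _
    · have h1 : Tendsto (fun n : ℕ => f x * χ (x * ((n : ℝ) + 1)⁻¹)) atTop
          (nhds (f x * χ (x * 0))) := ((c0.tendsto _).comp (hq0.const_mul x)).const_mul (f x)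
      rwa [mul_zero, one 0 (by simp), mul_one] at h1
  have hR : Tendsto (fun n : ℕ => 2 * K * C * (b - a) * ((n : ℝ) + 1)⁻¹ + (B b - B a)) atTop
      (nhds (2 * K * C * (b - a) * 0 + (B b - B a))) := (hq0.const_mul _).add_const _
  have := le_of_tendsto_of_tendsto' ((hlim heb).sub (hlim hea)) hR key
  rwa [mul_zero, zero_add] at this

section Smooth

variable {w : ℝ → ℝ → ℝ}

lemma hasDerivAt_snd_of_contDiff (hw : ContDiff ℝ (⊤ : ℕ∞) (Function.uncurry w)) (t x : ℝ) :
    HasDerivAt (w t) (fderiv ℝ (Function.uncurry w) (t, x) (0, 1)) x := by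
  have h1 := (hw.differentiable (by simp) (t, x)).hasFDerivAt
  exact h1.comp_hasDerivAt x ((hasDerivAt_const x t).prodMk (hasDerivAt_id x))

lemma hasDerivAt_fst_of_contDiff (hw : ContDiff ℝ (⊤ : ℕ∞) (Function.uncurry w)) (t x : ℝ) :
    HasDerivAt (fun τ => w τ x) (fderiv ℝ (Function.uncurry w) (t, x) (1, 0)) t := by
  have h1 := (hw.differentiable (by simp) (t, x)).hasFDerivAt
  exact h1.comp_hasDerivAt t ((hasDerivAt_id t).prodMk (hasDerivAt_const t x))

lemma contDiff_fderiv_apply (hw : ContDiff ℝ (⊤ : ℕ∞) (Function.uncurry w)) (z : ℝ × ℝ) :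
    ContDiff ℝ (⊤ : ℕ∞) fun p => fderiv ℝ (Function.uncurry w) p z :=
  (hw.fderiv_right (m := (⊤ : ℕ∞)) (by simp)).clm_apply contDiff_const

lemma contDiff_deriv_snd (hw : ContDiff ℝ (⊤ : ℕ∞) (Function.uncurry w)) :
    ContDiff ℝ (⊤ : ℕ∞) (Function.uncurry fun t x => deriv (w t) x) := by
  convert contDiff_fderiv_apply hw (0, 1) using 1
  exact funext fun p => (hasDerivAt_snd_of_contDiff hw p.1 p.2).deriv

/-- Mixed partial derivatives commute. -/
lemma hasDerivAt_deriv_snd (hw : ContDiff ℝ (⊤ : ℕ∞) (Function.uncurry w)) {w' : ℝ → ℝ → ℝ}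
    (hw' : ∀ t x, HasDerivAt (fun τ => w τ x) (w' t x) t) {t x d : ℝ}
    (hd : HasDerivAt (w' t) d x) : HasDerivAt (fun τ => deriv (w τ) x) d t := by
  have e1 : (fun τ => deriv (w τ) x) = fun τ => fderiv ℝ (Function.uncurry w) (τ, x) (0, 1) :=
    funext fun τ => (hasDerivAt_snd_of_contDiff hw τ x).deriv
  have e2 : w' t = fun y => fderiv ℝ (Function.uncurry w) (t, y) (1, 0) :=
    funext fun y => (hw' t y).unique (hasDerivAt_fst_of_contDiff hw t y)
  have hF := (((hw.fderiv_right (m := (⊤ : ℕ∞)) (by simp)).differentiable (by simp))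
    (t, x)).hasFDerivAt
  set D := fderiv ℝ (fderiv ℝ (Function.uncurry w)) (t, x) with hD
  have h1 : HasDerivAt (fun τ => fderiv ℝ (Function.uncurry w) (τ, x)) (D (1, 0)) t :=
    hF.comp_hasDerivAt t ((hasDerivAt_id t).prodMk (hasDerivAt_const t x))
  have h2 : HasDerivAt (fun y => fderiv ℝ (Function.uncurry w) (t, y)) (D (0, 1)) x :=
    hF.comp_hasDerivAt x ((hasDerivAt_const x t).prodMk (hasDerivAt_id x))
  have h3 := h1.clm_apply (hasDerivAt_const t ((0 : ℝ), (1 : ℝ)))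
  have h4 := h2.clm_apply (hasDerivAt_const x ((1 : ℝ), (0 : ℝ)))
  have hsym : D (1, 0) (0, 1) = D (0, 1) (1, 0) :=
    (hw.contDiffAt.isSymmSndFDerivAt (by simpa using WithTop.coe_le_coe.2 (le_top : (2 : ℕ∞) ≤ ⊤))).eq _ _
  rw [e1]
  rw [e2] at hd
  have h5 := hd.unique h4
  rw [h5]
  simpa [hsym] using h3

end Smooth

/-- A Gardner solution together with its spatial derivatives. -/
structure GardnerFlow (β : ℝ) (V : ℕ → ℝ → ℝ → ℝ) : Prop where
  cont : ∀ k, Continuous (Function.uncurry (V k))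
  dec : ∀ k t, Dec (V k t)
  dx : ∀ k t x, HasDerivAt (V k t) (V (k + 1) t x) x
  dt0 : ∀ t x, HasDerivAt (fun τ => V 0 τ x)
    (-(V 3 t x + (2 * V 0 t x - 3 * β * V 0 t x ^ 2) * V 1 t x)) t
  dt1 : ∀ t x, HasDerivAt (fun τ => V 1 τ x)
    (-(V 4 t x + (2 * V 0 t x - 3 * β * V 0 t x ^ 2) * V 2 t x +
      (2 - 6 * β * V 0 t x) * V 1 t x ^ 2)) t
  dt2 : ∀ t x, HasDerivAt (fun τ => V 2 τ x)
    (-(V 5 t x + (2 * V 0 t x - 3 * β * V 0 t x ^ 2) * V 3 t x +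
      3 * (2 - 6 * β * V 0 t x) * V 1 t x * V 2 t x - 6 * β * V 1 t x ^ 3)) t

lemma IsSchwartzFn.dec {f : ℝ → ℝ} (hf : IsSchwartzFn f) (n : ℕ)
    (hc : Continuous (iteratedDeriv n f)) : Dec (iteratedDeriv n f) := by
  obtain ⟨C0, h0⟩ := hf 0 n
  obtain ⟨C2, h2⟩ := hf 2 n
  refine ⟨hc, C0 + C2, fun x => ?_⟩
  rw [← div_eq_mul_inv, le_div_iff₀ (by positivity)]
  have h3 := h0 x
  have h4 := h2 x
  rw [sq_abs] at h4
  rw [pow_zero, one_mul] at h3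
  linarith

lemma IsGardnerSolution.exists_flow {β : ℝ} {v : ℝ → ℝ → ℝ} (hv : IsGardnerSolution β v) :
    ∃ V, V 0 = v ∧ GardnerFlow β V := by
  obtain ⟨hs, hS, heq⟩ := hv
  let V : ℕ → ℝ → ℝ → ℝ := fun k t => iteratedDeriv k (v t)
  have hV0 : V 0 = v := by ext t x; simp [V]
  have hVs : ∀ k t, V (k + 1) t = deriv (V k t) := fun k t => by simp [V, iteratedDeriv_succ]
  have hsm : ∀ k, ContDiff ℝ (⊤ : ℕ∞) (Function.uncurry (V k)) := by
    intro k
    induction k with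
    | zero => rw [hV0]; exact hs
    | succ k ih =>
      have : V (k + 1) = fun t x => deriv (V k t) x := by
        ext t x; rw [hVs]
      rw [this]
      exact contDiff_deriv_snd ih
  have hdx : ∀ k t x, HasDerivAt (V k t) (V (k + 1) t x) x := fun k t x => by
    rw [hVs]
    exact (hasDerivAt_snd_of_contDiff (hsm k) t x).differentiableAt.hasDerivAt
  have hc : ∀ k t, Continuous (V k t) := fun k t =>
    (hsm k).continuous.comp (by fun_prop : Continuous fun x : ℝ => (t, x))
  have hstep : ∀ k {w' : ℝ → ℝ → ℝ}, (∀ t x, HasDerivAt (fun τ => V k τ x) (w' t x) t) →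
      ∀ {d t x}, HasDerivAt (w' t) d x → HasDerivAt (fun τ => V (k + 1) τ x) d t := by
    intro k w' hw' d t x hd
    have := hasDerivAt_deriv_snd (hsm k) hw' hd
    simpa only [hVs] using this
  have d0 : ∀ t x, HasDerivAt (fun τ => V 0 τ x)
      (-(V 3 t x + (2 * V 0 t x - 3 * β * V 0 t x ^ 2) * V 1 t x)) t := by
    intro t x
    have h1 := (hasDerivAt_fst_of_contDiff (hsm 0) t x).differentiableAt.hasDerivAt
    refine h1.congr_deriv ?_
    have h2 := heq t x
    have h3 : HasDerivAt (fun y => deriv (deriv (v t)) y + (v t y) ^ 2 - β * (v t y) ^ 3)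
        (V 3 t x + 2 * V 0 t x * V 1 t x - β * (3 * V 0 t x ^ 2 * V 1 t x)) x := by
      have e : (fun y => deriv (deriv (v t)) y + (v t y) ^ 2 - β * (v t y) ^ 3) =
          fun y => V 2 t y + V 0 t y ^ 2 - β * V 0 t y ^ 3 := by
        ext y; rw [hVs 1, hVs 0, hV0]
      rw [e]
      have h4 := (hdx 0 t x).fun_pow 2
      have h5 := (hdx 0 t x).fun_pow 3
      simpa using ((hdx 2 t x).fun_add h4).fun_sub (h5.const_mul β)
    rw [h3.deriv] at h2
    have e : deriv (fun τ => V 0 τ x) t = deriv (fun τ => v τ x) t := by rw [hV0]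
    linear_combination e + h2
  have d1 : ∀ t x, HasDerivAt (fun τ => V 1 τ x)
      (-(V 4 t x + (2 * V 0 t x - 3 * β * V 0 t x ^ 2) * V 2 t x +
      (2 - 6 * β * V 0 t x) * V 1 t x ^ 2)) t := by
    intro t x
    refine hstep 0 d0 ?_
    have h0 := hdx 0 t x
    have h1 := (((h0.const_mul 2).fun_sub ((h0.fun_pow 2).const_mul (3 * β))).fun_mul
      (hdx 1 t x))
    have h2 := ((hdx 3 t x).fun_add h1).fun_neg
    refine h2.congr_deriv ?_
    simp only [Nat.reduceAdd]
    push_cast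
    ring
  have d2 : ∀ t x, HasDerivAt (fun τ => V 2 τ x)
      (-(V 5 t x + (2 * V 0 t x - 3 * β * V 0 t x ^ 2) * V 3 t x +
      3 * (2 - 6 * β * V 0 t x) * V 1 t x * V 2 t x - 6 * β * V 1 t x ^ 3)) t := by
    intro t x
    refine hstep 1 d1 ?_
    have h0 := hdx 0 t x
    have h1 := (((h0.const_mul 2).fun_sub ((h0.fun_pow 2).const_mul (3 * β))).fun_mul
      (hdx 2 t x))
    have h3 := ((h0.const_mul (6 * β)).const_sub 2).fun_mul ((hdx 1 t x).fun_pow 2)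
    have h2 := (((hdx 4 t x).fun_add h1).fun_add h3).fun_neg
    refine h2.congr_deriv ?_
    simp only [Nat.reduceAdd]
    push_cast
    ring
  exact ⟨V, hV0, fun k => (hsm k).continuous, fun k t => (hS t).dec k (hc k t), hdx, d0, d1, d2⟩

/-- Uniformly bounded families. -/
def BddOn (S : Set ℝ) (g : ℝ → ℝ → ℝ) : Prop :=
  (∀ t, Continuous (g t)) ∧ ∃ C, ∀ t ∈ S, ∀ x, |g t x| ≤ C

/-- Families bounded in `L¹`. -/
def L1On (S : Set ℝ) (g : ℝ → ℝ → ℝ) : Prop :=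
  (∀ t, Continuous (g t)) ∧ ∃ C, ∀ t ∈ S, Integrable (g t) ∧ ∫ x, |g t x| ≤ C

/-- Families bounded in `L²`. -/
def L2On (S : Set ℝ) (g : ℝ → ℝ → ℝ) : Prop :=
  (∀ t, Continuous (g t)) ∧ ∃ C, ∀ t ∈ S, Integrable (fun x => g t x ^ 2) ∧ ∫ x, g t x ^ 2 ≤ C

section Families

variable {S : Set ℝ} {f g : ℝ → ℝ → ℝ}

lemma BddOn.comp₂ (hf : BddOn S f) (hg : BddOn S g) {G : ℝ → ℝ → ℝ}
    (hG : Continuous (Function.uncurry G)) : BddOn S fun t x => G (f t x) (g t x) := by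
  obtain ⟨hf, B, hB⟩ := hf
  obtain ⟨hg, C, hC⟩ := hg
  obtain ⟨D, hD⟩ := ((isCompact_Icc (a := -B) (b := B)).prod
    (isCompact_Icc (a := -C) (b := C))).exists_bound_of_continuousOn hG.continuousOn
  exact ⟨fun t => hG.comp ((hf t).prodMk (hg t)), D, fun t ht x =>
    hD (f t x, g t x) ⟨abs_le.1 (hB t ht x), abs_le.1 (hC t ht x)⟩⟩

lemma BddOn.const (S : Set ℝ) (c : ℝ) : BddOn S fun _ _ => c :=
  ⟨fun _ => continuous_const, |c|, fun _ _ _ => le_rfl⟩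

lemma BddOn.mul (hf : BddOn S f) (hg : BddOn S g) : BddOn S fun t x => f t x * g t x :=
  hf.comp₂ hg (G := fun a b => a * b) (by fun_prop)

lemma L1On.add (hf : L1On S f) (hg : L1On S g) : L1On S fun t x => f t x + g t x := by
  obtain ⟨hf, B, hB⟩ := hf
  obtain ⟨hg, C, hC⟩ := hg
  refine ⟨fun t => (hf t).add (hg t), B + C, fun t ht => ⟨(hB t ht).1.add (hC t ht).1, ?_⟩⟩
  refine le_trans ?_ (add_le_add (hB t ht).2 (hC t ht).2)
  rw [← integral_add (hB t ht).1.abs (hC t ht).1.abs]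
  exact integral_mono ((hB t ht).1.add (hC t ht).1).abs ((hB t ht).1.abs.add (hC t ht).1.abs)
    fun x => abs_add_le _ _

lemma BddOn.mul_l1 (hf : BddOn S f) (hg : L1On S g) : L1On S fun t x => f t x * g t x := by
  obtain ⟨hf, B, hB⟩ := hf
  obtain ⟨hg, C, hC⟩ := hg
  have hi : ∀ t ∈ S, Integrable (fun x => f t x * g t x) := fun t ht =>
    (hC t ht).1.bdd_mul (hf t).aestronglyMeasurable (Eventually.of_forall (hB t ht))
  refine ⟨fun t => (hf t).mul (hg t), |B| * C, fun t ht => ⟨hi t ht, ?_⟩⟩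
  calc ∫ x, |f t x * g t x| ≤ ∫ x, |B| * |g t x| := by
        refine integral_mono (hi t ht).abs ((hC t ht).1.abs.const_mul _) fun x => ?_
        simp only [abs_mul]
        exact mul_le_mul_of_nonneg_right ((hB t ht x).trans (le_abs_self B)) (abs_nonneg _)
    _ ≤ _ := by
        rw [integral_const_mul]
        have := (hC t ht).2
        gcongr

lemma L1On.const_mul (hf : L1On S f) (c : ℝ) : L1On S fun t x => c * f t x :=
  (BddOn.const S c).mul_l1 hf

lemma L1On.sub (hf : L1On S f) (hg : L1On S g) : L1On S fun t x => f t x - g t x := by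
  simpa only [sub_eq_add_neg, neg_one_mul] using hf.add (hg.const_mul (-1))

lemma L1On.neg (hf : L1On S f) : L1On S fun t x => - f t x := by
  simpa only [neg_one_mul] using hf.const_mul (-1)

lemma L2On.mul (hf : L2On S f) (hg : L2On S g) : L1On S fun t x => f t x * g t x := by
  obtain ⟨hf, B, hB⟩ := hf
  obtain ⟨hg, C, hC⟩ := hg
  have hle : ∀ t x, |f t x * g t x| ≤ f t x ^ 2 + g t x ^ 2 := fun t x => by
    rw [abs_mul]
    nlinarith [sq_nonneg (|f t x| - |g t x|), sq_abs (f t x), sq_abs (g t x),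
      sq_nonneg (f t x), sq_nonneg (g t x)]
  have hi : ∀ t ∈ S, Integrable (fun x => f t x * g t x) := fun t ht =>
    ((hB t ht).1.add (hC t ht).1).mono' ((hf t).mul (hg t)).aestronglyMeasurable
      (Eventually.of_forall (hle t))
  refine ⟨fun t => (hf t).mul (hg t), B + C, fun t ht => ⟨hi t ht, ?_⟩⟩
  refine le_trans ?_ (add_le_add (hB t ht).2 (hC t ht).2)
  rw [← integral_add (hB t ht).1 (hC t ht).1]
  exact integral_mono (hi t ht).abs ((hB t ht).1.add (hC t ht).1) (hle t)

lemma L2On.sq (hf : L2On S f) : L1On S fun t x => f t x ^ 2 := by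
  simpa only [pow_two] using hf.mul hf

lemma BddOn.mul_l2 (hf : BddOn S f) (hg : L2On S g) : L2On S fun t x => f t x * g t x := by
  have h := (hf.mul hf).mul_l1 hg.sq
  obtain ⟨hc, C, hC⟩ := h
  have e : ∀ t x, f t x * f t x * g t x ^ 2 = (f t x * g t x) ^ 2 := fun t x => by ring
  simp only [e] at hC
  refine ⟨fun t => (hf.1 t).mul (hg.1 t), C, fun t ht => ⟨(hC t ht).1, ?_⟩⟩
  have := (hC t ht).2
  simpa only [abs_sq] using this

lemma L2On.add (hf : L2On S f) (hg : L2On S g) : L2On S fun t x => f t x + g t x := by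
  have h := (hf.sq.add (hg.sq)).add ((hf.mul hg).const_mul 2)
  obtain ⟨hc, C, hC⟩ := h
  have e : ∀ t x, f t x ^ 2 + g t x ^ 2 + 2 * (f t x * g t x) = (f t x + g t x) ^ 2 :=
    fun t x => by ring
  simp only [e] at hC
  refine ⟨fun t => (hf.1 t).add (hg.1 t), C, fun t ht => ⟨(hC t ht).1, ?_⟩⟩
  have := (hC t ht).2
  simpa only [abs_sq] using this

lemma L2On.const_mul (hf : L2On S f) (c : ℝ) : L2On S fun t x => c * f t x :=
  (BddOn.const S c).mul_l2 hf

lemma L2On.sub (hf : L2On S f) (hg : L2On S g) : L2On S fun t x => f t x - g t x := by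
  simpa only [sub_eq_add_neg, neg_one_mul] using hf.add (hg.const_mul (-1))

lemma L1On.zero (S : Set ℝ) : L1On S fun _ _ => 0 :=
  ⟨fun _ => continuous_const, 0, fun _ _ => by simp⟩

end Families

lemma abs_integral_sub_le_of_flux {e e' j k k₁ k₂ r : ℝ → ℝ → ℝ} {a b D : ℝ}
    (hab : a ≤ b)
    (he : Continuous (Function.uncurry e)) (he' : Continuous (Function.uncurry e'))
    (hd : ∀ t x, HasDerivAt (fun τ => e τ x) (e' t x) t)
    (hr : ∀ t, Continuous (r t))
    (hk : ∀ t x, HasDerivAt (k t) (k₁ t x) x) (hk₁ : ∀ t x, HasDerivAt (k₁ t) (k₂ t x) x)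
    (hJ : ∀ t x, HasDerivAt (fun y => j t y + k₂ t y) (e' t x - r t x) x)
    (hj1 : L1On (Set.Icc a b) j) (hk1 : L1On (Set.Icc a b) k)
    (hrD : ∀ t ∈ Set.Icc a b, Integrable (r t) ∧ ∫ x, |r t x| ≤ D)
    (hea : Integrable (e a)) (heb : Integrable (e b)) :
    |(∫ x, e b x) - ∫ x, e a x| ≤ D * (b - a) := by
  obtain ⟨hj, Cj, hCj⟩ := hj1
  obtain ⟨-, Ck, hCk⟩ := hk1
  have hB : ∀ t ∈ Set.Icc a b, HasDerivAt (fun t => D * t) D t := fun t _ => by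
    simpa using (hasDerivAt_id t).const_mul D
  have h1 := integral_le_of_flux (K := max Cj Ck) (ρ := fun t x => |r t x|) hab he he' hd hr hj hk
    hk₁ hJ (fun t ht => ⟨(hCj t ht).1, (hCj t ht).2.trans (le_max_left _ _)⟩)
    (fun t ht => ⟨(hCk t ht).1, (hCk t ht).2.trans (le_max_right _ _)⟩)
    (fun t _ x => le_abs_self _) (fun t _ x => abs_nonneg _) (fun t ht => (hrD t ht).1.abs)
    (fun t ht => (hrD t ht).2) hB hea heb
  have h2 := integral_le_of_flux (e := fun t x => - e t x) (e' := fun t x => - e' t x)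
    (j := fun t x => - j t x) (k := fun t x => - k t x) (k₁ := fun t x => - k₁ t x)
    (k₂ := fun t x => - k₂ t x) (r := fun t x => - r t x) (K := max Cj Ck)
    (ρ := fun t x => |r t x|) hab he.neg he'.neg (fun t x => (hd t x).fun_neg)
    (fun t => (hr t).neg) (fun t => (hj t).neg) (fun t x => (hk t x).fun_neg)
    (fun t x => (hk₁ t x).fun_neg)
    (fun t x => by
      have h3 := (hJ t x).fun_neg
      have e1 : (fun y => -(j t y + k₂ t y)) = fun y => -j t y + -k₂ t y := by
        ext y; ring
      rw [e1] at h3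
      exact h3.congr_deriv (by ring))
    (fun t ht => ⟨(hCj t ht).1.neg, by simpa using (hCj t ht).2.trans (le_max_left _ _)⟩)
    (fun t ht => ⟨(hCk t ht).1.neg, by simpa using (hCk t ht).2.trans (le_max_right _ _)⟩)
    (fun t _ x => neg_le_abs _) (fun t _ x => abs_nonneg _) (fun t ht => (hrD t ht).1.abs)
    (fun t ht => (hrD t ht).2) hB hea.neg heb.neg
  rw [integral_neg, integral_neg] at h2
  rw [abs_le]
  constructor <;> linarith

lemma integral_eq_of_flux {e e' j k k₁ k₂ : ℝ → ℝ → ℝ} {a b : ℝ}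
    (hab : a ≤ b)
    (he : Continuous (Function.uncurry e)) (he' : Continuous (Function.uncurry e'))
    (hd : ∀ t x, HasDerivAt (fun τ => e τ x) (e' t x) t)
    (hk : ∀ t x, HasDerivAt (k t) (k₁ t x) x) (hk₁ : ∀ t x, HasDerivAt (k₁ t) (k₂ t x) x)
    (hJ : ∀ t x, HasDerivAt (fun y => j t y + k₂ t y) (e' t x) x)
    (hj1 : L1On (Set.Icc a b) j) (hk1 : L1On (Set.Icc a b) k)
    (hea : Integrable (e a)) (heb : Integrable (e b)) :
    ∫ x, e b x = ∫ x, e a x := by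
  have := abs_integral_sub_le_of_flux (r := fun _ _ => 0) (D := 0) hab he he' hd
    (fun _ => continuous_const) hk hk₁ (fun t x => by simpa using hJ t x) hj1 hk1
    (fun t _ => by simp) hea heb
  rw [zero_mul] at this
  exact sub_eq_zero.1 (abs_nonpos_iff.1 this)

/-- The squared `L²` norm of the `k`-th spatial derivative. -/
noncomputable def en (V : ℕ → ℝ → ℝ → ℝ) (k : ℕ) (t : ℝ) : ℝ := ∫ x, V k t x ^ 2

/-- Boundedness in `H³`, uniformly on a set of times. -/
def H3On (S : Set ℝ) (V : ℕ → ℝ → ℝ → ℝ) : Prop := ∃ K, ∀ t ∈ S, ∀ k ≤ 3, en V k t ≤ K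

namespace GardnerFlow

variable {β : ℝ} {V : ℕ → ℝ → ℝ → ℝ} {S : Set ℝ} {a b : ℝ}

lemma l2On (h : GardnerFlow β V) (hS : H3On S V) {k : ℕ} (hk : k ≤ 3) : L2On S (V k) := by
  obtain ⟨K, hK⟩ := hS
  exact ⟨fun t => (h.dec k t).1, K, fun t ht => ⟨(h.dec k t).sq.integrable, hK t ht k hk⟩⟩

lemma sq_le (h : GardnerFlow β V) (k : ℕ) (t x : ℝ) :
    V k t x ^ 2 ≤ en V k t + en V (k + 1) t := by
  have := sq_le_integral (h.dx k t) (h.dec k t) (h.dec (k + 1) t) x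
  rwa [integral_add (h.dec k t).sq.integrable (h.dec (k + 1) t).sq.integrable] at this

lemma en_nonneg (k : ℕ) (t : ℝ) : 0 ≤ en V k t := integral_nonneg fun _ => sq_nonneg _

lemma bddOn (h : GardnerFlow β V) (hS : H3On S V) {k : ℕ} (hk : k ≤ 2) : BddOn S (V k) := by
  obtain ⟨K, hK⟩ := hS
  refine ⟨fun t => (h.dec k t).1, √(K + K), fun t ht x => Real.abs_le_sqrt ?_⟩
  exact (h.sq_le k t x).trans (add_le_add (hK t ht k (by omega)) (hK t ht (k + 1) (by omega)))

lemma cont_apply (h : GardnerFlow β V) (k : ℕ) : Continuous fun p : ℝ × ℝ => V k p.1 p.2 :=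
  h.cont k

/-- Conservation of mass. -/
lemma integral_sq_eq (h : GardnerFlow β V) (hab : a ≤ b) (hS : H3On (Set.Icc a b) V) :
    ∫ x, ((V 0 b x ^ 2)) =
      ∫ x, ((V 0 a x ^ 2)) := by
  have c := h.cont_apply
  have l0 := h.l2On hS (k := 0) (by norm_num)
  have l1 := h.l2On hS (k := 1) (by norm_num)
  have l2 := h.l2On hS (k := 2) (by norm_num)
  have l3 := h.l2On hS (k := 3) (by norm_num)
  have b0 := h.bddOn hS (k := 0) (by norm_num)
  have b1 := h.bddOn hS (k := 1) (by norm_num)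
  have hj : L1On (Set.Icc a b) fun t x => ((((-2) * (V 0 t x * V 2 t x)) + (1 * (V 1 t x * V 1 t x))) + (((((-4) / 3) * V 0 t x) + (((3 / 2) * β) * (V 0 t x ^ 2))) * (V 0 t x * V 0 t x))) :=
    ((((b0.comp₂ b1 (G := fun p q : ℝ => (-2)) (by fun_prop)).mul_l1 (l0.mul l2)).add
    ((b0.comp₂ b1 (G := fun p q : ℝ => 1) (by fun_prop)).mul_l1 (l1.mul l1))).add
    ((b0.comp₂ b1 (G := fun p q : ℝ => ((((-4) / 3) * p) + (((3 / 2) * β) * (p ^ 2)))) (by fun_prop)).mul_l1 (l0.mul l0)))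
  refine integral_eq_of_flux
    (e := fun t x => (V 0 t x ^ 2))
    (e' := fun t x => ((2 * V 0 t x) * (-(V 3 t x + (((2 * V 0 t x) - ((3 * β) * (V 0 t x ^ 2))) * V 1 t x)))))
    (j := fun t x => ((((-2) * (V 0 t x * V 2 t x)) + (1 * (V 1 t x * V 1 t x))) + (((((-4) / 3) * V 0 t x) + (((3 / 2) * β) * (V 0 t x ^ 2))) * (V 0 t x * V 0 t x))))
    (k := fun t x => 0) (k₁ := fun t x => 0)
    (k₂ := fun t x => 0)
    hab (by fun_prop) (by fun_prop) (fun t x => ?_) (fun t x => hasDerivAt_const x 0) (fun t x => hasDerivAt_const x 0) (fun t x => ?_) hj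
    (L1On.zero _) ?_ ?_
  · have h1 := ((h.dt0 t x).fun_pow 2)
    refine h1.congr_deriv ?_
    push_cast
    ring
  · have h1 := ((((((h.dx 0 t x).fun_mul (h.dx 2 t x)).const_mul (-2)).fun_add (((h.dx 1 t x).fun_mul (h.dx 1 t x)).const_mul 1)).fun_add ((((h.dx 0 t x).const_mul ((-4) / 3)).fun_add (((h.dx 0 t x).fun_pow 2).const_mul ((3 / 2) * β))).fun_mul ((h.dx 0 t x).fun_mul (h.dx 0 t x)))).add_const 0)
    refine h1.congr_deriv ?_
    simp only [Nat.reduceAdd]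
    push_cast
    ring
  all_goals exact ((h.dec 0 _).pow 1).integrable

/-- Conservation of energy. -/
lemma integral_energy_eq (h : GardnerFlow β V) (hab : a ≤ b) (hS : H3On (Set.Icc a b) V) :
    ∫ x, (((((1 / 2) * (V 1 b x ^ 2)) - ((1 / 3) * (V 0 b x ^ 3))) + ((β / 4) * (V 0 b x ^ 4)))) =
      ∫ x, (((((1 / 2) * (V 1 a x ^ 2)) - ((1 / 3) * (V 0 a x ^ 3))) + ((β / 4) * (V 0 a x ^ 4)))) := by
  have c := h.cont_apply
  have l0 := h.l2On hS (k := 0) (by norm_num)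
  have l1 := h.l2On hS (k := 1) (by norm_num)
  have l2 := h.l2On hS (k := 2) (by norm_num)
  have l3 := h.l2On hS (k := 3) (by norm_num)
  have b0 := h.bddOn hS (k := 0) (by norm_num)
  have b1 := h.bddOn hS (k := 1) (by norm_num)
  have hj : L1On (Set.Icc a b) fun t x => ((((((-1) * (V 1 t x * V 3 t x)) + ((-((2 * V 0 t x) - ((3 * β) * (V 0 t x ^ 2)))) * (V 1 t x * V 1 t x))) + ((1 / 2) * (V 2 t x * V 2 t x))) + ((V 0 t x - (β * (V 0 t x ^ 2))) * (V 0 t x * V 2 t x))) + (((1 / 2) * ((V 0 t x - (β * (V 0 t x ^ 2))) ^ 2)) * (V 0 t x * V 0 t x))) :=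
    ((((((b0.comp₂ b1 (G := fun p q : ℝ => (-1)) (by fun_prop)).mul_l1 (l1.mul l3)).add
    ((b0.comp₂ b1 (G := fun p q : ℝ => (-((2 * p) - ((3 * β) * (p ^ 2))))) (by fun_prop)).mul_l1 (l1.mul l1))).add
    ((b0.comp₂ b1 (G := fun p q : ℝ => (1 / 2)) (by fun_prop)).mul_l1 (l2.mul l2))).add
    ((b0.comp₂ b1 (G := fun p q : ℝ => (p - (β * (p ^ 2)))) (by fun_prop)).mul_l1 (l0.mul l2))).add
    ((b0.comp₂ b1 (G := fun p q : ℝ => ((1 / 2) * ((p - (β * (p ^ 2))) ^ 2))) (by fun_prop)).mul_l1 (l0.mul l0)))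
  refine integral_eq_of_flux
    (e := fun t x => ((((1 / 2) * (V 1 t x ^ 2)) - ((1 / 3) * (V 0 t x ^ 3))) + ((β / 4) * (V 0 t x ^ 4))))
    (e' := fun t x => ((V 1 t x * (-((V 4 t x + (((2 * V 0 t x) - ((3 * β) * (V 0 t x ^ 2))) * V 2 t x)) + ((2 - ((6 * β) * V 0 t x)) * (V 1 t x ^ 2))))) - (((V 0 t x ^ 2) - (β * (V 0 t x ^ 3))) * (-(V 3 t x + (((2 * V 0 t x) - ((3 * β) * (V 0 t x ^ 2))) * V 1 t x))))))
    (j := fun t x => ((((((-1) * (V 1 t x * V 3 t x)) + ((-((2 * V 0 t x) - ((3 * β) * (V 0 t x ^ 2)))) * (V 1 t x * V 1 t x))) + ((1 / 2) * (V 2 t x * V 2 t x))) + ((V 0 t x - (β * (V 0 t x ^ 2))) * (V 0 t x * V 2 t x))) + (((1 / 2) * ((V 0 t x - (β * (V 0 t x ^ 2))) ^ 2)) * (V 0 t x * V 0 t x))))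
    (k := fun t x => 0) (k₁ := fun t x => 0)
    (k₂ := fun t x => 0)
    hab (by fun_prop) (by fun_prop) (fun t x => ?_) (fun t x => hasDerivAt_const x 0) (fun t x => hasDerivAt_const x 0) (fun t x => ?_) hj
    (L1On.zero _) ?_ ?_
  · have h1 := (((((h.dt1 t x).fun_pow 2).const_mul (1 / 2)).fun_sub (((h.dt0 t x).fun_pow 3).const_mul (1 / 3))).fun_add (((h.dt0 t x).fun_pow 4).const_mul (β / 4)))
    refine h1.congr_deriv ?_
    push_cast
    ring
  · have h1 := ((((((((h.dx 1 t x).fun_mul (h.dx 3 t x)).const_mul (-1)).fun_add (((((h.dx 0 t x).const_mul 2).fun_sub (((h.dx 0 t x).fun_pow 2).const_mul (3 * β)))).fun_neg.fun_mul ((h.dx 1 t x).fun_mul (h.dx 1 t x)))).fun_add (((h.dx 2 t x).fun_mul (h.dx 2 t x)).const_mul (1 / 2))).fun_add (((h.dx 0 t x).fun_sub (((h.dx 0 t x).fun_pow 2).const_mul β)).fun_mul ((h.dx 0 t x).fun_mul (h.dx 2 t x)))).fun_add (((((h.dx 0 t x).fun_sub (((h.dx 0 t x).fun_pow 2).const_mul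 β)).fun_pow 2).const_mul (1 / 2)).fun_mul ((h.dx 0 t x).fun_mul (h.dx 0 t x)))).add_const 0)
    refine h1.congr_deriv ?_
    simp only [Nat.reduceAdd]
    push_cast
    ring
  all_goals exact (((((h.dec 1 _).pow 1).const_mul (1 / 2)).sub (((h.dec 0 _).pow 2).const_mul (1 / 3))).add (((h.dec 0 _).pow 3).const_mul (β / 4))).integrable

/-- Conservation of the second energy. -/
lemma integral_energy₂_eq (h : GardnerFlow β V) (hab : a ≤ b) (hS : H3On (Set.Icc a b) V) :
    ∫ x, (((((1 / 2) * (V 2 b x ^ 2)) - ((5 / 6) * (((2 * V 0 b x) - ((3 * β) * (V 0 b x ^ 2))) * (V 1 b x ^ 2)))) + ((((5 / 18) * (V 0 b x ^ 4)) - (((1 / 2) * β) * (V 0 b x ^ 5))) + (((1 / 4) * (β ^ 2)) * (V 0 b x ^ 6))))) =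
      ∫ x, (((((1 / 2) * (V 2 a x ^ 2)) - ((5 / 6) * (((2 * V 0 a x) - ((3 * β) * (V 0 a x ^ 2))) * (V 1 a x ^ 2)))) + ((((5 / 18) * (V 0 a x ^ 4)) - (((1 / 2) * β) * (V 0 a x ^ 5))) + (((1 / 4) * (β ^ 2)) * (V 0 a x ^ 6))))) := by
  have c := h.cont_apply
  have l0 := h.l2On hS (k := 0) (by norm_num)
  have l1 := h.l2On hS (k := 1) (by norm_num)
  have l2 := h.l2On hS (k := 2) (by norm_num)
  have l3 := h.l2On hS (k := 3) (by norm_num)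
  have b0 := h.bddOn hS (k := 0) (by norm_num)
  have b1 := h.bddOn hS (k := 1) (by norm_num)
  have hj : L1On (Set.Icc a b) fun t x => ((((((((3 / 2) * (V 3 t x * V 3 t x)) + (((5 / 3) * ((2 * V 0 t x) - ((3 * β) * (V 0 t x ^ 2)))) * (V 1 t x * V 3 t x))) + ((((-4) / 3) * ((2 * V 0 t x) - ((3 * β) * (V 0 t x ^ 2)))) * (V 2 t x * V 2 t x))) + ((((-5) / 6) * ((2 - ((6 * β) * V 0 t x)) * V 1 t x)) * (V 1 t x * V 2 t x))) + (((((5 / 6) * (((2 * V 0 t x) - ((3 * β) * (V 0 t x ^ 2))) ^ 2)) + (((1 / 4) * β) * (V 1 t x ^ 2))) + ((1 / 2) * ((((10 / 3) * (V 0 t x ^ 2)) - ((10 * β) * (V 0 t x ^ 3))) + (((15 / 2) * (β ^ 2)) * (V 0 t x ^ 4))))) * (V 1 t x * V 1 t x))) + ((-((((10 / 9) * (V 0 t x ^ 2)) - (((5 / 2) * β) * (V 0 t x ^ 3))) + (((3 / 2) * (β ^ 2)) * (V 0 t x ^ 4)))) * (V 0 t x * V 2 t x))) + ((-(((((4 /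 9) * (V 0 t x ^ 3)) - (((25 / 18) * β) * (V 0 t x ^ 4))) + (((3 / 2) * (β ^ 2)) * (V 0 t x ^ 5))) - (((9 / 16) * (β ^ 3)) * (V 0 t x ^ 6)))) * (V 0 t x * V 0 t x))) :=
    ((((((((b0.comp₂ b1 (G := fun p q : ℝ => (3 / 2)) (by fun_prop)).mul_l1 (l3.mul l3)).add
    ((b0.comp₂ b1 (G := fun p q : ℝ => ((5 / 3) * ((2 * p) - ((3 * β) * (p ^ 2))))) (by fun_prop)).mul_l1 (l1.mul l3))).add
    ((b0.comp₂ b1 (G := fun p q : ℝ => (((-4) / 3) * ((2 * p) - ((3 * β) * (p ^ 2))))) (by fun_prop)).mul_l1 (l2.mul l2))).add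
    ((b0.comp₂ b1 (G := fun p q : ℝ => (((-5) / 6) * ((2 - ((6 * β) * p)) * q))) (by fun_prop)).mul_l1 (l1.mul l2))).add
    ((b0.comp₂ b1 (G := fun p q : ℝ => ((((5 / 6) * (((2 * p) - ((3 * β) * (p ^ 2))) ^ 2)) + (((1 / 4) * β) * (q ^ 2))) + ((1 / 2) * ((((10 / 3) * (p ^ 2)) - ((10 * β) * (p ^ 3))) + (((15 / 2) * (β ^ 2)) * (p ^ 4)))))) (by fun_prop)).mul_l1 (l1.mul l1))).add
    ((b0.comp₂ b1 (G := fun p q : ℝ => (-((((10 / 9) * (p ^ 2)) - (((5 / 2) * β) * (p ^ 3))) + (((3 / 2) * (β ^ 2)) * (p ^ 4))))) (by fun_prop)).mul_l1 (l0.mul l2))).add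
    ((b0.comp₂ b1 (G := fun p q : ℝ => (-(((((4 / 9) * (p ^ 3)) - (((25 / 18) * β) * (p ^ 4))) + (((3 / 2) * (β ^ 2)) * (p ^ 5))) - (((9 / 16) * (β ^ 3)) * (p ^ 6))))) (by fun_prop)).mul_l1 (l0.mul l0)))
  refine integral_eq_of_flux
    (e := fun t x => ((((1 / 2) * (V 2 t x ^ 2)) - ((5 / 6) * (((2 * V 0 t x) - ((3 * β) * (V 0 t x ^ 2))) * (V 1 t x ^ 2)))) + ((((5 / 18) * (V 0 t x ^ 4)) - (((1 / 2) * β) * (V 0 t x ^ 5))) + (((1 / 4) * (β ^ 2)) * (V 0 t x ^ 6)))))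
    (e' := fun t x => (((V 2 t x * (-(((V 5 t x + (((2 * V 0 t x) - ((3 * β) * (V 0 t x ^ 2))) * V 3 t x)) + (((3 * (2 - ((6 * β) * V 0 t x))) * V 1 t x) * V 2 t x)) - ((6 * β) * (V 1 t x ^ 3))))) - ((5 / 6) * ((((2 - ((6 * β) * V 0 t x)) * (-(V 3 t x + (((2 * V 0 t x) - ((3 * β) * (V 0 t x ^ 2))) * V 1 t x)))) * (V 1 t x ^ 2)) + (((2 * ((2 * V 0 t x) - ((3 * β) * (V 0 t x ^ 2)))) * V 1 t x) * (-((V 4 t x + (((2 * V 0 t x) - ((3 * β) * (V 0 t x ^ 2))) * V 2 t x)) + ((2 - ((6 * β) * V 0 t x)) * (V 1 t x ^ 2)))))))) + (((((10 / 9) * (V 0 t x ^ 3)) - (((5 / 2) * β) * (V 0 t x ^ 4))) + (((3 / 2) * (β ^ 2)) * (V 0 t x ^ 5))) * (-(V 3 t x + (((2 * V 0 t x) - ((3 * β) * (V 0 t x ^ 2))) * V 1 t x))))))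
    (j := fun t x => ((((((((3 / 2) * (V 3 t x * V 3 t x)) + (((5 / 3) * ((2 * V 0 t x) - ((3 * β) * (V 0 t x ^ 2)))) * (V 1 t x * V 3 t x))) + ((((-4) / 3) * ((2 * V 0 t x) - ((3 * β) * (V 0 t x ^ 2)))) * (V 2 t x * V 2 t x))) + ((((-5) / 6) * ((2 - ((6 * β) * V 0 t x)) * V 1 t x)) * (V 1 t x * V 2 t x))) + (((((5 / 6) * (((2 * V 0 t x) - ((3 * β) * (V 0 t x ^ 2))) ^ 2)) + (((1 / 4) * β) * (V 1 t x ^ 2))) + ((1 / 2) * ((((10 / 3) * (V 0 t x ^ 2)) - ((10 * β) * (V 0 t x ^ 3))) + (((15 / 2) * (β ^ 2)) * (V 0 t x ^ 4))))) * (V 1 t x * V 1 t x))) + ((-((((10 / 9) * (V 0 t x ^ 2)) - (((5 / 2) * β) * (V 0 t x ^ 3))) + (((3 / 2) * (β ^ 2)) * (V 0 t x ^ 4)))) * (V 0 t x * V 2 t x))) + ((-(((((4 / 9) * (V 0 t x ^ 3)) - (((25 / 18) * β) * (V 0 t x ^ 4))) + (((3 / 2) * (β ^ 2)) * (V 0 t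 x ^ 5))) - (((9 / 16) * (β ^ 3)) * (V 0 t x ^ 6)))) * (V 0 t x * V 0 t x))))
    (k := fun t x => (((-1) / 2) * (V 2 t x ^ 2))) (k₁ := fun t x => (-(V 2 t x * V 3 t x)))
    (k₂ := fun t x => (-((V 3 t x ^ 2) + (V 2 t x * V 4 t x))))
    hab (by fun_prop) (by fun_prop) (fun t x => ?_) (fun t x => (((h.dx 2 t x).fun_pow 2).const_mul ((-1) / 2)).congr_deriv (by push_cast; ring)) (fun t x => (((h.dx 2 t x).fun_mul (h.dx 3 t x))).fun_neg.congr_deriv (by simp only [Nat.reduceAdd]; ring)) (fun t x => ?_) hj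
    ((l2.sq.const_mul (-1/2))) ?_ ?_
  · have h1 := (((((h.dt2 t x).fun_pow 2).const_mul (1 / 2)).fun_sub (((((h.dt0 t x).const_mul 2).fun_sub (((h.dt0 t x).fun_pow 2).const_mul (3 * β))).fun_mul ((h.dt1 t x).fun_pow 2)).const_mul (5 / 6))).fun_add (((((h.dt0 t x).fun_pow 4).const_mul (5 / 18)).fun_sub (((h.dt0 t x).fun_pow 5).const_mul ((1 / 2) * β))).fun_add (((h.dt0 t x).fun_pow 6).const_mul ((1 / 4) * (β ^ 2)))))
    refine h1.congr_deriv ?_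
    push_cast
    ring
  · have h1 := ((((((((((h.dx 3 t x).fun_mul (h.dx 3 t x)).const_mul (3 / 2)).fun_add (((((h.dx 0 t x).const_mul 2).fun_sub (((h.dx 0 t x).fun_pow 2).const_mul (3 * β))).const_mul (5 / 3)).fun_mul ((h.dx 1 t x).fun_mul (h.dx 3 t x)))).fun_add (((((h.dx 0 t x).const_mul 2).fun_sub (((h.dx 0 t x).fun_pow 2).const_mul (3 * β))).const_mul ((-4) / 3)).fun_mul ((h.dx 2 t x).fun_mul (h.dx 2 t x)))).fun_add ((((((h.dx 0 t x).const_mul (6 * β)).const_sub 2).fun_mul (h.dx 1 t x)).const_mul ((-5) / 6)).fun_mul ((h.dx 1 t x).fun_mul (h.dx 2 t x)))).fun_add ((((((((h.dx 0 t x).const_mul 2).fun_sub (((h.dx 0 t x).fun_pow 2).const_mul (3 * β))).fun_pow 2).const_mul (5 / 6)).fun_add (((h.dx 1 t x).fun_pow 2).const_mul ((1 / 4) * β))).fun_add ((((((h.dx 0 t x).fun_pow 2).const_mul (10 / 3)).fun_sub (((h.dx 0 t x).fun_pow 3).const_mul (10 * β))).fun_add (((h.dx 0 t x).fun_pow 4).const_mul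 ((15 / 2) * (β ^ 2)))).const_mul (1 / 2))).fun_mul ((h.dx 1 t x).fun_mul (h.dx 1 t x)))).fun_add (((((((h.dx 0 t x).fun_pow 2).const_mul (10 / 9)).fun_sub (((h.dx 0 t x).fun_pow 3).const_mul ((5 / 2) * β))).fun_add (((h.dx 0 t x).fun_pow 4).const_mul ((3 / 2) * (β ^ 2))))).fun_neg.fun_mul ((h.dx 0 t x).fun_mul (h.dx 2 t x)))).fun_add ((((((((h.dx 0 t x).fun_pow 3).const_mul (4 / 9)).fun_sub (((h.dx 0 t x).fun_pow 4).const_mul ((25 / 18) * β))).fun_add (((h.dx 0 t x).fun_pow 5).const_mul ((3 / 2) * (β ^ 2)))).fun_sub (((h.dx 0 t x).fun_pow 6).const_mul ((9 / 16) * (β ^ 3))))).fun_neg.fun_mul ((h.dx 0 t x).fun_mul (h.dx 0 t x)))).fun_add ((((h.dx 3 t x).fun_pow 2).fun_add ((h.dx 2 t x).fun_mul (h.dx 4 t x)))).fun_neg)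
    refine h1.congr_deriv ?_
    simp only [Nat.reduceAdd]
    push_cast
    ring
  all_goals exact (((((h.dec 2 _).pow 1).const_mul (1 / 2)).sub (((((h.dec 0 _).const_mul 2).sub (((h.dec 0 _).pow 1).const_mul (3 * β))).mul ((h.dec 1 _).pow 1)).const_mul (5 / 6))).add (((((h.dec 0 _).pow 3).const_mul (5 / 18)).sub (((h.dec 0 _).pow 4).const_mul ((1 / 2) * β))).add (((h.dec 0 _).pow 5).const_mul ((1 / 4) * (β ^ 2))))).integrable

end GardnerFlow

namespace GardnerFlow

variable {β : ℝ} {V : ℕ → ℝ → ℝ → ℝ} {S : Set ℝ} {a b : ℝ}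

lemma integral_quad (h : GardnerFlow β V) (t c₀ c₁ c₂ : ℝ) :
    Integrable (fun x => c₀ * V 0 t x ^ 2 + c₁ * V 1 t x ^ 2 + c₂ * V 2 t x ^ 2) ∧
    ∫ x, (c₀ * V 0 t x ^ 2 + c₁ * V 1 t x ^ 2 + c₂ * V 2 t x ^ 2) =
      c₀ * en V 0 t + c₁ * en V 1 t + c₂ * en V 2 t := by
  have i0 := ((h.dec 0 t).sq.const_mul c₀)
  have i1 := ((h.dec 1 t).sq.const_mul c₁)
  have i2 := ((h.dec 2 t).sq.const_mul c₂)
  refine ⟨((i0.add i1).add i2).integrable, ?_⟩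
  rw [integral_add (i0.add i1).integrable i2.integrable, integral_add i0.integrable i1.integrable,
    integral_const_mul, integral_const_mul, integral_const_mul]
  rfl

lemma integral_le_quad (h : GardnerFlow β V) {t c₀ c₁ c₂ : ℝ} {g : ℝ → ℝ} (hg : Integrable g)
    (hle : ∀ x, g x ≤ c₀ * V 0 t x ^ 2 + c₁ * V 1 t x ^ 2 + c₂ * V 2 t x ^ 2) :
    ∫ x, g x ≤ c₀ * en V 0 t + c₁ * en V 1 t + c₂ * en V 2 t := by
  rw [← (h.integral_quad t c₀ c₁ c₂).2]
  exact integral_mono hg (h.integral_quad t c₀ c₁ c₂).1 hle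

lemma quad_le_integral (h : GardnerFlow β V) {t c₀ c₁ c₂ : ℝ} {g : ℝ → ℝ} (hg : Integrable g)
    (hle : ∀ x, c₀ * V 0 t x ^ 2 + c₁ * V 1 t x ^ 2 + c₂ * V 2 t x ^ 2 ≤ g x) :
    c₀ * en V 0 t + c₁ * en V 1 t + c₂ * en V 2 t ≤ ∫ x, g x := by
  rw [← (h.integral_quad t c₀ c₁ c₂).2]
  exact integral_mono (h.integral_quad t c₀ c₁ c₂).1 hg hle

/-- The energy density. -/
noncomputable def _root_.energy (β : ℝ) (V : ℕ → ℝ → ℝ → ℝ) (t : ℝ) : ℝ :=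
  ∫ x, ((1 / 2) * V 1 t x ^ 2 - (1 / 3) * V 0 t x ^ 3 + (β / 4) * V 0 t x ^ 4)

/-- The second energy density. -/
noncomputable def _root_.energy₂ (β : ℝ) (V : ℕ → ℝ → ℝ → ℝ) (t : ℝ) : ℝ :=
  ∫ x, ((1 / 2) * V 2 t x ^ 2 - (5 / 6) * ((2 * V 0 t x - 3 * β * V 0 t x ^ 2) * V 1 t x ^ 2) +
    ((5 / 18) * V 0 t x ^ 4 - (1 / 2 * β) * V 0 t x ^ 5 + (1 / 4 * β ^ 2) * V 0 t x ^ 6))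

lemma integrable_energy (h : GardnerFlow β V) (t : ℝ) : Integrable fun x =>
    (1 / 2) * V 1 t x ^ 2 - (1 / 3) * V 0 t x ^ 3 + (β / 4) * V 0 t x ^ 4 :=
  ((((h.dec 1 t).sq.const_mul _).sub ((h.dec 0 t).cube.const_mul _)).add
    ((h.dec 0 t).pow_four.const_mul _)).integrable

lemma integrable_energy₂ (h : GardnerFlow β V) (t : ℝ) : Integrable fun x =>
    (1 / 2) * V 2 t x ^ 2 - (5 / 6) * ((2 * V 0 t x - 3 * β * V 0 t x ^ 2) * V 1 t x ^ 2) +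
    ((5 / 18) * V 0 t x ^ 4 - (1 / 2 * β) * V 0 t x ^ 5 + (1 / 4 * β ^ 2) * V 0 t x ^ 6) :=
  ((((h.dec 2 t).sq.const_mul _).sub (((((h.dec 0 t).const_mul 2).sub
    ((h.dec 0 t).sq.const_mul (3 * β))).mul (h.dec 1 t).sq).const_mul _)).add
    ((((h.dec 0 t).pow_four.const_mul _).sub (((h.dec 0 t).pow 4).const_mul _)).add
    (((h.dec 0 t).pow 5).const_mul _))).integrable

/-- The three conserved quantities agree at two times. -/
def _root_.SameInvariants (β : ℝ) (V : ℕ → ℝ → ℝ → ℝ) (s t : ℝ) : Prop :=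
  en V 0 s = en V 0 t ∧ energy β V s = energy β V t ∧ energy₂ β V s = energy₂ β V t

lemma sameInvariants (h : GardnerFlow β V) (hab : a ≤ b) (hS : H3On (Set.Icc a b) V) :
    SameInvariants β V a b :=
  ⟨(h.integral_sq_eq hab hS).symm, (h.integral_energy_eq hab hS).symm,
    (h.integral_energy₂_eq hab hS).symm⟩

lemma _root_.SameInvariants.symm {s t : ℝ} (h : SameInvariants β V s t) :
    SameInvariants β V t s := ⟨h.1.symm, h.2.1.symm, h.2.2.symm⟩

lemma abs_le_sqrt (h : GardnerFlow β V) {k : ℕ} {t K : ℝ} (h0 : en V k t ≤ K)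
    (h1 : en V (k + 1) t ≤ K) (x : ℝ) : |V k t x| ≤ √(2 * K) :=
  Real.abs_le_sqrt ((h.sq_le k t x).trans (by linarith))

/-- The mass and the energy control the `H¹` norm. -/
lemma exists_h1_bound (hβ : 0 < β) (K : ℝ) : ∃ K', ∀ V, GardnerFlow β V → ∀ s t,
    en V 0 s = en V 0 t → energy β V s = energy β V t → en V 0 s ≤ K → en V 1 s ≤ K →
    en V 1 t ≤ K' := by
  set S := √(2 * K)
  refine ⟨2 * ((1 / 3 * S + β / 4 * S ^ 2) * K + 1 / 2 * K + 1 / (9 * β) * K),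
    fun V h s t h0 h1 hs0 hs1 => ?_⟩
  have hS : ∀ x, |V 0 s x| ≤ S := h.abs_le_sqrt hs0 hs1
  have hS0 : 0 ≤ S := Real.sqrt_nonneg _
  have u1 : energy β V s ≤ (1 / 3 * S + β / 4 * S ^ 2) * en V 0 s + 1 / 2 * en V 1 s +
      0 * en V 2 s := by
    refine h.integral_le_quad (h.integrable_energy s) fun x => ?_
    have h2 := abs_le.1 (hS x)
    have h3 : V 0 s x ^ 2 ≤ S ^ 2 := sq_le_sq' h2.1 h2.2
    have h4 := mul_le_mul_of_nonneg_right h3 (sq_nonneg (V 0 s x))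
    have h5 := mul_le_mul_of_nonneg_right h2.1 (sq_nonneg (V 0 s x))
    nlinarith
  have l1 : -(1 / (9 * β)) * en V 0 t + 1 / 2 * en V 1 t + 0 * en V 2 t ≤ energy β V t := by
    refine h.quad_le_integral (h.integrable_energy t) fun x => ?_
    have h6 : 0 ≤ β / 4 * (V 0 t x * (V 0 t x - 2 / (3 * β))) ^ 2 := by positivity
    have h7 : β / 4 * (V 0 t x * (V 0 t x - 2 / (3 * β))) ^ 2 =
      β / 4 * V 0 t x ^ 4 - 1 / 3 * V 0 t x ^ 3 + 1 / (9 * β) * V 0 t x ^ 2 := by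
      field_simp; ring
    linarith
  have p1 : 0 ≤ 1 / 3 * S + β / 4 * S ^ 2 := by positivity
  have p2 : 0 ≤ 1 / (9 * β) := by positivity
  have q1 := mul_le_mul_of_nonneg_left hs0 p1
  have q2 := mul_le_mul_of_nonneg_left (h0 ▸ hs0) p2
  linarith

/-- The three conserved quantities control the `H²` norm. -/
lemma exists_h2_bound (hβ : 0 < β) (K : ℝ) : ∃ K', ∀ V, GardnerFlow β V → ∀ s t,
    SameInvariants β V s t → (∀ k ≤ 2, en V k s ≤ K) → ∀ k ≤ 2, en V k t ≤ K' := by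
  obtain ⟨K₁, hK₁⟩ := exists_h1_bound hβ K
  set M := max K K₁
  set S := √(2 * M)
  set p := 2 * S + 3 * β * S ^ 2 with hp
  set q := 5 / 18 * S ^ 2 + (1 / 2 * β) * S ^ 3 + (1 / 4 * β ^ 2) * S ^ 4 with hq
  have hS0 : 0 ≤ S := Real.sqrt_nonneg _
  refine ⟨max M (2 * (2 * (q * M) + 2 * (5 / 6 * p * M) + 1 / 2 * K)), fun V h s t hI hs => ?_⟩
  have hM0 : ∀ k ≤ 1, en V k s ≤ M := fun k hk => (hs k (by omega)).trans (le_max_left _ _)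
  have t0 : en V 0 t ≤ M := hI.1 ▸ hM0 0 (by omega)
  have t1 : en V 1 t ≤ M :=
    (hK₁ V h s t hI.1 hI.2.1 (hs 0 (by omega)) (hs 1 (by omega))).trans (le_max_right _ _)
  have key : ∀ {τ}, (∀ x, |V 0 τ x| ≤ S) → ∀ x,
      |(5 / 6) * ((2 * V 0 τ x - 3 * β * V 0 τ x ^ 2) * V 1 τ x ^ 2)| ≤
        5 / 6 * p * V 1 τ x ^ 2 ∧
      |(5 / 18) * V 0 τ x ^ 4 - (1 / 2 * β) * V 0 τ x ^ 5 + (1 / 4 * β ^ 2) * V 0 τ x ^ 6| ≤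
        q * V 0 τ x ^ 2 := by
    intro τ hτ x
    have e1 : |2 * V 0 τ x - 3 * β * V 0 τ x ^ 2| ≤ p := by
      refine (abs_sub _ _).trans ?_
      simp only [abs_mul, abs_pow, abs_of_pos hβ, Nat.abs_ofNat, hp]
      gcongr <;> exact hτ x
    have e2 : |(5 / 18) * V 0 τ x ^ 2 - (1 / 2 * β) * V 0 τ x ^ 3 +
        (1 / 4 * β ^ 2) * V 0 τ x ^ 4| ≤ q := by
      refine (abs_add_le _ _).trans ?_
      rw [hq]
      refine add_le_add ((abs_sub _ _).trans ?_) ?_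
      · simp only [abs_mul, abs_pow, abs_of_pos hβ, abs_div, abs_one, Nat.abs_ofNat]
        gcongr <;> exact hτ x
      · simp only [abs_mul, abs_pow, abs_of_pos hβ, abs_div, abs_one, Nat.abs_ofNat]
        gcongr; exact hτ x
    constructor
    · rw [abs_mul, abs_mul, abs_sq, abs_of_pos (by norm_num : (0 : ℝ) < 5 / 6), ← mul_assoc]
      gcongr
    · have e3 : (5 / 18) * V 0 τ x ^ 4 - (1 / 2 * β) * V 0 τ x ^ 5 +
          (1 / 4 * β ^ 2) * V 0 τ x ^ 6 = ((5 / 18) * V 0 τ x ^ 2 - (1 / 2 * β) * V 0 τ x ^ 3 +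
        (1 / 4 * β ^ 2) * V 0 τ x ^ 4) * V 0 τ x ^ 2 := by ring
      rw [e3, abs_mul, abs_sq]
      gcongr
  have ks := key (h.abs_le_sqrt (hM0 0 (by omega)) (hM0 1 (by omega)))
  have kt := key (h.abs_le_sqrt t0 t1)
  have u1 : energy₂ β V s ≤ q * en V 0 s + 5 / 6 * p * en V 1 s + 1 / 2 * en V 2 s := by
    refine h.integral_le_quad (h.integrable_energy₂ s) fun x => ?_
    have h1 := abs_le.1 (ks x).1
    have h2 := abs_le.1 (ks x).2
    linarith
  have l1 : -q * en V 0 t + -(5 / 6 * p) * en V 1 t + 1 / 2 * en V 2 t ≤ energy₂ β V t := by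
    refine h.quad_le_integral (h.integrable_energy₂ t) fun x => ?_
    have h1 := abs_le.1 (kt x).1
    have h2 := abs_le.1 (kt x).2
    linarith
  have p0 : 0 ≤ 5 / 6 * p := by positivity
  have q0 : 0 ≤ q := by positivity
  have m1 := mul_le_mul_of_nonneg_left (hM0 0 (by omega)) q0
  have m2 := mul_le_mul_of_nonneg_left (hM0 1 (by omega)) p0
  have m3 := mul_le_mul_of_nonneg_left t0 q0
  have m4 := mul_le_mul_of_nonneg_left t1 p0
  have m5 := hs 2 le_rfl
  have m6 := hI.2.2
  intro k hk
  interval_cases k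
  · exact t0.trans (le_max_left _ _)
  · exact t1.trans (le_max_left _ _)
  · refine le_trans ?_ (le_max_right _ _)
    linarith

end GardnerFlow

/-- The difference quotient is controlled in `L²` by the derivative. -/
lemma integral_sq_diff_le {g g' : ℝ → ℝ} (hd : ∀ x, HasDerivAt g (g' x) x) (hg' : Dec g')
    {h : ℝ} (hh : 0 < h) : ∫ x, (g (x + h) - g x) ^ 2 ≤ h ^ 2 * ∫ x, g' x ^ 2 := by
  have hc := hg'.1
  have hw : ∀ x, g (x + h) - g x = ∫ s in 0..h, g' (x + s) := fun x => by
    have := intervalIntegral.integral_eq_sub_of_hasDerivAt (a := 0) (b := h)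
      (f := fun s => g (x + s)) (f' := fun s => g' (x + s))
      (fun s _ => (hd (x + s)).comp_const_add x s)
      ((hc.comp (by fun_prop)).intervalIntegrable _ _)
    simpa using this.symm
  have hcs : ∀ x, (g (x + h) - g x) ^ 2 ≤ h * ∫ s in 0..h, g' (x + s) ^ 2 := fun x => by
    set w := g (x + h) - g x with hwd
    have h0 : 0 ≤ ∫ s in 0..h, (g' (x + s) - w / h) ^ 2 :=
      intervalIntegral.integral_nonneg hh.le fun s _ => sq_nonneg _
    have i1 : IntervalIntegrable (fun s => g' (x + s)) volume 0 h :=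
      (hc.comp (by fun_prop)).intervalIntegrable _ _
    have i2 : IntervalIntegrable (fun s => g' (x + s) ^ 2) volume 0 h :=
      ((hc.comp (by fun_prop : Continuous fun s : ℝ => x + s)).pow 2).intervalIntegrable _ _
    have e : ∫ s in 0..h, (g' (x + s) - w / h) ^ 2 =
        (∫ s in 0..h, g' (x + s) ^ 2) - 2 * (w / h) * w + h * (w / h) ^ 2 := by
      have e1 : ∀ s, (g' (x + s) - w / h) ^ 2 =
        g' (x + s) ^ 2 - 2 * (w / h) * g' (x + s) + (w / h) ^ 2 := fun s => by ring
      simp only [e1]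
      rw [intervalIntegral.integral_add (i2.sub (i1.const_mul _)) (by simp),
        intervalIntegral.integral_sub i2 (i1.const_mul _), intervalIntegral.integral_const_mul,
        ← hw, intervalIntegral.integral_const]
      simp [hwd]
    rw [e] at h0
    have e2 : h * (2 * (w / h) * w - h * (w / h) ^ 2) = w ^ 2 := by field_simp; ring
    nlinarith
  obtain ⟨C, hC0, hC⟩ := hg'.exists_nonneg
  have : IsFiniteMeasure (volume.restrict (Set.uIoc 0 h)) := by
    rw [Set.uIoc_of_le hh.le]; infer_instance
  have hint : Integrable (Function.uncurry fun x s : ℝ => g' (x + s) ^ 2)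
      (volume.prod (volume.restrict (Set.uIoc 0 h))) := by
    have hm : Integrable (fun p : ℝ × ℝ => (C ^ 2 * (2 * (1 + h ^ 2)) * (1 + p.1 ^ 2)⁻¹) * (1 : ℝ))
        (volume.prod (volume.restrict (Set.uIoc 0 h))) :=
      (integrable_inv_one_add_sq.const_mul _).mul_prod
        (g := fun _ : ℝ => (1 : ℝ)) (integrable_const _)
    refine hm.mono' (by
      have : Continuous (Function.uncurry fun x s : ℝ => g' (x + s) ^ 2) := by fun_prop
      exact this.aestronglyMeasurable) ?_
    have hae : ∀ᵐ p : ℝ × ℝ ∂(volume.prod (volume.restrict (Set.uIoc 0 h))),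
        p.2 ∈ Set.uIoc 0 h := by
      have : ∀ᵐ s ∂(volume.restrict (Set.uIoc (0 : ℝ) h)), s ∈ Set.uIoc 0 h :=
        ae_restrict_mem measurableSet_uIoc
      exact Measure.quasiMeasurePreserving_snd.ae this
    filter_upwards [hae] with p hp
    obtain ⟨x, s⟩ := p
    rw [Set.uIoc_of_le hh.le] at hp
    simp only [Function.uncurry_apply_pair, Real.norm_eq_abs, abs_sq, mul_one]
    have h1 : g' (x + s) ^ 2 ≤ (C * (1 + (x + s) ^ 2)⁻¹) ^ 2 := by
      rw [← sq_abs]; gcongr; exact hC _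
    refine h1.trans ?_
    have h2 : 0 < 1 + (x + s) ^ 2 := by positivity
    have h3 : (1 + (x + s) ^ 2)⁻¹ ≤ 1 := inv_le_one_of_one_le₀ (by nlinarith [sq_nonneg (x + s)])
    have h4 : 0 < (1 + (x + s) ^ 2)⁻¹ := by positivity
    have h5 : (1 + (x + s) ^ 2)⁻¹ ≤ 2 * (1 + h ^ 2) * (1 + x ^ 2)⁻¹ := by
      rw [← div_eq_mul_inv, inv_eq_one_div, div_le_div_iff₀ h2 (by positivity)]
      have hsh : s ^ 2 ≤ h ^ 2 := by nlinarith [hp.1, hp.2]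
      nlinarith [sq_nonneg (x + 2 * s), sq_nonneg (h * (x + s)), sq_nonneg h, sq_nonneg (x + s)]
    calc (C * (1 + (x + s) ^ 2)⁻¹) ^ 2 = C ^ 2 * ((1 + (x + s) ^ 2)⁻¹ * (1 + (x + s) ^ 2)⁻¹) := by
          ring
      _ ≤ C ^ 2 * (1 * (2 * (1 + h ^ 2) * (1 + x ^ 2)⁻¹)) := by gcongr
      _ = _ := by ring
  have hsw : ∫ x, ∫ s in 0..h, g' (x + s) ^ 2 = h * ∫ x, g' x ^ 2 := by
    have := integral_integral_swap hint
    simp only [Set.uIoc_of_le hh.le] at this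
    simp only [intervalIntegral.integral_of_le hh.le]
    rw [this]
    have e : ∀ s, ∫ x, g' (x + s) ^ 2 = ∫ x, g' x ^ 2 := fun s =>
      integral_add_right_eq_self (fun x => g' x ^ 2) s
    simp only [e]
    simp [hh.le]
  have hI : Integrable fun x => ∫ s in 0..h, g' (x + s) ^ 2 := by
    have := hint.integral_prod_left
    simp only [Set.uIoc_of_le hh.le] at this
    simpa only [intervalIntegral.integral_of_le hh.le, Function.uncurry_apply_pair] using this
  calc ∫ x, (g (x + h) - g x) ^ 2 ≤ ∫ x, h * ∫ s in 0..h, g' (x + s) ^ 2 := by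
        refine integral_mono_of_nonneg (Eventually.of_forall fun x => sq_nonneg _)
          (hI.const_mul h) (Eventually.of_forall hcs)
    _ = _ := by rw [integral_const_mul, hsw]; ring

/-- Recovering the derivative from the difference quotients. -/
lemma exists_integral_sq_deriv_le {g g' g'' : ℝ → ℝ} (hd : ∀ x, HasDerivAt g (g' x) x)
    (hd' : ∀ x, HasDerivAt g' (g'' x) x) (hg : Dec g) (hg' : Dec g') (hg'' : Dec g'') :
    ∃ C, ∀ h, 0 < h →
      h ^ 2 * ∫ x, g' x ^ 2 ≤ (∫ x, (g (x + h) - g x) ^ 2) + h ^ 3 * C := by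
  obtain ⟨B, hB0, hB⟩ := hg''.bounded
  refine ⟨2 * B * ∫ x, |g' x|, fun h hh => ?_⟩
  have hlip : ∀ x, |g (x + h) - g x - h * g' x| ≤ B * h ^ 2 := fun x => by
    obtain ⟨y, hy, hy'⟩ := exists_hasDerivAt_eq_slope g g' (by linarith : x < x + h)
      (fun z _ => (hd z).continuousAt.continuousWithinAt) (fun z _ => hd z)
    obtain ⟨z, hz, hz'⟩ := exists_hasDerivAt_eq_slope g' g'' hy.1
      (fun z _ => (hd' z).continuousAt.continuousWithinAt) (fun z _ => hd' z)
    have hyx : 0 < y - x := by linarith [hy.1]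
    rw [add_sub_cancel_left, eq_div_iff hh.ne'] at hy'
    rw [eq_div_iff hyx.ne'] at hz'
    have e : g (x + h) - g x - h * g' x = h * (g'' z * (y - x)) := by rw [hz', ← hy']; ring
    rw [e, abs_mul, abs_mul, abs_of_pos hh, abs_of_pos hyx]
    have h1 := hB z
    have h2 : y - x ≤ h := by linarith [hy.2]
    calc h * (|g'' z| * (y - x)) ≤ h * (B * h) := by gcongr
      _ = _ := by ring
  have i1 : Integrable fun x => (g (x + h) - g x) ^ 2 := ((hg.comp_add h).sub hg).sq.integrable
  have i2 : Integrable fun x => h ^ 3 * (2 * B) * |g' x| := (hg'.abs.const_mul _).integrable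
  calc h ^ 2 * ∫ x, g' x ^ 2 = ∫ x, h ^ 2 * g' x ^ 2 := (integral_const_mul _ _).symm
    _ ≤ ∫ x, ((g (x + h) - g x) ^ 2 + h ^ 3 * (2 * B) * |g' x|) := by
      refine integral_mono (hg'.sq.const_mul _).integrable (i1.add i2) fun x => ?_
      simp only
      set d := g (x + h) - g x - h * g' x with hdd
      have e : g (x + h) - g x = h * g' x + d := by rw [hdd]; ring
      rw [e]
      have h1 : |h * g' x * d| ≤ h * |g' x| * (B * h ^ 2) := by
        rw [abs_mul, abs_mul, abs_of_pos hh]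
        have := hlip x
        gcongr
      have h2 := (abs_le.1 h1).1
      nlinarith [sq_nonneg d]
    _ = _ := by rw [integral_add i1 i2, integral_const_mul]; ring

lemma sq_sub_le_of_deriv {g g' : ℝ → ℝ} (hd : ∀ x, HasDerivAt g (g' x) x) {B : ℝ}
    (hB : ∀ x, g' x ^ 2 ≤ B) {h : ℝ} (hh : 0 < h) (x : ℝ) :
    (g (x + h) - g x) ^ 2 ≤ h ^ 2 * B := by
  obtain ⟨y, _, hy'⟩ := exists_hasDerivAt_eq_slope g g' (by linarith : x < x + h)
    (fun z _ => (hd z).continuousAt.continuousWithinAt) (fun z _ => hd z)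
  rw [add_sub_cancel_left, eq_div_iff hh.ne'] at hy'
  rw [← hy', mul_pow, mul_comm]
  exact mul_le_mul_of_nonneg_left (hB y) (sq_nonneg h)

lemma sq_combination_le {p q r s a b c d M : ℝ} (hp : |p| ≤ M) (hq : |q| ≤ M) (hr : |r| ≤ M)
    (hs : |s| ≤ M) : (p * a + q * b + r * c + s * d) ^ 2 ≤
      4 * M ^ 2 * (a ^ 2 + b ^ 2 + c ^ 2 + d ^ 2) := by
  have key : ∀ {p : ℝ} (a : ℝ), |p| ≤ M → (p * a) ^ 2 ≤ M ^ 2 * a ^ 2 := fun a hp => by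
    rw [mul_pow]
    exact mul_le_mul_of_nonneg_right (sq_le_sq' (abs_le.1 hp).1 (abs_le.1 hp).2) (sq_nonneg a)
  have h1 := key a hp
  have h2 := key b hq
  have h3 := key c hr
  have h4 := key d hs
  nlinarith [sq_nonneg (p * a - q * b), sq_nonneg (p * a - r * c), sq_nonneg (p * a - s * d),
    sq_nonneg (q * b - r * c), sq_nonneg (q * b - s * d), sq_nonneg (r * c - s * d)]

namespace GardnerFlow

variable {β : ℝ} {V : ℕ → ℝ → ℝ → ℝ} {a b : ℝ}

/-- The remainder in the balance law for the difference quotients of `V 2`. -/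
noncomputable def rem (β : ℝ) (V : ℕ → ℝ → ℝ → ℝ) (h t x : ℝ) : ℝ :=
  (((-5) * (((V 1 t (x + h) + V 1 t x) - (β * ((((2 * (V 0 t (x + h) * V 1 t (x + h))) + (V 1 t (x + h) * V 0 t x)) + (V 0 t (x + h) * V 1 t x)) + (2 * (V 0 t x * V 1 t x))))) * ((V 2 t (x + h) - V 2 t x) ^ 2))) - (2 * ((V 2 t (x + h) - V 2 t x) * ((((V 3 t (x + h) + V 3 t x) - (β * ((((((((6 * (V 1 t (x + h) * V 2 t (x + h))) + (2 * (V 0 t (x + h) * V 3 t (x + h)))) + (V 3 t (x + h) * V 0 t x)) + (3 * (V 2 t (x + h) * V 1 t x))) + (3 * (V 1 t (x + h) * V 2 t x))) + (V 0 t (x + h) * V 3 t x)) + (6 * (V 1 t x * V 2 t x))) + (2 * (V 0 t x * V 3 t x))))) * (V 0 t (x + h) - V 0 t x)) + (3 * (((V 2 t (x + h) + V 2 t x) - (β * (((((((2 * (V 1 t (x + h) ^ 2)) + (2 * (V 0 t (x + h) * V 2 t (x + h)))) + (V 2 t (x + h) * V 0 t x)) + (2 * (V 1 t (x + h) * V 1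 t x))) + (V 0 t (x + h) * V 2 t x)) + (2 * (V 1 t x ^ 2))) + (2 * (V 0 t x * V 2 t x))))) * (V 1 t (x + h) - V 1 t x)))))))

lemma continuous_rem (hV : GardnerFlow β V) (h t : ℝ) : Continuous (rem β V h t) := by
  have c : ∀ k, Continuous (V k t) := fun k => (hV.dec k t).1
  have c' : ∀ k, Continuous fun x => V k t (x + h) := fun k => (c k).comp (by fun_prop)
  unfold rem
  fun_prop

lemma abs_integral_diff_sub_le (hV : GardnerFlow β V) (hab : a ≤ b) (hS : H3On (Set.Icc a b) V)
    {h D : ℝ} (hr : ∀ t ∈ Set.Icc a b, Integrable (rem β V h t) ∧ ∫ x, |rem β V h t x| ≤ D) :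
    |(∫ x, (V 2 b (x + h) - V 2 b x) ^ 2) - ∫ x, (V 2 a (x + h) - V 2 a x) ^ 2| ≤
      D * (b - a) := by
  have c := hV.cont_apply
  have c' : ∀ k, Continuous fun p : ℝ × ℝ => V k p.1 (p.2 + h) := fun k =>
    (c k).comp (by fun_prop : Continuous fun p : ℝ × ℝ => (p.1, p.2 + h))
  have l2 := hV.l2On hS (k := 2) (by norm_num)
  have l3 := hV.l2On hS (k := 3) (by norm_num)
  have b0 := hV.bddOn hS (k := 0) (by norm_num)
  have sh2 : ∀ {g : ℝ → ℝ → ℝ}, L2On (Set.Icc a b) g →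
      L2On (Set.Icc a b) fun t x => g t (x + h) := fun {g} hg => by
    obtain ⟨h1, C, hC⟩ := hg
    exact ⟨fun t => (h1 t).comp (by fun_prop), C, fun t ht =>
      ⟨(hC t ht).1.comp_add_right h,
        (integral_add_right_eq_self (fun x => g t x ^ 2) h).le.trans (hC t ht).2⟩⟩
  have b0' : BddOn (Set.Icc a b) fun t x => V 0 t (x + h) := by
    obtain ⟨h1, C, hC⟩ := b0
    exact ⟨fun t => (h1 t).comp (by fun_prop), C, fun t ht x => hC t ht _⟩
  have w2 := (sh2 l2).sub l2
  have w3 := (sh2 l3).sub l3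
  refine abs_integral_sub_le_of_flux
    (e := fun t x => ((V 2 t (x + h) - V 2 t x) ^ 2))
    (e' := fun t x => ((2 * (V 2 t (x + h) - V 2 t x)) * ((-(((V 5 t (x + h) + (((2 * V 0 t (x + h)) - ((3 * β) * (V 0 t (x + h) ^ 2))) * V 3 t (x + h))) + (((3 * (2 - ((6 * β) * V 0 t (x + h)))) * V 1 t (x + h)) * V 2 t (x + h))) - ((6 * β) * (V 1 t (x + h) ^ 3)))) - (-(((V 5 t x + (((2 * V 0 t x) - ((3 * β) * (V 0 t x ^ 2))) * V 3 t x)) + (((3 * (2 - ((6 * β) * V 0 t x))) * V 1 t x) * V 2 t x)) - ((6 * β) * (V 1 t x ^ 3)))))))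
    (j := fun t x => ((3 * ((V 3 t (x + h) - V 3 t x) ^ 2)) - (((V 0 t (x + h) + V 0 t x) - (β * (((V 0 t (x + h) ^ 2) + (V 0 t (x + h) * V 0 t x)) + (V 0 t x ^ 2)))) * ((V 2 t (x + h) - V 2 t x) ^ 2))))
    (k := fun t x => (-((V 2 t (x + h) - V 2 t x) ^ 2)))
    (k₁ := fun t x => ((-2) * ((V 2 t (x + h) - V 2 t x) * (V 3 t (x + h) - V 3 t x))))
    (k₂ := fun t x => ((-2) * (((V 3 t (x + h) - V 3 t x) ^ 2) + ((V 2 t (x + h) - V 2 t x) * (V 4 t (x + h) - V 4 t x)))))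
    (r := rem β V h) hab (by fun_prop) (by fun_prop) (fun t x => ?_) (hV.continuous_rem h)
    (fun t x => (((((hV.dx 2 t (x + h)).comp_add_const x h).fun_sub (hV.dx 2 t x)).fun_pow 2)).fun_neg.congr_deriv
      (by simp only [Nat.reduceAdd]; ring))
    (fun t x => (((((hV.dx 2 t (x + h)).comp_add_const x h).fun_sub (hV.dx 2 t x)).fun_mul (((hV.dx 3 t (x + h)).comp_add_const x h).fun_sub (hV.dx 3 t x))).const_mul (-2)).congr_deriv
      (by simp only [Nat.reduceAdd]; ring)) (fun t x => ?_)
    ((w3.sq.const_mul 3).sub ((b0'.comp₂ b0 (G := fun p q : ℝ =>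
      ((p + q) - (β * (((p ^ 2) + (p * q)) + (q ^ 2))))) (by fun_prop)).mul_l1 w2.sq))
    w2.sq.neg hr ((((hV.dec 2 a).comp_add h).sub (hV.dec 2 a)).sq.integrable)
    ((((hV.dec 2 b).comp_add h).sub (hV.dec 2 b)).sq.integrable)
  · have h1 := (((hV.dt2 t (x + h)).fun_sub (hV.dt2 t x)).fun_pow 2)
    refine h1.congr_deriv ?_
    push_cast
    ring
  · have h1 := (((((((hV.dx 3 t (x + h)).comp_add_const x h).fun_sub (hV.dx 3 t x)).fun_pow 2).const_mul 3).fun_sub (((((hV.dx 0 t (x + h)).comp_add_const x h).fun_add (hV.dx 0 t x)).fun_sub ((((((hV.dx 0 t (x + h)).comp_add_const x h).fun_pow 2).fun_add (((hV.dx 0 t (x + h)).comp_add_const x h).fun_mul (hV.dx 0 t x))).fun_add ((hV.dx 0 t x).fun_pow 2)).const_mul β)).fun_mul ((((hV.dx 2 t (x + h)).comp_add_const x h).fun_sub (hV.dx 2 t x)).fun_pow 2))).fun_add ((((((hV.dx 3 t (x + h)).comp_add_const x h).fun_sub (hV.dx 3 t x)).fun_pow 2).fun_add ((((hV.dx 2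 t (x + h)).comp_add_const x h).fun_sub (hV.dx 2 t x)).fun_mul (((hV.dx 4 t (x + h)).comp_add_const x h).fun_sub (hV.dx 4 t x)))).const_mul (-2)))
    refine h1.congr_deriv ?_
    simp only [rem, Nat.reduceAdd]
    push_cast
    ring

end GardnerFlow

namespace GardnerFlow

variable {β : ℝ} {V : ℕ → ℝ → ℝ → ℝ} {a b : ℝ}

lemma abs_two_mul_le (a b : ℝ) : |2 * (a * b)| ≤ a ^ 2 + b ^ 2 :=
  abs_le.2 ⟨by nlinarith [sq_nonneg (a + b)], by nlinarith [sq_nonneg (a - b)]⟩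

lemma abs_rem_le (hβ : 0 < β) {h t x S W₀ W₁ : ℝ}
    (hv0 : |V 0 t x| ≤ S) (hu0 : |V 0 t (x + h)| ≤ S)
    (hv1 : |V 1 t x| ≤ S) (hu1 : |V 1 t (x + h)| ≤ S)
    (hw0 : (V 0 t (x + h) - V 0 t x) ^ 2 ≤ W₀) (hw1 : (V 1 t (x + h) - V 1 t x) ^ 2 ≤ W₁) :
    |rem β V h t x| ≤ (5 * (2 * S + 6 * β * S ^ 2) + 4) * (V 2 t (x + h) - V 2 t x) ^ 2 +
      W₀ * (4 * (1 + 9 * β * S) ^ 2) *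
        (V 3 t (x + h) ^ 2 + V 3 t x ^ 2 + V 2 t (x + h) ^ 2 + V 2 t x ^ 2) +
      3 * (W₁ * (4 * (1 + 9 * β * S) ^ 2)) *
        (V 2 t (x + h) ^ 2 + V 2 t x ^ 2 + V 1 t (x + h) ^ 2 + V 1 t x ^ 2) := by
  have hS : 0 ≤ S := (abs_nonneg _).trans hv0
  unfold rem
  generalize V 0 t x = v0 at *
  generalize V 0 t (x + h) = u0 at *
  generalize V 1 t x = v1 at *
  generalize V 1 t (x + h) = u1 at *
  generalize V 2 t x = v2 at *
  generalize V 2 t (x + h) = u2 at *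
  generalize V 3 t x = v3 at *
  generalize V 3 t (x + h) = u3 at *
  set A1 : ℝ := ((u1 + v1) - (β * ((((2 * (u0 * u1)) + (u1 * v0)) + (u0 * v1)) + (2 * (v0 * v1))))) with hA1
  set A2 : ℝ := ((u2 + v2) - (β * (((((((2 * (u1 ^ 2)) + (2 * (u0 * u2))) + (u2 * v0)) + (2 * (u1 * v1))) + (u0 * v2)) + (2 * (v1 ^ 2))) + (2 * (v0 * v2))))) with hA2
  set A3 : ℝ := ((u3 + v3) - (β * ((((((((6 * (u1 * u2)) + (2 * (u0 * u3))) + (u3 * v0)) + (3 * (u2 * v1))) + (3 * (u1 * v2))) + (u0 * v3)) + (6 * (v1 * v2))) + (2 * (v0 * v3))))) with hA3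
  have hw0' : 0 ≤ W₀ := (sq_nonneg _).trans hw0
  have hw1' : 0 ≤ W₁ := (sq_nonneg _).trans hw1
  have hm : ∀ {p q : ℝ}, |p| ≤ S → |q| ≤ S → |p * q| ≤ S * S := fun hp hq => by
    rw [abs_mul]; exact mul_le_mul hp hq (abs_nonneg _) hS
  have m1 := abs_le.1 (hm hu0 hu1)
  have m2 := abs_le.1 (hm hu1 hv0)
  have m3 := abs_le.1 (hm hu0 hv1)
  have m4 := abs_le.1 (hm hv0 hv1)
  have hv0' := abs_le.1 hv0
  have hv1' := abs_le.1 hv1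
  have hu0' := abs_le.1 hu0
  have hu1' := abs_le.1 hu1
  have bA1 : |A1| ≤ 2 * S + 6 * β * S ^ 2 := by
    have e : |2 * (u0 * u1) + u1 * v0 + u0 * v1 + 2 * (v0 * v1)| ≤ 6 * (S * S) :=
      abs_le.2 ⟨by linarith, by linarith⟩
    have e1 := mul_le_mul_of_nonneg_left e hβ.le
    rw [← abs_of_pos hβ, ← abs_mul, abs_of_pos hβ] at e1
    have e2 := abs_le.1 e1
    exact abs_le.2 ⟨by rw [hA1]; linarith, by rw [hA1]; linarith⟩
  have hlin : ∀ {p : ℝ}, |p| ≤ 9 * S → |(-β) * p| ≤ 1 + 9 * β * S := fun hp => by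
    rw [abs_mul, abs_neg, abs_of_pos hβ]
    linarith [mul_le_mul_of_nonneg_left hp hβ.le]
  have hlin' : ∀ {p : ℝ}, |p| ≤ 9 * S → |1 + (-β) * p| ≤ 1 + 9 * β * S := fun hp => by
    refine (abs_add_le _ _).trans ?_
    rw [abs_mul, abs_neg, abs_of_pos hβ, abs_one]
    linarith [mul_le_mul_of_nonneg_left hp hβ.le]
  have n1 : |1 + (-β) * (2 * u0 + v0)| ≤ 1 + 9 * β * S :=
    hlin' (abs_le.2 ⟨by linarith, by linarith⟩)
  have n2 : |1 + (-β) * (u0 + 2 * v0)| ≤ 1 + 9 * β * S :=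
    hlin' (abs_le.2 ⟨by linarith, by linarith⟩)
  have bA2 : A2 ^ 2 ≤ 4 * (1 + 9 * β * S) ^ 2 * (u2 ^ 2 + v2 ^ 2 + u1 ^ 2 + v1 ^ 2) := by
    have := sq_combination_le (a := u2) (b := v2) (c := u1) (d := v1) n1 n2
      (hlin (p := 2 * (u1 + v1)) (abs_le.2 ⟨by linarith, by linarith⟩))
      (hlin (p := 2 * v1) (abs_le.2 ⟨by linarith, by linarith⟩))
    refine le_of_eq_of_le ?_ this
    rw [hA2]; ring
  have bA3 : A3 ^ 2 ≤ 4 * (1 + 9 * β * S) ^ 2 * (u3 ^ 2 + v3 ^ 2 + u2 ^ 2 + v2 ^ 2) := by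
    have := sq_combination_le (a := u3) (b := v3) (c := u2) (d := v2) n1 n2
      (hlin (p := 6 * u1 + 3 * v1) (abs_le.2 ⟨by linarith, by linarith⟩))
      (hlin (p := 3 * u1 + 6 * v1) (abs_le.2 ⟨by linarith, by linarith⟩))
    refine le_of_eq_of_le ?_ this
    rw [hA3]; ring
  have p1 := mul_le_mul_of_nonneg_left bA2 hw1'
  have p2 := mul_le_mul_of_nonneg_left bA3 hw0'
  have q1 : (A2 * (u1 - v1)) ^ 2 ≤ W₁ * A2 ^ 2 := by
    rw [mul_pow, mul_comm]; exact mul_le_mul_of_nonneg_right hw1 (sq_nonneg _)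
  have q0 : (A3 * (u0 - v0)) ^ 2 ≤ W₀ * A3 ^ 2 := by
    rw [mul_pow, mul_comm]; exact mul_le_mul_of_nonneg_right hw0 (sq_nonneg _)
  have r1 : |A1 * (u2 - v2) ^ 2| ≤ (2 * S + 6 * β * S ^ 2) * (u2 - v2) ^ 2 := by
    rw [abs_mul, abs_sq]; exact mul_le_mul_of_nonneg_right bA1 (sq_nonneg _)
  have r1' := abs_le.1 r1
  have z1 := abs_le.1 (abs_two_mul_le (u2 - v2) (A2 * (u1 - v1)))
  have z0 := abs_le.1 (abs_two_mul_le (u2 - v2) (A3 * (u0 - v0)))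
  clear_value A1 A2 A3
  generalize (1 + 9 * β * S) ^ 2 = M at *
  generalize 2 * S + 6 * β * S ^ 2 = A at *
  clear hA1 hA2 hA3 n1 n2 hlin hlin' m1 m2 m3 m4 hm bA1 bA2 bA3
  exact abs_le.2 ⟨by linarith, by linarith⟩

lemma exists_third_bound (hβ : 0 < β) {H : ℝ} (hH : 0 ≤ H) : ∃ C, 0 ≤ C ∧
    ∀ V, GardnerFlow β V → ∀ a b, a ≤ b →
    (∀ t ∈ Set.Icc a b, ∀ k ≤ 2, en V k t ≤ H) → ∀ Y, (∀ t ∈ Set.Icc a b, en V 3 t ≤ Y) →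
    |en V 3 b - en V 3 a| ≤ C * (1 + Y) * (b - a) := by
  set S := √(H + H) with hSd
  set A := 5 * (2 * S + 6 * β * S ^ 2) + 4 with hA
  set M := 4 * (1 + 9 * β * S) ^ 2 with hM
  have hS0 : 0 ≤ S := Real.sqrt_nonneg _
  have hA0 : 0 ≤ A := by positivity
  have hM0 : 0 ≤ M := by positivity
  refine ⟨A + (H + H) * M * (2 + 2 * H) + 12 * M * H * (1 + H), by positivity,
    fun V hV a b hab hE Y hY => ?_⟩
  set C := A + (H + H) * M * (2 + 2 * H) + 12 * M * H * (1 + H) with hC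
  have hY0 : 0 ≤ Y := (en_nonneg 3 a).trans (hY a ⟨le_rfl, hab⟩)
  have hC0 : 0 ≤ C := by positivity
  have h3 : H3On (Set.Icc a b) V := ⟨max H Y, fun t ht k hk => by
    rcases Nat.lt_or_ge k 3 with h | h
    · exact (hE t ht k (by omega)).trans (le_max_left _ _)
    · rw [show k = 3 by omega]; exact (hY t ht).trans (le_max_right _ _)⟩
  have key : ∀ h : ℝ, 0 < h →
      |(∫ x, (V 2 b (x + h) - V 2 b x) ^ 2) - ∫ x, (V 2 a (x + h) - V 2 a x) ^ 2| ≤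
        h ^ 2 * (C * (1 + Y)) * (b - a) := fun h hh => by
    refine hV.abs_integral_diff_sub_le hab h3 fun t ht => ?_
    have hb : ∀ k ≤ 1, ∀ x, |V k t x| ≤ S := fun k hk x => Real.abs_le_sqrt
      ((hV.sq_le k t x).trans (add_le_add (hE t ht k (by omega)) (hE t ht (k + 1) (by omega))))
    have hw0 := sq_sub_le_of_deriv (hV.dx 0 t) (B := H + H) (fun x => (hV.sq_le 1 t x).trans
      (add_le_add (hE t ht 1 (by norm_num)) (hE t ht 2 (by norm_num)))) hh
    have hw1 := sq_sub_le_of_deriv (hV.dx 1 t) (B := H + Y) (fun x => (hV.sq_le 2 t x).trans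
      (add_le_add (hE t ht 2 (by norm_num)) (hY t ht))) hh
    have hle : ∀ x, |rem β V h t x| ≤ _ := fun x => abs_rem_le hβ (hb 0 (by norm_num) x)
      (hb 0 (by norm_num) (x + h)) (hb 1 (by norm_num) x) (hb 1 (by norm_num) (x + h))
      (hw0 x) (hw1 x)
    have dq : ∀ k, Integrable fun x => V k t x ^ 2 := fun k => (hV.dec k t).sq.integrable
    have dq' : ∀ k, Integrable fun x => V k t (x + h) ^ 2 := fun k => (dq k).comp_add_right h
    have eq' : ∀ k, ∫ x, V k t (x + h) ^ 2 = en V k t := fun k =>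
      integral_add_right_eq_self (fun x => V k t x ^ 2) h
    have eq : ∀ k, ∫ x, V k t x ^ 2 = en V k t := fun k => rfl
    have iw : Integrable fun x => (V 2 t (x + h) - V 2 t x) ^ 2 :=
      (((hV.dec 2 t).comp_add h).sub (hV.dec 2 t)).sq.integrable
    have i1 : ∀ k l, Integrable fun x => V k t (x + h) ^ 2 + V k t x ^ 2 +
      V l t (x + h) ^ 2 + V l t x ^ 2 := fun k l => (((dq' k).fun_add (dq k)).fun_add (dq' l)).fun_add (dq l)
    have e1 : ∀ k l, ∫ x, (V k t (x + h) ^ 2 + V k t x ^ 2 +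
        V l t (x + h) ^ 2 + V l t x ^ 2) = 2 * en V k t + 2 * en V l t := fun k l => by
      rw [integral_add (((dq' k).fun_add (dq k)).fun_add (dq' l)) (dq l),
        integral_add ((dq' k).fun_add (dq k)) (dq' l), integral_add (dq' k) (dq k), eq', eq', eq, eq]
      ring
    have iB := ((iw.const_mul A).fun_add ((i1 3 2).const_mul (h ^ 2 * (H + H) * M))).fun_add
      ((i1 2 1).const_mul (3 * (h ^ 2 * (H + Y) * M)))
    have ir : Integrable (rem β V h t) := iB.mono' (hV.continuous_rem h t).aestronglyMeasurable
      (Eventually.of_forall hle)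
    refine ⟨ir, (integral_mono ir.abs iB hle).trans ?_⟩
    rw [integral_add ((iw.const_mul A).fun_add ((i1 3 2).const_mul _)) ((i1 2 1).const_mul _),
      integral_add (iw.const_mul A) ((i1 3 2).const_mul _), integral_const_mul,
      integral_const_mul, integral_const_mul, e1, e1]
    have g0 := integral_sq_diff_le (hV.dx 2 t) (hV.dec 3 t) hh
    rw [eq] at g0
    have g1 := hE t ht 1 (by norm_num)
    have g2 := hE t ht 2 (by norm_num)
    have g3 := hY t ht
    calc A * (∫ x, (V 2 t (x + h) - V 2 t x) ^ 2) +
          h ^ 2 * (H + H) * M * (2 * en V 3 t + 2 * en V 2 t) +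
          3 * (h ^ 2 * (H + Y) * M) * (2 * en V 2 t + 2 * en V 1 t)
        ≤ A * (h ^ 2 * Y) + h ^ 2 * (H + H) * M * (2 * Y + 2 * H) +
          3 * (h ^ 2 * (H + Y) * M) * (2 * H + 2 * H) := by
          have := mul_le_mul_of_nonneg_left g3 (sq_nonneg h)
          gcongr
          linarith
      _ ≤ h ^ 2 * (C * (1 + Y)) := by
          have : 0 ≤ h ^ 2 * (A + (H + H) * M * (2 + 2 * H * Y) + 12 * M * H * (1 + H * Y)) := by
            positivity
          rw [hC]
          nlinarith
  have up : ∀ t, ∃ D, ∀ h, 0 < h →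
      h ^ 2 * en V 3 t ≤ (∫ x, (V 2 t (x + h) - V 2 t x) ^ 2) + h ^ 3 * D := fun t =>
    exists_integral_sq_deriv_le (hV.dx 2 t) (hV.dx 3 t) (hV.dec 2 t) (hV.dec 3 t) (hV.dec 4 t)
  have dn : ∀ t h, 0 < h → ∫ x, (V 2 t (x + h) - V 2 t x) ^ 2 ≤ h ^ 2 * en V 3 t := fun t h hh =>
    integral_sq_diff_le (hV.dx 2 t) (hV.dec 3 t) hh
  have lim : ∀ {p q D : ℝ}, (∀ h : ℝ, 0 < h → h ^ 2 * p ≤ h ^ 2 * q + h ^ 3 * D) → p ≤ q := by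
    intro p q D hpq
    by_contra! hlt
    have hh : 0 < (p - q) / (|D| + 1) := div_pos (by linarith) (by positivity)
    set h := (p - q) / (|D| + 1) with hhd
    have e : h * (|D| + 1) = p - q := by rw [hhd]; field_simp
    have h1 := hpq h hh
    have h2 : h ^ 2 * (p - q - h * D) ≤ 0 := by nlinarith
    have h3 : 0 < h ^ 2 * (p - q - h * D) := by
      apply mul_pos (by positivity)
      have := mul_le_mul_of_nonneg_left (le_abs_self D) hh.le
      linarith
    linarith
  obtain ⟨D₁, hD₁⟩ := up a
  obtain ⟨D₂, hD₂⟩ := up b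
  refine abs_le.2 ⟨?_, ?_⟩
  · have : en V 3 a ≤ en V 3 b + C * (1 + Y) * (b - a) := lim (D := D₁) fun h hh => by
      have h1 := (abs_le.1 (key h hh)).1
      have h2 := hD₁ h hh
      have h3 := dn b h hh
      nlinarith
    linarith
  · have : en V 3 b ≤ en V 3 a + C * (1 + Y) * (b - a) := lim (D := D₂) fun h hh => by
      have h1 := (abs_le.1 (key h hh)).2
      have h2 := hD₂ h hh
      have h3 := dn a h hh
      nlinarith
    linarith

end GardnerFlow

section Regularity

variable {V : ℕ → ℝ → ℝ → ℝ} {S T : Set ℝ}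

lemma H3On.mono (h : H3On T V) (hST : S ⊆ T) : H3On S V :=
  let ⟨K, hK⟩ := h
  ⟨K, fun t ht => hK t (hST ht)⟩

lemma H3On.union (h : H3On S V) (h' : H3On T V) : H3On (S ∪ T) V := by
  obtain ⟨K, hK⟩ := h
  obtain ⟨K', hK'⟩ := h'
  refine ⟨max K K', fun t ht k hk => ?_⟩
  rcases ht with ht | ht
  · exact (hK t ht k hk).trans (le_max_left _ _)
  · exact (hK' t ht k hk).trans (le_max_right _ _)

lemma H3On.singleton (V : ℕ → ℝ → ℝ → ℝ) (t : ℝ) : H3On {t} V := by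
  refine ⟨en V 0 t + en V 1 t + en V 2 t + en V 3 t, fun s hs k hk => ?_⟩
  rw [Set.mem_singleton_iff.1 hs]
  have h := fun j => GardnerFlow.en_nonneg (V := V) j t
  have h0 := h 0
  have h1 := h 1
  have h2 := h 2
  have h3 := h 3
  interval_cases k <;> linarith

/-- The times near which the flow is bounded in `H³`. -/
def H3Near (V : ℕ → ℝ → ℝ → ℝ) (t : ℝ) : Prop := ∃ U ∈ nhds t, H3On U V

lemma H3On.of_isCompact (hS : IsCompact S) (h : ∀ t ∈ S, H3Near V t) : H3On S V := by
  refine hS.induction_on (p := fun s => H3On s V) ⟨0, by simp⟩ (fun _ _ hst ht => ht.mono hst)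
    (fun _ _ h h' => h.union h') fun t ht => ?_
  obtain ⟨U, hU, hUV⟩ := h t ht
  exact ⟨U, mem_nhdsWithin_of_mem_nhds hU, hUV⟩

lemma isOpen_h3Near : IsOpen {t | H3Near V t} := by
  rw [isOpen_iff_mem_nhds]
  rintro t ⟨U, hU, hUV⟩
  obtain ⟨W, hWU, hW, htW⟩ := mem_nhds_iff.1 hU
  exact mem_of_superset (hW.mem_nhds htW) fun s hs => ⟨W, hW.mem_nhds hs, hUV.mono hWU⟩

end Regularity

namespace GardnerFlow

variable {β : ℝ} {V : ℕ → ℝ → ℝ → ℝ} {a b : ℝ}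

lemma isClosed_en_le (h : GardnerFlow β V) (k : ℕ) (K : ℝ) : IsClosed {t | en V k t ≤ K} := by
  have e : {t | en V k t ≤ K} = ⋂ n : ℕ, {t | ∫ x in (-(n : ℝ))..n, V k t x ^ 2 ≤ K} := by
    ext t
    simp only [Set.mem_ofPred_eq, Set.mem_iInter]
    have hi := (h.dec k t).sq.integrable
    constructor
    · intro ht n
      refine le_trans ?_ ht
      rw [intervalIntegral.integral_of_le (by linarith [n.cast_nonneg (α := ℝ)])]
      exact setIntegral_le_integral hi (Eventually.of_forall fun x => sq_nonneg _)
    · intro ht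
      have := intervalIntegral_tendsto_integral (a := fun n : ℕ => -(n : ℝ)) (b := fun n : ℕ => (n : ℝ))
        hi (tendsto_neg_atTop_atBot.comp tendsto_natCast_atTop_atTop) tendsto_natCast_atTop_atTop
      exact le_of_tendsto' this ht
  rw [e]
  refine isClosed_iInter fun n => isClosed_le ?_ continuous_const
  have c := h.cont_apply k
  exact intervalIntegral.continuous_parametric_intervalIntegral_of_continuous' (by fun_prop) _ _

lemma sameInvariants_uIcc (h : GardnerFlow β V) {s t : ℝ} (hS : H3On (Set.uIcc s t) V) :
    SameInvariants β V s t := by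
  rcases le_total s t with hst | hst
  · rw [Set.uIcc_of_le hst] at hS
    exact h.sameInvariants hst hS
  · rw [Set.uIcc_of_ge hst] at hS
    exact (h.sameInvariants hst hS).symm

/-- Short time propagation of `H³` bounds, in both time directions. -/
lemma exists_short_time (hβ : 0 < β) {H : ℝ} (hH : 0 ≤ H) : ∃ δ > 0, ∀ V, GardnerFlow β V →
    ∀ s t, |t - s| ≤ δ → H3On (Set.uIcc s t) V →
    (∀ τ ∈ Set.uIcc s t, ∀ k ≤ 2, en V k τ ≤ H) → en V 3 t ≤ 2 * en V 3 s + 1 := by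
  obtain ⟨C, hC0, hC⟩ := exists_third_bound hβ hH
  refine ⟨1 / (2 * (C + 1)), by positivity, fun V hV s t hst hS hE => ?_⟩
  obtain ⟨K, hK⟩ := hS
  set A := (fun τ => en V 3 τ) '' Set.uIcc s t
  have hbdd : BddAbove A := ⟨K, by rintro _ ⟨τ, hτ, rfl⟩; exact hK τ hτ 3 le_rfl⟩
  have hY : ∀ τ ∈ Set.uIcc s t, en V 3 τ ≤ sSup A := fun τ hτ => le_csSup hbdd ⟨τ, hτ, rfl⟩
  set Y := sSup A
  have hY0 : 0 ≤ Y := (en_nonneg 3 s).trans (hY s Set.left_mem_uIcc)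
  have key : ∀ τ ∈ Set.uIcc s t, en V 3 τ ≤ en V 3 s + (1 + Y) / 2 := fun τ hτ => by
    have hsub : Set.uIcc s τ ⊆ Set.uIcc s t := Set.uIcc_subset_uIcc_left hτ
    have h1 : |en V 3 τ - en V 3 s| ≤ C * (1 + Y) * |τ - s| := by
      rcases le_total s τ with h | h
      · rw [Set.uIcc_of_le h] at hsub
        rw [abs_of_nonneg (sub_nonneg.2 h)]
        exact hC V hV s τ h (fun x hx => hE x (hsub hx)) Y fun x hx => hY x (hsub hx)
      · rw [Set.uIcc_of_ge h] at hsub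
        rw [abs_sub_comm, abs_sub_comm τ, abs_of_nonneg (sub_nonneg.2 h)]
        exact hC V hV τ s h (fun x hx => hE x (hsub hx)) Y fun x hx => hY x (hsub hx)
    have h2 : |τ - s| ≤ 1 / (2 * (C + 1)) := (Set.abs_sub_left_of_mem_uIcc hτ).trans hst
    have h3 : C * (1 + Y) * |τ - s| ≤ (1 + Y) / 2 := by
      calc C * (1 + Y) * |τ - s| ≤ C * (1 + Y) * (1 / (2 * (C + 1))) := by gcongr
        _ ≤ (C + 1) * (1 + Y) * (1 / (2 * (C + 1))) := by gcongr; linarith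
        _ = _ := by field_simp
    linarith [(abs_le.1 h1).2]
  have hYle : Y ≤ en V 3 s + (1 + Y) / 2 :=
    csSup_le ⟨_, s, Set.left_mem_uIcc, rfl⟩ (by rintro _ ⟨τ, hτ, rfl⟩; exact key τ hτ)
  linarith [hY t Set.right_mem_uIcc]

lemma exists_short_time_bound (hβ : 0 < β) (K : ℝ) : ∃ δ > 0, ∃ B, ∀ V, GardnerFlow β V →
    ∀ s t, |t - s| ≤ δ → H3On (Set.uIcc s t) V → (∀ k ≤ 3, en V k s ≤ K) →
    ∀ k ≤ 3, en V k t ≤ B := by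
  obtain ⟨K', hK'⟩ := exists_h2_bound hβ K
  obtain ⟨δ, hδ, h⟩ := exists_short_time hβ (le_max_right K' 0)
  refine ⟨δ, hδ, max (max K' 0) (2 * K + 1), fun V hV s t hst hS hs => ?_⟩
  have hE : ∀ τ ∈ Set.uIcc s t, ∀ k ≤ 2, en V k τ ≤ max K' 0 := fun τ hτ k hk =>
    (hK' V hV s τ (hV.sameInvariants_uIcc (hS.mono (Set.uIcc_subset_uIcc_left hτ)))
      (fun k hk => hs k (by omega)) k hk).trans (le_max_left _ _)
  intro k hk
  rcases Nat.lt_or_ge k 3 with hk' | hk'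
  · exact (hE t Set.right_mem_uIcc k (by omega)).trans (le_max_left _ _)
  · rw [show k = 3 by omega]
    exact (h V hV s t hst hS hE).trans
      ((show _ ≤ 2 * K + 1 by linarith [hs 3 le_rfl]).trans (le_max_right _ _))

/-- If the flow is locally bounded in `H³` away from the endpoint `q`, it is bounded up to `q`. -/
lemma h3On_uIcc_of_near (hβ : 0 < β) (hV : GardnerFlow β V) {q t : ℝ}
    (h : ∀ s ∈ Set.uIcc q t, s ≠ q → H3Near V s) : H3On (Set.uIcc q t) V := by
  rcases eq_or_ne q t with rfl | hqt
  · rw [Set.uIcc_self]; exact H3On.singleton V q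
  have hcpt : ∀ s ∈ Set.uIcc q t, s ≠ q → H3On (Set.uIcc s t) V := fun s hs hsq =>
    H3On.of_isCompact isCompact_uIcc fun τ hτ => h τ (Set.uIcc_subset_uIcc_right hs hτ) (by
      rintro rfl
      rw [Set.mem_uIcc] at hs hτ
      grind)
  obtain ⟨K, hK⟩ := H3On.singleton V t
  obtain ⟨K', hK'⟩ := exists_h2_bound hβ K
  obtain ⟨δ, hδ, hst⟩ := exists_short_time hβ (le_max_right K' 0)
  have hE : ∀ s ∈ Set.uIcc q t, s ≠ q → ∀ k ≤ 2, en V k s ≤ max K' 0 := fun s hs hsq k hk =>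
    (hK' V hV t s (hV.sameInvariants_uIcc (hcpt s hs hsq)).symm
      (fun k hk => hK t rfl k (by omega)) k hk).trans (le_max_left _ _)
  obtain ⟨t₀, ht₀, ht₀q, hd⟩ : ∃ t₀ ∈ Set.uIcc q t, t₀ ≠ q ∧ |t₀ - q| ≤ δ := by
    rcases lt_or_gt_of_ne hqt with hlt | hlt
    · refine ⟨min t (q + δ), ?_, ?_, ?_⟩
      · rw [Set.uIcc_of_le hlt.le]
        exact ⟨le_min hlt.le (by linarith), min_le_left _ _⟩
      · exact (lt_min hlt (by linarith)).ne'
      · rw [abs_of_nonneg (sub_nonneg.2 (le_min hlt.le (by linarith)))]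
        linarith [min_le_right t (q + δ)]
    · refine ⟨max t (q - δ), ?_, ?_, ?_⟩
      · rw [Set.uIcc_of_ge hlt.le]
        exact ⟨le_max_left _ _, max_le hlt.le (by linarith)⟩
      · exact (max_lt hlt (by linarith)).ne
      · rw [abs_of_nonpos (sub_nonpos.2 (max_le hlt.le (by linarith)))]
        linarith [le_max_right t (q - δ)]
  have hnear : H3On (Set.uIcc q t₀) V := by
    refine (show H3On (Set.uIcc q t₀ \ {q}) V from ⟨max (max K' 0) (2 * en V 3 t₀ + 1),
      fun s hs k hk => ?_⟩).union (H3On.singleton V q) |>.mono (by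
        rw [Set.sdiff_union_self]; exact Set.subset_union_left)
    have hs1 : s ∈ Set.uIcc q t := Set.uIcc_subset_uIcc_left ht₀ hs.1
    have hsq : s ≠ q := hs.2
    rcases Nat.lt_or_ge k 3 with hk' | hk'
    · exact (hE s hs1 hsq k (by omega)).trans (le_max_left _ _)
    · rw [show k = 3 by omega]
      have hs' := Set.mem_uIcc.1 hs.1
      have ht' := Set.mem_uIcc.1 ht₀
      have hsub : Set.uIcc t₀ s ⊆ Set.uIcc s t := fun τ hτ => by
        rw [Set.mem_uIcc] at hτ ⊢
        grind
      refine (hst V hV t₀ s ?_ ((hcpt s hs1 hsq).mono hsub) fun τ hτ => ?_).trans (le_max_right _ _)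
      · rw [abs_sub_comm]
        exact (Set.abs_sub_right_of_mem_uIcc hs.1).trans hd
      · have hτ' := Set.mem_uIcc.1 hτ
        refine hE τ (Set.uIcc_subset_uIcc_right hs1 (hsub hτ)) ?_
        grind
  refine (hnear.union (hcpt t₀ ht₀ ht₀q)).mono ?_
  exact Set.uIcc_subset_uIcc_union_uIcc

/-- Classical solutions are bounded in `H³` on compact time intervals. -/
lemma h3On_Icc (hβ : 0 < β) (hV : GardnerFlow β V) (a b : ℝ) : H3On (Set.Icc a b) V := by
  refine H3On.of_isCompact isCompact_Icc fun t _ => ?_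
  by_contra hbad
  set E := {t | H3Near V t}ᶜ with hEd
  have hEc : IsClosed E := isOpen_h3Near.isClosed_compl
  have : Nonempty E := ⟨t, hbad⟩
  have : CompleteSpace E := hEc.completeSpace_coe
  obtain ⟨n, hn⟩ := nonempty_interior_of_iUnion_of_closed
    (f := fun n : ℕ => {s : E | ∀ k ≤ 3, en V k s ≤ n}) (fun n => by
      have e : {s : E | ∀ k ≤ 3, en V k s ≤ n} =
          ⋂ k, ⋂ (_ : k ≤ 3), Subtype.val ⁻¹' {s : ℝ | en V k s ≤ n} := by ext; simp
      rw [e]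
      exact isClosed_iInter fun k => isClosed_iInter fun _ =>
        (hV.isClosed_en_le k n).preimage continuous_subtype_val) (by
      ext s
      simp only [Set.mem_iUnion, Set.mem_ofPred_eq, Set.mem_univ, iff_true]
      obtain ⟨K, hK⟩ := H3On.singleton V s
      obtain ⟨n, hn⟩ := exists_nat_ge K
      exact ⟨n, fun k hk => (hK s rfl k hk).trans hn⟩)
  obtain ⟨⟨p, hp⟩, hpn⟩ := hn
  rw [mem_interior_iff_mem_nhds, Metric.mem_nhds_iff] at hpn
  obtain ⟨r, hr, hball⟩ := hpn
  have hbK : ∀ q ∈ E, |q - p| < r → ∀ k ≤ 3, en V k q ≤ n := fun q hq hqp =>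
    hball (show (⟨q, hq⟩ : E) ∈ Metric.ball ⟨p, hp⟩ r from hqp)
  obtain ⟨δ, hδ, B, hB⟩ := exists_short_time_bound hβ (n : ℝ)
  refine hp ⟨Metric.ball p (min r δ), Metric.ball_mem_nhds _ (lt_min hr hδ), max B n,
    fun t ht => ?_⟩
  rw [Metric.mem_ball, Real.dist_eq, lt_min_iff] at ht
  by_cases htE : t ∈ E
  · exact fun k hk => (hbK t htE ht.1 k hk).trans (le_max_right _ _)
  obtain ⟨q, hq, hmin⟩ := ((isCompact_uIcc (a := p) (b := t)).inter_left hEc).exists_isMinOn (f := fun s => |s - t|) ⟨p, hp, Set.left_mem_uIcc⟩ (by fun_prop)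
  have h3 : H3On (Set.uIcc q t) V := h3On_uIcc_of_near hβ hV fun s hs hsq => by
    by_contra hsE
    have h1 : |q - t| ≤ |s - t| := hmin ⟨hsE, Set.uIcc_subset_uIcc_right hq.2 hs⟩
    have hs' := Set.mem_uIcc.1 hs
    grind
  refine fun k hk => (hB V hV q t ?_ h3 (hbK q hq.1 ?_) k hk).trans (le_max_left _ _)
  · exact (Set.abs_sub_right_of_mem_uIcc hq.2).trans ht.2.le
  · exact (Set.abs_sub_left_of_mem_uIcc hq.2).trans_lt ht.1

end GardnerFlow

/-- The properties of the soliton profile `Q` with derivative `Q'` used below. -/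
structure IsSoliton (β c : ℝ) (Q Q' : ℝ → ℝ) : Prop where
  d0 : ∀ x, HasDerivAt Q (Q' x) x
  d1 : ∀ x, HasDerivAt Q' (c * Q x - Q x ^ 2 + β * Q x ^ 3) x
  sq : ∀ x, Q' x ^ 2 = Q x ^ 2 * (c - 2 / 3 * Q x + β / 2 * Q x ^ 2)
  pos : ∀ x, 0 < Q x
  even : ∀ x, Q (-x) = Q x
  odd : ∀ x, Q' (-x) = -Q' x
  neg : ∀ x, 0 < x → Q' x < 0
  lt : ∀ x, 3 / 2 * β * Q x < 1
  decay : ∃ C, 0 ≤ C ∧ ∀ x, Q x ≤ C * exp (-(√c * |x|))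

/-- The derivative of the Gardner soliton profile. -/
noncomputable def QG' (c β s : ℝ) : ℝ :=
  -(3 * c * (√(1 - 9 / 2 * β * c) * (√c * sinh (√c * s)))) /
    (1 + √(1 - 9 / 2 * β * c) * cosh (√c * s)) ^ 2

lemma isSoliton_QG {β c : ℝ} (hβ : 0 < β) (hc : 0 < c) (hcβ : c < 2 / (9 * β)) :
    IsSoliton β c (QG c β) (QG' c β) := by
  have hk : 0 < 1 - 9 / 2 * β * c := by
    rw [lt_div_iff₀ (by positivity)] at hcβ
    linarith
  set r := √(1 - 9 / 2 * β * c) with hr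
  set s := √c with hs
  have hr0 : 0 < r := Real.sqrt_pos.2 hk
  have hs0 : 0 < s := Real.sqrt_pos.2 hc
  have hr2 : r ^ 2 = 1 - 9 / 2 * β * c := Real.sq_sqrt hk.le
  have hs2 : s ^ 2 = c := Real.sq_sqrt hc.le
  have hD : ∀ x, 1 < 1 + r * cosh (s * x) := fun x => by
    have := mul_pos hr0 (cosh_pos (s * x)); linarith
  have eQ : ∀ x, QG c β x = 3 * c / (1 + r * cosh (s * x)) := fun x => rfl
  have eQ' : ∀ x, QG' c β x = -(3 * c * (r * (s * sinh (s * x)))) /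
    (1 + r * cosh (s * x)) ^ 2 := fun x => rfl
  have hch : ∀ x, HasDerivAt (fun y => cosh (s * y)) (s * sinh (s * x)) x := fun x => by
    simpa [mul_comm] using ((hasDerivAt_id x).const_mul s).cosh
  have hsh : ∀ x, HasDerivAt (fun y => sinh (s * y)) (s * cosh (s * x)) x := fun x => by
    simpa [mul_comm] using ((hasDerivAt_id x).const_mul s).sinh
  have hDd : ∀ x, HasDerivAt (fun y => 1 + r * cosh (s * y)) (r * (s * sinh (s * x))) x := fun x =>
    ((hch x).const_mul r).const_add 1
  have key : ∀ x, r ^ 2 * sinh (s * x) ^ 2 = (1 + r * cosh (s * x)) ^ 2 -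
      2 * (1 + r * cosh (s * x)) + 9 / 2 * β * c := fun x => by
    have := cosh_sq (s * x)
    rw [show sinh (s * x) ^ 2 = cosh (s * x) ^ 2 - 1 by linarith]
    linear_combination hr2 * (-1)
  refine ⟨fun x => ?_, fun x => ?_, fun x => ?_, fun x => ?_, fun x => ?_, fun x => ?_,
    fun x hx => ?_, fun x => ?_, 6 * c / r, by positivity, fun x => ?_⟩
  · refine ((hasDerivAt_const x (3 * c)).fun_div (hDd x) (by linarith [hD x])).congr_deriv ?_
    rw [eQ']
    congr 1
    ring
  · have h0 : (1 + r * cosh (s * x)) ^ 2 ≠ 0 := by have := hD x; positivity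
    have h0' : 1 + r * cosh (s * x) ≠ 0 := by have := hD x; positivity
    refine (((((hsh x).const_mul s).const_mul r).const_mul (3 * c)).fun_neg.fun_div
      ((hDd x).fun_pow 2) h0).congr_deriv ?_
    rw [eQ]
    have k := key x
    set D := 1 + r * cosh (s * x) with hDd'
    have e : r * cosh (s * x) = D - 1 := by rw [hDd']; ring
    have e3 : r * (s * s) * cosh (s * x) = c * (D - 1) := by rw [← e, ← hs2]; ring
    have e4 : s ^ 2 * (r ^ 2 * sinh (s * x) ^ 2) = c * (D ^ 2 - 2 * D + 9 / 2 * β * c) := by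
      rw [k, hs2]
    trans (-(3 * c * (c * (D - 1))) * D ^ 2 +
      6 * c * D * (c * (D ^ 2 - 2 * D + 9 / 2 * β * c))) / D ^ 4
    · rw [← e3, ← e4]
      push_cast
      ring
    · field_simp
      ring
  · have h0' : 1 + r * cosh (s * x) ≠ 0 := by have := hD x; positivity
    rw [eQ, eQ']
    have k := key x
    set D := 1 + r * cosh (s * x)
    have e4 : s ^ 2 * (r ^ 2 * sinh (s * x) ^ 2) = c * (D ^ 2 - 2 * D + 9 / 2 * β * c) := by
      rw [k, hs2]
    have : (-(3 * c * (r * (s * sinh (s * x)))) / D ^ 2) ^ 2 =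
      9 * c ^ 2 * (s ^ 2 * (r ^ 2 * sinh (s * x) ^ 2)) / D ^ 4 := by ring_nf
    rw [this, e4]
    field_simp
    ring
  · rw [eQ]; have := hD x; positivity
  · rw [eQ, eQ, mul_neg, cosh_neg]
  · rw [eQ', eQ', mul_neg, cosh_neg, sinh_neg]; ring
  · rw [eQ']
    have h1 : 0 < sinh (s * x) := sinh_pos_iff.2 (by positivity)
    have h2 := hD x
    apply div_neg_of_neg_of_pos
    · have : 0 < 3 * c * (r * (s * sinh (s * x))) := by positivity
      linarith
    · positivity
  · rw [eQ]
    have h2 := hD x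
    have h3 : 1 + r ≤ 1 + r * cosh (s * x) := by nlinarith [one_le_cosh (s * x)]
    have h4 : 9 / 2 * β * c = (1 - r) * (1 + r) := by linear_combination hr2
    have h5 : r < 1 := by
      have : 0 < 9 / 2 * β * c := by positivity
      nlinarith
    rw [show 3 / 2 * β * (3 * c / (1 + r * cosh (s * x))) =
      9 / 2 * β * c / (1 + r * cosh (s * x)) by ring, div_lt_one (by linarith), h4]
    nlinarith
  · rw [eQ]
    have h1 : exp (s * |x|) ≤ 2 * cosh (s * x) := by
      rw [← cosh_abs, abs_mul, abs_of_pos hs0, cosh_eq]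
      linarith [exp_pos (-(s * |x|))]
    have h2 : r * exp (s * |x|) / 2 ≤ 1 + r * cosh (s * x) := by nlinarith
    have h3 : 0 < r * exp (s * |x|) / 2 := by positivity
    calc 3 * c / (1 + r * cosh (s * x)) ≤ 3 * c / (r * exp (s * |x|) / 2) := by gcongr
      _ = 6 * c / r * exp (-(s * |x|)) := by rw [exp_neg]; field_simp; ring

namespace IsSoliton

variable {β c : ℝ} {Q Q' : ℝ → ℝ}

lemma abs_deriv_le (h : IsSoliton β c Q Q') (hc : 0 < c) (x : ℝ) :
    |Q' x| ≤ √c * Q x := by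
  have h0 := h.pos x
  have h1 := h.lt x
  rw [← abs_of_pos (show 0 < √c * Q x by positivity)]
  rw [← sq_le_sq, h.sq, mul_pow, Real.sq_sqrt hc.le]
  nlinarith [mul_pos (mul_pos h0 h0) h0]

lemma abs_deriv₂_le (h : IsSoliton β c Q Q') (hβ : 0 < β) (hc : 0 < c) (x : ℝ) :
    |c * Q x - Q x ^ 2 + β * Q x ^ 3| ≤ (c + 1 / β) * Q x := by
  have h0 := h.pos x
  have h1 := h.lt x
  have h2 : Q x ≤ 1 / β := by rw [le_div_iff₀ hβ]; nlinarith [mul_pos hβ h0]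
  have h3 := mul_le_mul_of_nonneg_right h2 h0.le
  have h4 : 0 < β * Q x ^ 3 := by positivity
  have h5 : β * Q x ^ 3 ≤ Q x ^ 2 := by nlinarith [mul_pos h0 h0, mul_pos hβ h0]
  exact abs_le.2 ⟨by nlinarith [mul_pos hc h0], by nlinarith⟩

end IsSoliton

lemma dec_exp {s : ℝ} (hs : 0 < s) : Dec fun x => (1 + |x|) * exp (-(s * |x|)) := by
  refine ⟨by fun_prop, 1 + 1 / s + 2 / s ^ 2 + 6 / s ^ 3, fun x => ?_⟩
  have hx := abs_nonneg x
  set y := |x| with hy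
  have h0 : 0 < 1 + x ^ 2 := by positivity
  simp only
  rw [abs_of_nonneg (by positivity), ← div_eq_mul_inv, le_div_iff₀ h0, exp_neg,
    show (1 + y) * (exp (s * y))⁻¹ * (1 + x ^ 2) = (1 + y) * (1 + y ^ 2) / exp (s * y) by
      rw [hy, sq_abs]; field_simp, div_le_iff₀ (exp_pos _)]
  have hsy : 0 ≤ s * y := by positivity
  have e1 := pow_div_factorial_le_exp _ hsy 1
  have e2 := pow_div_factorial_le_exp _ hsy 2
  have e3 := pow_div_factorial_le_exp _ hsy 3
  have e0 := one_le_exp hsy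
  simp only [Nat.factorial] at e1 e2 e3
  norm_num at e1 e2 e3
  have f1 : y ≤ 1 / s * exp (s * y) := by
    rw [div_mul_eq_mul_div, le_div_iff₀ hs]; linarith
  have f2 : y ^ 2 ≤ 2 / s ^ 2 * exp (s * y) := by
    rw [div_mul_eq_mul_div, le_div_iff₀ (by positivity)]; nlinarith
  have f3 : y ^ 3 ≤ 6 / s ^ 3 * exp (s * y) := by
    rw [div_mul_eq_mul_div, le_div_iff₀ (by positivity)]; nlinarith
  nlinarith

namespace IsSoliton

variable {β c : ℝ} {Q Q' : ℝ → ℝ}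

lemma continuous (h : IsSoliton β c Q Q') : Continuous Q :=
  continuous_iff_continuousAt.2 fun x => (h.d0 x).continuousAt

lemma continuous' (h : IsSoliton β c Q Q') : Continuous Q' :=
  continuous_iff_continuousAt.2 fun x => (h.d1 x).continuousAt

lemma dec (h : IsSoliton β c Q Q') (hc : 0 < c) : Dec Q := by
  obtain ⟨C, hC0, hC⟩ := h.decay
  refine Dec.of_abs_le (dec_exp (Real.sqrt_pos.2 hc)) h.continuous (B := C) fun x => ?_
  rw [abs_of_pos (h.pos x), abs_of_nonneg (by positivity)]
  refine (hC x).trans (mul_le_mul_of_nonneg_left ?_ hC0)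
  nlinarith [abs_nonneg x, exp_pos (-(√c * |x|))]

lemma dec_deriv (h : IsSoliton β c Q Q') (hc : 0 < c) : Dec Q' :=
  Dec.of_abs_le (h.dec hc) h.continuous' (B := √c) fun x => by
    rw [abs_of_pos (h.pos x)]; exact h.abs_deriv_le hc x

lemma dec_deriv₂ (h : IsSoliton β c Q Q') (hβ : 0 < β) (hc : 0 < c) :
    Dec fun x => c * Q x - Q x ^ 2 + β * Q x ^ 3 := by
  have := h.continuous
  exact Dec.of_abs_le (h.dec hc) (by fun_prop) (B := c + 1 / β) fun x => by
    rw [abs_of_pos (h.pos x)]; exact h.abs_deriv₂_le hβ hc x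

lemma deriv_zero (h : IsSoliton β c Q Q') : Q' 0 = 0 := by
  have := h.odd 0
  rw [neg_zero] at this
  linarith

end IsSoliton

lemma sq_integral_mul_le {α : Type*} [MeasurableSpace α] {μ : Measure α} {f g : α → ℝ}
    (hf : Integrable (fun x => f x ^ 2) μ) (hg : Integrable (fun x => g x ^ 2) μ)
    (hfg : Integrable (fun x => f x * g x) μ) :
    (∫ x, f x * g x ∂μ) ^ 2 ≤ (∫ x, f x ^ 2 ∂μ) * ∫ x, g x ^ 2 ∂μ := by
  have h : ∀ t : ℝ, 0 ≤ (∫ x, g x ^ 2 ∂μ) * (t * t) + (2 * ∫ x, f x * g x ∂μ) * t +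
      ∫ x, f x ^ 2 ∂μ := fun t => by
    have h1 : 0 ≤ ∫ x, (t * g x + f x) ^ 2 ∂μ := integral_nonneg fun _ => sq_nonneg _
    have e : ∀ x, (t * g x + f x) ^ 2 = t * t * g x ^ 2 + 2 * t * (f x * g x) + f x ^ 2 :=
      fun x => by ring
    simp only [e] at h1
    rw [integral_add ((hg.const_mul _).fun_add (hfg.const_mul _)) hf,
      integral_add (hg.const_mul _) (hfg.const_mul _), integral_const_mul,
      integral_const_mul] at h1
    linarith
  have := discrim_le_zero h
  rw [discrim] at this
  nlinarith

lemma le_one_add_of_sq_le {x y : ℝ} (h : x ^ 2 ≤ y) : x ≤ 1 + y := by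
  nlinarith [sq_nonneg (x - 1)]

namespace IsSoliton

variable {β c : ℝ} {Q Q' : ℝ → ℝ}

lemma hasDerivAt_deriv₂ (h : IsSoliton β c Q Q') (x : ℝ) :
    HasDerivAt (fun y => c * Q y - Q y ^ 2 + β * Q y ^ 3)
      ((c - 2 * Q x + 3 * β * Q x ^ 2) * Q' x) x := by
  refine ((((h.d0 x).const_mul c).fun_sub ((h.d0 x).fun_pow 2)).fun_add
    (((h.d0 x).fun_pow 3).const_mul β)).congr_deriv ?_
  push_cast
  ring

/-- A Riccati lower bound, including the boundary terms from a multiple of `Q'`. -/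
lemma riccati_le (h : IsSoliton β c Q Q') {w w' P P' : ℝ → ℝ} {A a R μ : ℝ} (haR : a ≤ R)
    (hw : ∀ x, HasDerivAt w (w' x) x) (hw' : Continuous w')
    (hP : ∀ x ∈ Set.Icc a R, HasDerivAt P (P' x) x)
    (hμ : ∀ x ∈ Set.Icc a R, P' x + P x ^ 2 + μ ≤ c - 2 * Q x + 3 * β * Q x ^ 2) :
    (P R * (w R - A * Q' R) ^ 2 + A * ((2 * w R - A * Q' R) * (c * Q R - Q R ^ 2 + β * Q R ^ 3)))
      - (P a * (w a - A * Q' a) ^ 2 +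
        A * ((2 * w a - A * Q' a) * (c * Q a - Q a ^ 2 + β * Q a ^ 3))) ≤
      ∫ x in a..R, (w' x ^ 2 + (c - 2 * Q x + 3 * β * Q x ^ 2) * w x ^ 2 -
        μ * (w x - A * Q' x) ^ 2) := by
  have c1 := h.continuous
  have c2 := h.continuous'
  have c3 : Continuous w := continuous_iff_continuousAt.2 fun x => (hw x).continuousAt
  have hd : ∀ x ∈ Set.Icc a R, HasDerivAt (fun y => P y * (w y - A * Q' y) ^ 2 +
      A * ((2 * w y - A * Q' y) * (c * Q y - Q y ^ 2 + β * Q y ^ 3)))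
      (P' x * (w x - A * Q' x) ^ 2 + 2 * P x * (w x - A * Q' x) *
        (w' x - A * (c * Q x - Q x ^ 2 + β * Q x ^ 3)) +
        A * ((2 * w' x - A * (c * Q x - Q x ^ 2 + β * Q x ^ 3)) *
          (c * Q x - Q x ^ 2 + β * Q x ^ 3) +
          (2 * w x - A * Q' x) * ((c - 2 * Q x + 3 * β * Q x ^ 2) * Q' x))) x := fun x hx => by
    refine (((hP x hx).fun_mul (((hw x).fun_sub ((h.d1 x).const_mul A)).fun_pow 2)).fun_add
      (((((hw x).const_mul 2).fun_sub ((h.d1 x).const_mul A)).fun_mul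
        (h.hasDerivAt_deriv₂ x)).const_mul A)).congr_deriv ?_
    push_cast
    ring
  refine intervalIntegral.sub_le_integral_of_hasDeriv_right_of_le haR
    (fun x hx => (hd x hx).continuousAt.continuousWithinAt)
    (fun x hx => (hd x (Set.Ioo_subset_Icc_self hx)).hasDerivWithinAt)
    (Continuous.integrableOn_Icc (by fun_prop)) fun x hx => ?_
  have h1 := mul_le_mul_of_nonneg_right (hμ x (Set.Ioo_subset_Icc_self hx))
    (sq_nonneg (w x - A * Q' x))
  have h2 := sq_nonneg (w' x - A * (c * Q x - Q x ^ 2 + β * Q x ^ 3) - P x * (w x - A * Q' x))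
  nlinarith

lemma antitone_of_pos (h : IsSoliton β c Q Q') {x y : ℝ} (hx : 0 < x) (hxy : x ≤ y) :
    Q y ≤ Q x := by
  rcases hxy.eq_or_lt with rfl | hlt
  · rfl
  obtain ⟨z, hz, hz'⟩ := exists_hasDerivAt_eq_slope Q Q' hlt
    (fun z _ => (h.d0 z).continuousAt.continuousWithinAt) (fun z _ => h.d0 z)
  have h1 := h.neg z (hx.trans hz.1)
  rw [hz', div_neg_iff] at h1
  rcases h1 with h1 | h1 <;> linarith [h1.1, h1.2]

/-- Coercivity of the linearized operator on a half line, modulo `Q'`. -/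
lemma exists_half_line (h : IsSoliton β c Q Q') (hβ : 0 < β) (hc : 0 < c) :
    ∃ μ > 0, ∀ w w' : ℝ → ℝ, (∀ x, HasDerivAt w (w' x) x) → Dec w → Dec w' → w 0 = 0 →
      ∃ A, μ * ∫ x in Set.Ioi 0, (w x - A * Q' x) ^ 2 ≤
        ∫ x in Set.Ioi 0, (w' x ^ 2 + (c - 2 * Q x + 3 * β * Q x ^ 2) * w x ^ 2) := by
  set M := 4 / (3 * β) with hM
  have hM0 : 0 < M := by positivity
  set κ := M + 2 with hκ
  set x₁ := 1 / κ with hx₁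
  have hx₁0 : 0 < x₁ := by positivity
  have hQM : ∀ x, 2 * Q x ≤ M := fun x => by
    rw [hM, le_div_iff₀ (by positivity)]
    linarith [h.lt x]
  set g := c - 2 / 3 * Q x₁ + β / 2 * Q x₁ ^ 2 with hg
  have hg0 : 0 < g := by
    have h1 := h.sq x₁
    have h2 : 0 < Q' x₁ ^ 2 := by have := (h.neg x₁ hx₁0).ne; positivity
    rw [h1] at h2
    exact (pos_iff_pos_of_mul_pos h2).1 (by have := h.pos x₁; positivity)
  have hgle : ∀ x, x₁ ≤ x → g * Q x ^ 2 ≤ Q' x ^ 2 := fun x hx => by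
    rw [h.sq, mul_comm]
    refine mul_le_mul_of_nonneg_left ?_ (sq_nonneg _)
    have h1 := h.antitone_of_pos hx₁0 hx
    have h2 := h.pos x
    have h3 := h.lt x₁
    rw [hg]
    nlinarith [mul_nonneg (sub_nonneg.2 h1) (sub_nonneg.2 h3.le)]
  set κ₂ := g ^ 2 / √c with hκ₂
  have hκ₂0 : 0 < κ₂ := by positivity
  have hsc : 0 < √c := Real.sqrt_pos.2 hc
  refine ⟨min 1 (g ^ 2 / c), by positivity, fun w w' hw hdw hdw' hw0 => ?_⟩
  set μ := min 1 (g ^ 2 / c)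
  set A := w x₁ / Q' x₁ with hA
  have hz1 : w x₁ - A * Q' x₁ = 0 := by
    rw [hA, div_mul_cancel₀ _ (h.neg x₁ hx₁0).ne, sub_self]
  have hQ'0 := h.deriv_zero
  refine ⟨A, ?_⟩
  have s1 := h.riccati_le (w := w) (w' := w') (A := A) (μ := μ) (P := fun x => -κ * x)
    (P' := fun _ => -κ) hx₁0.le hw hdw'.1
    (fun x _ => by simpa using (hasDerivAt_id x).const_mul (-κ)) fun x hx => by
      have h1 : (κ * x) ^ 2 ≤ 1 := by
        have : κ * x ≤ 1 := by
          have := hx.2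
          rw [hx₁, le_div_iff₀ (by positivity)] at this
          linarith
        have h0 : 0 ≤ κ * x := mul_nonneg (by positivity) hx.1
        nlinarith
      have h2 := hQM x
      have h3 : 0 < 3 * β * Q x ^ 2 := by have := h.pos x; positivity
      have h4 : μ ≤ 1 := min_le_left _ _
      nlinarith
  set P := fun x => (c * Q x - Q x ^ 2 + β * Q x ^ 3) / Q' x + κ₂ * (Q x ^ 2 / Q' x ^ 2) with hPd
  have s2 := fun R (hR : x₁ ≤ R) => h.riccati_le (w := w) (w' := w') (A := A) (μ := μ)
    (P := P) (P' := fun x => ((c - 2 * Q x + 3 * β * Q x ^ 2) * Q' x * Q' x -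
      (c * Q x - Q x ^ 2 + β * Q x ^ 3) * (c * Q x - Q x ^ 2 + β * Q x ^ 3)) / Q' x ^ 2 +
      κ₂ * ((2 * Q x * Q' x * Q' x ^ 2 - Q x ^ 2 * (2 * Q' x *
      (c * Q x - Q x ^ 2 + β * Q x ^ 3))) / (Q' x ^ 2) ^ 2)) hR hw hdw'.1 (fun x hx => by
      have hne : Q' x ≠ 0 := (h.neg x (hx₁0.trans_le hx.1)).ne
      refine (((h.hasDerivAt_deriv₂ x).fun_div (h.d1 x) hne).fun_add
        ((((h.d0 x).fun_pow 2).fun_div ((h.d1 x).fun_pow 2) (pow_ne_zero 2 hne)).const_mul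
          κ₂)).congr_deriv ?_
      push_cast
      ring) (fun x hx => by
      have hneg := h.neg x (hx₁0.trans_le hx.1)
      have hne : Q' x ≠ 0 := hneg.ne
      have hQ := h.pos x
      have h1 := hgle x hx.1
      have h2 := (abs_le.1 (h.abs_deriv_le hc x)).1
      have h3 : Q x / Q' x ≤ -(1 / √c) := by
        rw [div_le_iff_of_neg hneg, neg_mul, one_div, ← div_eq_inv_mul, ← neg_div,
          div_le_iff₀ hsc]
        linarith
      have h4 : Q x ^ 2 / Q' x ^ 2 ≤ 1 / g := by
        rw [div_le_div_iff₀ (by positivity) hg0]; linarith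
      have h5 : (Q x ^ 2 / Q' x ^ 2) ^ 2 ≤ (1 / g) ^ 2 := by
        gcongr
      have h6 : μ ≤ g ^ 2 / c := min_le_right _ _
      have h7 : κ₂ ^ 2 * (1 / g) ^ 2 = g ^ 2 / c := by
        rw [hκ₂, div_pow, Real.sq_sqrt hc.le]; field_simp
      have h8 : 2 * κ₂ * (1 / √c) = 2 * (g ^ 2 / c) := by
        rw [hκ₂]
        have := Real.mul_self_sqrt hc.le
        field_simp
        rw [Real.sq_sqrt hc.le]
      have e : c - 2 * Q x + 3 * β * Q x ^ 2 - (((c - 2 * Q x + 3 * β * Q x ^ 2) * Q' x * Q' x -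
          (c * Q x - Q x ^ 2 + β * Q x ^ 3) * (c * Q x - Q x ^ 2 + β * Q x ^ 3)) / Q' x ^ 2 +
          κ₂ * ((2 * Q x * Q' x * Q' x ^ 2 - Q x ^ 2 * (2 * Q' x *
          (c * Q x - Q x ^ 2 + β * Q x ^ 3))) / (Q' x ^ 2) ^ 2)) - P x ^ 2 =
          -2 * κ₂ * (Q x / Q' x) - κ₂ ^ 2 * (Q x ^ 2 / Q' x ^ 2) ^ 2 := by
        simp only [hPd]
        field_simp
        ring
      have h9 := mul_le_mul_of_nonneg_left h3 (mul_pos two_pos hκ₂0).le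
      have h10 := mul_le_mul_of_nonneg_left h5 (sq_nonneg κ₂)
      linarith)
  have c1 := h.continuous
  have c2 := h.continuous'
  have c3 := hdw.1
  have c4 := hdw'.1
  have dz : Dec fun x => w x - A * Q' x := hdw.sub ((h.dec_deriv hc).const_mul A)
  have dV : Dec fun x => w' x ^ 2 + (c - 2 * Q x + 3 * β * Q x ^ 2) * w x ^ 2 := by
    obtain ⟨B, hB0, hB⟩ := (h.dec hc).bounded
    refine hdw'.sq.add (hdw.sq.bounded_mul (by fun_prop) (B := c + 2 * B + 3 * β * B ^ 2)
      fun x => ?_)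
    have h1 := hB x
    rw [abs_of_pos (h.pos x)] at h1
    have h2 := h.pos x
    have h3 : β * Q x ^ 2 ≤ β * B ^ 2 := by gcongr
    have h4 : 0 < β * Q x ^ 2 := by positivity
    exact abs_le.2 ⟨by nlinarith, by nlinarith⟩
  obtain ⟨B, hB⟩ : ∃ B, ∀ x, x₁ ≤ x → |P x| ≤ B := by
    refine ⟨(c + 1 / β) * (1 + 1 / g) + κ₂ * (1 / g), fun x hx => ?_⟩
    have hneg := h.neg x (hx₁0.trans_le hx)
    have hQ := h.pos x
    have hne : Q' x ≠ 0 := hneg.ne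
    have h4 : Q x ^ 2 / Q' x ^ 2 ≤ 1 / g := by
      rw [div_le_div_iff₀ (by positivity) hg0]; linarith [hgle x hx]
    have h5 : Q x / |Q' x| ≤ 1 + 1 / g := by
      have e : (Q x / |Q' x|) ^ 2 = Q x ^ 2 / Q' x ^ 2 := by rw [div_pow, sq_abs]
      rw [← e] at h4
      exact le_one_add_of_sq_le h4
    refine (abs_add_le _ _).trans (add_le_add ?_ ?_)
    · rw [abs_div]
      calc |c * Q x - Q x ^ 2 + β * Q x ^ 3| / |Q' x| ≤ (c + 1 / β) * Q x / |Q' x| := by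
            gcongr; exact h.abs_deriv₂_le hβ hc x
        _ = (c + 1 / β) * (Q x / |Q' x|) := by ring
        _ ≤ _ := by gcongr
    · rw [abs_of_nonneg (by positivity)]
      gcongr
  have dF := ((((hdw.const_mul 2).sub ((h.dec_deriv hc).const_mul A)).mul
    (h.dec_deriv₂ hβ hc)).const_mul A).tendsto_atTop
  have lim0 : Tendsto (fun R => -(B * (w R - A * Q' R) ^ 2) + A * ((2 * w R - A * Q' R) *
      (c * Q R - Q R ^ 2 + β * Q R ^ 3))) atTop (nhds 0) := by
    simpa using ((dz.sq.const_mul B).tendsto_atTop.neg).add dF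
  have dI := dV.sub (dz.sq.const_mul μ)
  have lim1 := intervalIntegral_tendsto_integral_Ioi 0 dI.integrable.integrableOn tendsto_id
  have hle : ∀ᶠ R in atTop, -(B * (w R - A * Q' R) ^ 2) + A * ((2 * w R - A * Q' R) *
      (c * Q R - Q R ^ 2 + β * Q R ^ 3)) ≤ ∫ x in (0 : ℝ)..R, (w' x ^ 2 +
      (c - 2 * Q x + 3 * β * Q x ^ 2) * w x ^ 2 - μ * (w x - A * Q' x) ^ 2) := by
    filter_upwards [eventually_ge_atTop x₁] with R hR
    have s2R := s2 R hR
    rw [← intervalIntegral.integral_add_adjacent_intervals (b := x₁)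
      (dI.1.intervalIntegrable _ _) (dI.1.intervalIntegrable _ _)]
    have hBR := mul_le_mul_of_nonneg_right (hB R hR) (sq_nonneg (w R - A * Q' R))
    have hPR := mul_le_mul_of_nonneg_right (neg_abs_le (P R)) (sq_nonneg (w R - A * Q' R))
    simp only [hz1, hw0, hQ'0] at s1 s2R
    linarith
  have := le_of_tendsto_of_tendsto lim0 lim1 hle
  rw [integral_sub dV.integrable.integrableOn (dz.sq.const_mul μ).integrable.integrableOn,
    integral_const_mul] at this
  linarith

end IsSoliton

lemma integral_eq_Ioi_add {f : ℝ → ℝ} (hf : Dec f) :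
    ∫ x, f x = (∫ x in Set.Ioi 0, f x) + ∫ x in Set.Ioi 0, f (-x) := by
  rw [integral_comp_neg_Ioi, neg_zero, add_comm,
    intervalIntegral.integral_Iic_add_Ioi hf.integrable.integrableOn hf.integrable.integrableOn]

namespace IsSoliton

variable {β c : ℝ} {Q Q' : ℝ → ℝ}

lemma dec_id_mul (h : IsSoliton β c Q Q') (hc : 0 < c) {f : ℝ → ℝ} (hf : Continuous f) {B : ℝ}
    (hB : ∀ x, |f x| ≤ B * Q x) : Dec fun x => x * f x := by
  obtain ⟨C, hC0, hC⟩ := h.decay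
  have hB0 : 0 ≤ B := by
    by_contra! hneg
    have := (abs_nonneg _).trans (hB 0)
    nlinarith [h.pos 0]
  refine Dec.of_abs_le (dec_exp (Real.sqrt_pos.2 hc)) (by fun_prop) (B := B * C) fun x => ?_
  rw [abs_mul, abs_of_nonneg (by positivity : 0 ≤ (1 + |x|) * exp (-(√c * |x|)))]
  calc |x| * |f x| ≤ |x| * (B * (C * exp (-(√c * |x|)))) :=
        mul_le_mul_of_nonneg_left ((hB x).trans
          (mul_le_mul_of_nonneg_left (hC x) hB0)) (abs_nonneg x)
    _ = B * C * (|x| * exp (-(√c * |x|))) := by ring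
    _ ≤ _ := by
      refine mul_le_mul_of_nonneg_left ?_ (by positivity)
      nlinarith [exp_pos (-(√c * |x|))]

/-- The derivative of the soliton with respect to its speed. -/
lemma exists_scaling (h : IsSoliton β c Q Q') (hβ : 0 < β) (hc : 0 < c)
    (hcβ : c < 2 / (9 * β)) : ∃ Λ Λ' : ℝ → ℝ, (∀ x, HasDerivAt Λ (Λ' x) x) ∧
      (∀ x, HasDerivAt Λ' ((c - 2 * Q x + 3 * β * Q x ^ 2) * Λ x + Q x) x) ∧ Dec Λ ∧ Dec Λ' ∧
      (∀ x, Λ (-x) = Λ x) ∧ 0 < Λ 0 ∧ 0 < ∫ x, Λ x * Q x := by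
  have hk : 0 < 1 - 9 / 2 * β * c := by
    rw [lt_div_iff₀ (by positivity)] at hcβ
    linarith
  set κ := (1 - 9 / 2 * β * c)⁻¹ with hκ
  have hκ0 : 0 < κ := inv_pos.2 hk
  have hκ1 : κ * (1 - 9 / 2 * β * c) = 1 := inv_mul_cancel₀ hk.ne'
  have c1 := h.continuous
  have c2 := h.continuous'
  have dQ := h.dec hc
  have dQ' := h.dec_deriv hc
  have dx := h.dec_id_mul hc c2 (h.abs_deriv_le hc)
  have dx2 := h.dec_id_mul hc (f := fun x => c * Q x - Q x ^ 2 + β * Q x ^ 3) (by fun_prop)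
    (h.abs_deriv₂_le hβ hc)
  have dx0 := h.dec_id_mul hc c1 (B := 1) fun x => by rw [abs_of_pos (h.pos x), one_mul]
  refine ⟨fun x => (x * Q' x + (1 + κ) * Q x - 3 / 2 * β * κ * Q x ^ 2) / (2 * c),
    fun x => (Q' x + x * (c * Q x - Q x ^ 2 + β * Q x ^ 3) + (1 + κ) * Q' x -
      3 / 2 * β * κ * (2 * Q x * Q' x)) / (2 * c), fun x => ?_, fun x => ?_,
      ((dx.add (dQ.const_mul _)).sub (dQ.sq.const_mul _)).div_const _,
      (((dQ'.add dx2).add (dQ'.const_mul _)).sub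
        (((dQ.const_mul 2).mul dQ').const_mul _)).div_const _, fun x => ?_, ?_, ?_⟩
  · refine (((((hasDerivAt_id' x).fun_mul (h.d1 x)).fun_add ((h.d0 x).const_mul _)).fun_sub
      (((h.d0 x).fun_pow 2).const_mul _)).div_const _).congr_deriv ?_
    push_cast
    ring
  · refine ((((((h.d1 x).fun_add ((hasDerivAt_id' x).fun_mul (h.hasDerivAt_deriv₂ x))).fun_add
      ((h.d1 x).const_mul _))).fun_sub ((((h.d0 x).const_mul 2).fun_mul
      (h.d1 x)).const_mul _)).div_const _).congr_deriv ?_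
    have hs := h.sq x
    simp only
    field_simp
    linear_combination (-6 * β * κ) * hs + 2 * Q x ^ 2 * hκ1
  · simp only [h.even, h.odd]
    ring
  · have h1 := h.lt 0
    have h2 := h.pos 0
    refine div_pos ?_ (by positivity)
    have : 0 < κ * Q 0 * (1 - 3 / 2 * β * Q 0) := mul_pos (by positivity) (by linarith)
    nlinarith
  · have hd := integral_deriv_eq_zero (f := fun x => x * Q x * Q x)
      (f' := fun x => x * Q' x * Q x + Q x ^ 2 + x * Q' x * Q x)
      (fun x => ((((hasDerivAt_id' x).fun_mul (h.d0 x)).fun_mul (h.d0 x)).congr_deriv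
        (by ring))) (dx0.mul dQ) (((dx.mul dQ).add dQ.sq).add (dx.mul dQ))
    set P := fun x => (1 / 2 * Q x ^ 2 + κ * (Q x ^ 2 * (1 - 3 / 2 * β * Q x))) / (2 * c) with hP
    have dP : Dec P := ((dQ.sq.const_mul (1 / 2)).add
      ((dQ.sq.sub (dQ.cube.const_mul (3 / 2 * β))).const_mul κ)).div_const (2 * c) |> fun hh => by
        refine (congrArg Dec (funext fun x => ?_)).mp hh
        simp only [hP]
        ring
    have hpos : ∀ x, 0 < P x := fun x => by
      have h1 := h.lt x
      have h2 := h.pos x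
      have : 0 < 1 - 3 / 2 * β * Q x := by linarith
      positivity
    have e : ∀ x, (x * Q' x + (1 + κ) * Q x - 3 / 2 * β * κ * Q x ^ 2) / (2 * c) * Q x =
      P x + 1 / (4 * c) * (x * Q' x * Q x + Q x ^ 2 + x * Q' x * Q x) := fun x => by
        simp only [hP]
        field_simp
        ring
    simp only [e]
    rw [integral_add dP.integrable ((((dx.mul dQ).add dQ.sq).add
      (dx.mul dQ)).const_mul _).integrable, integral_const_mul, hd, mul_zero, add_zero]
    exact integral_pos_of_integrable_nonneg_nonzero dP.1 dP.integrable (fun x => (hpos x).le)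
      (hpos 0).ne'

end IsSoliton

lemma sq_add_four_le (a b c d : ℝ) :
    (a + b - c - d) ^ 2 ≤ 4 * (a ^ 2 + b ^ 2 + c ^ 2 + d ^ 2) := by
  nlinarith [sq_nonneg (a - b), sq_nonneg (a + c), sq_nonneg (a + d),
    sq_nonneg (b + c), sq_nonneg (b + d), sq_nonneg (c - d)]

lemma sq_add_three_le (a b c : ℝ) : (a - b + c) ^ 2 ≤ 3 * (a ^ 2 + b ^ 2 + c ^ 2) := by
  nlinarith [sq_nonneg (a + b), sq_nonneg (a - c), sq_nonneg (b + c)]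

lemma exists_coercivity_const {μ d p q M Z : ℝ} (hμ : 0 < μ) (hd : 0 < d) (hp : 0 < p) (hq : 0 < q)
    (hM : 0 ≤ M) (hZ : 0 ≤ Z) : ∃ l > 0, ∃ C, 0 ≤ C ∧
    ∀ {E₁ E₂ J₁ J₂ I₁ I₂ A₁ A₂ s a b W H n : ℝ}, J₁ ^ 2 ≤ E₁ * M → J₂ ^ 2 ≤ E₂ * M →
      I₁ ^ 2 ≤ E₁ * p → I₂ ^ 2 ≤ E₂ * p → 0 ≤ E₁ → 0 ≤ E₂ →
      a = J₁ + J₂ - q * (A₁ + A₂) - s * d → b = I₁ - I₂ + p * (A₁ - A₂) →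
      n ≤ 2 * W + 2 * s ^ 2 * Z → W ≤ 2 * E₁ + 2 * E₂ + 2 * p * (A₁ ^ 2 + A₂ ^ 2) →
      μ * (E₁ + E₂) + 2 * s * a + s ^ 2 * d ≤ H → l * n ≤ H + C * (a ^ 2 + b ^ 2) := by
  set K := 10 + 8 * p * M / q ^ 2 + 8 * p * d ^ 2 / q ^ 2 + 2 * Z + 8 * p / q ^ 2 + 6 / p with hK
  have hK0 : 0 < K := by positivity
  set ν := min μ (d / 2) with hν
  have hν0 : 0 < ν := lt_min hμ (by positivity)
  refine ⟨ν / K, by positivity, 2 / d + ν, by positivity, ?_⟩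
  intro E₁ E₂ J₁ J₂ I₁ I₂ A₁ A₂ s a b W H n hJ₁ hJ₂ hI₁ hI₂ hE₁ hE₂ ha hb hn hW hH
  have h1 : (A₁ + A₂) ^ 2 ≤ 4 * (M * (E₁ + E₂) + s ^ 2 * d ^ 2 + a ^ 2) / q ^ 2 := by
    rw [le_div_iff₀ (by positivity)]
    have e : (A₁ + A₂) ^ 2 * q ^ 2 = (J₁ + J₂ - s * d - a) ^ 2 := by rw [ha]; ring
    rw [e]
    linarith [sq_add_four_le J₁ J₂ (s * d) a, mul_pow s d 2]
  have h2 : (A₁ - A₂) ^ 2 ≤ 3 * (b ^ 2 + p * (E₁ + E₂)) / p ^ 2 := by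
    rw [le_div_iff₀ (by positivity)]
    have e : (A₁ - A₂) ^ 2 * p ^ 2 = (b - I₁ + I₂) ^ 2 := by rw [hb]; ring
    rw [e]
    linarith [sq_add_three_le b I₁ I₂]
  have h3 : n ≤ K * (E₁ + E₂ + s ^ 2 + a ^ 2 + b ^ 2) := by
    have e1 : n ≤ 4 * (E₁ + E₂) + 2 * p * ((A₁ + A₂) ^ 2 + (A₁ - A₂) ^ 2) + 2 * s ^ 2 * Z := by
      linarith
    have e2 := mul_le_mul_of_nonneg_left h1 (by positivity : 0 ≤ 2 * p)
    have e3 := mul_le_mul_of_nonneg_left h2 (by positivity : 0 ≤ 2 * p)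
    have e4 : 2 * p * (4 * (M * (E₁ + E₂) + s ^ 2 * d ^ 2 + a ^ 2) / q ^ 2) =
      8 * p * M / q ^ 2 * (E₁ + E₂) + 8 * p * d ^ 2 / q ^ 2 * s ^ 2 + 8 * p / q ^ 2 * a ^ 2 := by
        ring
    have e5 : 2 * p * (3 * (b ^ 2 + p * (E₁ + E₂)) / p ^ 2) = 6 / p * b ^ 2 + 6 * (E₁ + E₂) := by
      field_simp
      ring
    rw [e4] at e2
    rw [e5] at e3
    have f1 : 0 ≤ 8 * p * M / q ^ 2 := by positivity
    have f2 : 0 ≤ 8 * p * d ^ 2 / q ^ 2 := by positivity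
    have f3 : 0 ≤ 8 * p / q ^ 2 := by positivity
    have f4 : 0 ≤ 6 / p := by positivity
    generalize 8 * p * M / q ^ 2 = k1 at *
    generalize 8 * p * d ^ 2 / q ^ 2 = k2 at *
    generalize 8 * p / q ^ 2 = k3 at *
    generalize 6 / p = k4 at *
    have hE : 0 ≤ E₁ + E₂ := add_nonneg hE₁ hE₂
    generalize E₁ + E₂ = E at *
    have := sq_nonneg s
    have := sq_nonneg a
    have := sq_nonneg b
    have g : ∀ x, 0 ≤ x → k1 * x ≥ 0 ∧ k2 * x ≥ 0 ∧ k3 * x ≥ 0 ∧ k4 * x ≥ 0 ∧ Z * x ≥ 0 :=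
      fun x hx => by refine ⟨?_, ?_, ?_, ?_, ?_⟩ <;> positivity
    have g1 := g _ hE
    have g2 := g _ (sq_nonneg s)
    have g3 := g _ (sq_nonneg a)
    have g4 := g _ (sq_nonneg b)
    rw [hK]
    linarith
  have h4 : ν * (E₁ + E₂) ≤ μ * (E₁ + E₂) :=
    mul_le_mul_of_nonneg_right (min_le_left _ _) (by positivity)
  have h5 : ν * s ^ 2 ≤ d / 2 * s ^ 2 := mul_le_mul_of_nonneg_right (min_le_right _ _) (sq_nonneg s)
  have h6 : -(2 / d * a ^ 2) ≤ 2 * s * a + d / 2 * s ^ 2 := by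
    have : 0 ≤ (d / 2) * (s + 2 / d * a) ^ 2 := by positivity
    have e : (d / 2) * (s + 2 / d * a) ^ 2 = 2 / d * a ^ 2 + (2 * s * a + d / 2 * s ^ 2) := by
      field_simp; ring
    linarith
  have h7 : ν / K * n ≤ ν * (E₁ + E₂ + s ^ 2 + a ^ 2 + b ^ 2) := by
    rw [div_mul_eq_mul_div, div_le_iff₀ hK0, mul_assoc, mul_comm _ K]
    exact mul_le_mul_of_nonneg_left h3 hν0.le
  have h8 : 0 ≤ 2 / d * b ^ 2 := by positivity
  linarith

namespace IsSoliton

variable {β c : ℝ} {Q Q' : ℝ → ℝ}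

lemma integral_Ioi_mul_deriv (h : IsSoliton β c Q Q') (hc : 0 < c) :
    ∫ x in Set.Ioi 0, Q' x * Q x = -(Q 0 ^ 2 / 2) := by
  have dQ := h.dec hc
  have dQ' := h.dec_deriv hc
  have := integral_Ioi_deriv 0 (f := fun x => Q x ^ 2 / 2) (f' := fun x => Q' x * Q x)
    (fun x => (((h.d0 x).fun_pow 2).div_const 2).congr_deriv (by push_cast; ring))
    (dQ.sq.div_const 2) (dQ'.mul dQ)
  simpa using this

lemma bounded_potential (h : IsSoliton β c Q Q') (hβ : 0 < β) (hc : 0 < c) :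
    ∃ B, ∀ x, |c - 2 * Q x + 3 * β * Q x ^ 2| ≤ B := by
  obtain ⟨B, hB0, hB⟩ := (h.dec hc).bounded
  refine ⟨c + 2 * B + 3 * β * B ^ 2, fun x => ?_⟩
  have h1 := hB x
  rw [abs_of_pos (h.pos x)] at h1
  have h2 := h.pos x
  have h3 : β * Q x ^ 2 ≤ β * B ^ 2 := by gcongr
  have h4 : 0 < β * Q x ^ 2 := by positivity
  exact abs_le.2 ⟨by nlinarith, by nlinarith⟩

/-- Coercivity of the linearized operator modulo the two orthogonality conditions. -/
lemma exists_coercivity (h : IsSoliton β c Q Q') (hβ : 0 < β) (hc : 0 < c)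
    (hcβ : c < 2 / (9 * β)) :
    ∃ l > 0, ∃ C, 0 ≤ C ∧ ∀ ε ε' : ℝ → ℝ, (∀ x, HasDerivAt ε (ε' x) x) → Dec ε → Dec ε' →
      l * ∫ x, ε x ^ 2 ≤ (∫ x, (ε' x ^ 2 + (c - 2 * Q x + 3 * β * Q x ^ 2) * ε x ^ 2)) +
        C * ((∫ x, ε x * Q x) ^ 2 + (∫ x, ε x * Q' x) ^ 2) := by
  obtain ⟨Λ, Λ', hΛ, hΛ', dΛ, dΛ', hΛe, hΛ0, hd⟩ := h.exists_scaling hβ hc hcβ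
  obtain ⟨μ, hμ, hhalf⟩ := h.exists_half_line hβ hc
  have dQ := h.dec hc
  have dQ' := h.dec_deriv hc
  obtain ⟨BV, hBV⟩ := h.bounded_potential hβ hc
  set V := fun x => c - 2 * Q x + 3 * β * Q x ^ 2 with hV
  have cV : Continuous V := by have := dQ.1; fun_prop
  have hVe : ∀ x, V (-x) = V x := fun x => by simp only [hV, h.even]
  have hVx : ∀ x, c - 2 * Q x + 3 * β * Q x ^ 2 = V x := fun x => rfl
  simp only [hVx] at hΛ' hhalf hBV ⊢
  clear_value V
  set d := ∫ x, Λ x * Q x with hdd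
  have hp : 0 < ∫ x in Set.Ioi 0, Q' x ^ 2 := by
    rw [setIntegral_pos_iff_support_of_nonneg_ae (Eventually.of_forall fun x => sq_nonneg _)
      dQ'.sq.integrable.integrableOn]
    refine lt_of_lt_of_le ?_ (measure_mono (s := Set.Ioi (0 : ℝ)) fun x hx =>
      ⟨pow_ne_zero 2 (h.neg x hx).ne, hx⟩)
    simp
  obtain ⟨l, hl, C, hC, key⟩ := exists_coercivity_const (M := ∫ x in Set.Ioi 0, Q x ^ 2)
    (Z := ∫ x, Λ x ^ 2) (q := Q 0 ^ 2 / 2) hμ hd hp (by have := h.pos 0; positivity)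
    (integral_nonneg fun _ => sq_nonneg _) (integral_nonneg fun _ => sq_nonneg _)
  refine ⟨l, hl, C, hC, fun ε ε' hε dε dε' => ?_⟩
  set s := -(ε 0 / Λ 0) with hs
  set w := fun x => ε x + s * Λ x with hw
  set w' := fun x => ε' x + s * Λ' x with hw'
  have hwd : ∀ x, HasDerivAt w (w' x) x := fun x => (hε x).fun_add ((hΛ x).const_mul s)
  have dw : Dec w := dε.add (dΛ.const_mul s)
  have dw' : Dec w' := dε'.add (dΛ'.const_mul s)
  have hw0 : w 0 = 0 := by
    simp only [hw, hs]; field_simp; ring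
  have hw2d : ∀ x, HasDerivAt (fun y => w (-y)) (-w' (-x)) x := fun x => by
    exact ((hwd (-x)).comp x (hasDerivAt_neg x)).congr_deriv (by ring)
  obtain ⟨A₁, hA₁⟩ := hhalf w w' hwd dw dw' hw0
  obtain ⟨A₂, hA₂⟩ := hhalf (fun x => w (-x)) (fun x => -w' (-x)) hw2d dw.comp_neg
    dw'.comp_neg.neg (by simpa using hw0)
  have dVf : ∀ {f : ℝ → ℝ}, Dec f → Dec fun x => V x * f x := fun hf => hf.bounded_mul cV hBV
  have hη₁ : Dec fun x => w x - A₁ * Q' x := dw.sub (dQ'.const_mul _)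
  have hη₂ : Dec fun x => w (-x) - A₂ * Q' x := dw.comp_neg.sub (dQ'.const_mul _)
  have hdecomp : ∀ f : ℝ → ℝ, Dec f → ∀ A₀ (g : ℝ → ℝ), Dec g →
      ∫ x in Set.Ioi 0, g x * f x = (∫ x in Set.Ioi 0, (g x - A₀ * Q' x) * f x) +
        A₀ * ∫ x in Set.Ioi 0, Q' x * f x := fun f df A₀ g dg => by
    rw [← integral_const_mul, ← integral_add
      ((dg.sub (dQ'.const_mul A₀)).mul df).integrable.integrableOn
      ((dQ'.mul df).const_mul A₀).integrable.integrableOn]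
    congr 1
    ext x
    ring
  have hCS : ∀ f g : ℝ → ℝ, Dec f → Dec g → (∫ x in Set.Ioi 0, f x * g x) ^ 2 ≤
      (∫ x in Set.Ioi 0, f x ^ 2) * ∫ x in Set.Ioi 0, g x ^ 2 := fun f g df dg =>
    sq_integral_mul_le df.sq.integrable.integrableOn dg.sq.integrable.integrableOn
      (df.mul dg).integrable.integrableOn
  have ha : ∫ x, w x * Q x = (∫ x, ε x * Q x) + s * d := by
    rw [hdd, ← integral_const_mul, ← integral_add (dε.mul dQ).integrable
      ((dΛ.mul dQ).const_mul s).integrable]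
    congr 1
    ext x
    simp only [hw]
    ring
  have hb0 : ∫ x, Λ x * Q' x = 0 := by
    rw [integral_eq_Ioi_add (dΛ.mul dQ')]
    simp only [hΛe, h.odd, mul_neg, integral_neg, add_neg_cancel]
  have hb : ∫ x, w x * Q' x = ∫ x, ε x * Q' x := by
    have : ∫ x, w x * Q' x = (∫ x, ε x * Q' x) + s * ∫ x, Λ x * Q' x := by
      rw [← integral_const_mul, ← integral_add (dε.mul dQ').integrable
        ((dΛ.mul dQ').const_mul s).integrable]
      congr 1
      ext x
      simp only [hw]
      ring
    rw [this, hb0, mul_zero, add_zero]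
  have hip1 : ∫ x, ε x * (V x * Λ x + Q x) = -∫ x, ε' x * Λ' x := by
    have := integral_by_parts hΛ' hε (dΛ'.mul dε) (((dVf dΛ).add dQ).mul dε) (dΛ'.mul dε')
    simp only [mul_comm] at this ⊢
    exact this
  have hip2 : ∫ x, Λ x * (V x * Λ x + Q x) = -∫ x, Λ' x * Λ' x := by
    have := integral_by_parts hΛ' hΛ (dΛ'.mul dΛ) (((dVf dΛ).add dQ).mul dΛ) (dΛ'.mul dΛ')
    simp only [mul_comm] at this ⊢
    exact this
  have hH : ∫ x, (ε' x ^ 2 + V x * ε x ^ 2) = (∫ x, (w' x ^ 2 + V x * w x ^ 2)) +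
      2 * s * (∫ x, ε x * Q x) + s ^ 2 * d := by
    have e : ∀ x, w' x ^ 2 + V x * w x ^ 2 = (ε' x ^ 2 + V x * ε x ^ 2) +
        2 * s * (ε' x * Λ' x) + 2 * s * (ε x * (V x * Λ x + Q x)) - 2 * s * (ε x * Q x) +
        s ^ 2 * (Λ' x * Λ' x) + s ^ 2 * (Λ x * (V x * Λ x + Q x)) - s ^ 2 * (Λ x * Q x) :=
      fun x => by simp only [hw, hw']; ring
    simp only [e]
    have i1 := dε'.sq.add (dVf dε.sq)
    have i2 := (dε'.mul dΛ').const_mul (2 * s)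
    have i3 := (dε.mul ((dVf dΛ).add dQ)).const_mul (2 * s)
    have i4 := (dε.mul dQ).const_mul (2 * s)
    have i5 := (dΛ'.mul dΛ').const_mul (s ^ 2)
    have i6 := (dΛ.mul ((dVf dΛ).add dQ)).const_mul (s ^ 2)
    have i7 := (dΛ.mul dQ).const_mul (s ^ 2)
    rw [integral_sub (((((i1.add i2).add i3).sub i4).add i5).add i6).integrable i7.integrable,
      integral_add ((((i1.add i2).add i3).sub i4).add i5).integrable i6.integrable,
      integral_add (((i1.add i2).add i3).sub i4).integrable i5.integrable,
      integral_sub ((i1.add i2).add i3).integrable i4.integrable,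
      integral_add (i1.add i2).integrable i3.integrable,
      integral_add i1.integrable i2.integrable]
    simp only [integral_const_mul, hip1, hip2]
    ring
  refine key (E₁ := ∫ x in Set.Ioi 0, (w x - A₁ * Q' x) ^ 2)
    (E₂ := ∫ x in Set.Ioi 0, (w (-x) - A₂ * Q' x) ^ 2) (A₁ := A₁) (A₂ := A₂) (s := s)
    (W := ∫ x, w x ^ 2) (hCS _ _ hη₁ dQ) (hCS _ _ hη₂ dQ) (hCS _ _ hη₁ dQ') (hCS _ _ hη₂ dQ')
    (integral_nonneg fun _ => sq_nonneg _) (integral_nonneg fun _ => sq_nonneg _) ?_ ?_ ?_ ?_ ?_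
  · have := integral_eq_Ioi_add (dw.mul dQ)
    simp only [h.even] at this
    rw [hdecomp Q dQ A₁ w dw, hdecomp Q dQ A₂ _ dw.comp_neg, h.integral_Ioi_mul_deriv hc] at this
    linarith
  · have := integral_eq_Ioi_add (dw.mul dQ')
    simp only [h.odd, mul_neg, integral_neg] at this
    rw [hdecomp Q' dQ' A₁ w dw, hdecomp Q' dQ' A₂ _ dw.comp_neg] at this
    simp only [← _root_.sq (Q' _)] at this
    linarith
  · rw [mul_assoc 2 (s ^ 2), ← integral_const_mul (s ^ 2), ← mul_add, ← integral_add
      dw.sq.integrable (dΛ.sq.const_mul _).integrable, ← integral_const_mul]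
    refine integral_mono dε.sq.integrable
      ((dw.sq.add (dΛ.sq.const_mul _)).const_mul 2).integrable fun x => ?_
    simp only [hw]
    nlinarith [sq_nonneg (ε x + s * Λ x + s * Λ x)]
  · have e : ∀ (g : ℝ → ℝ), Dec g → ∀ A : ℝ, ∫ x in Set.Ioi 0, g x ^ 2 ≤
        2 * (∫ x in Set.Ioi 0, (g x - A * Q' x) ^ 2) +
          2 * A ^ 2 * ∫ x in Set.Ioi 0, Q' x ^ 2 := fun g dg A => by
      have i1 := (dg.sub (dQ'.const_mul A)).sq.const_mul 2
      have i2 := dQ'.sq.const_mul (2 * A ^ 2)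
      rw [← integral_const_mul, ← integral_const_mul, ← integral_add
        i1.integrable.integrableOn i2.integrable.integrableOn]
      refine integral_mono dg.sq.integrable.integrableOn
        (i1.add i2).integrable.integrableOn fun x => ?_
      simp only
      nlinarith [sq_nonneg (g x - 2 * A * Q' x)]
    rw [integral_eq_Ioi_add dw.sq]
    have e1 := e w dw A₁
    have e2 := e _ dw.comp_neg A₂
    linarith
  · have := integral_eq_Ioi_add (dw'.sq.add (dVf dw.sq))
    simp only [hVe] at this
    simp only [neg_sq] at hA₂
    rw [hH, this]
    linarith

end IsSoliton

/-- A sum of well-separated solitons `q k`, with envelopes `G k` and a subordinate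
partition of unity `φ k`. The interactions are of size `e`. -/
structure Frame {N : ℕ} (β : ℝ) (c : Fin N → ℝ) (B l σ e : ℝ) (q q' G φ φ' : Fin N → ℝ → ℝ) :
    Prop where
  B_nonneg : 0 ≤ B
  l_pos : 0 < l
  e_nonneg : 0 ≤ e
  e_le : e ≤ 1
  c_nonneg : ∀ k, 0 ≤ c k
  c_le : ∀ k, c k ≤ B
  d0 : ∀ k x, HasDerivAt (q k) (q' k x) x
  d1 : ∀ k x, HasDerivAt (q' k) (c k * q k x - q k x ^ 2 + β * q k x ^ 3) x
  pos : ∀ k x, 0 ≤ q k x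
  le : ∀ k x, q k x ≤ B
  le_G : ∀ k x, q k x ≤ B * G k x
  abs_deriv_le : ∀ k x, |q' k x| ≤ B * q k x
  abs_deriv₂_le : ∀ k x, |c k * q k x - q k x ^ 2 + β * q k x ^ 3| ≤ B * q k x
  coercive : ∀ k, ∀ ε ε' : ℝ → ℝ, (∀ x, HasDerivAt ε (ε' x) x) → Dec ε → Dec ε' →
    l * ∫ x, ε x ^ 2 ≤ (∫ x, (ε' x ^ 2 + (c k - 2 * q k x + 3 * β * q k x ^ 2) * ε x ^ 2)) +
      B * ((∫ x, ε x * q k x) ^ 2 + (∫ x, ε x * q' k x) ^ 2)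
  G_dec : ∀ k, Dec (G k)
  G_nonneg : ∀ k x, 0 ≤ G k x
  G_le : ∀ k x, G k x ≤ 1
  integral_G : ∀ k, ∫ x, G k x ≤ B
  φ_pos : ∀ k x, 0 < φ k x
  φ_sum : ∀ x, ∑ k, φ k x = 1
  φ_deriv : ∀ k x, HasDerivAt (φ k) (φ' k x) x
  φ_cont : ∀ k, Continuous (φ' k)
  φ_le : ∀ k x, |φ' k x| ≤ σ * φ k x
  φ_mul_le : ∀ j k, j ≠ k → ∀ x, φ j x * q k x ≤ e * G k x
  mul_le : ∀ j k, j ≠ k → ∀ x, q j x * q k x ≤ e * G k x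

namespace Frame

variable {N : ℕ} {β B l σ e : ℝ} {c : Fin N → ℝ} {q q' G φ φ' : Fin N → ℝ → ℝ}

lemma cont (h : Frame β c B l σ e q q' G φ φ') (k : Fin N) : Continuous (q k) :=
  continuous_iff_continuousAt.2 fun x => (h.d0 k x).continuousAt

lemma cont' (h : Frame β c B l σ e q q' G φ φ') (k : Fin N) : Continuous (q' k) :=
  continuous_iff_continuousAt.2 fun x => (h.d1 k x).continuousAt

lemma cont_φ (h : Frame β c B l σ e q q' G φ φ') (k : Fin N) : Continuous (φ k) :=
  continuous_iff_continuousAt.2 fun x => (h.φ_deriv k x).continuousAt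

lemma dec (h : Frame β c B l σ e q q' G φ φ') (k : Fin N) : Dec (q k) :=
  (h.G_dec k).of_abs_le (h.cont k) (B := B) fun x => by
    rw [abs_of_nonneg (h.pos k x), abs_of_nonneg (h.G_nonneg k x)]; exact h.le_G k x

lemma dec' (h : Frame β c B l σ e q q' G φ φ') (k : Fin N) : Dec (q' k) :=
  (h.dec k).of_abs_le (h.cont' k) (B := B) fun x => by
    rw [abs_of_nonneg (h.pos k x)]; exact h.abs_deriv_le k x

lemma φ_le_one (h : Frame β c B l σ e q q' G φ φ') (k : Fin N) (x : ℝ) : φ k x ≤ 1 := by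
  rw [← h.φ_sum x]
  exact Finset.single_le_sum (f := fun k => φ k x) (fun i _ => (h.φ_pos i x).le)
    (Finset.mem_univ k)

lemma sum_φ' (h : Frame β c B l σ e q q' G φ φ') (x : ℝ) : ∑ k, φ' k x = 0 := by
  have h1 : HasDerivAt (fun y => ∑ k, φ k y) (∑ k, φ' k x) x :=
    HasDerivAt.fun_sum fun k _ => h.φ_deriv k x
  simp only [h.φ_sum] at h1
  exact h1.unique (hasDerivAt_const x 1)

lemma sum_nonneg (h : Frame β c B l σ e q q' G φ φ') (x : ℝ) : 0 ≤ ∑ k, q k x :=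
  Finset.sum_nonneg fun k _ => h.pos k x

lemma sum_le (h : Frame β c B l σ e q q' G φ φ') (x : ℝ) : ∑ k, q k x ≤ N * B := by
  simpa using Finset.sum_le_card_nsmul Finset.univ (fun k => q k x) B fun k _ => h.le k x

lemma le_sum (h : Frame β c B l σ e q q' G φ φ') (k : Fin N) (x : ℝ) : q k x ≤ ∑ j, q j x :=
  Finset.single_le_sum (f := fun k => q k x) (fun i _ => h.pos i x) (Finset.mem_univ k)

lemma sum_sub (h : Frame β c B l σ e q q' G φ φ') (k : Fin N) (x : ℝ) :
    (∑ j, q j x) - q k x = ∑ j ∈ Finset.univ.erase k, q j x := by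
  rw [← Finset.add_sum_erase _ _ (Finset.mem_univ k)]
  ring

lemma one_sub_φ (h : Frame β c B l σ e q q' G φ φ') (k : Fin N) (x : ℝ) :
    1 - φ k x = ∑ j ∈ Finset.univ.erase k, φ j x := by
  rw [← h.φ_sum x, ← Finset.add_sum_erase _ _ (Finset.mem_univ k)]
  ring

lemma one_sub_φ_mul_le (h : Frame β c B l σ e q q' G φ φ') (k : Fin N) (x : ℝ) :
    (1 - φ k x) * q k x ≤ N * e * G k x := by
  have he := h.e_nonneg
  have hG := h.G_nonneg k x
  rw [h.one_sub_φ, Finset.sum_mul]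
  calc ∑ j ∈ Finset.univ.erase k, φ j x * q k x ≤ ∑ j ∈ Finset.univ.erase k, e * G k x :=
        Finset.sum_le_sum fun j hj => h.φ_mul_le j k (Finset.ne_of_mem_erase hj) x
    _ ≤ ∑ j : Fin N, e * G k x := Finset.sum_le_sum_of_subset_of_nonneg (Finset.erase_subset _ _)
        fun j _ _ => by positivity
    _ = N * e * G k x := by simp; ring

lemma φ_mul_sum_sub_le (h : Frame β c B l σ e q q' G φ φ') (k : Fin N) (x : ℝ) :
    φ k x * ((∑ j, q j x) - q k x) ≤ N * e := by
  have he := h.e_nonneg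
  rw [h.sum_sub, Finset.mul_sum]
  calc ∑ j ∈ Finset.univ.erase k, φ k x * q j x ≤ ∑ j ∈ Finset.univ.erase k, e :=
        Finset.sum_le_sum fun j hj => (h.φ_mul_le k j (Finset.ne_of_mem_erase hj).symm x).trans
          (mul_le_of_le_one_right he (h.G_le j x))
    _ ≤ ∑ j : Fin N, e := Finset.sum_le_sum_of_subset_of_nonneg (Finset.erase_subset _ _)
        fun j _ _ => he
    _ = N * e := by simp

lemma potential_le (h : Frame β c B l σ e q q' G φ φ') (hβ : 0 < β) (k : Fin N) (x : ℝ) :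
    φ k x * ((2 * (∑ j, q j x) - 3 * β * (∑ j, q j x) ^ 2) - (2 * q k x - 3 * β * q k x ^ 2)) ≤
      (2 + 6 * β * (N * B)) * (N * e) := by
  have h1 := h.φ_mul_sum_sub_le k x
  have h2 := h.le_sum k x
  have h3 := h.sum_nonneg x
  have h4 := h.pos k x
  have h5 := (h.φ_pos k x).le
  have h0 : 0 ≤ N * e := mul_nonneg N.cast_nonneg h.e_nonneg
  have h7 : 0 ≤ N * B := mul_nonneg N.cast_nonneg h.B_nonneg
  generalize (∑ j, q j x) = R at *
  have e1 : φ k x * ((2 * R - 3 * β * R ^ 2) - (2 * q k x - 3 * β * q k x ^ 2)) =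
    (2 - 3 * β * (R + q k x)) * (φ k x * (R - q k x)) := by ring
  have h6 : 0 ≤ φ k x * (R - q k x) := mul_nonneg h5 (by linarith)
  rw [e1]
  calc _ ≤ (2 + 6 * β * (N * B)) * (φ k x * (R - q k x)) := by
        refine mul_le_mul_of_nonneg_right ?_ h6
        have : 0 ≤ 3 * β * (R + q k x) := by positivity
        have : 0 ≤ 6 * β * (N * B) := by positivity
        linarith
    _ ≤ _ := mul_le_mul_of_nonneg_left h1 (by positivity)

lemma localized_form_le (h : Frame β c B l σ e q q' G φ φ') (hβ : 0 < β) (u v x : ℝ) :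
    ∑ k, ((√(φ k x) * v + φ' k x / (2 * √(φ k x)) * u) ^ 2 +
      (c k - 2 * q k x + 3 * β * q k x ^ 2) * (√(φ k x) * u) ^ 2) ≤
    v ^ 2 + ((∑ k, c k * φ k x) - (2 * (∑ j, q j x) - 3 * β * (∑ j, q j x) ^ 2)) * u ^ 2 +
      (σ ^ 2 / 4 + N * ((2 + 6 * β * (N * B)) * (N * e))) * u ^ 2 := by
  have h1 : ∀ k, (√(φ k x) * v + φ' k x / (2 * √(φ k x)) * u) ^ 2 +
      (c k - 2 * q k x + 3 * β * q k x ^ 2) * (√(φ k x) * u) ^ 2 ≤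
      φ k x * v ^ 2 + φ' k x * (u * v) + σ ^ 2 / 4 * u ^ 2 * φ k x + c k * φ k x * u ^ 2 -
      φ k x * ((2 * (∑ j, q j x) - 3 * β * (∑ j, q j x) ^ 2) * u ^ 2) +
      ((2 + 6 * β * (N * B)) * (N * e)) * u ^ 2 := fun k => by
    have h2 := h.φ_pos k x
    have h3 := Real.sqrt_pos.2 h2
    have h4 : √(φ k x) ^ 2 = φ k x := Real.sq_sqrt h2.le
    have h5 : φ' k x / (2 * √(φ k x)) * √(φ k x) = φ' k x / 2 := by field_simp
    have h6 : (φ' k x / (2 * √(φ k x))) ^ 2 ≤ σ ^ 2 / 4 * φ k x := by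
      rw [div_pow, mul_pow, h4, div_le_iff₀ (by positivity)]
      have := sq_le_sq' (neg_le_of_abs_le (h.φ_le k x)) (le_of_abs_le (h.φ_le k x))
      linarith
    have h7 := mul_le_mul_of_nonneg_right (h.potential_le hβ k x) (sq_nonneg u)
    have h8 := mul_le_mul_of_nonneg_right h6 (sq_nonneg u)
    generalize (∑ j, q j x) = R at *
    generalize φ' k x / (2 * √(φ k x)) = θ' at *
    have e1 : (√(φ k x) * v + θ' * u) ^ 2 + (c k - 2 * q k x + 3 * β * q k x ^ 2) *
        (√(φ k x) * u) ^ 2 = √(φ k x) ^ 2 * v ^ 2 + 2 * (θ' * √(φ k x)) * (u * v) + θ' ^ 2 * u ^ 2 +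
        (c k - 2 * q k x + 3 * β * q k x ^ 2) * (√(φ k x) ^ 2 * u ^ 2) := by ring
    rw [e1, h4, h5]
    linarith
  refine (Finset.sum_le_sum fun k _ => h1 k).trans (le_of_eq ?_)
  simp only [Finset.sum_add_distrib, Finset.sum_sub_distrib, ← Finset.sum_mul, ← Finset.mul_sum,
    h.φ_sum, h.sum_φ', Finset.sum_const, Finset.card_univ, Fintype.card_fin, nsmul_eq_mul]
  ring

end Frame

namespace Frame

variable {N : ℕ} {β B l σ e : ℝ} {c : Fin N → ℝ} {q q' G φ φ' : Fin N → ℝ → ℝ}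

lemma integral_sq_le (h : Frame β c B l σ e q q' G φ φ') {k : Fin N} {p : ℝ → ℝ} {D : ℝ}
    (hp : Continuous p) (hpG : ∀ x, |p x| ≤ D * G k x) : ∫ x, p x ^ 2 ≤ D ^ 2 * B := by
  have hdec : Dec p := (h.G_dec k).of_abs_le hp (B := D) fun x => by
    rw [abs_of_nonneg (h.G_nonneg k x)]; exact hpG x
  calc ∫ x, p x ^ 2 ≤ ∫ x, D ^ 2 * G k x := by
        refine integral_mono hdec.sq.integrable ((h.G_dec k).integrable.const_mul _) fun x => ?_
        have h1 := sq_le_sq' (neg_le_of_abs_le (hpG x)) (le_of_abs_le (hpG x))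
        have h2 := mul_le_of_le_one_right (h.G_nonneg k x) (h.G_le k x)
        have h3 := mul_le_mul_of_nonneg_left h2 (sq_nonneg D)
        show p x ^ 2 ≤ D ^ 2 * G k x
        linarith
    _ = D ^ 2 * ∫ x, G k x := integral_const_mul _ _
    _ ≤ D ^ 2 * B := mul_le_mul_of_nonneg_left (h.integral_G k) (sq_nonneg D)

lemma sq_integral_sqrt_mul_le (h : Frame β c B l σ e q q' G φ φ') {k : Fin N} {p ε : ℝ → ℝ} {D : ℝ}
    (hD : 0 ≤ D) (hp : Continuous p) (hpq : ∀ x, |p x| ≤ D * q k x) (hε : Dec ε) :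
    (∫ x, √(φ k x) * ε x * p x) ^ 2 ≤
      2 * (∫ x, ε x * p x) ^ 2 + 2 * (D ^ 2 * N ^ 2 * e ^ 2 * B) * ∫ x, ε x ^ 2 := by
  have he := h.e_nonneg
  have hφ := (h.cont_φ k).sqrt
  have hdec : Dec p := (h.dec k).of_abs_le hp (B := D) fun x => by
    rw [abs_of_nonneg (h.pos k x)]; exact hpq x
  have h1 : ∀ x, |(1 - √(φ k x)) * p x| ≤ (D * N * e) * G k x := fun x => by
    have h2 := Real.sqrt_nonneg (φ k x)
    have h3 : √(φ k x) ≤ 1 := Real.sqrt_le_one.2 (h.φ_le_one k x)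
    have h4 : φ k x ≤ √(φ k x) := by
      nlinarith [Real.sq_sqrt (h.φ_pos k x).le]
    rw [abs_mul, abs_of_nonneg (by linarith)]
    calc _ ≤ (1 - φ k x) * (D * q k x) := mul_le_mul (by linarith) (hpq x) (abs_nonneg _)
          (by linarith)
      _ = D * ((1 - φ k x) * q k x) := by ring
      _ ≤ D * (N * e * G k x) := mul_le_mul_of_nonneg_left (h.one_sub_φ_mul_le k x) hD
      _ = _ := by ring
  have hc : Continuous fun x => (1 - √(φ k x)) * p x := (continuous_const.sub hφ).mul hp
  have hd2 : Dec fun x => (1 - √(φ k x)) * p x :=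
    (h.G_dec k).of_abs_le hc (B := D * N * e) fun x => by
      rw [abs_of_nonneg (h.G_nonneg k x)]; exact h1 x
  have h5 := h.integral_sq_le hc h1
  have h6 := sq_integral_mul_le (μ := volume) hε.sq.integrable hd2.sq.integrable
    (hε.mul hd2).integrable
  have h7 : (∫ x, √(φ k x) * ε x * p x) = (∫ x, ε x * p x) -
      ∫ x, ε x * ((1 - √(φ k x)) * p x) := by
    rw [← integral_sub (hε.mul hdec).integrable (hε.mul hd2).integrable]
    exact integral_congr_ae (Eventually.of_forall fun x => by simp only; ring)
  have h8 : 0 ≤ ∫ x, ε x ^ 2 := integral_nonneg fun x => sq_nonneg _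
  have h9 := mul_le_mul_of_nonneg_left h5 h8
  rw [h7]
  generalize (∫ x, ε x * p x) = a at *
  generalize (∫ x, ε x * ((1 - √(φ k x)) * p x)) = b at *
  nlinarith [sq_nonneg (a + b)]

lemma localized_coercive (h : Frame β c B l σ e q q' G φ φ') (hβ : 0 < β) {ε ε' : ℝ → ℝ}
    (hd : ∀ x, HasDerivAt ε (ε' x) x) (hε : Dec ε) (hε' : Dec ε') :
    (l - σ ^ 2 / 4 - (N * ((2 + 6 * β * (N * B)) * N) + N * (2 * B * (1 + B ^ 2) * N ^ 2 * B)) * e) *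
        (∫ x, ε x ^ 2) ≤
      (∫ x, (ε' x ^ 2 + ((∑ k, c k * φ k x) -
        (2 * (∑ j, q j x) - 3 * β * (∑ j, q j x) ^ 2)) * ε x ^ 2)) +
      2 * B * ∑ k, ((∫ x, ε x * q k x) ^ 2 + (∫ x, ε x * q' k x) ^ 2) := by
  have he := h.e_nonneg
  have hB := h.B_nonneg
  have hsc : ∀ k, Continuous fun x => √(φ k x) := fun k => (h.cont_φ k).sqrt
  have hs1 : ∀ k x, |√(φ k x)| ≤ 1 := fun k x => by
    rw [abs_of_nonneg (Real.sqrt_nonneg _)]; exact Real.sqrt_le_one.2 (h.φ_le_one k x)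
  have hsd : ∀ k x, HasDerivAt (fun x => √(φ k x)) (φ' k x / (2 * √(φ k x))) x := fun k x =>
    (h.φ_deriv k x).sqrt (h.φ_pos k x).ne'
  have hu : ∀ k, Dec fun x => √(φ k x) * ε x := fun k => hε.bounded_mul (hsc k) (hs1 k)
  have hu' : ∀ k, Dec fun x => √(φ k x) * ε' x + φ' k x / (2 * √(φ k x)) * ε x := fun k => by
    refine (hε'.bounded_mul (hsc k) (hs1 k)).add (hε.bounded_mul (B := |σ|) ?_ fun x => ?_)
    · exact (h.φ_cont k).div₀ (continuous_const.mul (hsc k)) fun x =>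
        (mul_pos two_pos (Real.sqrt_pos.2 (h.φ_pos k x))).ne'
    · have h2 := h.φ_pos k x
      have h3 := Real.sqrt_pos.2 h2
      rw [abs_div, abs_of_pos (by positivity : 0 < 2 * √(φ k x)), div_le_iff₀ (by positivity)]
      have h4 : φ k x ≤ √(φ k x) := by
        have := le_of_abs_le (hs1 k x)
        nlinarith [Real.sq_sqrt h2.le]
      calc _ ≤ σ * φ k x := h.φ_le k x
        _ ≤ |σ| * φ k x := mul_le_mul_of_nonneg_right (le_abs_self σ) h2.le
        _ ≤ |σ| * (2 * √(φ k x)) := mul_le_mul_of_nonneg_left (by linarith) (abs_nonneg _)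
  have hud : ∀ k x, HasDerivAt (fun x => √(φ k x) * ε x)
      (√(φ k x) * ε' x + φ' k x / (2 * √(φ k x)) * ε x) x := fun k x =>
    ((hsd k x).fun_mul (hd x)).congr_deriv (by ring)
  have hcoer := fun k => h.coercive k _ _ (hud k) (hu k) (hu' k)
  have ht1 := fun k => h.sq_integral_sqrt_mul_le (D := 1) zero_le_one (h.cont k)
    (fun x => by rw [abs_of_nonneg (h.pos k x), one_mul]) hε
  have ht2 := fun k => h.sq_integral_sqrt_mul_le hB (h.cont' k) (h.abs_deriv_le k) hε
  have hpot : ∀ k, Dec fun x => (√(φ k x) * ε' x + φ' k x / (2 * √(φ k x)) * ε x) ^ 2 +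
      (c k - 2 * q k x + 3 * β * q k x ^ 2) * (√(φ k x) * ε x) ^ 2 := fun k => by
    have e1 := ((((hu k).sq.const_mul (c k)).sub (((h.dec k).mul (hu k).sq).const_mul 2)).add
      (((h.dec k).sq.mul (hu k).sq).const_mul (3 * β)))
    refine (hu' k).sq.add ?_
    convert e1 using 2 with x
    ring
  have hSq : Dec fun x => ∑ j, q j x := Dec.sum _ fun j _ => h.dec j
  have hR : Dec fun x => ε' x ^ 2 + ((∑ k, c k * φ k x) -
        (2 * (∑ j, q j x) - 3 * β * (∑ j, q j x) ^ 2)) * ε x ^ 2 := by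
    have e2 : ∀ k ∈ Finset.univ, Dec fun x => c k * (φ k x * ε x ^ 2) := fun k _ =>
      (hε.sq.bounded_mul (h.cont_φ k) (B := 1) fun x => by
        rw [abs_of_pos (h.φ_pos k x)]; exact h.φ_le_one k x).const_mul _
    have e1 := hε'.sq.add (((Dec.sum _ e2).sub ((hSq.mul hε.sq).const_mul 2)).add
      ((hSq.sq.mul hε.sq).const_mul (3 * β)))
    convert e1 using 2 with x
    simp only [← mul_assoc, ← Finset.sum_mul]
    ring
  have key := integral_mono (integrable_finsetSum Finset.univ fun k _ => (hpot k).integrable)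
    (hR.add (hε.sq.const_mul (σ ^ 2 / 4 + N * ((2 + 6 * β * (N * B)) * (N * e))))).integrable
    fun x => h.localized_form_le hβ (ε x) (ε' x) x
  rw [integral_finsetSum _ fun k _ => (hpot k).integrable,
    integral_add hR.integrable (hε.sq.const_mul _).integrable, integral_const_mul] at key
  have hsum : ∑ k, ∫ x, (√(φ k x) * ε x) ^ 2 = ∫ x, ε x ^ 2 := by
    rw [← integral_finsetSum _ fun k _ => (hu k).sq.integrable]
    refine integral_congr_ae (Eventually.of_forall fun x => ?_)
    simp only [mul_pow, Real.sq_sqrt (h.φ_pos _ x).le, ← Finset.sum_mul, h.φ_sum, one_mul]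
  have hS := Finset.sum_le_sum fun k (_ : k ∈ Finset.univ) => hcoer k
  rw [← Finset.mul_sum, hsum, Finset.sum_add_distrib, ← Finset.mul_sum] at hS
  have hT := Finset.sum_le_sum fun k (_ : k ∈ Finset.univ) => add_le_add (ht1 k) (ht2 k)
  have hT' : ∑ k, (2 * (∫ x, ε x * q k x) ^ 2 + 2 * ((1:ℝ) ^ 2 * N ^ 2 * e ^ 2 * B) * (∫ x, ε x ^ 2) +
      (2 * (∫ x, ε x * q' k x) ^ 2 + 2 * (B ^ 2 * N ^ 2 * e ^ 2 * B) * ∫ x, ε x ^ 2)) =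
      2 * (∑ k, ((∫ x, ε x * q k x) ^ 2 + (∫ x, ε x * q' k x) ^ 2)) +
      N * (2 * (1 + B ^ 2) * N ^ 2 * e ^ 2 * B) * ∫ x, ε x ^ 2 := by
    simp only [Finset.sum_add_distrib, ← Finset.mul_sum, Finset.sum_const, Finset.card_univ,
      Fintype.card_fin, nsmul_eq_mul]
    ring
  rw [hT'] at hT
  have hT2 := mul_le_mul_of_nonneg_left hT hB
  have h8 : 0 ≤ ∫ x, ε x ^ 2 := integral_nonneg fun x => sq_nonneg _
  have h9 : N * (2 * B * (1 + B ^ 2) * N ^ 2 * B) * e ^ 2 * (∫ x, ε x ^ 2) ≤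
      N * (2 * B * (1 + B ^ 2) * N ^ 2 * B) * e * (∫ x, ε x ^ 2) := by
    refine mul_le_mul_of_nonneg_right (mul_le_mul_of_nonneg_left ?_ (by positivity)) h8
    nlinarith [h.e_le]
  linarith

lemma exists_coercivity (N : ℕ) {β B l : ℝ} (hβ : 0 < β) (hB : 0 ≤ B) (hl : 0 < l) :
    ∃ e₀ > 0, ∃ κ > 0, ∀ (c : Fin N → ℝ) (σ e : ℝ) (q q' G φ φ' : Fin N → ℝ → ℝ),
      Frame β c B l σ e q q' G φ φ' → e ≤ e₀ → σ ^ 2 ≤ l →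
      ∀ ε ε' : ℝ → ℝ, (∀ x, HasDerivAt ε (ε' x) x) → Dec ε → Dec ε' →
      κ * (∫ x, (ε x ^ 2 + ε' x ^ 2)) ≤
        (∫ x, (ε' x ^ 2 + ((∑ k, c k * φ k x) -
          (2 * (∑ j, q j x) - 3 * β * (∑ j, q j x) ^ 2)) * ε x ^ 2)) +
        2 * B * ∑ k, ((∫ x, ε x * q k x) ^ 2 + (∫ x, ε x * q' k x) ^ 2) := by
  set K := N * ((2 + 6 * β * (N * B)) * N) + N * (2 * B * (1 + B ^ 2) * N ^ 2 * B) with hK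
  have hK0 : 0 ≤ K := by positivity
  set τ := l / (8 * (N * B + 1)) with hτ
  have hτ0 : 0 < τ := by positivity
  have hτ1 : τ * (8 * (N * B + 1)) = l := by rw [hτ]; field_simp
  refine ⟨l / (4 * (K + 1)), by positivity, τ / (1 + τ), by positivity, ?_⟩
  intro c σ e q q' G φ φ' h he hσ ε ε' hd hε hε'
  have h1 := h.localized_coercive hβ hd hε hε'
  rw [← hK] at h1
  have h2 : K * e ≤ l / 4 := by
    have := h.e_nonneg
    rw [le_div_iff₀ (by positivity)] at he
    nlinarith
  have h8 : 0 ≤ ∫ x, ε x ^ 2 := integral_nonneg fun x => sq_nonneg _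
  have h3 : l / 2 * (∫ x, ε x ^ 2) ≤ (l - σ ^ 2 / 4 - K * e) * ∫ x, ε x ^ 2 :=
    mul_le_mul_of_nonneg_right (by linarith) h8
  have hSq : Dec fun x => ∑ j, q j x := Dec.sum _ fun j _ => h.dec j
  have hR : Dec fun x => ε' x ^ 2 + ((∑ k, c k * φ k x) -
        (2 * (∑ j, q j x) - 3 * β * (∑ j, q j x) ^ 2)) * ε x ^ 2 := by
    have e2 : ∀ k ∈ Finset.univ, Dec fun x => c k * (φ k x * ε x ^ 2) := fun k _ =>
      (hε.sq.bounded_mul (h.cont_φ k) (B := 1) fun x => by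
        rw [abs_of_pos (h.φ_pos k x)]; exact h.φ_le_one k x).const_mul _
    have e1 := hε'.sq.add (((Dec.sum _ e2).sub ((hSq.mul hε.sq).const_mul 2)).add
      ((hSq.sq.mul hε.sq).const_mul (3 * β)))
    convert e1 using 2 with x
    simp only [← mul_assoc, ← Finset.sum_mul]
    ring
  have h4 : (∫ x, ε' x ^ 2) ≤ (∫ x, (ε' x ^ 2 + ((∑ k, c k * φ k x) -
        (2 * (∑ j, q j x) - 3 * β * (∑ j, q j x) ^ 2)) * ε x ^ 2)) +
        2 * (N * B) * ∫ x, ε x ^ 2 := by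
    rw [← integral_const_mul, ← integral_add hR.integrable (hε.sq.const_mul _).integrable]
    refine integral_mono hε'.sq.integrable (hR.add (hε.sq.const_mul _)).integrable fun x => ?_
    have h5 := h.sum_le x
    have h6 : 0 ≤ ∑ k, c k * φ k x := Finset.sum_nonneg fun k _ =>
      mul_nonneg (h.c_nonneg k) (h.φ_pos k x).le
    have h7 : 0 ≤ 3 * β * (∑ j, q j x) ^ 2 := by positivity
    have h9 : 0 ≤ ((∑ k, c k * φ k x) - (2 * (∑ j, q j x) - 3 * β * (∑ j, q j x) ^ 2) +
      2 * (N * B)) * ε x ^ 2 := mul_nonneg (by linarith) (sq_nonneg _)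
    simp only
    linarith
  rw [integral_add hε.sq.integrable hε'.sq.integrable]
  have h10 : 0 ≤ 2 * B * ∑ k, ((∫ x, ε x * q k x) ^ 2 + (∫ x, ε x * q' k x) ^ 2) := by
    refine mul_nonneg (by positivity) (Finset.sum_nonneg fun k _ => by positivity)
  rw [div_mul_eq_mul_div, div_le_iff₀ (by positivity)]
  generalize (∫ x, (ε' x ^ 2 + ((∑ k, c k * φ k x) -
        (2 * (∑ j, q j x) - 3 * β * (∑ j, q j x) ^ 2)) * ε x ^ 2)) = H at *
  generalize 2 * B * ∑ k, ((∫ x, ε x * q k x) ^ 2 + (∫ x, ε x * q' k x) ^ 2) = S at *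
  generalize (∫ x, ε x ^ 2) = n at *
  generalize (∫ x, ε' x ^ 2) = m at *
  have h11 := mul_le_mul_of_nonneg_left h4 hτ0.le
  have h12 : 0 ≤ τ * S := by positivity
  have h13 : (τ * (8 * (N * B + 1))) * n = l * n := by rw [hτ1]
  have h14 : 0 ≤ τ * n := by positivity
  have h15 : 0 ≤ τ * (N * B) * n := by positivity
  linarith

end Frame

/-- The density of the energy of the Gardner equation. -/
noncomputable def energyDensity (β u v : ℝ) : ℝ := (1 / 2) * v ^ 2 - (1 / 3) * u ^ 3 + (β / 4) * u ^ 4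

lemma abs_integral_sub_le {f g D : ℝ → ℝ} (hf : Dec f) (hg : Dec g) (hD : Dec D)
    (h : ∀ x, |f x - g x| ≤ D x) : |(∫ x, f x) - ∫ x, g x| ≤ ∫ x, D x := by
  rw [← integral_sub hf.integrable hg.integrable]
  exact (abs_integral_le_integral_abs).trans
    (integral_mono (hf.sub hg).abs.integrable hD.integrable h)

lemma Dec.energyDensity {β : ℝ} {u v : ℝ → ℝ} (hu : Dec u) (hv : Dec v) :
    Dec fun x => energyDensity β (u x) (v x) :=
  ((hv.sq.const_mul _).sub (hu.cube.const_mul _)).add (hu.pow_four.const_mul _)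

namespace Frame

variable {N : ℕ} {β B l σ e : ℝ} {c : Fin N → ℝ} {q q' G φ φ' : Fin N → ℝ → ℝ}

lemma sum_mul_sub_nonneg (h : Frame β c B l σ e q q' G φ φ') (x : ℝ) :
    0 ≤ ∑ k, q k x * ((∑ j, q j x) - q k x) :=
  Finset.sum_nonneg fun k _ => mul_nonneg (h.pos k x) (sub_nonneg.2 (h.le_sum k x))

lemma sum_mul_sub_le (h : Frame β c B l σ e q q' G φ φ') (x : ℝ) :
    ∑ k, q k x * ((∑ j, q j x) - q k x) ≤ N * e * ∑ k, G k x := by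
  rw [Finset.mul_sum]
  refine Finset.sum_le_sum fun k _ => ?_
  have he := h.e_nonneg
  have hG := h.G_nonneg k x
  rw [h.sum_sub, Finset.mul_sum]
  calc ∑ j ∈ Finset.univ.erase k, q k x * q j x ≤ ∑ j ∈ Finset.univ.erase k, e * G k x :=
        Finset.sum_le_sum fun j hj => by
          rw [mul_comm]; exact h.mul_le j k (Finset.ne_of_mem_erase hj) x
    _ ≤ ∑ j : Fin N, e * G k x := Finset.sum_le_sum_of_subset_of_nonneg (Finset.erase_subset _ _)
        fun j _ _ => by positivity
    _ = N * e * G k x := by simp; ring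

lemma sq_sub_sum_sq (q : Fin N → ℝ → ℝ) (x : ℝ) :
    (∑ j, q j x) ^ 2 - ∑ k, q k x ^ 2 = ∑ k, q k x * ((∑ j, q j x) - q k x) := by
  simp only [mul_sub, Finset.sum_sub_distrib, ← Finset.sum_mul]
  simp only [sq]

lemma abs_deriv_sq_sub_le (h : Frame β c B l σ e q q' G φ φ') (x : ℝ) :
    |(∑ j, q' j x) ^ 2 - ∑ k, q' k x ^ 2| ≤ B ^ 2 * ∑ k, q k x * ((∑ j, q j x) - q k x) := by
  rw [sq_sub_sum_sq, Finset.mul_sum]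
  refine (Finset.abs_sum_le_sum_abs _ _).trans (Finset.sum_le_sum fun k _ => ?_)
  have h1 : |(∑ j, q' j x) - q' k x| ≤ B * ((∑ j, q j x) - q k x) := by
    rw [h.sum_sub, ← Finset.add_sum_erase _ _ (Finset.mem_univ k), add_sub_cancel_left,
      Finset.mul_sum]
    exact (Finset.abs_sum_le_sum_abs _ _).trans (Finset.sum_le_sum fun j _ => h.abs_deriv_le j x)
  rw [abs_mul]
  calc _ ≤ (B * q k x) * (B * ((∑ j, q j x) - q k x)) :=
        mul_le_mul (h.abs_deriv_le k x) h1 (abs_nonneg _) (mul_nonneg h.B_nonneg (h.pos k x))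
    _ = _ := by ring

lemma abs_cube_sub_le (h : Frame β c B l σ e q q' G φ φ') (x : ℝ) :
    |(∑ j, q j x) ^ 3 - ∑ k, q k x ^ 3| ≤
      2 * (N * B) * ∑ k, q k x * ((∑ j, q j x) - q k x) := by
  have e1 : (∑ j, q j x) ^ 3 - ∑ k, q k x ^ 3 =
      ∑ k, q k x * ((∑ j, q j x) ^ 2 - q k x ^ 2) := by
    simp only [mul_sub, Finset.sum_sub_distrib, ← Finset.sum_mul]
    congr 1
    · ring
    · exact Finset.sum_congr rfl fun k _ => by ring
  rw [e1, Finset.mul_sum]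
  refine (Finset.abs_sum_le_sum_abs _ _).trans (Finset.sum_le_sum fun k _ => ?_)
  have h2 := h.le_sum k x
  have h3 := h.sum_le x
  have h4 := h.pos k x
  generalize (∑ j, q j x) = R at *
  have h5 : q k x * (R ^ 2 - q k x ^ 2) = (R + q k x) * (q k x * (R - q k x)) := by ring
  have h6 : 0 ≤ q k x * (R - q k x) := mul_nonneg h4 (by linarith)
  rw [h5, abs_of_nonneg (mul_nonneg (by linarith) h6)]
  exact mul_le_mul_of_nonneg_right (by linarith) h6

lemma abs_pow_four_sub_le (h : Frame β c B l σ e q q' G φ φ') (x : ℝ) :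
    |(∑ j, q j x) ^ 4 - ∑ k, q k x ^ 4| ≤
      3 * (N * B) ^ 2 * ∑ k, q k x * ((∑ j, q j x) - q k x) := by
  have e1 : (∑ j, q j x) ^ 4 - ∑ k, q k x ^ 4 =
      ∑ k, q k x * ((∑ j, q j x) ^ 3 - q k x ^ 3) := by
    simp only [mul_sub, Finset.sum_sub_distrib, ← Finset.sum_mul]
    congr 1
    · ring
    · exact Finset.sum_congr rfl fun k _ => by ring
  rw [e1, Finset.mul_sum]
  refine (Finset.abs_sum_le_sum_abs _ _).trans (Finset.sum_le_sum fun k _ => ?_)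
  have h2 := h.le_sum k x
  have h3 := h.sum_le x
  have h4 := h.pos k x
  have hB := h.B_nonneg
  generalize (∑ j, q j x) = R at *
  have h5 : q k x * (R ^ 3 - q k x ^ 3) = (R ^ 2 + R * q k x + q k x ^ 2) * (q k x * (R - q k x)) := by
    ring
  have h6 : 0 ≤ q k x * (R - q k x) := mul_nonneg h4 (by linarith)
  have h7 : 0 ≤ R := h4.trans h2
  rw [h5, abs_of_nonneg (mul_nonneg (by positivity) h6)]
  refine mul_le_mul_of_nonneg_right ?_ h6
  have h8 : R ^ 2 ≤ (N * B) ^ 2 := pow_le_pow_left₀ h7 h3 2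
  have h9 : R * q k x ≤ R ^ 2 := by rw [_root_.sq]; exact mul_le_mul_of_nonneg_left h2 h7
  have h10 : q k x ^ 2 ≤ R ^ 2 := pow_le_pow_left₀ h4 h2 2
  linarith

lemma dec_sum_G (h : Frame β c B l σ e q q' G φ φ') : Dec fun x => ∑ k, G k x :=
  Dec.sum _ fun k _ => h.G_dec k

lemma integral_sum_G_le (h : Frame β c B l σ e q q' G φ φ') : ∫ x, ∑ k, G k x ≤ N * B := by
  rw [integral_finsetSum _ fun k _ => (h.G_dec k).integrable]
  simpa using Finset.sum_le_card_nsmul Finset.univ (fun k => ∫ x, G k x) B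
    fun k _ => h.integral_G k

lemma abs_energyDensity_sub_le (h : Frame β c B l σ e q q' G φ φ') (hβ : 0 < β) {u v η x : ℝ}
    (hu : |u| ≤ η) (hη : η ≤ 1) :
    |energyDensity β ((∑ k, q k x) + u) ((∑ k, q' k x) + v) -
      ((∑ k, energyDensity β (q k x) (q' k x)) + ((∑ k, q' k x) * v +
        (∑ k, (c k * q k x - q k x ^ 2 + β * q k x ^ 3)) * u) - (∑ k, c k * q k x) * u +
        (1 / 2) * (v ^ 2 - (2 * (∑ k, q k x) - 3 * β * (∑ k, q k x) ^ 2) * u ^ 2))| ≤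
    ((B ^ 2 + 2 * (N * B) + β * (3 * (N * B) ^ 2) + (1 + β * (2 * (N * B)))) * N * e) *
      (∑ k, G k x) + (1 + β * (N * B) + β) * η * u ^ 2 := by
  have h1 := abs_le.1 (h.abs_deriv_sq_sub_le x)
  have h2 := abs_le.1 (h.abs_cube_sub_le x)
  have h3 := abs_le.1 (h.abs_pow_four_sub_le x)
  have h4 := sq_sub_sum_sq q x
  have h5 := h.sum_mul_sub_le x
  have h6 := h.sum_mul_sub_nonneg x
  have h7 := h.sum_le x
  have h8 := h.sum_nonneg x
  have hB := h.B_nonneg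
  have he1 : ∑ k, energyDensity β (q k x) (q' k x) = (1 / 2) * (∑ k, q' k x ^ 2) -
      (1 / 3) * (∑ k, q k x ^ 3) + (β / 4) * ∑ k, q k x ^ 4 := by
    simp only [energyDensity, Finset.sum_add_distrib, Finset.sum_sub_distrib, ← Finset.mul_sum]
  have he2 : ∑ k, (c k * q k x - q k x ^ 2 + β * q k x ^ 3) = (∑ k, c k * q k x) -
      (∑ k, q k x ^ 2) + β * ∑ k, q k x ^ 3 := by
    simp only [Finset.sum_add_distrib, Finset.sum_sub_distrib, ← Finset.mul_sum]
  rw [he1, he2]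
  have hM : 0 ≤ N * B := by positivity
  rw [show (B ^ 2 + 2 * (N * B) + β * (3 * (N * B) ^ 2) + (1 + β * (2 * (N * B)))) * N * e *
    (∑ k, G k x) = (B ^ 2 + 2 * (N * B) + β * (3 * (N * B) ^ 2) + (1 + β * (2 * (N * B)))) *
    (N * e * ∑ k, G k x) by ring]
  generalize (∑ k, q k x * ((∑ j, q j x) - q k x)) = P at *
  generalize (N * e * ∑ k, G k x) = Γ at *
  generalize (∑ k, c k * q k x) = L
  generalize (∑ k, q k x ^ 2) = R₂ at *
  generalize (∑ k, q k x ^ 3) = R₃ at *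
  generalize (∑ k, q k x ^ 4) = R₄ at *
  generalize (∑ k, q' k x ^ 2) = T₂ at *
  generalize (∑ k, q' k x) = T at *
  generalize (∑ k, q k x) = R at *
  generalize (N * B : ℝ) = M at *
  have e1 : energyDensity β (R + u) (T + v) - ((1 / 2) * T₂ - (1 / 3) * R₃ + (β / 4) * R₄ +
      (T * v + (L - R₂ + β * R₃) * u) - L * u + (1 / 2) * (v ^ 2 - (2 * R - 3 * β * R ^ 2) * u ^ 2)) =
      ((1 / 2) * (T ^ 2 - T₂) - (1 / 3) * (R ^ 3 - R₃) + (β / 4) * (R ^ 4 - R₄)) +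
      (-(R ^ 2 - R₂) + β * (R ^ 3 - R₃)) * u + (-(1 / 3) + β * R + (β / 4) * u) * u * u ^ 2 := by
    unfold energyDensity; ring
  rw [e1, h4]
  have hb : β * (R ^ 4 - R₄) ≤ β * (3 * M ^ 2 * P) ∧ -(β * (3 * M ^ 2 * P)) ≤ β * (R ^ 4 - R₄) :=
    ⟨mul_le_mul_of_nonneg_left h3.2 hβ.le, by
      have := mul_le_mul_of_nonneg_left h3.1 hβ.le; linarith⟩
  have hb3 : β * (R ^ 3 - R₃) ≤ β * (2 * M * P) ∧ -(β * (2 * M * P)) ≤ β * (R ^ 3 - R₃) :=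
    ⟨mul_le_mul_of_nonneg_left h2.2 hβ.le, by
      have := mul_le_mul_of_nonneg_left h2.1 hβ.le; linarith⟩
  have hMP : 0 ≤ M * P := mul_nonneg hM h6
  have hBP : 0 ≤ B ^ 2 * P := mul_nonneg (sq_nonneg B) h6
  have hβMP : 0 ≤ β * (2 * M * P) := by positivity
  have hβMP2 : 0 ≤ β * (3 * M ^ 2 * P) := by positivity
  have a1 : |(1 / 2) * (T ^ 2 - T₂) - (1 / 3) * (R ^ 3 - R₃) + (β / 4) * (R ^ 4 - R₄)| ≤
      B ^ 2 * P + 2 * M * P + β * (3 * M ^ 2 * P) := by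
    rw [abs_le]; constructor <;> linarith [h1.1, h1.2, h2.1, h2.2, hb.1, hb.2]
  have a2 : |(-P + β * (R ^ 3 - R₃)) * u| ≤ (P + β * (2 * M * P)) * 1 := by
    rw [abs_mul]
    refine mul_le_mul ?_ (hu.trans hη) (abs_nonneg _) (by positivity)
    rw [abs_le]; constructor <;> linarith [hb3.1, hb3.2]
  have a3 : |(-(1 / 3) + β * R + (β / 4) * u) * u * u ^ 2| ≤ (1 + β * M + β) * η * u ^ 2 := by
    rw [abs_mul, abs_of_nonneg (sq_nonneg u), abs_mul]
    refine mul_le_mul_of_nonneg_right (mul_le_mul ?_ hu (abs_nonneg _) (by positivity)) (sq_nonneg u)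
    have h9 := abs_le.1 (hu.trans hη)
    have h10 := mul_le_mul_of_nonneg_left h7 hβ.le
    have h11 : 0 ≤ β * R := by positivity
    have h12 := mul_le_mul_of_nonneg_left h9.1 hβ.le
    have h13 := mul_le_mul_of_nonneg_left h9.2 hβ.le
    rw [abs_le]; constructor <;> linarith
  refine (abs_add_le _ _).trans (add_le_add ((abs_add_le _ _).trans ((add_le_add a1 a2).trans ?_)) a3)
  have := mul_le_mul_of_nonneg_left h5
    (by positivity : 0 ≤ B ^ 2 + 2 * M + β * (3 * M ^ 2) + (1 + β * (2 * M)))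
  linarith

lemma dec_form (h : Frame β c B l σ e q q' G φ φ') {ε ε' : ℝ → ℝ} (hε : Dec ε) (hε' : Dec ε') :
    Dec fun x => ε' x ^ 2 - (2 * (∑ j, q j x) - 3 * β * (∑ j, q j x) ^ 2) * ε x ^ 2 := by
  have hSq : Dec fun x => ∑ j, q j x := Dec.sum _ fun j _ => h.dec j
  exact hε'.sq.sub (((hSq.const_mul 2).sub (hSq.sq.const_mul (3 * β))).mul hε.sq)

lemma abs_energy_sub_le (h : Frame β c B l σ e q q' G φ φ') (hβ : 0 < β) {ε ε' : ℝ → ℝ} {η : ℝ}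
    (hd : ∀ x, HasDerivAt ε (ε' x) x) (hε : Dec ε) (hε' : Dec ε') (hη : ∀ x, |ε x| ≤ η)
    (hη1 : η ≤ 1) :
    |(∫ x, energyDensity β ((∑ k, q k x) + ε x) ((∑ k, q' k x) + ε' x)) -
      ((∑ k, ∫ x, energyDensity β (q k x) (q' k x)) - (∑ k, c k * ∫ x, ε x * q k x) +
        (1 / 2) * ∫ x, (ε' x ^ 2 - (2 * (∑ k, q k x) - 3 * β * (∑ k, q k x) ^ 2) * ε x ^ 2))| ≤
    ((B ^ 2 + 2 * (N * B) + β * (3 * (N * B) ^ 2) + (1 + β * (2 * (N * B)))) * N * (N * B)) * e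
      + (1 + β * (N * B) + β) * η * ∫ x, ε x ^ 2 := by
  have hB := h.B_nonneg
  have he := h.e_nonneg
  have hq : Dec fun x => ∑ k, q k x := Dec.sum _ fun k _ => h.dec k
  have hq' : Dec fun x => ∑ k, q' k x := Dec.sum _ fun k _ => h.dec' k
  have hcq : Dec fun x => ∑ k, c k * q k x := Dec.sum _ fun k _ => (h.dec k).const_mul _
  have hq2 : Dec fun x => ∑ k, (c k * q k x - q k x ^ 2 + β * q k x ^ 3) := Dec.sum _ fun k _ =>
    (((h.dec k).const_mul _).sub (h.dec k).sq).add ((h.dec k).cube.const_mul _)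
  have d1 := Dec.sum Finset.univ fun k _ => (h.dec k).energyDensity (β := β) (h.dec' k)
  have d2 := (hq'.mul hε').add (hq2.mul hε)
  have d3 := hcq.mul hε
  have d4 := (h.dec_form hε hε').const_mul (1 / 2)
  have hint : ∫ x, ((∑ k, q' k x) * ε' x +
      (∑ k, (c k * q k x - q k x ^ 2 + β * q k x ^ 3)) * ε x) = 0 := by
    refine integral_deriv_eq_zero (f := fun x => (∑ k, q' k x) * ε x) (fun x => ?_)
      (hq'.mul hε) d2
    have h1 : HasDerivAt (fun x => ∑ k, q' k x)
        (∑ k, (c k * q k x - q k x ^ 2 + β * q k x ^ 3)) x :=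
      HasDerivAt.fun_sum fun k _ => h.d1 k x
    exact (h1.fun_mul (hd x)).congr_deriv (by ring)
  have hlin : ∫ x, (∑ k, c k * q k x) * ε x = ∑ k, c k * ∫ x, ε x * q k x := by
    simp only [← integral_const_mul]
    rw [← integral_finsetSum _ fun k _ => ((hε.mul (h.dec k)).const_mul _).integrable]
    refine integral_congr_ae (Eventually.of_forall fun x => ?_)
    simp only [Finset.sum_mul]
    exact Finset.sum_congr rfl fun k _ => by ring
  have key := abs_integral_sub_le ((hq.add hε).energyDensity (β := β) (hq'.add hε'))
    (((d1.add d2).sub d3).add d4)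
    ((h.dec_sum_G.const_mul ((B ^ 2 + 2 * (N * B) + β * (3 * (N * B) ^ 2) +
      (1 + β * (2 * (N * B)))) * N * e)).add (hε.sq.const_mul ((1 + β * (N * B) + β) * η)))
    fun x => h.abs_energyDensity_sub_le hβ (v := ε' x) (hη x) hη1
  rw [integral_add ((d1.add d2).sub d3).integrable d4.integrable,
    integral_sub (d1.add d2).integrable d3.integrable, integral_add d1.integrable d2.integrable,
    hint, hlin, integral_finsetSum _ fun k _ => ((h.dec k).energyDensity (h.dec' k)).integrable,
    integral_const_mul, integral_add (h.dec_sum_G.const_mul _).integrable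
      (hε.sq.const_mul _).integrable, integral_const_mul, integral_const_mul, add_zero] at key
  refine key.trans (add_le_add ?_ le_rfl)
  have := mul_le_mul_of_nonneg_left h.integral_sum_G_le (by positivity :
    0 ≤ (B ^ 2 + 2 * (N * B) + β * (3 * (N * B) ^ 2) + (1 + β * (2 * (N * B)))) * N * e)
  linarith

end Frame

namespace Frame

variable {N : ℕ} {β B l σ e : ℝ} {c : Fin N → ℝ} {q q' G φ φ' : Fin N → ℝ → ℝ}

lemma dec_weight_mul (h : Frame β c B l σ e q q' G φ φ') (s : Finset (Fin N)) {f : ℝ → ℝ}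
    (hf : Dec f) : Dec fun x => (∑ k ∈ s, φ k x) * f x := by
  have : Dec fun x => ∑ k ∈ s, φ k x * f x := Dec.sum _ fun k _ =>
    hf.bounded_mul (h.cont_φ k) (B := 1) fun x => by
      rw [abs_of_pos (h.φ_pos k x)]; exact h.φ_le_one k x
  simpa only [Finset.sum_mul] using this

lemma abs_weight_sub_mul_le (h : Frame β c B l σ e q q' G φ φ') (s : Finset (Fin N)) (k : Fin N)
    (x : ℝ) : |((∑ j ∈ s, φ j x) - if k ∈ s then 1 else 0) * q k x| ≤ N * e * G k x := by
  have h1 := h.one_sub_φ_mul_le k x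
  have h2 := h.pos k x
  have h3 := h.φ_sum x
  have h4 : ∀ j, 0 ≤ φ j x := fun j => (h.φ_pos j x).le
  rw [abs_mul, abs_of_nonneg h2]
  refine le_trans (mul_le_mul_of_nonneg_right ?_ h2) h1
  have h5 : ∑ j ∈ s, φ j x ≤ 1 := by
    rw [← h3]
    exact Finset.sum_le_sum_of_subset_of_nonneg (Finset.subset_univ _) fun j _ _ => h4 j
  split_ifs with hk
  · have h6 := Finset.single_le_sum (f := fun j => φ j x) (fun j _ => h4 j) hk
    rw [abs_le]; constructor <;> linarith
  · have h6 : ∑ j ∈ s, φ j x ≤ ∑ j ∈ Finset.univ.erase k, φ j x :=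
      Finset.sum_le_sum_of_subset_of_nonneg (fun j hj => Finset.mem_erase.2
        ⟨fun hjk => hk (hjk ▸ hj), Finset.mem_univ _⟩) fun j _ _ => h4 j
    have h7 : 0 ≤ ∑ j ∈ s, φ j x := Finset.sum_nonneg fun j _ => h4 j
    rw [h.one_sub_φ, sub_zero, abs_of_nonneg h7]
    exact h6

lemma abs_weighted_mass_sub_le (h : Frame β c B l σ e q q' G φ φ') (s : Finset (Fin N))
    {ε : ℝ → ℝ} (hε : Dec ε) (hη : ∀ x, |ε x| ≤ 1) :
    |(∫ x, (∑ k ∈ s, φ k x) * ((∑ k, q k x) + ε x) ^ 2) -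
      (∑ k ∈ s, ((∫ x, q k x ^ 2) + 2 * ∫ x, ε x * q k x) +
        ∫ x, (∑ k ∈ s, φ k x) * ε x ^ 2)| ≤ ((3 + B) * N * (N * B)) * e := by
  have hB := h.B_nonneg
  have he := h.e_nonneg
  have hq : Dec fun x => ∑ k, q k x := Dec.sum _ fun k _ => h.dec k
  have d0 : ∀ k, Dec fun x => q k x ^ 2 + 2 * (ε x * q k x) := fun k =>
    (h.dec k).sq.add ((hε.mul (h.dec k)).const_mul 2)
  have d1 : Dec fun x => ∑ k ∈ s, (q k x ^ 2 + 2 * (ε x * q k x)) := Dec.sum _ fun k _ => d0 k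
  have d2 := h.dec_weight_mul s hε.sq
  have key := abs_integral_sub_le (h.dec_weight_mul s (hq.add hε).sq) (d1.add d2)
    (h.dec_sum_G.const_mul ((3 + B) * N * e)) fun x => by
      have h1 := h.abs_weight_sub_mul_le s
      have h2 := h.sum_mul_sub_le x
      have h3 := h.sum_mul_sub_nonneg x
      have h4 := sq_sub_sum_sq q x
      have h5 : ∑ k ∈ s, φ k x ≤ 1 := by
        rw [← h.φ_sum x]
        exact Finset.sum_le_sum_of_subset_of_nonneg (Finset.subset_univ _)
          fun j _ _ => (h.φ_pos j x).le
      have h6 : 0 ≤ ∑ k ∈ s, φ k x := Finset.sum_nonneg fun j _ => (h.φ_pos j x).le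
      have e2 : ∑ k ∈ s, (q k x ^ 2 + 2 * (ε x * q k x)) =
          ∑ k, (if k ∈ s then (1:ℝ) else 0) * (q k x ^ 2 + 2 * (ε x * q k x)) := by
        simp only [ite_mul, one_mul, zero_mul, Finset.sum_ite_mem, Finset.univ_inter]
      have e3 : (∑ k ∈ s, φ k x) * ((∑ k, q k x) + ε x) ^ 2 -
          (∑ k ∈ s, (q k x ^ 2 + 2 * (ε x * q k x)) + (∑ k ∈ s, φ k x) * ε x ^ 2) =
          (∑ k ∈ s, φ k x) * (∑ k, q k x * ((∑ j, q j x) - q k x)) +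
          ∑ k, (((∑ j ∈ s, φ j x) - if k ∈ s then 1 else 0) * q k x) * (q k x + 2 * ε x) := by
        have e4 : ∀ k, (((∑ j ∈ s, φ j x) - if k ∈ s then 1 else 0) * q k x) * (q k x + 2 * ε x) =
          (∑ j ∈ s, φ j x) * q k x ^ 2 + (∑ j ∈ s, φ j x) * (2 * ε x) * q k x -
          (if k ∈ s then (1:ℝ) else 0) * (q k x ^ 2 + 2 * (ε x * q k x)) := fun k => by ring
        have e6 : ∑ k, (((∑ j ∈ s, φ j x) - if k ∈ s then 1 else 0) * q k x) * (q k x + 2 * ε x) =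
            (∑ j ∈ s, φ j x) * (∑ k, q k x ^ 2) + (∑ j ∈ s, φ j x) * (2 * ε x) * (∑ k, q k x) -
            ∑ k ∈ s, (q k x ^ 2 + 2 * (ε x * q k x)) := by
          rw [Finset.sum_congr rfl fun k _ => e4 k, Finset.sum_sub_distrib, ← e2,
            Finset.sum_add_distrib, ← Finset.mul_sum, ← Finset.mul_sum]
        rw [e6, ← h4]
        ring
      rw [e3]
      have h7 : |∑ k, (((∑ j ∈ s, φ j x) - if k ∈ s then 1 else 0) * q k x) * (q k x + 2 * ε x)| ≤
          (2 + B) * (N * e * ∑ k, G k x) := by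
        rw [Finset.mul_sum, Finset.mul_sum]
        refine (Finset.abs_sum_le_sum_abs _ _).trans (Finset.sum_le_sum fun k _ => ?_)
        rw [abs_mul, mul_comm (2 + B)]
        refine mul_le_mul (h1 k x) ?_ (abs_nonneg _)
          (mul_nonneg (by positivity) (h.G_nonneg k x))
        have := abs_le.1 (hη x)
        have := h.pos k x
        have := h.le k x
        rw [abs_le]; constructor <;> linarith
      have h8 : |(∑ k ∈ s, φ k x) * (∑ k, q k x * ((∑ j, q j x) - q k x))| ≤
          1 * (N * e * ∑ k, G k x) := by
        rw [abs_mul, abs_of_nonneg h6, abs_of_nonneg h3]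
        exact mul_le_mul h5 h2 h3 zero_le_one
      refine (abs_add_le _ _).trans ((add_le_add h8 h7).trans (le_of_eq ?_))
      ring
  have e5 : ∫ x, ∑ k ∈ s, (q k x ^ 2 + 2 * (ε x * q k x)) =
      ∑ k ∈ s, ((∫ x, q k x ^ 2) + 2 * ∫ x, ε x * q k x) := by
    rw [integral_finsetSum _ fun k _ => (d0 k).integrable]
    refine Finset.sum_congr rfl fun k _ => ?_
    rw [integral_add (h.dec k).sq.integrable ((hε.mul (h.dec k)).const_mul 2).integrable,
      integral_const_mul]
  rw [integral_add d1.integrable d2.integrable, e5, integral_const_mul] at key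
  refine key.trans ?_
  have := mul_le_mul_of_nonneg_left h.integral_sum_G_le (by positivity : 0 ≤ (3 + B) * N * e)
  linarith

end Frame

section Combine

variable {N : ℕ} {c w a b P a₀ P₀ M I I₀ : Fin N → ℝ} {κ K e α η E E' F F₀ m : ℝ}

lemma sum_mul_sum_Ici (hcw : ∀ k, c k = ∑ j ∈ Finset.Iic k, w j) (a : Fin N → ℝ) :
    ∑ j, w j * ∑ k ∈ Finset.Ici j, a k = ∑ k, c k * a k := by
  simp only [hcw, Finset.sum_mul, Finset.mul_sum]
  exact Finset.sum_comm' fun j k => by simp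

lemma abs_le_of_abs_sum_Ici_le {T : ℝ} (hT : ∀ j, |∑ k ∈ Finset.Ici j, a k| ≤ T) (k : Fin N) :
    |a k| ≤ 2 * T := by
  have h0 : 0 ≤ T := (abs_nonneg _).trans (hT k)
  have h1 : a k = (∑ i ∈ Finset.Ici k, a i) - ∑ i ∈ Finset.Ioi k, a i := by
    have h : Finset.Ici k = insert k (Finset.Ioi k) := by ext i; simp [le_iff_eq_or_lt]
    rw [h, Finset.sum_insert (by simp)]
    ring
  have h2 : |∑ i ∈ Finset.Ioi k, a i| ≤ T := by
    by_cases hk : (k : ℕ) + 1 < N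
    · have h : Finset.Ioi k = Finset.Ici ⟨k + 1, hk⟩ := by
        ext i
        rw [Finset.mem_Ioi, Finset.mem_Ici, ← Fin.val_fin_lt, ← Fin.val_fin_le]
        exact Nat.lt_iff_add_one_le
      rw [h]
      exact hT _
    · have h : Finset.Ioi k = ∅ := by
        ext i
        have := i.2
        rw [Finset.mem_Ioi, ← Fin.val_fin_lt]
        simp only [Finset.notMem_empty, iff_false]
        omega
      simpa [h] using h0
  rw [h1]
  exact (abs_sub _ _).trans (by linarith [hT k])

lemma abs_sum_le_of_forall {s : Finset (Fin N)} {T : ℝ} (h : ∀ k, |a k| ≤ T) :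
    |∑ k ∈ s, a k| ≤ N * T := by
  refine (Finset.abs_sum_le_sum_abs _ _).trans ?_
  calc _ ≤ ∑ k, |a k| := Finset.sum_le_sum_of_subset_of_nonneg (Finset.subset_univ _)
        fun _ _ _ => abs_nonneg _
    _ ≤ N * T := by
        simpa using Finset.sum_le_card_nsmul Finset.univ (fun k => |a k|) T fun k _ => h k

lemma abs_sum_mul_le_of_forall {T : ℝ} (hc : ∀ k, 0 ≤ c k) (h : ∀ k, |a k| ≤ T) :
    |∑ k, c k * a k| ≤ (∑ k, c k) * T := by
  rw [Finset.sum_mul]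
  refine (Finset.abs_sum_le_sum_abs _ _).trans (Finset.sum_le_sum fun k _ => ?_)
  rw [abs_mul, abs_of_nonneg (hc k)]
  exact mul_le_mul_of_nonneg_left (h k) (hc k)

/-- Energy conservation and almost monotonicity of the localized masses control the deviations. -/
structure LyapunovData (w c : Fin N → ℝ) (κ K e α η : ℝ) (a b P a₀ P₀ M I I₀ : Fin N → ℝ)
    (E E' F F₀ m : ℝ) : Prop where
  e_nonneg : 0 ≤ e
  e_le : e ≤ 1
  α_nonneg : 0 ≤ α
  α_le : α ≤ 1
  η_nonneg : 0 ≤ η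
  η_le : η ≤ 1
  energy₀ : |E - (E' - (∑ k, c k * a₀ k) + (1 / 2) * F₀)| ≤ K * (e + α ^ 2)
  energy : |E - (E' - (∑ k, c k * a k) + (1 / 2) * F)| ≤ K * (e + η ^ 3)
  mass₀ : ∀ j, |I₀ j - (M j + 2 * (∑ k ∈ Finset.Ici j, a₀ k) + P₀ j)| ≤ K * e
  mass : ∀ j, |I j - (M j + 2 * (∑ k ∈ Finset.Ici j, a k) + P j)| ≤ K * e
  mono : ∀ j, I j ≤ I₀ j + K * e
  P_nonneg : ∀ j, 0 ≤ P j
  P₀_le : ∀ j, P₀ j ≤ α ^ 2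
  F₀_le : |F₀| ≤ K * α ^ 2
  F_le : |F| ≤ K * η ^ 2
  a₀_le : ∀ k, |a₀ k| ≤ K * α
  coercive : κ * m ≤ (F + ∑ j, w j * P j) + K * ∑ k, (a k ^ 2 + b k ^ 2)

namespace LyapunovData

lemma form_le (h : LyapunovData w c κ K e α η a b P a₀ P₀ M I I₀ E E' F F₀ m) (hK : 0 ≤ K)
    (hw : ∀ j, 0 < w j) (hcw : ∀ k, c k = ∑ j ∈ Finset.Iic k, w j) :
    F + ∑ j, w j * P j ≤ (5 * K + (1 + 3 * K) * ∑ j, w j) * (α ^ 2 + e + η ^ 3) := by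
  have he := h.e_nonneg
  have hα := h.α_nonneg
  have hη := h.η_nonneg
  have h1 : ∑ j, w j * P j ≤
      (∑ j, w j * (2 * ∑ k ∈ Finset.Ici j, a₀ k)) - (∑ j, w j * (2 * ∑ k ∈ Finset.Ici j, a k)) +
        (∑ j, w j) * (α ^ 2 + 3 * (K * e)) := by
    rw [Finset.sum_mul, ← Finset.sum_sub_distrib, ← Finset.sum_add_distrib]
    refine Finset.sum_le_sum fun j _ => ?_
    rw [← mul_sub, ← mul_add]
    refine mul_le_mul_of_nonneg_left ?_ (hw j).le
    have h2 := abs_le.1 (h.mass₀ j)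
    have h3 := abs_le.1 (h.mass j)
    linarith [h.mono j, h.P₀_le j, h2.1, h2.2, h3.1, h3.2]
  have h4 : ∀ a : Fin N → ℝ, ∑ j, w j * (2 * ∑ k ∈ Finset.Ici j, a k) = 2 * ∑ k, c k * a k :=
    fun a => by
      rw [← sum_mul_sum_Ici hcw, Finset.mul_sum]
      exact Finset.sum_congr rfl fun j _ => by ring
  rw [h4, h4] at h1
  have h5 := abs_le.1 h.energy₀
  have h6 := abs_le.1 h.energy
  have h7 := abs_le.1 h.F₀_le
  have hW : 0 ≤ ∑ j, w j := Finset.sum_nonneg fun j _ => (hw j).le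
  have e1 : (5 * K + (1 + 3 * K) * ∑ j, w j) * (α ^ 2 + e + η ^ 3) =
    5 * K * α ^ 2 + 5 * K * e + 5 * K * η ^ 3 + (∑ j, w j) * α ^ 2 + 3 * ((∑ j, w j) * (K * e)) +
    ((∑ j, w j) * e + (∑ j, w j) * η ^ 3 + 3 * K * (∑ j, w j) * (α ^ 2 + η ^ 3)) := by ring
  have h8 : 0 ≤ (∑ j, w j) * e + (∑ j, w j) * η ^ 3 + 3 * K * (∑ j, w j) * (α ^ 2 + η ^ 3) := by
    positivity
  have h9 : 0 ≤ K * e := by positivity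
  have h10 : 0 ≤ K * α ^ 2 := by positivity
  have h11 : 0 ≤ K * η ^ 3 := by positivity
  rw [e1]
  linarith [h5.1, h5.2, h6.1, h6.2, h7.1, h7.2]

lemma abs_le (h : LyapunovData w c κ K e α η a b P a₀ P₀ M I I₀ E E' F F₀ m) (hK : 0 ≤ K)
    (hw : ∀ j, 0 < w j) (hcw : ∀ k, c k = ∑ j ∈ Finset.Iic k, w j) (k : Fin N) :
    |a k| ≤ 2 * ((1 + N * K + 2 * K + (∑ j, (w j)⁻¹) * ((∑ k, c k) * K + 4 * K +
      (∑ j, w j) * (1 + N * K + 2 * K))) * (α + e + η ^ 2)) := by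
  have he := h.e_nonneg
  have hα := h.α_nonneg
  have hη := h.η_nonneg
  have hη3 : η ^ 3 ≤ η ^ 2 := pow_le_pow_of_le_one hη h.η_le (by norm_num)
  have hα2 : α ^ 2 ≤ α := by nlinarith [h.α_le]
  have hc : ∀ k, 0 ≤ c k := fun k => by
    rw [hcw]; exact Finset.sum_nonneg fun j _ => (hw j).le
  have hW : 0 ≤ ∑ j, w j := Finset.sum_nonneg fun j _ => (hw j).le
  have hC : 0 ≤ ∑ j, c j := Finset.sum_nonneg fun j _ => hc j
  have hΩ : 0 ≤ ∑ j, (w j)⁻¹ := Finset.sum_nonneg fun j _ => (inv_pos.2 (hw j)).le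
  set X := α + e + η ^ 2 with hX
  have hX0 : 0 ≤ X := by positivity
  set U := (1 + N * K + 2 * K) * X with hU
  have hU0 : 0 ≤ U := by positivity
  have h1 : ∀ j, ∑ k ∈ Finset.Ici j, a k ≤ U := fun j => by
    have h2 := _root_.abs_le.1 (h.mass₀ j)
    have h3 := _root_.abs_le.1 (h.mass j)
    have h4 := _root_.abs_le.1 (abs_sum_le_of_forall (s := Finset.Ici j) h.a₀_le)
    have h5 : U = α + e + η ^ 2 + N * (K * α) + N * K * (e + η ^ 2) + 2 * (K * e) +
      2 * (K * (α + η ^ 2)) := by rw [hU, hX]; ring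
    have h6 : 0 ≤ N * K * (e + η ^ 2) := by positivity
    have h7 : 0 ≤ 2 * (K * (α + η ^ 2)) := by positivity
    have h8 : 0 ≤ K * e := by positivity
    have h9 : 0 ≤ η ^ 2 := by positivity
    linarith [h.mono j, h.P₀_le j, h.P_nonneg j, h2.1, h2.2, h3.1, h3.2, h4.1, h4.2]
  have h2 : -(((∑ k, c k) * K + 4 * K) * X) ≤ ∑ j, w j * ∑ k ∈ Finset.Ici j, a k := by
    rw [sum_mul_sum_Ici hcw]
    have h5 := _root_.abs_le.1 h.energy₀
    have h6 := _root_.abs_le.1 h.energy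
    have h7 := _root_.abs_le.1 h.F₀_le
    have h8 := _root_.abs_le.1 h.F_le
    have h9 := _root_.abs_le.1 (abs_sum_mul_le_of_forall hc h.a₀_le)
    have e1 : ((∑ k, c k) * K + 4 * K) * X = (∑ k, c k) * (K * α) + 4 * (K * α) + 4 * (K * e) +
      4 * (K * η ^ 2) + (∑ k, c k) * K * (e + η ^ 2) := by rw [hX]; ring
    have h10 : 0 ≤ (∑ k, c k) * K * (e + η ^ 2) := by positivity
    have h11 := mul_le_mul_of_nonneg_left hη3 hK
    have h12 := mul_le_mul_of_nonneg_left hα2 hK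
    have h13 : 0 ≤ K * e := by positivity
    have h14 : 0 ≤ K * α := by positivity
    have h15 : 0 ≤ K * η ^ 2 := by positivity
    linarith [h5.1, h5.2, h6.1, h6.2, h7.1, h7.2, h8.1, h8.2, h9.1, h9.2]
  refine abs_le_of_abs_sum_Ici_le (fun j => ?_) k
  have h3 : ∑ i ∈ Finset.univ.erase j, w i * ∑ k ∈ Finset.Ici i, a k ≤ (∑ i, w i) * U := by
    rw [Finset.sum_mul]
    calc _ ≤ ∑ i ∈ Finset.univ.erase j, w i * U := Finset.sum_le_sum fun i _ =>
          mul_le_mul_of_nonneg_left (h1 i) (hw i).le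
      _ ≤ _ := Finset.sum_le_sum_of_subset_of_nonneg (Finset.subset_univ _) fun i _ _ =>
          mul_nonneg (hw i).le hU0
  rw [← Finset.add_sum_erase _ (fun i => w i * ∑ k ∈ Finset.Ici i, a k) (Finset.mem_univ j)] at h2
  set V := ((∑ k, c k) * K + 4 * K) * X + (∑ i, w i) * U with hV
  have hV0 : 0 ≤ V := by positivity
  have h4 : -V ≤ w j * ∑ k ∈ Finset.Ici j, a k := by linarith
  have h5 : (w j)⁻¹ ≤ ∑ i, (w i)⁻¹ :=
    Finset.single_le_sum (f := fun i => (w i)⁻¹) (fun i _ => (inv_pos.2 (hw i)).le) (Finset.mem_univ j)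
  have h6 : -((∑ i, (w i)⁻¹) * V) ≤ ∑ k ∈ Finset.Ici j, a k := by
    have h7 := mul_le_mul_of_nonneg_left h4 (inv_pos.2 (hw j)).le
    rw [inv_mul_cancel_left₀ (hw j).ne'] at h7
    have h8 := mul_le_mul_of_nonneg_right h5 hV0
    linarith
  have e2 : (1 + N * K + 2 * K + (∑ j, (w j)⁻¹) * ((∑ k, c k) * K + 4 * K +
      (∑ j, w j) * (1 + N * K + 2 * K))) * X = U + (∑ i, (w i)⁻¹) * V := by rw [hV, hU]; ring
  have h9 : 0 ≤ (∑ i, (w i)⁻¹) * V := by positivity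
  rw [e2, _root_.abs_le]
  constructor
  · linarith
  · linarith [h1 j]

end LyapunovData

lemma exists_lyapunov_bound (w c : Fin N → ℝ) (hw : ∀ j, 0 < w j)
    (hcw : ∀ k, c k = ∑ j ∈ Finset.Iic k, w j) (hκ : 0 < κ) (hK : 0 ≤ K) :
    ∃ C, 0 ≤ C ∧ ∀ e α η a b P a₀ P₀ M I I₀ E E' F F₀ m,
      LyapunovData w c κ K e α η a b P a₀ P₀ M I I₀ E E' F F₀ m →
      m ≤ C * (α ^ 2 + e + η ^ 3 + ∑ k, b k ^ 2) := by
  have hc : ∀ k, 0 ≤ c k := fun k => by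
    rw [hcw]; exact Finset.sum_nonneg fun j _ => (hw j).le
  have hW : 0 ≤ ∑ j, w j := Finset.sum_nonneg fun j _ => (hw j).le
  have hC : 0 ≤ ∑ j, c j := Finset.sum_nonneg fun j _ => hc j
  have hΩ : 0 ≤ ∑ j, (w j)⁻¹ := Finset.sum_nonneg fun j _ => (inv_pos.2 (hw j)).le
  set C₁ := 5 * K + (1 + 3 * K) * ∑ j, w j with hC₁
  have hC₁0 : 0 ≤ C₁ := by positivity
  set C₂ := 1 + N * K + 2 * K + (∑ j, (w j)⁻¹) * ((∑ k, c k) * K + 4 * K +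
      (∑ j, w j) * (1 + N * K + 2 * K)) with hC₂
  have hC₂0 : 0 ≤ C₂ := by positivity
  refine ⟨(C₁ + K * (N * (4 * C₂ ^ 2 * 3)) + K) / κ, by positivity, ?_⟩
  intro e α η a b P a₀ P₀ M I I₀ E E' F F₀ m h
  have h1 := h.form_le hK hw hcw
  have h2 := h.abs_le hK hw hcw
  rw [← hC₁] at h1
  rw [← hC₂] at h2
  have he := h.e_nonneg
  have hα := h.α_nonneg
  have hη := h.η_nonneg
  have hη1 := h.η_le
  have h3 : (α + e + η ^ 2) ^ 2 ≤ 3 * (α ^ 2 + e + η ^ 3) := by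
    have h4 : η ^ 4 ≤ η ^ 3 := pow_le_pow_of_le_one hη h.η_le (by norm_num)
    nlinarith [sq_nonneg (α - e), sq_nonneg (e - η ^ 2), sq_nonneg (α - η ^ 2), h.e_le]
  have h4 : ∑ k, a k ^ 2 ≤ N * (4 * C₂ ^ 2 * 3) * (α ^ 2 + e + η ^ 3) := by
    have h5 : ∀ k, a k ^ 2 ≤ 4 * C₂ ^ 2 * (3 * (α ^ 2 + e + η ^ 3)) := fun k => by
      calc a k ^ 2 ≤ (2 * (C₂ * (α + e + η ^ 2))) ^ 2 :=
            sq_le_sq' (neg_le_of_abs_le (h2 k)) (le_of_abs_le (h2 k))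
        _ = 4 * C₂ ^ 2 * (α + e + η ^ 2) ^ 2 := by ring
        _ ≤ _ := mul_le_mul_of_nonneg_left h3 (by positivity)
    refine (Finset.sum_le_card_nsmul Finset.univ (fun k => a k ^ 2) _ fun k _ => h5 k).trans
      (le_of_eq ?_)
    simp
    ring
  have h5 := h.coercive
  rw [Finset.sum_add_distrib] at h5
  have h6 : 0 ≤ ∑ k, b k ^ 2 := Finset.sum_nonneg fun k _ => sq_nonneg _
  rw [div_mul_eq_mul_div, le_div_iff₀ hκ]
  have h7 := mul_le_mul_of_nonneg_left h4 hK
  have h8 : 0 ≤ (C₁ + K * (N * (4 * C₂ ^ 2 * 3))) * ∑ k, b k ^ 2 := by positivity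
  have h9 : 0 ≤ K * (α ^ 2 + e + η ^ 3) := by positivity
  linarith

end Combine

namespace Frame

variable {N : ℕ} {β B l σ e : ℝ} {c w : Fin N → ℝ} {q q' G φ φ' : Fin N → ℝ → ℝ}

lemma integral_coercive_form (h : Frame β c B l σ e q q' G φ φ')
    (hcw : ∀ k, c k = ∑ j ∈ Finset.Iic k, w j) {ε ε' : ℝ → ℝ} (hε : Dec ε) (hε' : Dec ε') :
    (∫ x, (ε' x ^ 2 + ((∑ k, c k * φ k x) -
        (2 * (∑ j, q j x) - 3 * β * (∑ j, q j x) ^ 2)) * ε x ^ 2)) =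
      (∫ x, (ε' x ^ 2 - (2 * (∑ j, q j x) - 3 * β * (∑ j, q j x) ^ 2) * ε x ^ 2)) +
      ∑ j, w j * ∫ x, (∑ k ∈ Finset.Ici j, φ k x) * ε x ^ 2 := by
  have h1 : ∀ j, Dec fun x => w j * ((∑ k ∈ Finset.Ici j, φ k x) * ε x ^ 2) := fun j =>
    (h.dec_weight_mul _ hε.sq).const_mul _
  simp only [← integral_const_mul]
  rw [← integral_finsetSum _ fun j _ => (h1 j).integrable,
    ← integral_add (h.dec_form hε hε').integrable (Dec.sum _ fun j _ => h1 j).integrable]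
  refine integral_congr_ae (Eventually.of_forall fun x => ?_)
  simp only [← mul_assoc]
  rw [← Finset.sum_mul, sum_mul_sum_Ici hcw]
  ring

lemma abs_integral_form_le (h : Frame β c B l σ e q q' G φ φ') (hβ : 0 < β) {ε ε' : ℝ → ℝ}
    (hε : Dec ε) (hε' : Dec ε') :
    |∫ x, (ε' x ^ 2 - (2 * (∑ j, q j x) - 3 * β * (∑ j, q j x) ^ 2) * ε x ^ 2)| ≤
      (1 + 2 * (N * B) + 3 * β * (N * B) ^ 2) * ∫ x, (ε x ^ 2 + ε' x ^ 2) := by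
  have hB := h.B_nonneg
  rw [← integral_const_mul]
  refine abs_integral_le_integral_abs.trans (integral_mono (h.dec_form hε hε').abs.integrable
    ((hε.sq.add hε'.sq).const_mul _).integrable fun x => ?_)
  have h7 := h.sum_le x
  have h8 := h.sum_nonneg x
  have h9 := mul_le_mul_of_nonneg_left (pow_le_pow_left₀ h8 h7 2) (by positivity : 0 ≤ 3 * β)
  have h10 : 0 ≤ 3 * β * (∑ j, q j x) ^ 2 := by positivity
  have hM : 0 ≤ N * B := by positivity
  simp only
  generalize (∑ j, q j x) = R at *
  generalize (N * B : ℝ) = M at *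
  have h11 : |(2 * R - 3 * β * R ^ 2) * ε x ^ 2| ≤ (2 * M + 3 * β * M ^ 2) * ε x ^ 2 := by
    rw [abs_mul, abs_of_nonneg (sq_nonneg (ε x))]
    refine mul_le_mul_of_nonneg_right ?_ (sq_nonneg _)
    have : 0 ≤ 3 * β * M ^ 2 := by positivity
    rw [abs_le]; constructor <;> linarith
  refine (abs_sub _ _).trans ?_
  rw [abs_of_nonneg (sq_nonneg (ε' x))]
  have h12 : 0 ≤ (2 * M + 3 * β * M ^ 2) * ε' x ^ 2 := by positivity
  linarith [sq_nonneg (ε x)]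

lemma abs_integral_mul_le (h : Frame β c B l σ e q q' G φ φ') (k : Fin N) {ε : ℝ → ℝ} {α : ℝ}
    (hα : 0 ≤ α) (hε : Dec ε) (hεα : ∫ x, ε x ^ 2 ≤ α ^ 2) :
    |∫ x, ε x * q k x| ≤ (1 + B ^ 3) * α := by
  have hB := h.B_nonneg
  refine abs_le_of_sq_le_sq ?_ (by positivity)
  have h1 := sq_integral_mul_le (μ := volume) hε.sq.integrable (h.dec k).sq.integrable
    (hε.mul (h.dec k)).integrable
  have h2 := h.integral_sq_le (k := k) (D := B) (h.cont k) fun x => by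
    rw [abs_of_nonneg (h.pos k x)]; exact h.le_G k x
  have h3 : (∫ x, ε x ^ 2) * (∫ x, q k x ^ 2) ≤ α ^ 2 * (B ^ 2 * B) :=
    mul_le_mul hεα h2 (integral_nonneg fun x => sq_nonneg _) (sq_nonneg _)
  have h4 : α ^ 2 * (B ^ 2 * B) ≤ α ^ 2 * (1 + B ^ 3) ^ 2 := by
    refine mul_le_mul_of_nonneg_left ?_ (sq_nonneg _)
    nlinarith [pow_nonneg hB 3, pow_nonneg hB 6]
  linarith

lemma exists_stability_bound (hβ : 0 < β) (hB : 0 ≤ B) (hl : 0 < l) {D : ℝ} (hD : 0 ≤ D)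
    (w c : Fin N → ℝ) (hw : ∀ j, 0 < w j) (hcw : ∀ k, c k = ∑ j ∈ Finset.Iic k, w j) :
    ∃ e₀ > 0, ∃ C, 0 ≤ C ∧ ∀ (σ e : ℝ) (q q' G φ φ' p p' G₁ χ χ' : Fin N → ℝ → ℝ),
      Frame β c B l σ e q q' G φ φ' → Frame β c B l σ e p p' G₁ χ χ' → e ≤ e₀ → σ ^ 2 ≤ l →
      (∀ k, ∫ x, p k x ^ 2 = ∫ x, q k x ^ 2) →
      (∀ k, ∫ x, energyDensity β (p k x) (p' k x) = ∫ x, energyDensity β (q k x) (q' k x)) →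
      ∀ (δ δ' ε ε' : ℝ → ℝ), (∀ x, HasDerivAt δ (δ' x) x) → Dec δ → Dec δ' →
      (∀ x, HasDerivAt ε (ε' x) x) → Dec ε → Dec ε' →
      ∀ α η, 0 ≤ α → α ≤ 1 → 0 ≤ η → η ≤ 1 →
      ∫ x, (δ x ^ 2 + δ' x ^ 2) ≤ α ^ 2 → ∫ x, (ε x ^ 2 + ε' x ^ 2) ≤ η ^ 2 →
      ∫ x, energyDensity β ((∑ k, q k x) + ε x) ((∑ k, q' k x) + ε' x) =
        ∫ x, energyDensity β ((∑ k, p k x) + δ x) ((∑ k, p' k x) + δ' x) →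
      (∀ j, ∫ x, (∑ k ∈ Finset.Ici j, φ k x) * ((∑ k, q k x) + ε x) ^ 2 ≤
        (∫ x, (∑ k ∈ Finset.Ici j, χ k x) * ((∑ k, p k x) + δ x) ^ 2) + D * e) →
      ∫ x, (ε x ^ 2 + ε' x ^ 2) ≤
        C * (α ^ 2 + e + η ^ 3 + ∑ k, (∫ x, ε x * q' k x) ^ 2) := by
  obtain ⟨e₀, he₀, κ, hκ, hcoer⟩ := exists_coercivity N hβ hB hl
  set A₁ := (B ^ 2 + 2 * (N * B) + β * (3 * (N * B) ^ 2) + (1 + β * (2 * (N * B)))) * N * (N * B)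
    with hA₁
  set A₂ := 1 + β * (N * B) + β with hA₂
  set A₃ := (3 + B) * N * (N * B) with hA₃
  set A₄ := 1 + 2 * (N * B) + 3 * β * (N * B) ^ 2 with hA₄
  have hA₁0 : 0 ≤ A₁ := by positivity
  have hA₂0 : 0 ≤ A₂ := by positivity
  have hA₃0 : 0 ≤ A₃ := by positivity
  have hA₄0 : 0 ≤ A₄ := by positivity
  have hB3 : 0 ≤ B ^ 3 := by positivity
  set K := A₁ + A₂ + A₃ + A₄ + D + (1 + B ^ 3) + 2 * B with hK
  have hK0 : 0 ≤ K := by positivity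
  obtain ⟨C, hC, hC'⟩ := exists_lyapunov_bound w c hw hcw hκ hK0
  refine ⟨e₀, he₀, C, hC, ?_⟩
  intro σ e q q' G φ φ' p p' G₁ χ χ' h h₁ he hσ hM hE δ δ' ε ε' hδd hδ hδ' hd hε hε' α η hα hα1 hη
    hη1 hαb hηb hen hmono
  have he0 := h.e_nonneg
  have hsδ : ∀ x, |δ x| ≤ α := fun x => abs_le_of_sq_le_sq ((sq_le_integral hδd hδ hδ' x).trans hαb) hα
  have hsε : ∀ x, |ε x| ≤ η := fun x => abs_le_of_sq_le_sq ((sq_le_integral hd hε hε' x).trans hηb) hη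
  have hle : ∀ {f g : ℝ → ℝ}, Dec f → Dec g → (∫ x, f x ^ 2) ≤ ∫ x, (f x ^ 2 + g x ^ 2) :=
    fun hf hg => integral_mono hf.sq.integrable (hf.sq.add hg.sq).integrable fun x =>
      le_add_of_nonneg_right (sq_nonneg _)
  have hδ2 := (hle hδ hδ').trans hαb
  have hε2 := (hle hε hε').trans hηb
  have hE0 := h₁.abs_energy_sub_le hβ hδd hδ hδ' hsδ hα1
  have hE1 := h.abs_energy_sub_le hβ hd hε hε' hsε hη1
  simp only [hE, ← hen] at hE0
  have hI0 := fun j => h₁.abs_weighted_mass_sub_le (Finset.Ici j) hδ fun x => (hsδ x).trans hα1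
  have hI1 := fun j => h.abs_weighted_mass_sub_le (Finset.Ici j) hε fun x => (hsε x).trans hη1
  simp only [hM, Finset.sum_add_distrib, ← Finset.mul_sum] at hI0
  simp only [Finset.sum_add_distrib, ← Finset.mul_sum] at hI1
  rw [← hA₁, ← hA₂] at hE0 hE1
  rw [← hA₃] at hI0 hI1
  have hc := hcoer c σ e q q' G φ φ' h he hσ ε ε' hd hε hε'
  rw [h.integral_coercive_form hcw hε hε'] at hc
  have hF0 := h₁.abs_integral_form_le hβ hδ hδ'
  have hF := h.abs_integral_form_le hβ hε hε'
  rw [← hA₄] at hF0 hF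
  have ha0 := fun k => h₁.abs_integral_mul_le k hα hδ hδ2
  have hKA : ∀ {A y}, A ≤ K → 0 ≤ y → A * y ≤ K * y := fun h1 h2 => mul_le_mul_of_nonneg_right h1 h2
  have hα2 : 0 ≤ α ^ 2 := sq_nonneg α
  refine hC' e α η _ _ _ _ _ _ _ _ _ _ _ _ _ ⟨he0, h.e_le, hα, hα1, hη, hη1, hE0.trans ?_, hE1.trans ?_,
    fun j => (hI0 j).trans ?_, fun j => (hI1 j).trans ?_, fun j => (hmono j).trans ?_, fun j => ?_,
    fun j => ?_, hF0.trans ?_, hF.trans ?_, fun k => (ha0 k).trans ?_, hc.trans ?_⟩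
  · have h1 := mul_le_mul_of_nonneg_left hδ2 (by positivity : 0 ≤ A₂ * α)
    have h2 := hKA (A := A₁) (y := e) (by linarith) he0
    have h3 := hKA (A := A₂) (y := α ^ 2) (by linarith) hα2
    have h4 : A₂ * α * α ^ 2 ≤ A₂ * 1 * α ^ 2 := by gcongr
    linarith
  · have h1 := mul_le_mul_of_nonneg_left hε2 (by positivity : 0 ≤ A₂ * η)
    have h2 := hKA (A := A₁) (y := e) (by linarith) he0
    have h3 := hKA (A := A₂) (y := η ^ 3) (by linarith) (by positivity)
    linarith
  · exact hKA (by linarith) he0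
  · exact hKA (by linarith) he0
  · have := hKA (A := D) (y := e) (by linarith) he0
    linarith
  · exact integral_nonneg fun x => mul_nonneg (Finset.sum_nonneg fun k _ => (h.φ_pos k x).le)
      (sq_nonneg _)
  · refine (integral_mono (h₁.dec_weight_mul _ hδ.sq).integrable hδ.sq.integrable fun x => ?_).trans hδ2
    refine mul_le_of_le_one_left (sq_nonneg _) ?_
    rw [← h₁.φ_sum x]
    exact Finset.sum_le_sum_of_subset_of_nonneg (Finset.subset_univ _) fun j _ _ => (h₁.φ_pos j x).le
  · exact (mul_le_mul_of_nonneg_left hαb hA₄0).trans (hKA (by linarith) hα2)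
  · exact (mul_le_mul_of_nonneg_left hηb hA₄0).trans (hKA (by linarith) (sq_nonneg _))
  · exact hKA (by linarith) hα
  · exact add_le_add le_rfl (hKA (by linarith) (Finset.sum_nonneg fun k _ => by positivity))

end Frame

/-- Smoothed indicator of the half-line to the right of `m j`, with the conventions `1` for `j = 0`
and `0` for `j ≥ N`. -/
noncomputable def solitonWeight (N : ℕ) (σ : ℝ) (m : ℕ → ℝ) (j : ℕ) (x : ℝ) : ℝ :=
  if j = 0 then 1 else if j < N then sigmoid (σ * (x - m j)) else 0

/-- The points `m 1, …, m (N - 1)` separate the positions `X k`, at distance at least `ℓ`. -/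
structure Separated {N : ℕ} (m : ℕ → ℝ) (ℓ : ℝ) (X : Fin N → ℝ) : Prop where
  add_le : ∀ (k : Fin N) (j : ℕ), j < N → (k : ℕ) < j → X k + ℓ ≤ m j
  le_sub : ∀ (k : Fin N) (j : ℕ), 0 < j → j ≤ (k : ℕ) → m j + ℓ ≤ X k

section Weight

variable {N : ℕ} {σ ℓ : ℝ} {m : ℕ → ℝ} {X : Fin N → ℝ}

lemma solitonWeight_zero (x : ℝ) : solitonWeight N σ m 0 x = 1 := if_pos rfl

lemma solitonWeight_self (hN : 0 < N) (x : ℝ) : solitonWeight N σ m N x = 0 := by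
  simp [solitonWeight, hN.ne']

lemma solitonWeight_of_lt {j : ℕ} (hj : 0 < j) (hjN : j < N) (x : ℝ) :
    solitonWeight N σ m j x = sigmoid (σ * (x - m j)) := by
  simp [solitonWeight, hj.ne', hjN]

lemma solitonWeight_nonneg (j : ℕ) (x : ℝ) : 0 ≤ solitonWeight N σ m j x := by
  unfold solitonWeight; split_ifs <;> first | positivity | exact sigmoid_nonneg _

lemma solitonWeight_le_one (j : ℕ) (x : ℝ) : solitonWeight N σ m j x ≤ 1 := by
  unfold solitonWeight; split_ifs <;> first | exact sigmoid_le_one _ | norm_num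

lemma hasDerivAt_solitonWeight (j : ℕ) (x : ℝ) : HasDerivAt (solitonWeight N σ m j)
    (σ * (solitonWeight N σ m j x * (1 - solitonWeight N σ m j x))) x := by
  unfold solitonWeight
  split_ifs
  · simpa using hasDerivAt_const x (1 : ℝ)
  · have h1 : HasDerivAt (fun x => σ * (x - m j)) σ x := by
      simpa using ((hasDerivAt_id x).sub_const (m j)).const_mul σ
    exact ((hasDerivAt_sigmoid _).comp x h1).congr_deriv (by ring)
  · simpa using hasDerivAt_const x (0 : ℝ)

lemma solitonWeight_succ_lt (hσ : 0 < σ) (hℓ : 0 < ℓ) (h : Separated m ℓ X) (k : Fin N) (x : ℝ) :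
    solitonWeight N σ m (k + 1) x < solitonWeight N σ m k x := by
  have hk := k.2
  have h0 : 0 < N := by omega
  rcases Nat.eq_zero_or_pos (k : ℕ) with hk0 | hk0
  · rw [hk0, solitonWeight_zero]
    rcases Nat.lt_or_ge 1 N with hN | hN
    · rw [solitonWeight_of_lt (by omega) (by omega)]
      exact sigmoid_lt_one _
    · rw [show 0 + 1 = N by omega, solitonWeight_self h0]
      exact one_pos
  · rw [solitonWeight_of_lt hk0 hk]
    rcases Nat.lt_or_ge (k + 1) N with hN | hN
    · rw [solitonWeight_of_lt (by omega) hN]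
      have h1 := h.add_le k (k + 1) hN (by omega)
      have h2 := h.le_sub k k hk0 le_rfl
      exact sigmoid_lt (mul_lt_mul_of_pos_left (by linarith) hσ)
    · rw [show (k : ℕ) + 1 = N by omega, solitonWeight_self h0]
      exact sigmoid_pos _

lemma sum_Ici_solitonWeight_sub (j : Fin N) (x : ℝ) :
    ∑ k ∈ Finset.Ici j, (solitonWeight N σ m k x - solitonWeight N σ m (k + 1) x) =
      solitonWeight N σ m j x := by
  have hj := j.2
  have h1 : ∑ k ∈ Finset.Ico (j : ℕ) N, (solitonWeight N σ m k x - solitonWeight N σ m (k + 1) x) =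
      solitonWeight N σ m j x := by
    rw [Finset.sum_Ico_eq_sum_range]
    have := Finset.sum_range_sub' (fun i => solitonWeight N σ m (j + i) x) (N - j)
    simp only [add_zero, ← add_assoc] at this
    rw [this, show (j : ℕ) + (N - j) = N by omega, solitonWeight_self (by omega), sub_zero]
  rw [← h1, ← Fin.map_valEmbedding_Ici, Finset.sum_map]
  rfl

lemma exp_le_of_separated (hσ : 0 < σ) (h : Separated m ℓ X) {j k : Fin N} (hjk : j ≠ k)
    (x : ℝ) : (solitonWeight N σ m j x - solitonWeight N σ m (j + 1) x) *
      exp (-(σ * |x - X k|)) ≤ exp (-(σ * ℓ)) := by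
  have hj := j.2
  have hk := k.2
  have key : ∀ y, y ≤ σ * |x - X k| - σ * ℓ → sigmoid y * exp (-(σ * |x - X k|)) ≤
      exp (-(σ * ℓ)) := fun y hy => by
    have h1 : sigmoid y ≤ exp y := by
      have h2 := sigmoid_mul_rexp_neg y
      have h3 := sigmoid_le_one (-y)
      rw [exp_neg] at h2
      rw [← h2, ← div_eq_mul_inv, div_le_one (exp_pos _)] at h3
      exact h3
    calc _ ≤ exp y * exp (-(σ * |x - X k|)) := mul_le_mul_of_nonneg_right h1 (exp_pos _).le
      _ = exp (y - σ * |x - X k|) := by rw [← exp_add]; rfl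
      _ ≤ exp (-(σ * ℓ)) := exp_le_exp.2 (by linarith)
  rcases lt_or_gt_of_ne hjk with hlt | hlt
  · have hlt' : (j : ℕ) + 1 ≤ k := hlt
    have h1 := h.le_sub k (j + 1) (by omega) hlt'
    have h2 : solitonWeight N σ m j x - solitonWeight N σ m (j + 1) x ≤
        sigmoid (-(σ * (x - m (j + 1)))) := by
      rw [solitonWeight_of_lt (j := j + 1) (by omega) (by omega), sigmoid_neg]
      linarith [solitonWeight_le_one (N := N) (σ := σ) (m := m) j x]
    refine (mul_le_mul_of_nonneg_right h2 (exp_pos _).le).trans (key _ ?_)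
    have h3 := neg_abs_le (x - X k)
    have h4 : -(x - m (j + 1)) ≤ |x - X k| - ℓ := by linarith
    linarith [mul_le_mul_of_nonneg_left h4 hσ.le]
  · have hlt' : (k : ℕ) < j := hlt
    have h1 := h.add_le k j hj hlt'
    have h2 : solitonWeight N σ m j x - solitonWeight N σ m (j + 1) x ≤
        sigmoid (σ * (x - m j)) := by
      rw [solitonWeight_of_lt (j := j) (by omega) (by omega)]
      linarith [solitonWeight_nonneg (N := N) (σ := σ) (m := m) (j + 1) x]
    refine (mul_le_mul_of_nonneg_right h2 (exp_pos _).le).trans (key _ ?_)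
    have h3 := le_abs_self (x - X k)
    have h4 : x - m j ≤ |x - X k| - ℓ := by linarith
    linarith [mul_le_mul_of_nonneg_left h4 hσ.le]

lemma Separated.le_abs_sub (h : Separated m ℓ X) {j k : Fin N} (hjk : j ≠ k) :
    2 * ℓ ≤ |X j - X k| := by
  have key : ∀ j k : Fin N, j < k → 2 * ℓ ≤ X k - X j := fun j k hlt => by
    have hlt' : (j : ℕ) < k := hlt
    have h1 := h.add_le j k k.2 hlt'
    have h2 := h.le_sub k k (by omega) le_rfl
    linarith
  rcases lt_or_gt_of_ne hjk with hlt | hlt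
  · have h1 := key j k hlt
    have h2 := neg_abs_le (X j - X k)
    linarith
  · exact (key k j hlt).trans (le_abs_self _)

lemma exp_mul_exp_le_of_separated (hσ : 0 < σ) (hℓ : 0 ≤ ℓ) (h : Separated m ℓ X) {j k : Fin N}
    (hjk : j ≠ k) (x : ℝ) :
    exp (-(σ * |x - X j|)) * exp (-(σ * |x - X k|)) ≤ exp (-(σ * ℓ)) := by
  rw [← exp_add]
  refine exp_le_exp.2 ?_
  have h1 := h.le_abs_sub hjk
  have h2 : |X j - X k| ≤ |x - X j| + |x - X k| := by
    rw [abs_sub_comm x (X j)]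
    exact abs_sub_le _ _ _
  have h3 : ℓ ≤ |x - X j| + |x - X k| := by linarith
  linarith [mul_le_mul_of_nonneg_left h3 hσ.le]

end Weight

section Bounds

variable {ι : Type*} [Fintype ι]

lemma exists_pos_forall_le {f : ι → ℝ} (hf : ∀ i, 0 < f i) : ∃ a > 0, ∀ i, a ≤ f i := by
  have h0 : 0 ≤ ∑ i, (f i)⁻¹ := Finset.sum_nonneg fun i _ => (inv_pos.2 (hf i)).le
  refine ⟨(1 + ∑ i, (f i)⁻¹)⁻¹, by positivity, fun i => ?_⟩
  refine inv_le_of_inv_le₀ (hf i) ?_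
  have := Finset.single_le_sum (f := fun i => (f i)⁻¹) (fun i _ => (inv_pos.2 (hf i)).le)
    (Finset.mem_univ i)
  linarith

lemma exists_nonneg_forall_le (f : ι → ℝ) : ∃ a, 0 ≤ a ∧ ∀ i, f i ≤ a :=
  ⟨∑ i, |f i|, Finset.sum_nonneg fun _ _ => abs_nonneg _, fun _ => (le_abs_self _).trans
    (Finset.single_le_sum (f := fun i => |f i|) (fun _ _ => abs_nonneg _) (Finset.mem_univ _))⟩

end Bounds

lemma IsSoliton.coercive_translate {β c l C B : ℝ} {Q Q' : ℝ → ℝ} {l' : ℝ} (hl : l' ≤ l) (hB : C ≤ B)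
    (h : ∀ ε ε' : ℝ → ℝ, (∀ x, HasDerivAt ε (ε' x) x) → Dec ε → Dec ε' →
      l * ∫ x, ε x ^ 2 ≤ (∫ x, (ε' x ^ 2 + (c - 2 * Q x + 3 * β * Q x ^ 2) * ε x ^ 2)) +
        C * ((∫ x, ε x * Q x) ^ 2 + (∫ x, ε x * Q' x) ^ 2)) (a : ℝ) (ε ε' : ℝ → ℝ)
    (hε : ∀ x, HasDerivAt ε (ε' x) x) (dε : Dec ε) (dε' : Dec ε') :
    l' * ∫ x, ε x ^ 2 ≤
      (∫ x, (ε' x ^ 2 + (c - 2 * Q (x - a) + 3 * β * Q (x - a) ^ 2) * ε x ^ 2)) +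
        B * ((∫ x, ε x * Q (x - a)) ^ 2 + (∫ x, ε x * Q' (x - a)) ^ 2) := by
  have h1 := h (fun x => ε (x + a)) (fun x => ε' (x + a)) (fun x => (hε (x + a)).comp_add_const x a)
    (dε.comp_add a) (dε'.comp_add a)
  rw [integral_add_right_eq_self (fun x => ε x ^ 2) a,
    ← integral_sub_right_eq_self (fun x => ε' (x + a) ^ 2 + _) a,
    ← integral_sub_right_eq_self (fun x => ε (x + a) * Q x) a,
    ← integral_sub_right_eq_self (fun x => ε (x + a) * Q' x) a] at h1
  simp only [sub_add_cancel] at h1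
  have h2 : 0 ≤ ∫ x, ε x ^ 2 := integral_nonneg fun x => sq_nonneg _
  have h3 := mul_le_mul_of_nonneg_right hl h2
  have h4 := mul_le_mul_of_nonneg_right hB (add_nonneg
    (sq_nonneg (∫ x, ε x * Q (x - a))) (sq_nonneg (∫ x, ε x * Q' (x - a))))
  linarith

lemma dec_exp_neg_abs {s : ℝ} (hs : 0 < s) : Dec fun x => exp (-(s * |x|)) := by
  refine (dec_exp hs).of_abs_le (B := 1) (by fun_prop) fun x => ?_
  have h1 : 0 ≤ (1 + |x|) * exp (-(s * |x|)) := by positivity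
  rw [one_mul, abs_of_pos (exp_pos _), abs_of_nonneg h1]
  have h2 := abs_nonneg x
  exact le_mul_of_one_le_left (exp_pos _).le (by linarith)

lemma abs_sub_mul_one_sub_le {σ a b : ℝ} (hσ : 0 < σ) (ha : a ≤ 1) (hb : 0 ≤ b) (hab : b ≤ a) :
    |σ * (a * (1 - a)) - σ * (b * (1 - b))| ≤ σ * (a - b) := by
  rw [show σ * (a * (1 - a)) - σ * (b * (1 - b)) = σ * (a - b) * (1 - a - b) by ring, abs_mul,
    abs_of_nonneg (mul_nonneg hσ.le (sub_nonneg.2 hab))]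
  exact mul_le_of_le_one_right (mul_nonneg hσ.le (sub_nonneg.2 hab))
    (abs_le.2 ⟨by linarith, by linarith⟩)

theorem exists_frame {N : ℕ} (hN : 0 < N) {β σ₀ : ℝ} {c : Fin N → ℝ} {Q Q' : Fin N → ℝ → ℝ} (hβ : 0 < β)
    (hc : ∀ k, 0 < c k) (hcβ : ∀ k, c k < 2 / (9 * β))
    (hQ : ∀ k, IsSoliton β (c k) (Q k) (Q' k)) (hσ₀ : 0 < σ₀) :
    ∃ l > 0, ∃ σ > 0, σ ≤ σ₀ ∧ σ ^ 2 ≤ l ∧ ∃ B, 0 ≤ B ∧ ∃ D, 0 ≤ D ∧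
      (∀ k x, Q k x ≤ B * exp (-(2 * σ * |x|))) ∧
      ∀ m ℓ X, 0 < ℓ → Separated m ℓ X → D * exp (-(σ * ℓ)) ≤ 1 →
        Frame β c B l σ (D * exp (-(σ * ℓ))) (fun k x => Q k (x - X k)) (fun k x => Q' k (x - X k))
          (fun k x => exp (-(σ * |x - X k|)))
          (fun k x => solitonWeight N σ m k x - solitonWeight N σ m (k + 1) x)
          (fun k x => σ * (solitonWeight N σ m k x * (1 - solitonWeight N σ m k x)) -
            σ * (solitonWeight N σ m (k + 1) x * (1 - solitonWeight N σ m (k + 1) x))) := by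
  choose l₀ hl₀ C₀ hC₀ hco using fun k => (hQ k).exists_coercivity hβ (hc k) (hcβ k)
  choose C₁ hC₁ hdecay using fun k => (hQ k).decay
  obtain ⟨l, hl, hl_le⟩ := exists_pos_forall_le hl₀
  obtain ⟨s, hs, hsc⟩ := exists_pos_forall_le fun k => Real.sqrt_pos.2 (hc k)
  obtain ⟨B₀, hB₀, hCB₀⟩ := exists_nonneg_forall_le C₀
  obtain ⟨B₁, hB₁, hCB₁⟩ := exists_nonneg_forall_le C₁
  obtain ⟨B₂, hB₂, hCB₂⟩ := exists_nonneg_forall_le fun k => √(c k)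
  obtain ⟨B₃, hB₃, hCB₃⟩ := exists_nonneg_forall_le fun k => c k + 1 / β
  set σ := min σ₀ (min (√l) (s / 2)) with hσd
  have hσ : 0 < σ := lt_min hσ₀ (lt_min (Real.sqrt_pos.2 hl) (by linarith))
  have hσs : ∀ k, 2 * σ ≤ √(c k) := fun k => by
    have h1 : σ ≤ s / 2 := (min_le_right _ _).trans (min_le_right _ _)
    linarith [hsc k]
  have hσl : σ ^ 2 ≤ l := by
    have h1 : σ ≤ √l := (min_le_right _ _).trans (min_le_left _ _)
    calc σ ^ 2 ≤ √l ^ 2 := pow_le_pow_left₀ hσ.le h1 2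
      _ = l := Real.sq_sqrt hl.le
  have hσσ : σ ≤ σ₀ := min_le_left _ _
  clear_value σ
  have hI : 0 ≤ ∫ x, exp (-(σ * |x|)) := integral_nonneg fun x => (exp_pos _).le
  set B := B₀ + B₁ + B₂ + B₃ + ∫ x, exp (-(σ * |x|)) with hBd
  have hB0 : 0 ≤ B := by positivity
  have hBB₀ : B₀ ≤ B := by linarith
  have hBB₁ : B₁ ≤ B := by linarith
  have hBB₂ : B₂ ≤ B := by linarith
  have hBB₃ : B₃ ≤ B := by linarith
  have hBI : ∫ x, exp (-(σ * |x|)) ≤ B := by linarith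
  clear_value B
  have hQe : ∀ k x, Q k x ≤ B * exp (-(2 * σ * |x|)) := fun k x => by
    refine (hdecay k x).trans (mul_le_mul ((hCB₁ k).trans hBB₁) (exp_le_exp.2 ?_)
      (exp_pos _).le hB0)
    exact neg_le_neg (mul_le_mul_of_nonneg_right (hσs k) (abs_nonneg x))
  have hQG : ∀ k x, Q k x ≤ B * exp (-(σ * |x|)) * exp (-(σ * |x|)) := fun k x => by
    refine (hQe k x).trans_eq ?_
    rw [mul_assoc B, ← exp_add]
    ring_nf
  have hG1 : ∀ x, exp (-(σ * |x|)) ≤ 1 := fun x => by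
    rw [exp_le_one_iff]
    have := mul_nonneg hσ.le (abs_nonneg x)
    linarith
  have hQG' : ∀ k x, Q k x ≤ B * exp (-(σ * |x|)) := fun k x =>
    (hQG k x).trans (mul_le_of_le_one_right (mul_nonneg hB0 (exp_pos _).le) (hG1 x))
  refine ⟨l, hl, σ, hσ, hσσ, hσl, B, hB0, B + B ^ 2, by positivity, hQe,
    fun m ℓ X hℓ hX he => ?_⟩
  have hlt := fun k x => solitonWeight_succ_lt hσ hℓ hX k x
  exact {
    B_nonneg := hB0
    l_pos := hl
    e_nonneg := by positivity
    e_le := he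
    c_nonneg := fun k => (hc k).le
    c_le := fun k => by
      have h1 : c k + 1 / β ≤ B₃ := hCB₃ k
      have h2 : 0 < 1 / β := by positivity
      linarith
    d0 := fun k x => ((hQ k).d0 (x - X k)).comp_sub_const x (X k)
    d1 := fun k x => ((hQ k).d1 (x - X k)).comp_sub_const x (X k)
    pos := fun k x => ((hQ k).pos _).le
    le := fun k x => (hQG' k _).trans (mul_le_of_le_one_right hB0 (hG1 _))
    le_G := fun k x => hQG' k _
    abs_deriv_le := fun k x => ((hQ k).abs_deriv_le (hc k) _).trans
      (mul_le_mul_of_nonneg_right ((hCB₂ k).trans hBB₂) ((hQ k).pos _).le)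
    abs_deriv₂_le := fun k x => ((hQ k).abs_deriv₂_le hβ (hc k) _).trans
      (mul_le_mul_of_nonneg_right ((hCB₃ k).trans hBB₃) ((hQ k).pos _).le)
    coercive := fun k ε ε' hε dε dε' => IsSoliton.coercive_translate (hl_le k)
      ((hCB₀ k).trans hBB₀) (hco k) (X k) ε ε' hε dε dε'
    G_dec := fun k => (dec_exp_neg_abs hσ).comp_sub (X k)
    G_nonneg := fun k x => (exp_pos _).le
    G_le := fun k x => hG1 _
    integral_G := fun k => by
      rw [integral_sub_right_eq_self (fun x => exp (-(σ * |x|)))]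
      exact hBI
    φ_pos := fun k x => sub_pos.2 (hlt k x)
    φ_sum := fun x => by
      have h1 := sum_Ici_solitonWeight_sub (σ := σ) (m := m) (⟨0, hN⟩ : Fin N) x
      rw [show Finset.Ici (⟨0, hN⟩ : Fin N) = Finset.univ from
        Finset.eq_univ_iff_forall.2 fun k => Finset.mem_Ici.2 (Nat.zero_le (k : ℕ))] at h1
      rw [h1]
      exact solitonWeight_zero x
    φ_deriv := fun k x => (hasDerivAt_solitonWeight _ x).sub (hasDerivAt_solitonWeight _ x)
    φ_cont := fun k => by
      have h1 : ∀ j, Continuous (solitonWeight N σ m j) := fun j =>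
        continuous_iff_continuousAt.2 fun x => (hasDerivAt_solitonWeight j x).continuousAt
      have h2 := h1 k
      have h3 := h1 (k + 1)
      fun_prop
    φ_le := fun k x => abs_sub_mul_one_sub_le hσ (solitonWeight_le_one _ _)
      (solitonWeight_nonneg _ _) (hlt k x).le
    φ_mul_le := fun j k hjk x => by
      have h1 := exp_le_of_separated hσ hX hjk x
      have h2 := mul_le_mul_of_nonneg_left (hQG k (x - X k)) (sub_pos.2 (hlt j x)).le
      have h3 := exp_pos (-(σ * |x - X k|))
      have h4 := exp_pos (-(σ * ℓ))
      generalize solitonWeight N σ m j x - solitonWeight N σ m (j + 1) x = p at h1 h2 ⊢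
      generalize exp (-(σ * |x - X k|)) = g at h1 h2 h3 ⊢
      generalize exp (-(σ * ℓ)) = E at h1 h4 ⊢
      have h5 := mul_le_mul_of_nonneg_left h1 (mul_nonneg hB0 h3.le)
      have h6 : 0 ≤ B ^ 2 * E * g := by positivity
      nlinarith
    mul_le := fun j k hjk x => by
      have h1 := exp_mul_exp_le_of_separated hσ hℓ.le hX hjk x
      have h2 := mul_le_mul (hQG' j (x - X j)) (hQG k (x - X k)) ((hQ k).pos _).le
        (by positivity)
      have h3 := exp_pos (-(σ * |x - X k|))
      have h4 := exp_pos (-(σ * ℓ))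
      generalize exp (-(σ * |x - X k|)) = g at h1 h2 h3 ⊢
      generalize exp (-(σ * |x - X j|)) = g' at h1 h2 ⊢
      generalize exp (-(σ * ℓ)) = E at h1 h4 ⊢
      have h5 := mul_le_mul_of_nonneg_left h1 (mul_nonneg (sq_nonneg B) h3.le)
      have h6 : 0 ≤ B * E * g := by positivity
      nlinarith }

namespace GardnerFlow

variable {β : ℝ} {V : ℕ → ℝ → ℝ → ℝ}

/-- Almost monotonicity of a mass weighted by a moving smoothed step function `S`. -/
lemma weighted_mass_le (hβ : 0 < β) (hV : GardnerFlow β V) {σ μ b : ℝ} (hσ : 0 < σ) (hb : 0 ≤ b)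
    {S : ℝ → ℝ → ℝ} (cS : Continuous (Function.uncurry S)) (hS0 : ∀ t x, 0 ≤ S t x)
    (hS1 : ∀ t x, S t x ≤ 1) (hS : ∀ t x, HasDerivAt (S t) (σ * (S t x * (1 - S t x))) x)
    (hSt : ∀ t x, HasDerivAt (fun τ => S τ x) (-(μ * (σ * (S t x * (1 - S t x))))) t)
    {ρ : ℝ → ℝ → ℝ} {F F' : ℝ → ℝ} (hρ0 : ∀ t ∈ Set.Icc 0 b, ∀ x, 0 ≤ ρ t x)
    (hρ : ∀ t ∈ Set.Icc 0 b, Integrable (ρ t)) (hρF : ∀ t ∈ Set.Icc 0 b, ∫ x, ρ t x ≤ F' t)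
    (hF : ∀ t ∈ Set.Icc 0 b, HasDerivAt F (F' t) t)
    (hle : ∀ t ∈ Set.Icc 0 b, ∀ x,
      (4 / 3 * V 0 t x - (μ - σ ^ 2)) * V 0 t x ^ 2 * (σ * (S t x * (1 - S t x))) ≤ ρ t x) :
    (∫ x, V 0 b x ^ 2 * S b x) - (∫ x, V 0 0 x ^ 2 * S 0 x) ≤ F b - F 0 := by
  have hH := h3On_Icc hβ hV 0 b
  have c := hV.cont_apply
  have cS' : Continuous fun p : ℝ × ℝ => S p.1 p.2 := cS
  have l0 := hV.l2On hH (k := 0) (by norm_num)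
  have l1 := hV.l2On hH (k := 1) (by norm_num)
  have l2 := hV.l2On hH (k := 2) (by norm_num)
  have b0 := hV.bddOn hH (k := 0) (by norm_num)
  have bS : BddOn (Set.Icc 0 b) S := ⟨fun t => cS.comp (by fun_prop : Continuous fun x => (t, x)),
    1, fun t _ x => (abs_of_nonneg (hS0 t x)).trans_le (hS1 t x)⟩
  have hj : L1On (Set.Icc 0 b) fun t x => (((((((-2) * S t x) * (V 0 t x * V 2 t x)) + (S t x * (V 1 t x * V 1 t x))) + ((-((((4 / 3) * V 0 t x) - (((3 / 2) * β) * (V 0 t x ^ 2))) * S t x)) * (V 0 t x * V 0 t x))) + ((2 * (σ * (S t x * (1 - S t x)))) * (V 0 t x * V 1 t x))) + ((-((σ ^ 2) * ((S t x * (1 - S t x)) * (1 - (2 * S t x))))) * (V 0 t x * V 0 t x))) :=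
    ((((bS.comp₂ b0 (G := fun s _ => (-2) * s) (by fun_prop)).mul_l1 (l0.mul l2)).add
      (bS.mul_l1 (l1.mul l1))).add
      ((bS.comp₂ b0 (G := fun s p => -((4 / 3 * p - 3 / 2 * β * p ^ 2) * s))
        (by fun_prop)).mul_l1 (l0.mul l0))).add
      ((bS.comp₂ b0 (G := fun s _ => 2 * (σ * (s * (1 - s)))) (by fun_prop)).mul_l1
        (l0.mul l1)) |>.add
      ((bS.comp₂ b0 (G := fun s _ => -(σ ^ 2 * (s * (1 - s) * (1 - 2 * s)))) (by fun_prop)).mul_l1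
        (l0.mul l0))
  have hdec : ∀ t, Integrable fun x => V 0 t x ^ 2 * S t x := fun t =>
    ((hV.dec 0 t).pow 1).mul_bounded (cS.comp (by fun_prop : Continuous fun x => (t, x)))
      (B := 1) (fun x => (abs_of_nonneg (hS0 t x)).trans_le (hS1 t x)) |>.integrable
  obtain ⟨cj, K, hK⟩ := hj
  refine integral_le_of_flux (K := K)
    (e := fun t x => ((V 0 t x ^ 2) * S t x))
    (e' := fun t x => ((((2 * V 0 t x) * (-(V 3 t x + (((2 * V 0 t x) - ((3 * β) * (V 0 t x ^ 2))) * V 1 t x)))) * S t x) + ((V 0 t x ^ 2) * (-(μ * (σ * (S t x * (1 - S t x))))))))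
    (r := fun t x => (((((-3) * ((σ * (S t x * (1 - S t x))) * (V 1 t x ^ 2))) + (((σ ^ 3) * ((S t x * (1 - S t x)) * ((1 - (6 * S t x)) + (6 * (S t x ^ 2))))) * (V 0 t x ^ 2))) + (((((4 / 3) * V 0 t x) - (((3 / 2) * β) * (V 0 t x ^ 2))) * (V 0 t x ^ 2)) * (σ * (S t x * (1 - S t x))))) - ((μ * (σ * (S t x * (1 - S t x)))) * (V 0 t x ^ 2))))
    (k := fun _ _ => 0) (k₁ := fun _ _ => 0) (k₂ := fun _ _ => 0) (ρ := ρ)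
    hb (by fun_prop) (by fun_prop) (fun t x => ?_)
    (fun t => by have := fun k => (hV.dec k t).1; have := bS.1 t; fun_prop) cj
    (fun t x => hasDerivAt_const x 0) (fun t x => hasDerivAt_const x 0) (fun t x => ?_) hK
    (fun t ht => ⟨integrable_zero _ _ _, ?_⟩) (fun t ht x => ?_) hρ0 hρ hρF hF (hdec 0) (hdec b)
  · have h1 := (((hV.dt0 t x).fun_pow 2).fun_mul (hSt t x))
    refine h1.congr_deriv ?_
    push_cast
    ring
  · have h1 := ((((((((hS t x).const_mul (-2)).fun_mul ((hV.dx 0 t x).fun_mul (hV.dx 2 t x))).fun_add ((hS t x).fun_mul ((hV.dx 1 t x).fun_mul (hV.dx 1 t x)))).fun_add ((((((hV.dx 0 t x).const_mul (4 / 3)).fun_sub (((hV.dx 0 t x).fun_pow 2).const_mul ((3 / 2) * β))).fun_mul (hS t x))).fun_neg.fun_mul ((hV.dx 0 t x).fun_mul (hV.dx 0 t x)))).fun_add (((((hS t x).fun_mul ((hS t x).const_sub 1)).const_mul σ).const_mul 2).fun_mul ((hV.dx 0 t x).fun_mul (hV.dx 1 t x)))).fun_add ((((((hS t x).fun_mul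 ((hS t x).const_sub 1)).fun_mul (((hS t x).const_mul 2).const_sub 1)).const_mul (σ ^ 2))).fun_neg.fun_mul ((hV.dx 0 t x).fun_mul (hV.dx 0 t x))))).add_const 0
    refine h1.congr_deriv ?_
    simp only [Nat.reduceAdd]
    push_cast
    ring
  · simpa using (integral_nonneg fun x => abs_nonneg _).trans (hK t ht).2
  · refine le_trans ?_ (hle t ht x)
    have h0 := hS0 t x
    have h1 := hS1 t x
    generalize S t x = s at h0 h1 ⊢
    generalize V 0 t x = u
    generalize V 1 t x = w
    have h2 : 0 ≤ s * (1 - s) := mul_nonneg h0 (sub_nonneg.2 h1)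
    have h3 : 0 ≤ σ * (s * (1 - s)) := mul_nonneg hσ.le h2
    have h4 : 0 ≤ σ * (s * (1 - s)) * w ^ 2 := mul_nonneg h3 (sq_nonneg w)
    have h5 : 0 ≤ β * u ^ 4 * (σ * (s * (1 - s))) := by positivity
    have h6 : 0 ≤ σ ^ 3 * (s * (1 - s)) ^ 2 * u ^ 2 := by positivity
    linarith

end GardnerFlow

lemma sigmoid_le_exp (y : ℝ) : sigmoid y ≤ exp y := by
  have h2 := sigmoid_mul_rexp_neg y
  have h3 := sigmoid_le_one (-y)
  rw [exp_neg] at h2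
  rwa [← h2, ← div_eq_mul_inv, div_le_one (exp_pos _)] at h3

lemma sigmoid_mul_one_sub_le (y : ℝ) : sigmoid y * (1 - sigmoid y) ≤ exp (-|y|) := by
  have key : ∀ z, sigmoid (-z) ≤ exp (-z) := fun z => sigmoid_le_exp _
  rw [← sigmoid_neg]
  rcases le_total 0 y with h | h
  · rw [abs_of_nonneg h]
    exact (mul_le_of_le_one_left (sigmoid_nonneg _) (sigmoid_le_one _)).trans (key y)
  · rw [abs_of_nonpos h, neg_neg]
    exact (mul_le_of_le_one_right (sigmoid_nonneg _) (sigmoid_le_one _)).trans (sigmoid_le_exp y)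

lemma Separated.le_abs_sub_point {N : ℕ} {m : ℕ → ℝ} {ℓ : ℝ} {X : Fin N → ℝ}
    (h : Separated m ℓ X) (k : Fin N) {j : ℕ} (hj : 0 < j) (hjN : j < N) : ℓ ≤ |X k - m j| := by
  rcases Nat.lt_or_ge k j with hk | hk
  · have h1 := h.add_le k j hjN hk
    have h2 := neg_abs_le (X k - m j)
    linarith
  · exact le_trans (by linarith [h.le_sub k j hj hk]) (le_abs_self _)

lemma Separated.sigmoid_mul_exp_le {N : ℕ} {σ ℓ : ℝ} {m : ℕ → ℝ} {X : Fin N → ℝ} (hσ : 0 < σ)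
    (h : Separated m ℓ X) (k : Fin N) {j : ℕ} (hj : 0 < j) (hjN : j < N) (x : ℝ) :
    sigmoid (σ * (x - m j)) * (1 - sigmoid (σ * (x - m j))) * exp (-(σ * |x - X k|)) ≤
      exp (-(σ * ℓ)) := by
  refine (mul_le_mul_of_nonneg_right (sigmoid_mul_one_sub_le _) (exp_pos _).le).trans ?_
  rw [← exp_add, abs_mul, abs_of_pos hσ]
  refine exp_le_exp.2 ?_
  have h1 := h.le_abs_sub_point k hj hjN
  have h2 := abs_sub_le (X k) x (m j)
  rw [abs_sub_comm (X k) x] at h2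
  have h3 : ℓ ≤ |x - X k| + |x - m j| := h1.trans h2
  have h4 := mul_le_mul_of_nonneg_left h3 hσ.le
  linarith

/-- The pointwise bound on the interaction term in the monotonicity formula. -/
lemma interaction_le {N : ℕ} {u κ ν P B E s σ : ℝ} {q G : Fin N → ℝ} (hσ : 0 ≤ σ) (hB : 0 ≤ B)
    (hs : 0 ≤ s) (hP : |u| ≤ P) (hν : 4 / 3 * κ ≤ ν) (hq : ∀ k, 0 ≤ q k)
    (hqG : ∀ k, q k ≤ B * G k * G k) (hG : ∀ k, 0 ≤ G k) (hε : |u - ∑ k, q k| ≤ κ)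
    (hsG : ∀ k, s * G k ≤ E) :
    (4 / 3 * u - ν) * u ^ 2 * (σ * s) ≤ 4 / 3 * P ^ 2 * B * σ * E * ∑ k, G k := by
  have h1 : 4 / 3 * u - ν ≤ 4 / 3 * ∑ k, q k := by linarith [(abs_le.1 hε).2]
  have h2 : u ^ 2 ≤ P ^ 2 := by
    rw [← sq_abs]
    exact pow_le_pow_left₀ (abs_nonneg u) hP 2
  have h3 : 0 ≤ ∑ k, q k := Finset.sum_nonneg fun k _ => hq k
  have h4 : (∑ k, q k) * s ≤ B * E * ∑ k, G k := by
    rw [Finset.sum_mul, Finset.mul_sum]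
    refine Finset.sum_le_sum fun k _ => ?_
    have h5 := mul_le_mul_of_nonneg_right (hqG k) hs
    have h6 := mul_le_mul_of_nonneg_left (hsG k) (mul_nonneg hB (hG k))
    linarith
  have h7 : 0 ≤ σ * s := mul_nonneg hσ hs
  calc (4 / 3 * u - ν) * u ^ 2 * (σ * s) ≤ 4 / 3 * (∑ k, q k) * u ^ 2 * (σ * s) :=
        mul_le_mul_of_nonneg_right (mul_le_mul_of_nonneg_right h1 (sq_nonneg u)) h7
    _ ≤ 4 / 3 * (∑ k, q k) * P ^ 2 * (σ * s) :=
        mul_le_mul_of_nonneg_right (mul_le_mul_of_nonneg_left h2 (by positivity)) h7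
    _ = 4 / 3 * P ^ 2 * σ * ((∑ k, q k) * s) := by ring
    _ ≤ 4 / 3 * P ^ 2 * σ * (B * E * ∑ k, G k) := mul_le_mul_of_nonneg_left h4 (by positivity)
    _ = _ := by ring

theorem GardnerFlow.solitonWeight_mass_le {β : ℝ} {V : ℕ → ℝ → ℝ → ℝ} (hβ : 0 < β)
    (hV : GardnerFlow β V) {N : ℕ} {σ δ B b ℓ κ : ℝ} (hσ : 0 < σ) (hδ : 0 < δ) (hB : 0 ≤ B)
    {Q : Fin N → ℝ → ℝ} (hQ0 : ∀ k x, 0 ≤ Q k x)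
    (hQ : ∀ k x, Q k x ≤ B * exp (-(2 * σ * |x|))) {a μ : ℕ → ℝ} (hb : 0 ≤ b)
    (hκ1 : κ ≤ 1) {j : ℕ} (hj : j < N) (hμ : 0 < j → 4 / 3 * κ + σ ^ 2 ≤ μ j) {X : Fin N → ℝ → ℝ}
    (hX : ∀ t ∈ Set.Icc 0 b, Separated (fun j => a j + μ j * t) (ℓ + δ * t) fun k => X k t)
    (hε : ∀ t ∈ Set.Icc 0 b, ∀ x, |V 0 t x - ∑ k, Q k (x - X k t)| ≤ κ) :
    (∫ x, solitonWeight N σ (fun j => a j + μ j * b) j x * V 0 b x ^ 2) ≤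
      (∫ x, solitonWeight N σ (fun j => a j + μ j * 0) j x * V 0 0 x ^ 2) +
        4 / 3 * (N * B + 1) ^ 2 * B * N * (∫ x, exp (-(σ * |x|))) / δ * exp (-(σ * ℓ)) := by
  set I := ∫ x, exp (-(σ * |x|)) with hI
  have hI0 : 0 ≤ I := integral_nonneg fun x => (exp_pos _).le
  set P := 4 / 3 * (N * B + 1) ^ 2 * B with hP
  have hP0 : 0 ≤ P := by positivity
  rcases Nat.eq_zero_or_pos j with rfl | hj0
  · simp only [solitonWeight_zero, one_mul]
    rw [hV.integral_sq_eq hb (h3On_Icc hβ hV 0 b)]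
    exact le_add_of_nonneg_right (by positivity)
  simp only [solitonWeight_of_lt hj0 hj]
  set S : ℝ → ℝ → ℝ := fun t x => sigmoid (σ * (x - (a j + μ j * t))) with hSd
  have cS : Continuous (Function.uncurry S) := by
    have := contDiff_sigmoid.continuous
    simp only [hSd, Function.uncurry_def]
    fun_prop
  have hS : ∀ t x, HasDerivAt (S t) (σ * (S t x * (1 - S t x))) x := fun t x => by
    have h1 : HasDerivAt (fun x => σ * (x - (a j + μ j * t))) σ x := by
      simpa using ((hasDerivAt_id x).sub_const (a j + μ j * t)).const_mul σ
    exact ((hasDerivAt_sigmoid _).comp x h1).congr_deriv (by ring)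
  have hSt : ∀ t x, HasDerivAt (fun τ => S τ x) (-(μ j * (σ * (S t x * (1 - S t x))))) t :=
    fun t x => by
      have h1 : HasDerivAt (fun t => σ * (x - (a j + μ j * t))) (-(σ * μ j)) t := by
        have := ((((hasDerivAt_id t).const_mul (μ j)).const_add (a j)).const_sub x).const_mul σ
        exact this.congr_deriv (by ring)
      exact ((hasDerivAt_sigmoid _).comp t h1).congr_deriv (by ring)
  have hG : ∀ k t, Dec fun x => exp (-(σ * |x - X k t|)) := fun k t =>
    (dec_exp_neg_abs hσ).comp_sub (X k t)
  have key := hV.weighted_mass_le hβ (μ := μ j) hσ hb cS (fun t x => sigmoid_nonneg _)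
    (fun t x => sigmoid_le_one _) hS hSt
    (ρ := fun t x => P * σ * exp (-(σ * (ℓ + δ * t))) * ∑ k, exp (-(σ * |x - X k t|)))
    (F := fun t => -(P * N * I / δ * exp (-(σ * (ℓ + δ * t)))))
    (F' := fun t => P * σ * exp (-(σ * (ℓ + δ * t))) * (N * I))
    (fun t _ x => by positivity) (fun t _ => ((Dec.sum _ fun k _ => hG k t).const_mul _).integrable)
    (fun t _ => by
      rw [integral_const_mul, integral_finsetSum _ fun k _ => (hG k t).integrable]
      have h1 : ∀ k, ∫ x, exp (-(σ * |x - X k t|)) = I := fun k =>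
        integral_sub_right_eq_self (fun x => exp (-(σ * |x|))) (X k t)
      simp [h1])
    (fun t _ => by
      have h1 : HasDerivAt (fun t => -(σ * (ℓ + δ * t))) (-(σ * δ)) t := by
        have := ((((hasDerivAt_id t).const_mul δ).const_add ℓ).const_mul σ).neg
        exact this.congr_deriv (by ring)
      refine ((h1.exp.const_mul (P * N * I / δ)).neg).congr_deriv ?_
      field_simp)
    (fun t ht x => by
      have hsep := hX t ht
      have hg : ∀ k, Q k (x - X k t) ≤
          B * exp (-(σ * |x - X k t|)) * exp (-(σ * |x - X k t|)) := fun k => by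
        refine (hQ k _).trans_eq ?_
        rw [mul_assoc B, ← exp_add]
        ring_nf
      have hN : |V 0 t x| ≤ N * B + 1 := by
        have h1 : ∑ k, Q k (x - X k t) ≤ N * B := by
          have := Finset.sum_le_card_nsmul Finset.univ (fun k => Q k (x - X k t)) B
            fun k _ => (hQ k _).trans (mul_le_of_le_one_right hB (exp_le_one_iff.2 (by
              have := abs_nonneg (x - X k t)
              simp only [Left.neg_nonpos_iff]
              positivity)))
          simpa using this
        have h2 : 0 ≤ ∑ k, Q k (x - X k t) := Finset.sum_nonneg fun k _ => hQ0 k _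
        have h3 := abs_le.1 (hε t ht x)
        exact abs_le.2 ⟨by linarith, by linarith⟩
      exact interaction_le (B := B) (κ := κ) (P := N * B + 1) hσ.le hB
        (mul_nonneg (sigmoid_nonneg _) (sub_nonneg.2 (sigmoid_le_one _))) hN
        (by linarith [hμ hj0]) (fun k => hQ0 k _) hg (fun k => (exp_pos _).le) (hε t ht x)
        fun k => hsep.sigmoid_mul_exp_le hσ k hj0 hj x)
  have h1 : 0 ≤ P * N * I / δ * exp (-(σ * (ℓ + δ * b))) := by positivity
  simp only [mul_zero, add_zero] at key ⊢
  simp only [hSd, mul_zero, add_zero] at key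
  simp only [mul_comm (sigmoid _)]
  linarith

/-- Global solvability of a scalar ODE with a bounded and Lipschitz vector field. -/
theorem exists_global_solution {h : ℝ → ℝ → ℝ} {M K : NNReal} (hM : ∀ t x, |h t x| ≤ M)
    (hK : ∀ t, LipschitzWith K (h t)) (hc : ∀ x, Continuous fun t => h t x) (x₀ : ℝ) :
    ∃ X : ℝ → ℝ, X 0 = x₀ ∧ ∀ t, HasDerivAt X (h t (X t)) t := by
  have key : ∀ n : ℕ, ∃ α : ℝ → ℝ, α 0 = x₀ ∧
      ∀ t ∈ Set.Ioo (-((n : ℝ) + 1)) (n + 1), HasDerivAt α (h t (α t)) t := fun n => by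
    have h0 : (0 : ℝ) ∈ Set.Icc (-((n : ℝ) + 1)) (n + 1) := ⟨by linarith, by positivity⟩
    have hP : IsPicardLindelof h (⟨0, h0⟩ : Set.Icc (-((n : ℝ) + 1)) (n + 1)) x₀
        (M * (n + 1)) 0 M K :=
      { lipschitzOnWith := fun t _ => (hK t).lipschitzOnWith
        continuousOn := fun x _ => (hc x).continuousOn
        norm_le := fun t _ x _ => hM t x
        mul_max_le := by simp }
    obtain ⟨α, h1, h2⟩ := hP.exists_eq_forall_mem_Icc_hasDerivWithinAt₀
    exact ⟨α, h1, fun t ht => (h2 t ⟨ht.1.le, ht.2.le⟩).hasDerivAt (Icc_mem_nhds ht.1 ht.2)⟩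
  choose α hα0 hα using key
  have heq : ∀ m n : ℕ, ∀ t : ℝ, |t| < m + 1 → |t| < n + 1 → α m t = α n t := fun m n t hm hn => by
    have hr : 0 < min ((m : ℝ) + 1) (n + 1) := by positivity
    have hsub : ∀ s ∈ Set.Ioo (-min ((m : ℝ) + 1) (n + 1)) (min ((m : ℝ) + 1) (n + 1)),
        s ∈ Set.Ioo (-((m : ℝ) + 1)) (m + 1) ∧ s ∈ Set.Ioo (-((n : ℝ) + 1)) (n + 1) :=
      fun s hs => by
        have h1 := min_le_left ((m : ℝ) + 1) (n + 1)
        have h2 := min_le_right ((m : ℝ) + 1) (n + 1)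
        exact ⟨⟨by linarith [hs.1], by linarith [hs.2]⟩, ⟨by linarith [hs.1], by linarith [hs.2]⟩⟩
    refine ODE_solution_unique_of_mem_Ioo (v := h) (s := fun _ => Set.univ) (t₀ := 0)
      (fun t _ => (hK t).lipschitzOnWith) ⟨neg_neg_of_pos hr, hr⟩
      (fun s hs => ⟨hα m s (hsub s hs).1, trivial⟩) (fun s hs => ⟨hα n s (hsub s hs).2, trivial⟩)
      ((hα0 m).trans (hα0 n).symm) (abs_lt.1 (lt_min hm hn))
  refine ⟨fun t => α ⌈|t|⌉₊ t, hα0 _, fun t => ?_⟩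
  have ht : |t| < (⌈|t|⌉₊ : ℝ) + 1 := (Nat.le_ceil _).trans_lt (lt_add_one _)
  refine (hα _ t (abs_lt.1 ht)).congr_of_eventuallyEq ?_
  filter_upwards [Ioo_mem_nhds (abs_lt.1 ht).1 (abs_lt.1 ht).2] with s hs
  exact heq _ _ s ((Nat.le_ceil _).trans_lt (lt_add_one _)) (abs_lt.2 hs)

lemma continuous_of_abs_sub_le {f : ℝ → ℝ} (h : ∀ a b, ∃ D, ∀ s t, a ≤ s → s ≤ t → t ≤ b →
    |f t - f s| ≤ D * (t - s)) : Continuous f := by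
  refine continuous_iff_continuousAt.2 fun t₀ => ?_
  obtain ⟨D, hD⟩ := h (t₀ - 1) (t₀ + 1)
  have h1 : ∀ t ∈ Set.Ioo (t₀ - 1) (t₀ + 1), |f t - f t₀| ≤ D * |t - t₀| := fun t ht => by
    rcases le_total t₀ t with h2 | h2
    · rw [abs_of_nonneg (sub_nonneg.2 h2)]
      exact hD t₀ t (by linarith) h2 ht.2.le
    · rw [abs_sub_comm, abs_sub_comm t, abs_of_nonneg (sub_nonneg.2 h2)]
      exact hD t t₀ ht.1.le h2 (by linarith)
  rw [ContinuousAt, tendsto_iff_norm_sub_tendsto_zero]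
  refine squeeze_zero' (Eventually.of_forall fun t => norm_nonneg _)
    (eventually_of_mem (Ioo_mem_nhds (by linarith) (by linarith)) fun t ht => h1 t ht) ?_
  have h2 : Continuous fun t => D * |t - t₀| := by fun_prop
  simpa using h2.tendsto t₀

lemma Dec.l2On {g : ℝ → ℝ} (hg : Dec g) (S : Set ℝ) : L2On S fun _ => g :=
  ⟨fun _ => hg.1, ∫ x, g x ^ 2, fun _ _ => ⟨hg.sq.integrable, le_rfl⟩⟩

namespace GardnerFlow

variable {β : ℝ} {V : ℕ → ℝ → ℝ → ℝ}

lemma en_zero_eq (hβ : 0 < β) (hV : GardnerFlow β V) (t : ℝ) : en V 0 t = en V 0 0 := by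
  rcases le_total 0 t with h | h
  · exact hV.integral_sq_eq h (h3On_Icc hβ hV 0 t)
  · exact (hV.integral_sq_eq h (h3On_Icc hβ hV t 0)).symm

lemma continuous_integral_mul (hβ : 0 < β) (hV : GardnerFlow β V) {g g' : ℝ → ℝ}
    (hg : ∀ x, HasDerivAt g (g' x) x) (dg : Dec g) (dg' : Dec g') :
    Continuous fun t => ∫ x, V 0 t x * g x := by
  refine continuous_of_abs_sub_le fun a b => ?_
  have hH := h3On_Icc hβ hV a b
  have c := hV.cont_apply
  have cg := dg.1
  have cg' := dg'.1
  have l0 := hV.l2On hH (k := 0) (by norm_num)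
  have l2 := hV.l2On hH (k := 2) (by norm_num)
  have b0 := hV.bddOn hH (k := 0) (by norm_num)
  have l : L2On (Set.Icc a b) fun t x => V 2 t x + (V 0 t x - β * V 0 t x ^ 2) * V 0 t x :=
    l2.add ((b0.comp₂ b0 (G := fun p _ => p - β * p ^ 2) (by fun_prop)).mul_l2 l0)
  obtain ⟨cr, D, hD⟩ := l.mul (dg'.l2On (Set.Icc a b))
  refine ⟨D, fun s t hs hst ht => ?_⟩
  have hsub : Set.Icc s t ⊆ Set.Icc a b := Set.Icc_subset_Icc hs ht
  obtain ⟨cj, J, hJ⟩ := (l.mul (dg.l2On (Set.Icc a b))).neg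
  refine abs_integral_sub_le_of_flux (e := fun t x => V 0 t x * g x)
    (e' := fun t x => -(V 3 t x + (2 * V 0 t x - 3 * β * V 0 t x ^ 2) * V 1 t x) * g x)
    (r := fun t x => (V 2 t x + (V 0 t x - β * V 0 t x ^ 2) * V 0 t x) * g' x)
    (k := fun t x => 0) (k₁ := fun t x => 0) (k₂ := fun t x => 0)
    hst (by fun_prop) (by fun_prop) (fun t x => (hV.dt0 t x).mul_const (g x)) cr
    (fun t x => hasDerivAt_const x 0) (fun t x => hasDerivAt_const x 0) (fun t x => ?_)
    ⟨cj, J, fun t ht => hJ t (hsub ht)⟩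
    (L1On.zero _) (fun t ht => hD t (hsub ht)) ((hV.dec 0 s).mul dg).integrable
    ((hV.dec 0 t).mul dg).integrable
  have h1 := (((((hV.dx 2 t x).fun_add (((hV.dx 0 t x).fun_sub
    (((hV.dx 0 t x).fun_pow 2).const_mul β)).fun_mul (hV.dx 0 t x))).fun_mul (hg x)).fun_neg)).add_const 0
  refine h1.congr_deriv ?_
  simp only [Nat.reduceAdd]
  push_cast
  ring

end GardnerFlow

lemma abs_integral_mul_le_sqrt {f g : ℝ → ℝ} (hf : Dec f) (hg : Dec g) {A B : ℝ}
    (hA : ∫ x, f x ^ 2 ≤ A) (hB : ∫ x, g x ^ 2 ≤ B) : |∫ x, f x * g x| ≤ √(A * B) := by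
  have h0 : 0 ≤ ∫ x, g x ^ 2 := integral_nonneg fun x => sq_nonneg _
  have h1 : 0 ≤ A := (integral_nonneg fun x => sq_nonneg (f x)).trans hA
  refine Real.abs_le_sqrt ((sq_integral_mul_le hf.sq.integrable hg.sq.integrable
    (hf.mul hg).integrable).trans ?_)
  exact mul_le_mul hA hB h0 h1

lemma abs_integral_mul_translate_sub_le {f g g' : ℝ → ℝ} (hf : Dec f)
    (hg : ∀ x, HasDerivAt g (g' x) x) (dg : Dec g) (dg' : Dec g') {A : ℝ}
    (hA : ∫ x, f x ^ 2 ≤ A) (y z : ℝ) :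
    |(∫ x, f x * g (x - y)) - ∫ x, f x * g (x - z)| ≤ √(A * ∫ x, g' x ^ 2) * |y - z| := by
  wlog h : z < y generalizing y z
  · rcases eq_or_lt_of_le (not_lt.1 h) with h1 | h1
    · simp [h1]
    · rw [abs_sub_comm, abs_sub_comm y]
      exact this z y h1
  have d1 : ∀ a, Dec fun x => g (x - a) := fun a => dg.comp_sub a
  rw [← integral_sub (hf.mul (d1 y)).integrable (hf.mul (d1 z)).integrable, abs_sub_comm y,
    abs_of_neg (sub_neg.2 h)]
  simp only [← mul_sub]
  have h1 := integral_sq_diff_le (fun x => (hg (x - y)).comp_sub_const x y) (dg'.comp_sub y)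
    (sub_pos.2 h)
  rw [integral_sub_right_eq_self (fun x => g' x ^ 2) y] at h1
  simp only [show ∀ x, x + (y - z) - y = x - z from fun x => by ring] at h1
  have h2 : ∫ x, (g (x - y) - g (x - z)) ^ 2 ≤ (y - z) ^ 2 * ∫ x, g' x ^ 2 := by
    refine le_trans (le_of_eq ?_) h1
    congr 1; ext x; ring
  refine (abs_integral_mul_le_sqrt hf ((d1 y).sub (d1 z)) hA h2).trans_eq ?_
  rw [show A * ((y - z) ^ 2 * ∫ x, g' x ^ 2) = A * (∫ x, g' x ^ 2) * (y - z) ^ 2 by ring,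
    Real.sqrt_mul' _ (sq_nonneg _), Real.sqrt_sq (sub_pos.2 h).le]
  ring

/-- The modulated trajectory of a soliton. -/
theorem exists_modulation {β c : ℝ} {V : ℕ → ℝ → ℝ → ℝ} (hβ : 0 < β) (hV : GardnerFlow β V)
    {Q Q' : ℝ → ℝ} (hQ : IsSoliton β c Q Q') (hc : 0 < c) (K x₀ : ℝ) :
    ∃ X : ℝ → ℝ, X 0 = x₀ ∧ ContDiff ℝ 1 X ∧
      ∀ t, HasDerivAt X (c - K * ∫ x, V 0 t x * Q' (x - X t)) t := by
  have dQ' := hQ.dec_deriv hc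
  have dQ'' := hQ.dec_deriv₂ hβ hc
  have hA : ∀ t, ∫ x, V 0 t x ^ 2 ≤ en V 0 0 := fun t => (hV.en_zero_eq hβ t).le
  set h : ℝ → ℝ → ℝ := fun t y => c - K * ∫ x, V 0 t x * Q' (x - y) with hh
  have hM : ∀ t y, |h t y| ≤ |c| + |K| * √(en V 0 0 * ∫ x, Q' x ^ 2) := fun t y => by
    have h1 := abs_integral_mul_le_sqrt (hV.dec 0 t) (dQ'.comp_sub y) (hA t)
      (integral_sub_right_eq_self (fun x => Q' x ^ 2) y).le
    refine (abs_sub _ _).trans (add_le_add le_rfl ?_)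
    rw [abs_mul]
    exact mul_le_mul_of_nonneg_left h1 (abs_nonneg K)
  have hL : ∀ t, LipschitzWith (|K| * √(en V 0 0 * ∫ x, (c * Q x - Q x ^ 2 + β * Q x ^ 3) ^ 2)).toNNReal
      (h t) := fun t => LipschitzWith.of_dist_le_mul fun y z => by
    rw [Real.coe_toNNReal _ (by positivity), Real.dist_eq, Real.dist_eq, mul_assoc]
    have h1 := abs_integral_mul_translate_sub_le (hV.dec 0 t) hQ.d1 dQ' dQ'' (hA t) y z
    rw [show h t y - h t z = -(K * ((∫ x, V 0 t x * Q' (x - y)) - ∫ x, V 0 t x * Q' (x - z))) by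
      simp only [hh]; ring, abs_neg, abs_mul]
    exact mul_le_mul_of_nonneg_left h1 (abs_nonneg K)
  have hcont : ∀ y, Continuous fun t => h t y := fun y => continuous_const.sub
    (continuous_const.mul (hV.continuous_integral_mul hβ
      (fun x => (hQ.d1 (x - y)).comp_sub_const x y) (dQ'.comp_sub y) (dQ''.comp_sub y)))
  obtain ⟨X, hX0, hX⟩ := exists_global_solution (M := (|c| + |K| * √(en V 0 0 * ∫ x, Q' x ^ 2)).toNNReal)
    (fun t y => by rw [Real.coe_toNNReal _ (by positivity)]; exact hM t y) hL hcont x₀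
  refine ⟨X, hX0, contDiff_one_iff_deriv.2 ⟨fun t => (hX t).differentiableAt, ?_⟩, hX⟩
  have h1 : Continuous (Function.uncurry h) :=
    continuous_prod_of_continuous_lipschitzWith' _ _ hL hcont
  rw [show deriv X = fun t => h t (X t) from funext fun t => (hX t).deriv]
  have h2 : Continuous X := continuous_iff_continuousAt.2 fun t => (hX t).continuousAt
  exact h1.comp (continuous_id.prodMk h2)

lemma Dec.l2On_translate {g : ℝ → ℝ} (hg : Dec g) (X : ℝ → ℝ) (S : Set ℝ) :
    L2On S fun t x => g (x - X t) :=
  ⟨fun t => (hg.comp_sub (X t)).1, ∫ x, g x ^ 2, fun t _ => ⟨(hg.comp_sub (X t)).sq.integrable,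
    (integral_sub_right_eq_self (fun x => g x ^ 2) (X t)).le⟩⟩

lemma BddOn.of_continuous {Y : ℝ → ℝ} (hY : Continuous Y) (a b : ℝ) :
    BddOn (Set.Icc a b) fun t _ => Y t := by
  obtain ⟨C, hC⟩ := (isCompact_Icc (a := a) (b := b)).exists_bound_of_continuousOn hY.continuousOn
  exact ⟨fun t => continuous_const, C, fun t ht _ => hC t ht⟩

section Direction

variable {β c : ℝ} {V : ℕ → ℝ → ℝ → ℝ} {Q Q' X Y : ℝ → ℝ}

/-- Evolution of the translational direction of a modulated soliton. -/
lemma GardnerFlow.abs_direction_sub_le (hβ : 0 < β) (hV : GardnerFlow β V)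
    (hQ : IsSoliton β c Q Q') (hc : 0 < c)
    (hX : ∀ t, HasDerivAt X (Y t) t) (hY : Continuous Y) {a b D : ℝ} (hab : a ≤ b)
    {q q' q₂ q₃ q₄ : ℝ → ℝ → ℝ} (hq : q = fun t x => Q (x - X t))
    (hq' : q' = fun t x => Q' (x - X t))
    (hq₂ : q₂ = fun t x => c * q t x - q t x ^ 2 + β * q t x ^ 3)
    (hq₃ : q₃ = fun t x => (c - 2 * q t x + 3 * β * q t x ^ 2) * q' t x)
    (hq₄ : q₄ = fun t x => (c - 2 * q t x + 3 * β * q t x ^ 2) * q₂ t x +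
      (-2 + 6 * β * q t x) * q' t x ^ 2)
    (hD : ∀ t ∈ Set.Icc a b, ∫ x, |(V 0 t x - q t x) * (q₄ t x - Y t * q₂ t x +
      (V 0 t x + q t x - β * (V 0 t x ^ 2 + V 0 t x * q t x + q t x ^ 2)) * q₂ t x)| ≤ D) :
    |((∫ x, V 0 b x * q' b x) + (c * b - X b) * ∫ x, Q' x ^ 2) -
      ((∫ x, V 0 a x * q' a x) + (c * a - X a) * ∫ x, Q' x ^ 2)| ≤ D * (b - a) := by
  have hH := h3On_Icc hβ hV a b
  have c1 := hV.cont
  have c2 := hV.cont_apply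
  have cQ := hQ.continuous
  have cQ' := hQ.continuous'
  have cX : Continuous X := continuous_iff_continuousAt.2 fun t => (hX t).continuousAt
  have dQ' := hQ.dec_deriv hc
  have l0 := hV.l2On hH (k := 0) (by norm_num)
  have l1 := hV.l2On hH (k := 1) (by norm_num)
  have l2 := hV.l2On hH (k := 2) (by norm_num)
  have b0 := hV.bddOn hH (k := 0) (by norm_num)
  have lq : L2On (Set.Icc a b) q := hq ▸ (hQ.dec hc).l2On_translate X _
  have lq' : L2On (Set.Icc a b) q' := hq' ▸ dQ'.l2On_translate X _
  have lq2 : L2On (Set.Icc a b) q₂ := by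
    rw [hq₂, hq]; exact (hQ.dec_deriv₂ hβ hc).l2On_translate X _
  have bq : BddOn (Set.Icc a b) q := by
    obtain ⟨M, hM⟩ := (hQ.dec hc).bounded
    rw [hq]
    exact ⟨fun t => ((hQ.dec hc).comp_sub (X t)).1, M, fun t _ x => hM.2 _⟩
  have bq' : BddOn (Set.Icc a b) q' := by
    obtain ⟨M, hM⟩ := dQ'.bounded
    rw [hq']
    exact ⟨fun t => (dQ'.comp_sub (X t)).1, M, fun t _ x => hM.2 _⟩
  have bY := BddOn.of_continuous hY a b
  have bZ := BddOn.of_continuous (Y := fun t => c - Y t) (by fun_prop) a b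
  have bT := BddOn.of_continuous (Y := fun t => -((c * t - X t) * Y t)) (by fun_prop) a b
  have bp : BddOn (Set.Icc a b) fun t x => c - 2 * q t x + 3 * β * q t x ^ 2 :=
    bq.comp₂ bq (G := fun p _ => c - 2 * p + 3 * β * p ^ 2) (by fun_prop)
  have lq3 : L2On (Set.Icc a b) q₃ := hq₃ ▸ bp.mul_l2 lq'
  have lq4 : L2On (Set.Icc a b) q₄ := by
    rw [hq₄]
    refine (bp.mul_l2 lq2).add ?_
    have := ((bq.comp₂ bq' (G := fun p r => (-2 + 6 * β * p) * r) (by fun_prop))).mul_l2 lq'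
    simpa only [pow_two, mul_assoc] using this
  have lW := l0.sub lq
  have lWx := l1.sub lq'
  have dq : ∀ t x, HasDerivAt (q t) (q' t x) x := fun t x => by
    simp only [hq, hq']; exact (hQ.d0 (x - X t)).comp_sub_const x (X t)
  have dq' : ∀ t x, HasDerivAt (q' t) (q₂ t x) x := fun t x => by
    simp only [hq₂, hq, hq']; exact (hQ.d1 (x - X t)).comp_sub_const x (X t)
  have dq2 : ∀ t x, HasDerivAt (q₂ t) (q₃ t x) x := fun t x => by
    rw [hq₂, hq₃]
    refine ((((dq t x).const_mul c).fun_sub ((dq t x).fun_pow 2)).fun_add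
      (((dq t x).fun_pow 3).const_mul β)).congr_deriv ?_
    push_cast; ring
  have dq3 : ∀ t x, HasDerivAt (q₃ t) (q₄ t x) x := fun t x => by
    rw [hq₃, hq₄]
    refine ((((((dq t x).const_mul 2).const_sub c).fun_add
      (((dq t x).fun_pow 2).const_mul (3 * β)))).fun_mul (dq' t x)).congr_deriv ?_
    push_cast; ring
  have tq' : ∀ t x, HasDerivAt (fun τ => q' τ x) (-(Y t * q₂ t x)) t := fun t x => by
    simp only [hq', hq₂, hq]
    refine ((hQ.d1 (x - X t)).comp t ((hX t).const_sub x)).congr_deriv ?_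
    ring
  have uq : Continuous (Function.uncurry q) := by rw [hq]; fun_prop
  have uq' : Continuous (Function.uncurry q') := by rw [hq']; fun_prop
  have uq2 : Continuous (Function.uncurry q₂) := by rw [hq₂]; fun_prop
  have i1 : ∀ t, Integrable fun x => V 0 t x * q' t x := fun t => by
    rw [hq']; exact ((hV.dec 0 t).mul (dQ'.comp_sub (X t))).integrable
  have i2 : ∀ t, Integrable fun x => (c * t - X t) * q' t x ^ 2 := fun t => by
    rw [hq']; exact ((dQ'.comp_sub (X t)).sq.const_mul _).integrable
  have hG : ∀ t, ∫ x, (V 0 t x * q' t x + (c * t - X t) * q' t x ^ 2) =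
      (∫ x, V 0 t x * q' t x) + (c * t - X t) * ∫ x, Q' x ^ 2 := fun t => by
    rw [integral_add (i1 t) (i2 t), integral_const_mul, hq',
      integral_sub_right_eq_self (fun x => Q' x ^ 2) (X t)]
  rw [← hG, ← hG]
  have br : BddOn (Set.Icc a b) fun t x =>
      V 0 t x + q t x - β * (V 0 t x ^ 2 + V 0 t x * q t x + q t x ^ 2) :=
    b0.comp₂ bq (G := fun u p => u + p - β * (u ^ 2 + u * p + p ^ 2)) (by fun_prop)
  have lr := lW.mul ((lq4.sub (bY.mul_l2 lq2)).add (br.mul_l2 lq2))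
  have lf := (l2.add ((b0.comp₂ b0 (G := fun p _ => p - β * p ^ 2) (by fun_prop)).mul_l2 l0)).mul lq'
  have lj := ((lf.neg.add ((lWx.mul lq2).sub (lW.mul lq3))).add (bZ.mul_l1 (lq.mul lq'))).add
    (bT.mul_l1 (lq'.mul lq'))
  have hri : ∀ t ∈ Set.Icc a b, Integrable fun x => (V 0 t x - q t x) * (q₄ t x - Y t * q₂ t x +
      (V 0 t x + q t x - β * (V 0 t x ^ 2 + V 0 t x * q t x + q t x ^ 2)) * q₂ t x) := fun t ht => by
    obtain ⟨-, C, hC⟩ := lr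
    exact (hC t ht).1
  refine abs_integral_sub_le_of_flux
    (e := fun t x => V 0 t x * q' t x + (c * t - X t) * q' t x ^ 2)
    (e' := fun t x => -(V 3 t x + (2 * V 0 t x - 3 * β * V 0 t x ^ 2) * V 1 t x) * q' t x +
      V 0 t x * (-(Y t * q₂ t x)) + ((c - Y t) * q' t x ^ 2 +
        (c * t - X t) * (2 * q' t x * (-(Y t * q₂ t x)))))
    (k := fun t x => 0) (k₁ := fun t x => 0) (k₂ := fun t x => 0) hab
    (by fun_prop) (by fun_prop) (fun t x => ?_) lr.1
    (fun t x => hasDerivAt_const x 0) (fun t x => hasDerivAt_const x 0) (fun t x => ?_)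
    lj (L1On.zero _) (fun t ht => ⟨hri t ht, hD t ht⟩) ((i1 a).fun_add (i2 a)) ((i1 b).fun_add (i2 b))
  · refine (((hV.dt0 t x).fun_mul (tq' t x)).fun_add
      ((((hasDerivAt_id' t).const_mul c).fun_sub (hX t)).fun_mul
        ((tq' t x).fun_pow 2))).congr_deriv ?_
    push_cast; ring
  · have v0 := hV.dx 0 t x
    have hW := v0.fun_sub (dq t x)
    have hWx := (hV.dx 1 t x).fun_sub (dq' t x)
    have hf := (((hV.dx 2 t x).fun_add ((v0.fun_sub
      ((v0.fun_pow 2).const_mul β)).fun_mul v0)).fun_mul (dq' t x)).fun_neg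
    have hj := ((hf.fun_add ((hWx.fun_mul (dq2 t x)).fun_sub (hW.fun_mul (dq3 t x)))).fun_add
      (((dq t x).fun_mul (dq' t x)).const_mul (c - Y t))).fun_add
      (((dq' t x).fun_mul (dq' t x)).const_mul (-((c * t - X t) * Y t)))
    refine (hj.add_const 0).congr_deriv ?_
    simp only [Nat.reduceAdd]
    have e2 : q₂ t x = c * q t x - q t x ^ 2 + β * q t x ^ 3 := by rw [hq₂]
    generalize q₃ t x = z3, q₄ t x = z4 at *
    push_cast
    generalize V 0 t x = u0, V 1 t x = u1, V 2 t x = u2, V 3 t x = u3, q t x = z0, q' t x = z1 at *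
    rw [e2]
    ring

end Direction

lemma GardnerFlow.exists_direction_bound {β c : ℝ} {Q Q' : ℝ → ℝ} (hβ : 0 < β)
    (hQ : IsSoliton β c Q Q') (hc : 0 < c) {M : ℝ} (hM : 0 ≤ M) :
    ∃ C, 0 ≤ C ∧ ∀ (V : ℕ → ℝ → ℝ → ℝ) (X Y : ℝ → ℝ), GardnerFlow β V →
      (∀ t, HasDerivAt X (Y t) t) → Continuous Y → ∀ a b D : ℝ, a ≤ b →
      (∀ t ∈ Set.Icc a b, (∀ x, |V 0 t x| ≤ M) ∧ |Y t| ≤ M ∧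
        ∫ x, |V 0 t x - Q (x - X t)| * Q (x - X t) ≤ D) →
      |((∫ x, V 0 b x * Q' (x - X b)) + (c * b - X b) * ∫ x, Q' x ^ 2) -
        ((∫ x, V 0 a x * Q' (x - X a)) + (c * a - X a) * ∫ x, Q' x ^ 2)| ≤ C * D * (b - a) := by
  obtain ⟨S, hS, hQS⟩ := (hQ.dec hc).bounded
  have hQS : ∀ x, Q x ≤ S := fun x => (le_abs_self _).trans (hQS x)
  set B := c + 1 / β with hB
  have hB0 : 0 ≤ B := by positivity
  set B₂ := (c + 2 * S + 3 * β * S ^ 2) * B + (2 + 6 * β * S) * c * S with hB₂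
  have hB₂0 : 0 ≤ B₂ := by positivity
  set C := B₂ + M * B + (M + S + β * (M ^ 2 + M * S + S ^ 2)) * B with hC
  have hC0 : 0 ≤ C := by positivity
  refine ⟨C, hC0, fun V X Y hV hX hY a b D hab h => ?_⟩
  refine hV.abs_direction_sub_le hβ hQ hc hX hY hab rfl rfl rfl rfl rfl fun t ht => ?_
  obtain ⟨hVM, hYM, hD⟩ := h t ht
  have dW := ((hV.dec 0 t).sub ((hQ.dec hc).comp_sub (X t))).abs.mul ((hQ.dec hc).comp_sub (X t))
  refine le_trans (integral_mono_of_nonneg (Eventually.of_forall fun x => abs_nonneg _)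
    (dW.const_mul C).integrable (Eventually.of_forall fun x => ?_))
    ((integral_const_mul C _).trans_le (mul_le_mul_of_nonneg_left hD hC0))
  have h0 := hQ.pos (x - X t)
  have h1 := hQS (x - X t)
  have h2 := hQ.abs_deriv₂_le hβ hc (x - X t)
  have h3 := hQ.abs_deriv_le hc (x - X t)
  have h4 := hVM x
  simp only
  rw [← hB] at h2
  generalize Q (x - X t) = p, Q' (x - X t) = p', V 0 t x = u, Y t = y at *
  generalize c * p - p ^ 2 + β * p ^ 3 = p₂ at *
  have e1 : |c - 2 * p + 3 * β * p ^ 2| ≤ c + 2 * S + 3 * β * S ^ 2 := by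
    have : 3 * β * p ^ 2 ≤ 3 * β * S ^ 2 := by gcongr
    have : 0 ≤ 3 * β * p ^ 2 := by positivity
    exact abs_le.2 ⟨by linarith [show 0 ≤ 3 * β * S ^ 2 by positivity], by linarith⟩
  have e2 : |-2 + 6 * β * p| ≤ 2 + 6 * β * S := by
    have : 6 * β * p ≤ 6 * β * S := by gcongr
    have : 0 ≤ 6 * β * p := by positivity
    exact abs_le.2 ⟨by linarith, by linarith⟩
  have e3 : p' ^ 2 ≤ c * S * p := by
    have h5 := mul_le_mul h3 h3 (abs_nonneg _) (by positivity)
    rw [abs_mul_abs_self] at h5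
    nlinarith [Real.mul_self_sqrt hc.le, mul_le_mul_of_nonneg_left h1 (mul_pos hc h0).le]
  have e4 : |(c - 2 * p + 3 * β * p ^ 2) * p₂ + (-2 + 6 * β * p) * p' ^ 2| ≤ B₂ * p := by
    refine (abs_add_le _ _).trans ?_
    rw [abs_mul, abs_mul, abs_of_nonneg (sq_nonneg p'), hB₂, add_mul, mul_assoc _ B,
      mul_assoc (2 + 6 * β * S), mul_assoc (2 + 6 * β * S)]
    exact add_le_add (mul_le_mul e1 h2 (abs_nonneg _) (by positivity))
      (mul_le_mul e2 e3 (sq_nonneg _) (by positivity))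
  have e5 : |y * p₂| ≤ M * B * p := by
    rw [abs_mul, mul_assoc]
    exact mul_le_mul hYM h2 (abs_nonneg _) hM
  have e6 : |u + p - β * (u ^ 2 + u * p + p ^ 2)| ≤ M + S + β * (M ^ 2 + M * S + S ^ 2) := by
    have hp : |p| ≤ S := (abs_of_pos h0).trans_le h1
    have q1 : |u ^ 2| ≤ M ^ 2 := by rw [abs_pow]; gcongr
    have q2 : |u * p| ≤ M * S := by rw [abs_mul]; exact mul_le_mul h4 hp (abs_nonneg _) hM
    have q3 : |p ^ 2| ≤ S ^ 2 := by rw [abs_pow]; gcongr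
    have q4 : |β * (u ^ 2 + u * p + p ^ 2)| ≤ β * (M ^ 2 + M * S + S ^ 2) := by
      rw [abs_mul, abs_of_pos hβ]
      exact mul_le_mul_of_nonneg_left ((abs_add_le _ _).trans
        (add_le_add ((abs_add_le _ _).trans (add_le_add q1 q2)) q3)) hβ.le
    exact (abs_sub _ _).trans (add_le_add ((abs_add_le _ _).trans (add_le_add h4 hp)) q4)
  have e7 : |(u + p - β * (u ^ 2 + u * p + p ^ 2)) * p₂| ≤
      (M + S + β * (M ^ 2 + M * S + S ^ 2)) * B * p := by
    rw [abs_mul, mul_assoc _ B]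
    exact mul_le_mul e6 h2 (abs_nonneg _) (by positivity)
  rw [abs_mul, mul_left_comm]
  refine mul_le_mul_of_nonneg_left ?_ (abs_nonneg _)
  refine (abs_add_le _ _).trans ((add_le_add ((abs_sub _ _).trans (add_le_add e4 e5)) e7).trans_eq ?_)
  rw [hC]; ring

/-- A quantity driven by linear feedback stays small. -/
lemma le_of_feedback {c κ K D b : ℝ} {g X : ℝ → ℝ} (hκ : 0 < κ) (hK : 0 < K) (hD : 0 ≤ D)
    (hg : Continuous g) (hX : ∀ t, HasDerivAt X (c - K * g t) t)
    (h : ∀ s t, 0 ≤ s → s ≤ t → t ≤ b →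
      (g t + (c * t - X t) * κ) - (g s + (c * s - X s) * κ) ≤ D * (t - s))
    {t : ℝ} (ht : t ∈ Set.Icc 0 b) : g t ≤ max (g 0) 0 + D / (K * κ) := by
  set M := max (g 0) 0 + D / (K * κ) with hM
  have hM0 : g 0 ≤ M := (le_max_left _ _).trans (le_add_of_nonneg_right (by positivity))
  have hM1 : D ≤ κ * (K * M) := by
    have h1 : D / (K * κ) ≤ M := le_add_of_nonneg_left (le_max_right _ _)
    rw [div_le_iff₀ (by positivity)] at h1
    linarith
  have hc : IsCompact (Set.Icc 0 t ∩ {s | g s ≤ M}) :=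
    isCompact_Icc.inter_right (isClosed_le hg continuous_const)
  obtain ⟨s, ⟨hs, hsM⟩, hmax⟩ := hc.exists_isGreatest ⟨0, ⟨le_rfl, ht.1⟩, hM0⟩
  have h1 : K * M * (t - s) ≤ (c * t - X t) - (c * s - X s) := by
    have hd : ∀ r, HasDerivAt (fun r => c * r - X r) (K * g r) r := fun r => by
      refine (((hasDerivAt_id' r).const_mul c).fun_sub (hX r)).congr_deriv ?_
      ring
    refine (convex_Icc s t).mul_sub_le_image_sub_of_le_deriv
      (fun r _ => (hd r).continuousAt.continuousWithinAt)
      (fun r _ => (hd r).differentiableAt.differentiableWithinAt) (fun r hr => ?_)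
      s (Set.left_mem_Icc.2 hs.2) t (Set.right_mem_Icc.2 hs.2) hs.2
    rw [interior_Icc] at hr
    rw [(hd r).deriv]
    refine mul_le_mul_of_nonneg_left (not_lt.1 fun h2 => ?_) hK.le
    exact absurd (hmax ⟨⟨hs.1.trans hr.1.le, hr.2.le⟩, h2.le⟩) (not_le.2 hr.1)
  have h2 := h s t hs.1 hs.2 ht.2
  have h3 := mul_le_mul_of_nonneg_left h1 hκ.le
  have h4 := mul_le_mul_of_nonneg_right hM1 (sub_nonneg.2 hs.2)
  have h5 : g s ≤ M := hsM
  nlinarith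

lemma abs_le_of_feedback {c κ K D b : ℝ} {g X : ℝ → ℝ} (hκ : 0 < κ) (hK : 0 < K) (hD : 0 ≤ D)
    (hg : Continuous g) (hX : ∀ t, HasDerivAt X (c - K * g t) t)
    (h : ∀ s t, 0 ≤ s → s ≤ t → t ≤ b →
      |(g t + (c * t - X t) * κ) - (g s + (c * s - X s) * κ)| ≤ D * (t - s))
    {t : ℝ} (ht : t ∈ Set.Icc 0 b) : |g t| ≤ |g 0| + D / (K * κ) := by
  have h0 : ∀ z : ℝ, max z 0 ≤ |z| := fun z => max_le (le_abs_self z) (abs_nonneg z)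
  refine abs_le.2 ⟨?_, (le_of_feedback hκ hK hD hg hX (fun s t h1 h2 h3 =>
    (le_abs_self _).trans (h s t h1 h2 h3)) ht).trans (by gcongr; exact h0 _)⟩
  have h1 := le_of_feedback (g := fun t => -g t) (X := fun t => -X t) (c := -c) hκ hK hD hg.neg
    (fun t => (hX t).fun_neg.congr_deriv (by ring)) (fun s t h1 h2 h3 => by
      have := (neg_le_abs _).trans (h s t h1 h2 h3)
      linarith) ht
  have h2 := h0 (-g 0)
  rw [abs_neg] at h2
  linarith

lemma L2On.sum {ι : Type*} {S : Set ℝ} {f : ι → ℝ → ℝ → ℝ} (s : Finset ι)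
    (h : ∀ i, L2On S (f i)) : L2On S fun t x => ∑ i ∈ s, f i t x := by
  classical
  induction s using Finset.induction_on with
  | empty =>
    simp only [Finset.sum_empty]
    exact Dec.zero.l2On S
  | insert i s hi ih =>
    simp only [Finset.sum_insert hi]
    exact (h i).add ih

/-- The `H¹` distance between a solution and a moving sum of solitons is continuous in time. -/
lemma GardnerFlow.continuous_deviation {N : ℕ} {β : ℝ} {c : Fin N → ℝ} {V : ℕ → ℝ → ℝ → ℝ}
    {Q Q' : Fin N → ℝ → ℝ} {X Y : Fin N → ℝ → ℝ} (hβ : 0 < β) (hV : GardnerFlow β V)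
    (hQ : ∀ k, IsSoliton β (c k) (Q k) (Q' k)) (hc : ∀ k, 0 < c k)
    (hX : ∀ k t, HasDerivAt (X k) (Y k t) t) (hY : ∀ k, Continuous (Y k)) :
    Continuous fun t => ∫ x, ((V 0 t x - ∑ k, Q k (x - X k t)) ^ 2 +
      (V 1 t x - ∑ k, Q' k (x - X k t)) ^ 2) := by
  refine continuous_of_abs_sub_le fun a b => ?_
  have hH := h3On_Icc hβ hV a b
  have c1 := hV.cont
  have c2 := hV.cont_apply
  have cQ := fun k => (hQ k).continuous
  have cQ' := fun k => (hQ k).continuous'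
  have cX : ∀ k, Continuous (X k) := fun k =>
    continuous_iff_continuousAt.2 fun t => (hX k t).continuousAt
  obtain ⟨Q₂, hQ₂⟩ : ∃ Q₂ : Fin N → ℝ → ℝ, ∀ k x,
      Q₂ k x = c k * Q k x - Q k x ^ 2 + β * Q k x ^ 3 := ⟨_, fun _ _ => rfl⟩
  have dQ := fun k => (hQ k).dec (hc k)
  have dQ' := fun k => (hQ k).dec_deriv (hc k)
  have dQ2 : ∀ k, Dec (Q₂ k) := fun k => by
    rw [show Q₂ k = _ from funext (hQ₂ k)]; exact (hQ k).dec_deriv₂ hβ (hc k)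
  have cQ2 := fun k => (dQ2 k).1
  have d1 : ∀ k x, HasDerivAt (Q' k) (Q₂ k x) x := fun k x => hQ₂ k x ▸ (hQ k).d1 x
  have l0 := hV.l2On hH (k := 0) (by norm_num)
  have l1 := hV.l2On hH (k := 1) (by norm_num)
  have l2 := hV.l2On hH (k := 2) (by norm_num)
  have l3 := hV.l2On hH (k := 3) (by norm_num)
  have b0 := hV.bddOn hH (k := 0) (by norm_num)
  have lR := L2On.sum Finset.univ fun k => (dQ k).l2On_translate (X k) (Set.Icc a b)
  have lR1 := L2On.sum Finset.univ fun k => (dQ' k).l2On_translate (X k) (Set.Icc a b)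
  have lR2 := L2On.sum Finset.univ fun k => (dQ2 k).l2On_translate (X k) (Set.Icc a b)
  have lS := L2On.sum Finset.univ fun k => (BddOn.of_continuous (hY k) a b).mul_l2
    ((dQ' k).l2On_translate (X k) (Set.Icc a b))
  have lε := l0.sub lR
  have lε1 := l1.sub lR1
  have lε2 := l2.sub lR2
  have lεt := ((l3.add ((b0.comp₂ b0 (G := fun p _ => 2 * p - 3 * β * p ^ 2)
    (by fun_prop)).mul_l2 l1)).const_mul (-1)).add lS
  obtain ⟨cr, D, hD⟩ := ((lε.sub lε2).mul lεt).const_mul 2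
  obtain ⟨cj, J, hJ⟩ := (lε1.mul lεt).const_mul 2
  refine ⟨D, fun s t hs hst ht => ?_⟩
  have hsub : Set.Icc s t ⊆ Set.Icc a b := Set.Icc_subset_Icc hs ht
  have hi : ∀ t, Integrable fun x => (V 0 t x - ∑ k, Q k (x - X k t)) ^ 2 +
      (V 1 t x - ∑ k, Q' k (x - X k t)) ^ 2 := fun t =>
    (((hV.dec 0 t).sub (Dec.sum _ fun k _ => (dQ k).comp_sub (X k t))).sq.add
      ((hV.dec 1 t).sub (Dec.sum _ fun k _ => (dQ' k).comp_sub (X k t))).sq).integrable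
  refine abs_integral_sub_le_of_flux
    (e := fun t x => (V 0 t x - ∑ k, Q k (x - X k t)) ^ 2 + (V 1 t x - ∑ k, Q' k (x - X k t)) ^ 2)
    (e' := fun t x => 2 * (V 0 t x - ∑ k, Q k (x - X k t)) *
        (-1 * (V 3 t x + (2 * V 0 t x - 3 * β * V 0 t x ^ 2) * V 1 t x) +
          ∑ k, Y k t * Q' k (x - X k t)) +
      2 * (V 1 t x - ∑ k, Q' k (x - X k t)) * (-1 * (V 4 t x + (2 * V 0 t x - 3 * β * V 0 t x ^ 2) *
        V 2 t x + (2 - 6 * β * V 0 t x) * V 1 t x ^ 2) + ∑ k, Y k t * Q₂ k (x - X k t)))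
    (k := fun t x => 0) (k₁ := fun t x => 0) (k₂ := fun t x => 0) hst
    (by fun_prop) (by fun_prop) (fun t x => ?_) cr
    (fun t x => hasDerivAt_const x 0) (fun t x => hasDerivAt_const x 0) (fun t x => ?_)
    ⟨cj, J, fun t ht => hJ t (hsub ht)⟩ (L1On.zero _) (fun t ht => hD t (hsub ht)) (hi s) (hi t)
  · have tR := HasDerivAt.fun_sum (u := Finset.univ) fun k _ =>
      ((hQ k).d0 (x - X k t)).comp t ((hX k t).const_sub x)
    have tR1 := HasDerivAt.fun_sum (u := Finset.univ) fun k _ =>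
      (d1 k (x - X k t)).comp t ((hX k t).const_sub x)
    simp only [Function.comp_def] at tR tR1
    refine ((((hV.dt0 t x).fun_sub tR).fun_pow 2).fun_add
      (((hV.dt1 t x).fun_sub tR1).fun_pow 2)).congr_deriv ?_
    simp only [mul_neg, Finset.sum_neg_distrib, sub_neg_eq_add, mul_comm (Y _ t)]
    push_cast; ring
  · have xR := HasDerivAt.fun_sum (u := Finset.univ) fun k _ =>
      ((hQ k).d0 (x - X k t)).comp_sub_const x (X k t)
    have xR1 := HasDerivAt.fun_sum (u := Finset.univ) fun k _ =>
      (d1 k (x - X k t)).comp_sub_const x (X k t)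
    have xS := HasDerivAt.fun_sum (u := Finset.univ) fun k _ =>
      ((d1 k (x - X k t)).comp_sub_const x (X k t)).const_mul (Y k t)
    have v0 := hV.dx 0 t x
    have h1 := ((((hV.dx 1 t x).fun_sub xR1).fun_mul ((((hV.dx 3 t x).fun_add
      (((v0.const_mul 2).fun_sub ((v0.fun_pow 2).const_mul (3 * β))).fun_mul
        (hV.dx 1 t x))).const_mul (-1)).fun_add xS)).const_mul 2).add_const 0
    refine h1.congr_deriv ?_
    simp only [Nat.reduceAdd]
    push_cast
    ring

namespace Frame

variable {N : ℕ} {β B l σ e : ℝ} {c : Fin N → ℝ} {q q' G φ φ' : Fin N → ℝ → ℝ}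

lemma mono (h : Frame β c B l σ e q q' G φ φ') {e₁ : ℝ} (he : e ≤ e₁) (he₁ : e₁ ≤ 1) :
    Frame β c B l σ e₁ q q' G φ φ' :=
  { h with
    e_nonneg := h.e_nonneg.trans he
    e_le := he₁
    φ_mul_le := fun j k hjk x => (h.φ_mul_le j k hjk x).trans
      (mul_le_mul_of_nonneg_right he (h.G_nonneg k x))
    mul_le := fun j k hjk x => (h.mul_le j k hjk x).trans
      (mul_le_mul_of_nonneg_right he (h.G_nonneg k x)) }

lemma integral_mul_le (h : Frame β c B l σ e q q' G φ φ') {j k : Fin N} (hjk : j ≠ k) :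
    ∫ x, q j x * q k x ≤ e * B :=
  (integral_mono ((h.dec j).mul (h.dec k)).integrable ((h.G_dec k).const_mul e).integrable
    (h.mul_le j k hjk)).trans ((integral_const_mul e _).trans_le
      (mul_le_mul_of_nonneg_left (h.integral_G k) h.e_nonneg))

lemma abs_integral_sum_mul_deriv_le (h : Frame β c B l σ e q q' G φ φ') (k : Fin N) :
    |∫ x, (∑ j, q j x) * q' k x| ≤ N * (B * (e * B)) := by
  simp only [Finset.sum_mul]
  rw [integral_finsetSum _ fun j _ => ((h.dec j).mul (h.dec' k)).integrable]
  refine (Finset.abs_sum_le_sum_abs _ _).trans ?_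
  have h1 : ∀ j ∈ Finset.univ, |∫ x, q j x * q' k x| ≤ B * (e * B) := fun j _ => by
    have hB := h.B_nonneg
    have he := h.e_nonneg
    by_cases hjk : j = k
    · subst hjk
      have h2 : ∫ x, 2 * (q j x * q' j x) = 0 :=
        integral_deriv_eq_zero (f := fun x => q j x ^ 2) (fun x =>
          ((h.d0 j x).fun_pow 2).congr_deriv (by push_cast; ring))
          (h.dec j).sq (((h.dec j).mul (h.dec' j)).const_mul 2)
      rw [integral_const_mul] at h2
      have h3 : ∫ x, q j x * q' j x = 0 := by linarith
      rw [h3, abs_zero]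
      positivity
    · refine abs_integral_le_integral_abs.trans (le_trans ?_
        (mul_le_mul_of_nonneg_left (h.integral_mul_le hjk) hB))
      rw [← integral_const_mul]
      refine integral_mono ((h.dec j).mul (h.dec' k)).abs.integrable
        (((h.dec j).mul (h.dec k)).const_mul B).integrable fun x => ?_
      simp only
      rw [abs_mul, abs_of_nonneg (h.pos j x), mul_left_comm]
      exact mul_le_mul_of_nonneg_left (h.abs_deriv_le k x) (h.pos j x)
  simpa using Finset.sum_le_card_nsmul _ _ _ h1

lemma abs_integral_mul_deriv_le (h : Frame β c B l σ e q q' G φ φ') (k : Fin N) {ε : ℝ → ℝ}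
    (hε : Dec ε) {η : ℝ} (hη : 0 ≤ η) (hle : ∫ x, ε x ^ 2 ≤ η ^ 2) :
    |∫ x, ε x * q' k x| ≤ √((B ^ 2) ^ 2 * B) * η := by
  have h1 : ∫ x, q' k x ^ 2 ≤ (B ^ 2) ^ 2 * B := h.integral_sq_le (h.cont' k) fun x => by
    rw [pow_two, mul_assoc]
    exact (h.abs_deriv_le k x).trans (mul_le_mul_of_nonneg_left (h.le_G k x) h.B_nonneg)
  refine (abs_integral_mul_le_sqrt hε (h.dec' k) hle h1).trans_eq ?_
  rw [Real.sqrt_mul (sq_nonneg η), Real.sqrt_sq hη, mul_comm]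

lemma integral_abs_sub_mul_le (h : Frame β c B l σ e q q' G φ φ') (k : Fin N) {u : ℝ → ℝ}
    (hu : Dec u) {η : ℝ} (hη : 0 ≤ η) (hle : ∫ x, (u x - ∑ j, q j x) ^ 2 ≤ η ^ 2) :
    ∫ x, |u x - q k x| * q k x ≤ √(B ^ 2 * B) * η + N * (e * B) := by
  have hB := h.B_nonneg
  have he := h.e_nonneg
  have h1 : ∫ x, q k x ^ 2 ≤ B ^ 2 * B := h.integral_sq_le (h.cont k) fun x => by
    rw [abs_of_nonneg (h.pos k x)]; exact h.le_G k x
  have dε : Dec fun x => u x - ∑ j, q j x := hu.sub (Dec.sum _ fun j _ => h.dec j)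
  have h2 : ∫ x, |u x - ∑ j, q j x| * q k x ≤ √(B ^ 2 * B) * η := by
    refine (le_abs_self _).trans ((abs_integral_mul_le_sqrt dε.abs (h.dec k) (A := η ^ 2) (by
      simpa only [sq_abs] using hle) h1).trans_eq ?_)
    rw [Real.sqrt_mul (sq_nonneg η), Real.sqrt_sq hη, mul_comm]
  have ds : Dec fun x => ∑ j ∈ Finset.univ.erase k, q j x * q k x :=
    Dec.sum _ fun j _ => (h.dec j).mul (h.dec k)
  have h3 : ∫ x, ∑ j ∈ Finset.univ.erase k, q j x * q k x ≤ N * (e * B) := by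
    rw [integral_finsetSum _ fun j _ => ((h.dec j).mul (h.dec k)).integrable]
    refine (Finset.sum_le_card_nsmul _ _ (e * B) fun j hj =>
      h.integral_mul_le (Finset.ne_of_mem_erase hj)).trans ?_
    rw [nsmul_eq_mul]
    refine mul_le_mul_of_nonneg_right ?_ (by positivity)
    exact_mod_cast (Finset.card_erase_le).trans (by simp)
  refine le_trans ?_ (add_le_add h2 h3)
  rw [← integral_add (dε.abs.mul (h.dec k)).integrable ds.integrable]
  refine integral_mono ((hu.sub (h.dec k)).abs.mul (h.dec k)).integrable
    ((dε.abs.mul (h.dec k)).add ds).integrable fun x => ?_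
  simp only
  rw [← Finset.sum_mul, ← add_mul, ← h.sum_sub]
  refine mul_le_mul_of_nonneg_right ?_ (h.pos k x)
  have h4 : 0 ≤ (∑ j, q j x) - q k x := sub_nonneg.2 (h.le_sum k x)
  calc |u x - q k x| = |(u x - ∑ j, q j x) + ((∑ j, q j x) - q k x)| := by congr 1; ring
    _ ≤ _ := (abs_add_le _ _).trans_eq (by rw [abs_of_nonneg h4])

end Frame

lemma exists_increments {N : ℕ} {c : Fin N → ℝ} (hc : StrictMono c) (hpos : ∀ k, 0 < c k) :
    ∃ w : Fin N → ℝ, (∀ j, 0 < w j) ∧ ∀ k, c k = ∑ j ∈ Finset.Iic k, w j := by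
  refine ⟨fun j => c j - if 0 < (j : ℕ) then c ⟨j - 1, by omega⟩ else 0, fun j => ?_, fun k => ?_⟩
  · simp only
    split_ifs with h
    · exact sub_pos.2 (hc (Fin.mk_lt_of_lt_val (by omega)))
    · simpa using hpos j
  · obtain ⟨n, hn⟩ := k
    induction n with
    | zero =>
      have h1 : Finset.Iic (⟨0, hn⟩ : Fin N) = {⟨0, hn⟩} := by
        ext i; simp [Fin.le_def, Fin.ext_iff]
      rw [h1, Finset.sum_singleton]
      simp
    | succ n ih =>
      have h1 : Finset.Iic (⟨n + 1, hn⟩ : Fin N) =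
          insert ⟨n + 1, hn⟩ (Finset.Iic ⟨n, by omega⟩) := by
        ext i; simp [Fin.le_def, Fin.ext_iff]; omega
      rw [h1, Finset.sum_insert (by simp [Fin.le_def]), ← ih (by omega)]
      simp

/-- A continuity argument. -/
lemma le_one_of_bootstrap {F : ℝ → ℝ} (hF : Continuous F)
    (h : ∀ T, 0 ≤ T → (∀ t ∈ Set.Icc 0 T, F t ≤ 1) → F T < 1) (h0 : F 0 < 1) {t : ℝ} (ht : 0 ≤ t) :
    F t ≤ 1 := by
  by_contra! hlt
  have hc : IsCompact (Set.Icc 0 t ∩ {s | 1 ≤ F s}) :=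
    isCompact_Icc.inter_right (isClosed_le continuous_const hF)
  obtain ⟨s, ⟨hs, hs1⟩, hmin⟩ := hc.exists_isLeast ⟨t, ⟨ht, le_rfl⟩, hlt.le⟩
  have hs1 : 1 ≤ F s := hs1
  obtain ⟨r, hr, hr1⟩ := intermediate_value_Icc hs.1 hF.continuousOn ⟨h0.le, hs1⟩
  have hrs : s = r := le_antisymm (hmin ⟨⟨hr.1, hr.2.trans hs.2⟩, hr1.ge⟩) hr.2
  refine absurd (h s hs.1 fun u hu => ?_) (not_lt.2 hs1)
  by_contra! hu1
  have hus : u = s := le_antisymm hu.2 (hmin ⟨⟨hu.1, hu.2.trans hs.2⟩, hu1.le⟩)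
  rw [hus, hrs, hr1] at hu1
  exact lt_irrefl _ hu1

lemma Separated.mono {N : ℕ} {m : ℕ → ℝ} {ℓ ℓ' : ℝ} {X : Fin N → ℝ} (h : Separated m ℓ X)
    (hle : ℓ' ≤ ℓ) : Separated m ℓ' X :=
  ⟨fun k j h1 h2 => by linarith [h.add_le k j h1 h2],
    fun k j h1 h2 => by linarith [h.le_sub k j h1 h2]⟩

lemma exists_separated {N : ℕ} {c : Fin N → ℝ} (hc : StrictMono c) {a δ : ℝ} (ha : ∀ k, a ≤ c k)
    (hδ : ∀ i j, i < j → 4 * δ ≤ c j - c i) {x₀ : Fin N → ℝ} (hx : StrictMono x₀) {L : ℝ}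
    (hL : ∀ i j : Fin N, (i : ℕ) + 1 = (j : ℕ) → x₀ i + L < x₀ j) :
    ∃ m μ : ℕ → ℝ, (∀ j, j < N → a ≤ μ j) ∧ ∀ (X : Fin N → ℝ) (t : ℝ), 0 ≤ t →
      (∀ k, |X k - x₀ k - c k * t| ≤ δ * t) →
      Separated (fun j => m j + μ j * t) (L / 2 + δ * t) X := by
  obtain ⟨u, hu⟩ : ∃ u : (Fin N → ℝ) → ℕ → ℝ, ∀ f j (h : j < N), u f j = f ⟨j, h⟩ :=
    ⟨fun f j => if h : j < N then f ⟨j, h⟩ else 0, fun f j h => dif_pos h⟩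
  refine ⟨fun j => (u x₀ (j - 1) + u x₀ j) / 2, fun j => (u c (j - 1) + u c j) / 2,
    fun j hj => ?_, fun X t ht hX => ⟨fun k j hj hkj => ?_, fun k j hj hjk => ?_⟩⟩
  · simp only [hu c j hj, hu c (j - 1) (by omega)]
    linarith [ha ⟨j, hj⟩, ha ⟨j - 1, by omega⟩]
  · have h1 := hL ⟨j - 1, by omega⟩ ⟨j, hj⟩ (by simp; omega)
    have h2 := hδ ⟨j - 1, by omega⟩ ⟨j, hj⟩ (Fin.mk_lt_mk.2 (by omega))
    have h3 : x₀ k ≤ x₀ ⟨j - 1, by omega⟩ := hx.monotone (Fin.le_def.2 (by simp; omega))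
    have h4 : c k ≤ c ⟨j - 1, by omega⟩ := hc.monotone (Fin.le_def.2 (by simp; omega))
    simp only [hu c j hj, hu c (j - 1) (by omega), hu x₀ j hj, hu x₀ (j - 1) (by omega)]
    have h5 := (abs_le.1 (hX k)).2
    generalize c ⟨j - 1, _⟩ = c1, c ⟨j, hj⟩ = c2 at *
    nlinarith [mul_le_mul_of_nonneg_right h4 ht, mul_le_mul_of_nonneg_right h2 ht]
  · have h1 := hL ⟨j - 1, by omega⟩ ⟨j, by omega⟩ (by simp; omega)
    have h2 := hδ ⟨j - 1, by omega⟩ ⟨j, by omega⟩ (Fin.mk_lt_mk.2 (by omega))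
    have h3 : x₀ ⟨j, by omega⟩ ≤ x₀ k := hx.monotone (Fin.le_def.2 (by simp; omega))
    have h4 : c ⟨j, by omega⟩ ≤ c k := hc.monotone (Fin.le_def.2 (by simp; omega))
    have hj' : j < N := by omega
    simp only [hu c j hj', hu c (j - 1) (by omega), hu x₀ j hj', hu x₀ (j - 1) (by omega)]
    have h5 := (abs_le.1 (hX k)).1
    generalize c ⟨j - 1, _⟩ = c1, c ⟨j, hj'⟩ = c2 at *
    nlinarith [mul_le_mul_of_nonneg_right h4 ht, mul_le_mul_of_nonneg_right h2 ht]

lemma direction_bound_le {G H B C₁ κ₀ K α e η N : ℝ} (hG : 0 ≤ G) (hH : 0 ≤ H) (hB : 0 ≤ B)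
    (hC₁ : 0 ≤ C₁) (hκ₀ : 0 < κ₀) (hK : 1 ≤ K) (hα : 0 ≤ α) (he : 0 ≤ e) (hη : 0 ≤ η)
    (hN : 0 ≤ N) :
    G * α + N * (B * (e * B)) + C₁ * (H * η + N * (e * B)) / (K * κ₀) ≤
      (G + N * B ^ 2 + C₁ / κ₀ * (H + N * B)) * (α + e + η / K) := by
  have hK0 : 0 < K := by linarith
  have h2 : e / K ≤ e := div_le_self he hK
  have h3 : 0 ≤ η / K := by positivity
  have h4 : C₁ * (H * η + N * (e * B)) / (K * κ₀) =
      C₁ / κ₀ * H * (η / K) + C₁ / κ₀ * (N * B) * (e / K) := by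
    field_simp
  have h6 : 0 ≤ C₁ / κ₀ := by positivity
  rw [h4]
  have h5 : C₁ / κ₀ * (N * B) * (e / K) ≤ C₁ / κ₀ * (N * B) * e := by gcongr
  generalize C₁ / κ₀ = r, η / K = y at *
  have h9 : 0 ≤ G * e + G * y + N * B ^ 2 * α + N * B ^ 2 * y + r * H * α + r * H * e +
      r * (N * B) * α + r * (N * B) * y := by positivity
  linarith

lemma sq_le_of_abs_sub_le {z g C E α e y : ℝ} (hα : 0 ≤ α) (he : 0 ≤ e) (he1 : e ≤ 1)
    (hy : 0 ≤ y) (hE : 0 ≤ E) (hz : |g - z| ≤ E * e) (hg : |g| ≤ C * (α + e + y)) :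
    z ^ 2 ≤ 3 * (C + E) ^ 2 * (α ^ 2 + e + y ^ 2) := by
  rw [abs_sub_comm] at hz
  have h4 : |z| ≤ (C + E) * (α + e + y) := by
    have h5 := abs_sub_abs_le_abs_sub z g
    have h6 : 0 ≤ E * (α + y) := by positivity
    linarith
  rw [← sq_abs]
  refine (pow_le_pow_left₀ (abs_nonneg z) h4 2).trans ?_
  rw [mul_pow, mul_comm 3, mul_assoc]
  refine mul_le_mul_of_nonneg_left ?_ (sq_nonneg _)
  have h5 : e ^ 2 ≤ e := by nlinarith
  nlinarith [sq_nonneg (α - e), sq_nonneg (α - y), sq_nonneg (e - y)]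

set_option maxHeartbeats 1000000 in
/-- Improvement of the a priori bounds satisfied by a modulated sum of solitons. -/
theorem exists_a_priori_bound {N : ℕ} (hN : 0 < N) {β : ℝ} (hβ : 0 < β) {c : Fin N → ℝ}
    (hc : StrictMono c) (hpos : ∀ k, 0 < c k) (hcβ : ∀ k, c k < 2 / (9 * β))
    {Q Q' : Fin N → ℝ → ℝ} (hQ : ∀ k, IsSoliton β (c k) (Q k) (Q' k)) :
    ∃ δ > 0, ∃ σ > 0, ∃ D > 0, ∃ e₀ > 0, ∃ κ > 0, κ ≤ 1 ∧ ∃ C, 1 ≤ C ∧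
      ∀ (V : ℕ → ℝ → ℝ → ℝ), GardnerFlow β V → ∀ (L e α K : ℝ) (x₀ : Fin N → ℝ)
        (X g : Fin N → ℝ → ℝ) (n : ℝ → ℝ), 0 < L → StrictMono x₀ →
      (∀ i j : Fin N, (i : ℕ) + 1 = (j : ℕ) → x₀ i + L < x₀ j) →
      e = D * exp (-(σ * (L / 2))) → e ≤ e₀ → 0 ≤ α → α ≤ 1 → 1 ≤ K →
      (∀ k, X k 0 = x₀ k) → (∀ k t, HasDerivAt (X k) (c k - K * g k t) t) →
      (∀ k t, g k t = ∫ x, V 0 t x * Q' k (x - X k t)) → (∀ k, Continuous (g k)) →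
      (∀ t, n t = ∫ x, ((V 0 t x - ∑ k, Q k (x - X k t)) ^ 2 +
        (V 1 t x - ∑ k, Q' k (x - X k t)) ^ 2)) →
      n 0 ≤ α ^ 2 → (∀ k, |g k 0| ≤ C * (α + e)) ∧ ∀ η T, 0 ≤ η → η ≤ κ → 0 ≤ T →
      (∀ t ∈ Set.Icc 0 T, n t ≤ η ^ 2) → (∀ t ∈ Set.Icc 0 T, ∀ k, |K * g k t| ≤ δ) →
      n T ≤ C * (α ^ 2 + e + η ^ 3 + (η / K) ^ 2) ∧ ∀ k, |g k T| ≤ C * (α + e + η / K) := by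
  have hn1 : Nonempty (Fin N) := ⟨⟨0, hN⟩⟩
  obtain ⟨a, ha, hac⟩ := exists_pos_forall_le hpos
  obtain ⟨d, hd, hdc⟩ := exists_pos_forall_le (f := fun p : Fin N × Fin N =>
    if p.1 < p.2 then c p.2 - c p.1 else 1) fun p => by
      split_ifs with h
      · exact sub_pos.2 (hc h)
      · exact one_pos
  have hgap : ∀ i j, i < j → 4 * (d / 4) ≤ c j - c i := fun i j hij => by
    have := hdc (i, j)
    rw [if_pos hij] at this
    linarith
  have hδ : 0 < d / 4 := by positivity
  generalize d / 4 = δ at *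
  have hσ₀ : 0 < √(a / 2) := Real.sqrt_pos.2 (by linarith)
  obtain ⟨l, hl, σ, hσ, hσσ, hσl, B, hB, D₀, hD₀, hQB, hframe⟩ :=
    exists_frame hN hβ hpos hcβ hQ hσ₀
  have hσa : σ ^ 2 ≤ a / 2 := by
    calc σ ^ 2 ≤ √(a / 2) ^ 2 := by gcongr
      _ = a / 2 := Real.sq_sqrt (by linarith)
  obtain ⟨w, hw, hcw⟩ := exists_increments hc hpos
  have hD : 0 < D₀ + 1 := by linarith
  have hD01 : D₀ ≤ D₀ + 1 := by linarith
  generalize D₀ + 1 = D at *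
  set P := 4 / 3 * (N * B + 1) ^ 2 * B * N * (∫ x, exp (-(σ * |x|))) / δ with hP
  have hI0 : 0 ≤ ∫ x, exp (-(σ * |x|)) := integral_nonneg fun x => (exp_pos _).le
  have hP0 : 0 ≤ P := by positivity
  obtain ⟨e₁, he₁, Cs, hCs, hstab⟩ :=
    Frame.exists_stability_bound hβ hB hl (div_nonneg hP0 hD.le) w c hw hcw
  obtain ⟨B', hB', hcB'⟩ := exists_nonneg_forall_le c
  set M := N * B + 1 + (B' + δ) with hM
  have hM0 : 0 ≤ M := by positivity
  choose Cd hCd hdir using fun k => GardnerFlow.exists_direction_bound hβ (hQ k) (hpos k) hM0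
  obtain ⟨C₁, hC₁, hCdC⟩ := exists_nonneg_forall_le Cd
  have hκpos : ∀ k, 0 < ∫ x, Q' k x ^ 2 := fun k => by
    have hdec := ((hQ k).dec_deriv (hpos k)).sq
    refine integral_pos_of_integrable_nonneg_nonzero hdec.1 hdec.integrable
      (fun x => sq_nonneg _) (x := 1) ?_
    exact pow_ne_zero 2 ((hQ k).neg 1 one_pos).ne
  obtain ⟨κ₀, hκ₀, hκκ⟩ := exists_pos_forall_le hκpos
  set G := √((B ^ 2) ^ 2 * B) with hG
  set H := √(B ^ 2 * B) with hH
  have hG0 : 0 ≤ G := Real.sqrt_nonneg _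
  have hH0 : 0 ≤ H := Real.sqrt_nonneg _
  set C₂ := G + N * B ^ 2 + C₁ / κ₀ * (H + N * B) with hC₂
  have hC₂0 : 0 ≤ C₂ := by positivity
  set C₃ := C₂ + N * B ^ 2 with hC₃
  have hC₃0 : 0 ≤ C₃ := by positivity
  refine ⟨δ, hδ, σ, hσ, D, hD, min e₁ 1, lt_min he₁ one_pos, min 1 (a / 4),
    lt_min one_pos (by positivity), min_le_left _ _, 1 + C₂ + Cs * (1 + N * (3 * C₃ ^ 2)),
    by linarith [show 0 ≤ Cs * (1 + N * (3 * C₃ ^ 2)) by positivity], ?_⟩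
  intro V hV L e α K x₀ X g n hL hx hxL he hele hα hα1 hK hX0 hX hg hgc hn hn0
  have hee₁ : e ≤ e₁ := hele.trans (min_le_left _ _)
  have he1 : e ≤ 1 := hele.trans (min_le_right _ _)
  have he0 : 0 ≤ e := by rw [he]; positivity
  have hK0 : 0 < K := by linarith
  obtain ⟨m, μ, hμ, hsep⟩ := exists_separated hc hac hgap hx hxL
  have hsep' : ∀ t, 0 ≤ t → (∀ k, |X k t - x₀ k - c k * t| ≤ δ * t) →
      Separated (fun j => m j + μ j * t) (L / 2 + δ * t) fun k => X k t :=
    fun t ht hdrift => hsep (fun k => X k t) t ht hdrift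
  have hfr : ∀ t (ht : 0 ≤ t), (∀ k, |X k t - x₀ k - c k * t| ≤ δ * t) →
      Frame β c B l σ e (fun k x => Q k (x - X k t)) (fun k x => Q' k (x - X k t)) _ _ _ :=
    fun t ht hdrift =>
    (hframe _ (L / 2) _ (by linarith) ((hsep' t ht hdrift).mono
      (le_add_of_nonneg_right (mul_nonneg hδ.le ht))) (by
        refine le_trans ?_ he1
        rw [he]; gcongr)).mono (by rw [he]; gcongr) he1
  have dQ := fun k => (hQ k).dec (hpos k)
  have dQ' := fun k => (hQ k).dec_deriv (hpos k)
  have dε : ∀ t, Dec fun x => V 0 t x - ∑ k, Q k (x - X k t) := fun t =>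
    (hV.dec 0 t).sub (Dec.sum _ fun k _ => (dQ k).comp_sub (X k t))
  have dε' : ∀ t, Dec fun x => V 1 t x - ∑ k, Q' k (x - X k t) := fun t =>
    (hV.dec 1 t).sub (Dec.sum _ fun k _ => (dQ' k).comp_sub (X k t))
  have hεd : ∀ t x, HasDerivAt (fun x => V 0 t x - ∑ k, Q k (x - X k t))
      (V 1 t x - ∑ k, Q' k (x - X k t)) x := fun t x =>
    (hV.dx 0 t x).fun_sub (HasDerivAt.fun_sum fun k _ =>
      ((hQ k).d0 (x - X k t)).comp_sub_const x (X k t))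
  have hε2 : ∀ t, ∫ x, (V 0 t x - ∑ k, Q k (x - X k t)) ^ 2 ≤ n t := fun t => by
    rw [hn t]
    exact integral_mono (dε t).sq.integrable ((dε t).sq.add (dε' t).sq).integrable fun x =>
      le_add_of_nonneg_right (sq_nonneg _)
  have hbg : ∀ t, 0 ≤ t → (∀ k, |X k t - x₀ k - c k * t| ≤ δ * t) → ∀ k,
      |g k t - ∫ x, (V 0 t x - ∑ k, Q k (x - X k t)) * Q' k (x - X k t)| ≤ N * (B * (e * B)) :=
    fun t ht hdrift k => by
      have h1 := (hfr t ht hdrift).abs_integral_sum_mul_deriv_le k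
      have d1 := (dQ' k).comp_sub (X k t)
      rw [hg, ← integral_sub ((hV.dec 0 t).mul d1).integrable ((dε t).mul d1).integrable]
      refine le_of_eq_of_le ?_ h1
      congr 2; ext x; ring
  have hdrift0 : ∀ k, |X k 0 - x₀ k - c k * 0| ≤ δ * 0 := fun k => by simp [hX0 k]
  have hg0 : ∀ k, |g k 0| ≤ G * α + N * (B * (e * B)) := fun k => by
    have h1 := (hfr 0 le_rfl hdrift0).abs_integral_mul_deriv_le k (dε 0) hα ((hε2 0).trans hn0)
    have h2 := hbg 0 le_rfl hdrift0 k
    rw [← hG] at h1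
    have h3 := abs_sub_abs_le_abs_sub (g k 0)
      (∫ x, (V 0 0 x - ∑ k, Q k (x - X k 0)) * Q' k (x - X k 0))
    linarith
  have hCs' : 0 ≤ Cs * (1 + N * (3 * C₃ ^ 2)) := by positivity
  refine ⟨fun k => (hg0 k).trans ?_, ?_⟩
  · have h1 := direction_bound_le hG0 hH0 hB hC₁ hκ₀ hK hα he0 le_rfl (Nat.cast_nonneg (α := ℝ) N)
    rw [zero_div, add_zero, ← hC₂] at h1
    have h2 : 0 ≤ C₁ * (H * 0 + N * (e * B)) / (K * κ₀) := by positivity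
    have h3 : 0 ≤ (1 + Cs * (1 + N * (3 * C₃ ^ 2))) * (α + e) := by positivity
    linarith
  intro η T hη hηκ hT hnT hgT
  have hη1 : η ≤ 1 := hηκ.trans (min_le_left _ _)
  have hηa : η ≤ a / 4 := hηκ.trans (min_le_right _ _)
  have h0T : (0 : ℝ) ∈ Set.Icc 0 T := ⟨le_rfl, hT⟩
  have hTT : T ∈ Set.Icc 0 T := ⟨hT, le_rfl⟩
  have hsup : ∀ t ∈ Set.Icc 0 T, ∀ x, |V 0 t x - ∑ k, Q k (x - X k t)| ≤ η := fun t ht x =>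
    abs_le_of_sq_le_sq (((sq_le_integral (hεd t) (dε t) (dε' t) x).trans_eq (hn t).symm).trans
      (hnT t ht)) hη
  have hdrift : ∀ t ∈ Set.Icc 0 T, ∀ k, |X k t - x₀ k - c k * t| ≤ δ * t := fun t ht k => by
    have h1 := (convex_Icc (0 : ℝ) t).norm_image_sub_le_of_norm_hasDerivWithin_le
      (f := fun t => X k t - c k * t) (f' := fun t => -(K * g k t)) (C := δ)
      (fun s _ => (((hX k s).fun_sub ((hasDerivAt_id' s).const_mul (c k))).congr_deriv
        (by ring)).hasDerivWithinAt)
      (fun s hs => by rw [norm_neg]; exact hgT s ⟨hs.1, hs.2.trans ht.2⟩ k)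
      (Set.left_mem_Icc.2 ht.1) (Set.right_mem_Icc.2 ht.1)
    rw [Real.norm_eq_abs, Real.norm_eq_abs, sub_zero, abs_of_nonneg ht.1, hX0 k] at h1
    refine le_of_eq_of_le ?_ h1
    congr 1; ring
  have hD0 : 0 ≤ H * η + N * (e * B) := by positivity
  have hgk : ∀ k, |g k T| ≤ C₂ * (α + e + η / K) := fun k => by
    have h1 := abs_le_of_feedback (b := T) (hκpos k) hK0 (mul_nonneg (hCd k) hD0) (hgc k) (hX k)
      (fun s t hs hst htT => by
        rw [hg, hg]
        refine hdir k V (X k) (fun t => c k - K * g k t) hV (hX k)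
          (continuous_const.sub (continuous_const.mul (hgc k))) s t _ hst fun r hr => ?_
        have hr' : r ∈ Set.Icc 0 T := ⟨hs.trans hr.1, hr.2.trans htT⟩
        refine ⟨fun x => ?_, ?_, ?_⟩
        · have h2 := hsup r hr' x
          have h3 := (hfr r hr'.1 (hdrift r hr')).sum_le x
          have h4 := (hfr r hr'.1 (hdrift r hr')).sum_nonneg x
          rw [abs_le] at h2 ⊢
          constructor <;> linarith
        · have h2 := abs_le.1 (hgT r hr' k)
          have h3 := hcB' k
          have h4 := hpos k
          have h5 : 0 ≤ N * B := by positivity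
          rw [abs_le]
          constructor <;> linarith
        · exact (hfr r hr'.1 (hdrift r hr')).integral_abs_sub_mul_le k (hV.dec 0 r) hη ((hε2 r).trans (hnT r hr')))
      hTT
    refine h1.trans ((add_le_add (hg0 k) (?_ : _ ≤ C₁ * (H * η + N * (e * B)) / (K * κ₀))).trans ?_)
    · have := hCdC k
      have := hκκ k
      gcongr
    · exact direction_bound_le hG0 hH0 hB hC₁ hκ₀ hK hα he0 hη (Nat.cast_nonneg N)
  have hbk : ∀ k, (∫ x, (V 0 T x - ∑ k, Q k (x - X k T)) * Q' k (x - X k T)) ^ 2 ≤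
      3 * C₃ ^ 2 * (α ^ 2 + e + (η / K) ^ 2) := fun k => by
    have h1 := hbg T hT (hdrift T hTT) k
    rw [show (N : ℝ) * (B * (e * B)) = N * B ^ 2 * e by ring] at h1
    exact sq_le_of_abs_sub_le hα he0 he1 (by positivity) (by positivity) h1 (hgk k)
  have h3 : 0 ≤ η / K := by positivity
  refine ⟨?_, fun k => (hgk k).trans (mul_le_mul_of_nonneg_right ?_ (by positivity))⟩
  swap
  · linarith
  have hsum : ∑ k, (∫ x, (V 0 T x - ∑ k, Q k (x - X k T)) * Q' k (x - X k T)) ^ 2 ≤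
      N * (3 * C₃ ^ 2 * (α ^ 2 + e + (η / K) ^ 2)) := by
    refine (Finset.sum_le_card_nsmul Finset.univ _ _ fun k _ => hbk k).trans_eq ?_
    rw [Finset.card_univ, Fintype.card_fin, nsmul_eq_mul]
  have htr : ∀ (f : ℝ → ℝ → ℝ) k, ∫ x, f (Q k (x - X k 0)) (Q' k (x - X k 0)) =
      ∫ x, f (Q k (x - X k T)) (Q' k (x - X k T)) := fun f k => by
    rw [integral_sub_right_eq_self (fun x => f (Q k x) (Q' k x)),
      integral_sub_right_eq_self (fun x => f (Q k x) (Q' k x))]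
  have key := hstab σ e _ _ _ _ _ _ _ _ _ _ (hfr T hT (hdrift T hTT)) (hfr 0 le_rfl hdrift0) hee₁ hσl
    (htr fun u _ => u ^ 2) (htr (energyDensity β)) _ _ _ _ (hεd 0) (dε 0) (dε' 0) (hεd T) (dε T)
    (dε' T) α η hα hα1 hη hη1 ((hn 0).symm.trans_le hn0) ((hn T).symm.trans_le (hnT T hTT)) (by
      simp only [add_sub_cancel]
      exact (hV.sameInvariants hT (GardnerFlow.h3On_Icc hβ hV 0 T)).2.1.symm) fun j => by
      simp only [add_sub_cancel, sum_Ici_solitonWeight_sub]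
      rw [div_mul_eq_mul_div]
      have h1 := hV.solitonWeight_mass_le hβ hσ hδ hB (fun k x => ((hQ k).pos x).le) hQB hT
        (κ := min 1 (a / 4)) (min_le_left _ _) (j := j) j.2 (fun _ => by
          have := hμ j j.2
          have : min 1 (a / 4) ≤ a / 4 := min_le_right _ _
          linarith) (fun t ht => hsep' t ht.1 (hdrift t ht)) fun t ht x => (hsup t ht x).trans hηκ
      rw [← hP] at h1
      refine h1.trans_eq ?_
      rw [he]
      congr 1
      field_simp
  rw [← hn] at key
  refine key.trans ?_
  have h4 : 0 ≤ α ^ 2 + e + η ^ 3 + (η / K) ^ 2 := by positivity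
  have h5 : 0 ≤ (1 + C₂) * (α ^ 2 + e + η ^ 3 + (η / K) ^ 2) := by positivity
  have h6 : α ^ 2 + e + η ^ 3 +
      ∑ k, (∫ x, (V 0 T x - ∑ k, Q k (x - X k T)) * Q' k (x - X k T)) ^ 2 ≤
      (1 + N * (3 * C₃ ^ 2)) * (α ^ 2 + e + η ^ 3 + (η / K) ^ 2) := by
    have h7 : 0 ≤ N * (3 * C₃ ^ 2) * η ^ 3 := by positivity
    have h8 : 0 ≤ (η / K) ^ 2 := by positivity
    linarith
  have h7 := mul_le_mul_of_nonneg_left h6 hCs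
  linarith

lemma le_of_a_priori_step {N : ℕ} {δ C K α e η : ℝ} {n : ℝ → ℝ} {g : Fin N → ℝ → ℝ} (hδ : 0 < δ)
    (hC : 1 ≤ C) (hK : 8 * C ≤ K) (hα : 0 < α) (he : 0 ≤ e) (hη : 0 < η)
    (hη2 : η ^ 2 = 8 * C * (α ^ 2 + e)) (hηC : 8 * C * η ≤ 1) (hηδ : 6 * K * C * N * η ≤ δ)
    (hn : Continuous n) (hn0 : ∀ t, 0 ≤ n t) (hg : ∀ k, Continuous (g k)) (hnα : n 0 ≤ α ^ 2)
    (hg0 : ∀ k, |g k 0| ≤ C * (α + e))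
    (hstep : ∀ T, 0 ≤ T → (∀ t ∈ Set.Icc 0 T, n t ≤ η ^ 2) →
      (∀ t ∈ Set.Icc 0 T, ∀ k, |K * g k t| ≤ δ) →
      n T ≤ C * (α ^ 2 + e + η ^ 3 + (η / K) ^ 2) ∧ ∀ k, |g k T| ≤ C * (α + e + η / K))
    {t : ℝ} (ht : 0 ≤ t) : n t ≤ η ^ 2 ∧ ∀ k, |K * g k t| ≤ 3 * K * C * η := by
  have hK0 : 0 < K := by linarith
  have hη1 : η ≤ 1 := by nlinarith
  have hαη : α ^ 2 + e ≤ η ^ 2 / 8 := by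
    rw [hη2]
    nlinarith [show 0 ≤ (C - 1) * (α ^ 2 + e) from mul_nonneg (by linarith) (by positivity)]
  have hα' : α ≤ η := abs_le_of_sq_le_sq' (by nlinarith) hη.le |>.2
  have he' : e ≤ η := by nlinarith
  have hsum : ∀ t, (∀ k, |g k t| ≤ C * (α + e + η / K)) →
      (∀ k, |K * g k t| ≤ 3 * K * C * η) ∧ ∑ k, (K * g k t) ^ 2 / δ ^ 2 ≤ 1 / 4 := fun t h => by
    have h1 : ∀ k, |K * g k t| ≤ 3 * K * C * η := fun k => by
      rw [abs_mul, abs_of_pos hK0]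
      refine (mul_le_mul_of_nonneg_left (h k) hK0.le).trans ?_
      have h2 : η / K ≤ η := div_le_self hη.le (by linarith)
      have h3 : C * (α + e + η / K) ≤ C * (3 * η) := mul_le_mul_of_nonneg_left (by linarith)
        (by linarith)
      have := mul_le_mul_of_nonneg_left h3 hK0.le
      linarith
    refine ⟨h1, ?_⟩
    refine (Finset.sum_le_card_nsmul Finset.univ _ ((3 * K * C * η) ^ 2 / δ ^ 2) fun k _ => ?_).trans ?_
    · have := pow_le_pow_left₀ (abs_nonneg _) (h1 k) 2
      rw [sq_abs] at this
      gcongr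
    · rw [Finset.card_univ, Fintype.card_fin, nsmul_eq_mul, ← mul_div_assoc,
        div_le_iff₀ (by positivity)]
      have h2 : (6 * K * C * N * η) ^ 2 ≤ δ ^ 2 := by gcongr
      have h3 : (N : ℝ) ≤ N ^ 2 := by exact_mod_cast Nat.le_self_pow two_ne_zero N
      have h4 := mul_le_mul_of_nonneg_right h3 (sq_nonneg (3 * K * C * η))
      linarith
  have hn8 : ∀ T, n T ≤ C * (α ^ 2 + e + η ^ 3 + (η / K) ^ 2) → n T ≤ 3 / 8 * η ^ 2 := fun T h => by
    have h1 : C * η ^ 3 ≤ η ^ 2 / 8 := by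
      nlinarith [mul_le_mul_of_nonneg_right hηC (sq_nonneg η)]
    have h2 : C * (η / K) ^ 2 ≤ η ^ 2 / 8 := by
      rw [div_pow, ← mul_div_assoc, div_le_iff₀ (by positivity)]
      have h3 : 8 * C ≤ K ^ 2 := by nlinarith
      nlinarith [mul_le_mul_of_nonneg_right h3 (sq_nonneg η)]
    linarith
  have hle : ∀ t, n t / η ^ 2 + ∑ k, (K * g k t) ^ 2 / δ ^ 2 ≤ 1 →
      n t ≤ η ^ 2 ∧ ∀ k, |K * g k t| ≤ δ := fun t h => by
    have h1 : ∀ k, 0 ≤ (K * g k t) ^ 2 / δ ^ 2 := fun k => by positivity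
    have h2 : 0 ≤ n t / η ^ 2 := div_nonneg (hn0 t) (sq_nonneg η)
    have h3 : 0 ≤ ∑ k, (K * g k t) ^ 2 / δ ^ 2 := Finset.sum_nonneg fun k _ => h1 k
    refine ⟨?_, fun k => abs_le_of_sq_le_sq ?_ hδ.le⟩
    · have h4 : n t / η ^ 2 ≤ 1 := by linarith
      rwa [div_le_one (by positivity)] at h4
    · have h4 : (K * g k t) ^ 2 / δ ^ 2 ≤ 1 :=
        (Finset.single_le_sum (f := fun k => (K * g k t) ^ 2 / δ ^ 2) (fun k _ => h1 k)
          (Finset.mem_univ k)).trans (by linarith)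
      rwa [div_le_one (by positivity)] at h4
  have hlt : ∀ t, n t ≤ 3 / 8 * η ^ 2 → (∀ k, |g k t| ≤ C * (α + e + η / K)) →
      n t / η ^ 2 + ∑ k, (K * g k t) ^ 2 / δ ^ 2 < 1 := fun t h1 h2 => by
    have h3 := (hsum t h2).2
    rw [← div_le_iff₀ (by positivity)] at h1
    linarith
  have key : ∀ t, 0 ≤ t → n t / η ^ 2 + ∑ k, (K * g k t) ^ 2 / δ ^ 2 ≤ 1 := fun t ht => by
    refine le_one_of_bootstrap (F := fun t => n t / η ^ 2 + ∑ k, (K * g k t) ^ 2 / δ ^ 2)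
      (by fun_prop) (fun T hT h => ?_) ?_ ht
    · obtain ⟨h1, h2⟩ := hstep T hT (fun t ht => (hle t (h t ht)).1) fun t ht => (hle t (h t ht)).2
      exact hlt T (hn8 T h1) h2
    · refine hlt 0 (by linarith [sq_nonneg η]) fun k => (hg0 k).trans ?_
      have : 0 ≤ C * (η / K) := by positivity
      linarith
  refine ⟨(hle t (key t ht)).1, (hsum t ?_).1⟩
  exact (hstep t ht (fun s hs => (hle s (key s hs.1)).1) fun s hs => (hle s (key s hs.1)).2).2

lemma exists_separation_le {D σ m : ℝ} (hD : 0 < D) (hσ : 0 < σ) (hm : 0 < m) :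
    ∃ L₀ > 0, ∀ L, L₀ < L → D * exp (-(σ * (L / 2))) ≤ m := by
  refine ⟨2 * D / (σ * m), by positivity, fun L hL => ?_⟩
  have hL0 : 0 < L := lt_trans (by positivity) hL
  rw [div_lt_iff₀ (by positivity)] at hL
  have h1 := add_one_le_exp (σ * (L / 2))
  rw [exp_neg, ← div_eq_mul_inv, div_le_iff₀ (exp_pos _)]
  nlinarith [mul_le_mul_of_nonneg_left h1 hm.le]

/-- Orbital stability of well separated ordered solitons, in terms of the flow. -/
theorem exists_stability {N : ℕ} (hN : 0 < N) {β : ℝ} (hβ : 0 < β) {c : Fin N → ℝ}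
    (hc : StrictMono c) (hpos : ∀ k, 0 < c k) (hcβ : ∀ k, c k < 2 / (9 * β))
    {Q Q' : Fin N → ℝ → ℝ} (hQ : ∀ k, IsSoliton β (c k) (Q k) (Q' k)) :
    ∃ α₀ > 0, ∃ A₀ > 0, ∃ L₀ > 0, ∃ γ > 0, ∀ L α : ℝ, L₀ < L → 0 < α → α < α₀ →
      ∀ x₀ : Fin N → ℝ, StrictMono x₀ →
      (∀ i j : Fin N, (i : ℕ) + 1 = (j : ℕ) → x₀ i + L < x₀ j) →
      ∀ V : ℕ → ℝ → ℝ → ℝ, GardnerFlow β V →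
      (∫ x, ((V 0 0 x - ∑ k, Q k (x - x₀ k)) ^ 2 + (V 1 0 x - ∑ k, Q' k (x - x₀ k)) ^ 2)) ≤ α ^ 2 →
      ∃ X : Fin N → ℝ → ℝ, (∀ k, ContDiff ℝ 1 (X k)) ∧ ∀ t, 0 ≤ t →
        √(∫ x, ((V 0 t x - ∑ k, Q k (x - X k t)) ^ 2 + (V 1 t x - ∑ k, Q' k (x - X k t)) ^ 2)) +
          (∑ k, |deriv (X k) t - c k|) ≤ A₀ * (α + exp (-γ * L)) := by
  obtain ⟨δ, hδ, σ, hσ, D, hD, e₀, he₀, κ, hκ, hκ1, C, hC, hap⟩ :=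
    exists_a_priori_bound hN hβ hc hpos hcβ hQ
  have hC0 : 0 < C := by linarith
  have hN' : (0 : ℝ) < N := Nat.cast_pos.2 hN
  set K := 8 * C with hK
  have hK0 : 0 < K := by positivity
  set η₀ := min κ (min (1 / (8 * C)) (δ / (6 * K * C * N))) with hη₀
  have hη₀0 : 0 < η₀ := lt_min hκ (lt_min (by positivity) (by positivity))
  obtain ⟨L₀, hL₀, hL₀e⟩ := exists_separation_le hD hσ
    (lt_min he₀ (show 0 < η₀ ^ 2 / (16 * C) by positivity))
  set S := (1 + N * (3 * K * C)) * √(8 * C) with hS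
  refine ⟨min 1 (η₀ / (4 * C)), lt_min one_pos (by positivity), S * (1 + √D), by positivity, L₀, hL₀,
    σ / 4, by positivity, ?_⟩
  intro L α hL hα hαα x₀ hx hxL V hV hV0
  have hL0 : 0 < L := hL₀.trans hL
  set e := D * exp (-(σ * (L / 2))) with he
  have he0 : 0 < e := by positivity
  have hee := hL₀e L hL
  have hee₀ : e ≤ e₀ := hee.trans (min_le_left _ _)
  have hα1 : α ≤ 1 := hαα.le.trans (min_le_left _ _)
  set η := √(8 * C * (α ^ 2 + e)) with hη
  have hη0 : 0 < η := Real.sqrt_pos.2 (by positivity)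
  have hη2 : η ^ 2 = 8 * C * (α ^ 2 + e) := Real.sq_sqrt (by positivity)
  have hηη₀ : η ≤ η₀ := by
    refine abs_le_of_sq_le_sq' ?_ hη₀0.le |>.2
    have h1 : e ≤ η₀ ^ 2 / (16 * C) := hee.trans (min_le_right _ _)
    have h2 : α ≤ η₀ / (4 * C) := hαα.le.trans (min_le_right _ _)
    have h3 : α ^ 2 ≤ (η₀ / (4 * C)) ^ 2 := by gcongr
    have h4 : (η₀ / (4 * C)) ^ 2 ≤ η₀ ^ 2 / (16 * C) := by
      rw [div_pow]
      gcongr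
      nlinarith
    have h5 : 8 * C * (2 * (η₀ ^ 2 / (16 * C))) = η₀ ^ 2 := by field_simp; norm_num
    rw [hη2, ← h5]
    gcongr
    linarith
  choose X hX0 hXC hXd using fun k => exists_modulation hβ hV (hQ k) (hpos k) K (x₀ k)
  set g : Fin N → ℝ → ℝ := fun k t => ∫ x, V 0 t x * Q' k (x - X k t) with hg
  have hgd : ∀ k, g k = fun t => (c k - deriv (X k) t) / K := fun k => by
    ext t
    rw [(hXd k t).deriv]
    field_simp
    ring
  have hgc : ∀ k, Continuous (g k) := fun k => by
    rw [hgd]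
    exact (continuous_const.sub ((hXC k).continuous_deriv le_rfl)).div_const K
  set n : ℝ → ℝ := fun t => ∫ x, ((V 0 t x - ∑ k, Q k (x - X k t)) ^ 2 +
    (V 1 t x - ∑ k, Q' k (x - X k t)) ^ 2) with hn
  have hnc : Continuous n := hV.continuous_deviation hβ hQ hpos hXd fun k =>
    continuous_const.sub (continuous_const.mul (hgc k))
  have hn0 : n 0 ≤ α ^ 2 := by
    simpa only [hn, hX0] using hV0
  obtain ⟨hg0, hstep⟩ := hap V hV L e α K x₀ X g n hL0 hx hxL he hee₀ hα.le hα1 (by linarith) hX0 hXd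
    (fun _ _ => rfl) hgc (fun _ => rfl) hn0
  refine ⟨X, hXC, fun t ht => ?_⟩
  obtain ⟨h1, h2⟩ := le_of_a_priori_step hδ hC le_rfl hα he0.le hη0 hη2 (by
      have := hηη₀.trans ((min_le_right _ _).trans (min_le_left _ _))
      rw [le_div_iff₀ (by positivity)] at this
      linarith) (by
      have := hηη₀.trans ((min_le_right _ _).trans (min_le_right _ _))
      rw [le_div_iff₀ (by positivity)] at this
      linarith) hnc (fun t => integral_nonneg fun x => by positivity) hgc hn0 hg0
    (fun T hT => hstep η T hη0.le (hηη₀.trans (min_le_left _ _)) hT) ht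
  have h3 : √(n t) ≤ η := Real.sqrt_le_iff.2 ⟨hη0.le, h1⟩
  have h4 : ∑ k, |deriv (X k) t - c k| ≤ N * (3 * K * C * η) := by
    refine (Finset.sum_le_card_nsmul Finset.univ _ _ fun k _ => ?_).trans_eq
      (by rw [Finset.card_univ, Fintype.card_fin, nsmul_eq_mul])
    rw [(hXd k t).deriv, abs_sub_comm, sub_sub_cancel]
    exact h2 k
  have h5 : η ≤ √(8 * C) * ((1 + √D) * (α + exp (-(σ / 4) * L))) := by
    rw [hη, Real.sqrt_mul (by positivity)]
    refine mul_le_mul_of_nonneg_left ?_ (Real.sqrt_nonneg _)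
    refine Real.sqrt_le_iff.2 ⟨by positivity, ?_⟩
    have h6 : e = (√D * exp (-(σ / 4) * L)) ^ 2 := by
      rw [he, mul_pow, Real.sq_sqrt hD.le, ← Real.exp_nat_mul]
      congr 2
      push_cast
      ring
    rw [h6]
    have h7 : 0 ≤ √D := Real.sqrt_nonneg _
    have h8 := exp_pos (-(σ / 4) * L)
    generalize exp (-(σ / 4) * L) = y at *
    have h9 : 0 ≤ √D * y := by positivity
    have : α ^ 2 + (√D * y) ^ 2 ≤ (α + √D * y) ^ 2 := by nlinarith [mul_nonneg hα.le h9]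
    refine this.trans (pow_le_pow_left₀ (by positivity) ?_ 2)
    linarith [mul_nonneg h7 hα.le]
  calc √(n t) + ∑ k, |deriv (X k) t - c k| ≤ (1 + N * (3 * K * C)) * η := by linarith
    _ ≤ (1 + N * (3 * K * C)) * (√(8 * C) * ((1 + √D) * (α + exp (-(σ / 4) * L)))) := by gcongr
    _ = S * (1 + √D) * (α + exp (-(σ / 4) * L)) := by rw [hS]; ring

/-- `H¹`-stability of the sum of `N` solitons of the Gardner equation
(Martel-Merle-Tsai / Martel-Merle), under Weinstein's criterium. -/
theorem gardner_sum_of_solitons_H1_stability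
    (N : ℕ) (hN : 2 ≤ N) (β : ℝ) (hβ : 0 < β)
    (c : Fin N → ℝ) (hcpos : ∀ j, 0 < c j) (hc : StrictMono c)
    (hcβ : ∀ j, c j < 2 / (9 * β))
    (hWeinstein : ∀ j, ∃ d : ℝ, 0 < d ∧
      HasDerivAt (fun c' : ℝ => ∫ x : ℝ, (QG c' β x) ^ 2) d (c j)) :
    ∃ α₀ A₀ L₀ γ : ℝ, 0 < α₀ ∧ 0 < A₀ ∧ 0 < L₀ ∧ 0 < γ ∧
      ∀ L α : ℝ, L₀ < L → 0 < α → α < α₀ →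
      ∀ x₀ : Fin N → ℝ, StrictMono x₀ →
        (∀ i j : Fin N, (i : ℕ) + 1 = (j : ℕ) → x₀ i + L < x₀ j) →
      ∀ v : ℝ → ℝ → ℝ, IsGardnerSolution β v →
        (∫ x : ℝ, ((v 0 x - ∑ j, QG (c j) β (x - x₀ j)) ^ 2 +
            (deriv (fun y => v 0 y - ∑ j, QG (c j) β (y - x₀ j)) x) ^ 2)) ≤ α ^ 2 →
        ∃ X : Fin N → ℝ → ℝ, (∀ j, ContDiff ℝ 1 (X j)) ∧
          ∀ t : ℝ, 0 ≤ t →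
            Real.sqrt (∫ x : ℝ, ((v t x - ∑ j, QG (c j) β (x - X j t)) ^ 2 +
                (deriv (fun y => v t y - ∑ j, QG (c j) β (y - X j t)) x) ^ 2)) +
              (∑ j, |deriv (X j) t - c j|) ≤ A₀ * (α + Real.exp (-γ * L)) := by
  have hQ := fun k => isSoliton_QG hβ (hcpos k) (hcβ k)
  obtain ⟨α₀, hα₀, A₀, hA₀, L₀, hL₀, γ, hγ, h⟩ :=
    exists_stability (by omega) hβ hc hcpos hcβ hQ
  refine ⟨α₀, A₀, L₀, γ, hα₀, hA₀, hL₀, hγ, fun L α hL hα hαα x₀ hx hxL v hv hv0 => ?_⟩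
  obtain ⟨V, rfl, hV⟩ := hv.exists_flow
  have hd : ∀ t (y : Fin N → ℝ) x, deriv (fun x => V 0 t x - ∑ j, QG (c j) β (x - y j)) x =
      V 1 t x - ∑ j, QG' (c j) β (x - y j) := fun t y x =>
    ((hV.dx 0 t x).fun_sub (HasDerivAt.fun_sum fun k _ =>
      ((hQ k).d0 (x - y k)).comp_sub_const x (y k))).deriv
  simp only [hd] at hv0 ⊢
  exact h L α hL hα hαα x₀ hx hxL V hV hv0
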